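/- Let n ≥ 1, α ∈ (0, n+1), C ≥ 1 and 0 < δ₀ ≤ 1. Let F ⊂ B_{ℝ^{n+1}}(0,1) be a finite nonempty set and μ the uniform measure on F, and assume μ(B_{ℝ^{n+1}}(x,δ)) ≤ C·δ^α for all x ∈ ℝ^{n+1} and all δ ∈ [δ₀, 1]. Then for every ε ∈ (0, min{α, n+1−α}/(10⁴ n)) there exist constants D ≥ 1 and c > 0 depending only on n and ε such that the following holds: for all δ ∈ [δ₀, 1/100] and all t ≥ D with e^{nt/2}·δ₀ ≤ δ ≤ e^{−nt/2}, there exists a subset 𝓔 = 𝓔_{t,δ} ⊂ [0,1] with |𝓔| ≤ D·e^{−cε²t} such that for every r ∈ [0,1] \ 𝓔 there exists F_{t,δ,r} ⊂ F with μ(F \ F_{t,δ,r}) ≤ D·e^{−cε²t}, and for all w ∈ F_{t,δ,r}: μ({w' ∈ F_{t,δ,r} : ‖a_t·u_r·w' − a_t·u_r·w‖ ≤ δ}) ≤ D·C·e^{−ϖ(α)t/2}·δ^{α−ε}. -/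

import Mathlib

open MeasureTheory Real Metric

noncomputable section

/-- The `i`-th coordinate (0-indexed) of the `j`-th derivative of the curve
`ξ(r) = (r/1!, r²/2!, …, r^{n+1}/(n+1)!) ∈ ℝ^{n+1}`; the `i`-th coordinate of `ξ` is
`r^{i+1}/(i+1)!`, so its `j`-th derivative is `r^{i+1-j}/(i+1-j)!` if `j ≤ i+1` and `0`
otherwise. -/
def xiD (n j : ℕ) (r : ℝ) : EuclideanSpace ℝ (Fin (n + 1)) :=
  (EuclideanSpace.equiv (Fin (n + 1)) ℝ).symm fun i =>
    if j ≤ i.1 + 1 then r ^ (i.1 + 1 - j) / (Nat.factorial (i.1 + 1 - j) : ℝ) else 0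

/-- The action of `u_r`: `u_r·w = (w·ξ^{(1)}(r), …, w·ξ^{(n+1)}(r))`. -/
def uAct (n : ℕ) (r : ℝ) (w : EuclideanSpace ℝ (Fin (n + 1))) :
    EuclideanSpace ℝ (Fin (n + 1)) :=
  (EuclideanSpace.equiv (Fin (n + 1)) ℝ).symm fun i => ∑ l, w l * xiD n (i.1 + 1) r l

/-- The action of `a_t`: `a_t·w = (e^{nt/2} w₁, e^{(n−2)t/2} w₂, …, e^{−nt/2} w_{n+1})`. -/
def aAct (n : ℕ) (t : ℝ) (w : EuclideanSpace ℝ (Fin (n + 1))) :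
    EuclideanSpace ℝ (Fin (n + 1)) :=
  (EuclideanSpace.equiv (Fin (n + 1)) ℝ).symm fun i =>
    Real.exp ((((n : ℝ) - 2 * (i.1 : ℝ)) * t) / 2) * w i

/-- The uniform (normalized counting) measure of a set `A` with respect to a finite set `F`. -/
def mass {V : Type*} (F : Finset V) (A : Set V) : ℝ :=
  (Nat.card ↥(A ∩ (F : Set V)) : ℝ) / F.card

/-- `ϖ(α) = max{nα − ⌊α⌋(⌊α⌋+1), ⌊α⌋(2n − ⌊α⌋ + 1) − nα}`. -/
def varpi (n : ℕ) (α : ℝ) : ℝ :=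
  max ((n : ℝ) * α - (⌊α⌋ : ℝ) * ((⌊α⌋ : ℝ) + 1))
    ((⌊α⌋ : ℝ) * (2 * (n : ℝ) - (⌊α⌋ : ℝ) + 1) - (n : ℝ) * α)

section

/-- Continuous and bounded functions, as a predicate. -/
def CB {X E : Type*} [TopologicalSpace X] [NormedAddCommGroup E] (f : X → E) : Prop :=
  Continuous f ∧ ∃ C : ℝ, ∀ y, ‖f y‖ ≤ C

namespace CB

variable {X E : Type*} [TopologicalSpace X] [NormedAddCommGroup E]

lemma const (c : E) : CB (fun _ : X => c) := ⟨continuous_const, ‖c‖, fun _ => le_rfl⟩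

lemma add {f g : X → E} (hf : CB f) (hg : CB g) : CB (fun y => f y + g y) := by
  obtain ⟨hf, C, hC⟩ := hf
  obtain ⟨hg, D, hD⟩ := hg
  exact ⟨hf.add hg, C + D, fun y => (norm_add_le _ _).trans (add_le_add (hC y) (hD y))⟩

lemma sum {κ : Type*} (s : Finset κ) {f : κ → X → E} (h : ∀ k ∈ s, CB (f k)) :
    CB (fun y => ∑ k ∈ s, f k y) := by
  classical
  induction s using Finset.induction_on with
  | empty => simpa using const (X := X) (0 : E)
  | insert a s ha ih =>
    simp only [Finset.sum_insert ha]
    exact (h a (by simp)).add (ih fun k hk => h k (by simp [hk]))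

lemma mul {R : Type*} [NormedRing R] {f g : X → R} (hf : CB f) (hg : CB g) :
    CB (fun y => f y * g y) := by
  obtain ⟨hf, C, hC⟩ := hf
  obtain ⟨hg, D, hD⟩ := hg
  exact ⟨hf.mul hg, C * D, fun y => (norm_mul_le _ _).trans
    (mul_le_mul (hC y) (hD y) (norm_nonneg _) ((norm_nonneg _).trans (hC y)))⟩

lemma pow {R : Type*} [NormedRing R] {f : X → R} (hf : CB f) (n : ℕ) :
    CB (fun y => f y ^ n) := by
  induction n with
  | zero => simpa using const (X := X) (1 : R)
  | succ n ih => simpa only [pow_succ] using ih.mul hf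

lemma norm {f : X → E} (hf : CB f) : CB (fun y => ‖f y‖) := by
  obtain ⟨hf, C, hC⟩ := hf
  exact ⟨hf.norm, C, fun y => by simpa using hC y⟩

lemma integrable {f : X → E} (hf : CB f) [MeasurableSpace X] [OpensMeasurableSpace X]
    [SecondCountableTopology X] {P : Measure X} [IsFiniteMeasure P] : Integrable f P := by
  obtain ⟨hf, C, hC⟩ := hf
  exact Integrable.of_bound hf.aestronglyMeasurable C (Filter.Eventually.of_forall hC)

end CB

variable {N : ℕ}

/-- The character with frequency `η`. -/
def chr (η y : Fin N → ℝ) : ℂ := Complex.exp ((η ⬝ᵥ y : ℝ) * Complex.I)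

lemma norm_chr (η y : Fin N → ℝ) : ‖chr η y‖ = 1 := Complex.norm_exp_ofReal_mul_I _

lemma chr_cb (η : Fin N → ℝ) : CB (chr η) := by
  refine ⟨?_, 1, fun y => (norm_chr η y).le⟩
  unfold chr
  have : Continuous fun y : Fin N → ℝ => η ⬝ᵥ y := by
    unfold dotProduct; fun_prop
  fun_prop

lemma chr_add (η θ y : Fin N → ℝ) : chr (η + θ) y = chr η y * chr θ y := by
  unfold chr
  rw [← Complex.exp_add, add_dotProduct]
  push_cast
  ring_nf

lemma chr_neg (η y : Fin N → ℝ) : chr (-η) y = (starRingEnd ℂ) (chr η y) := by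
  unfold chr
  rw [← Complex.exp_conj, neg_dotProduct]
  simp

/-- Trigonometric polynomials with frequencies in `S`. -/
def TP (S : Set (Fin N → ℝ)) : Submodule ℂ ((Fin N → ℝ) → ℂ) := Submodule.span ℂ (chr '' S)

lemma TP_mono {S T : Set (Fin N → ℝ)} (h : S ⊆ T) : TP S ≤ TP T :=
  Submodule.span_mono (Set.image_mono h)

lemma chr_mem_TP {S : Set (Fin N → ℝ)} {η : Fin N → ℝ} (h : η ∈ S) : chr η ∈ TP S :=
  Submodule.subset_span ⟨η, h, rfl⟩

lemma TP_cb {S : Set (Fin N → ℝ)} {f : (Fin N → ℝ) → ℂ} (h : f ∈ TP S) : CB f := by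
  induction h using Submodule.span_induction with
  | mem x hx => obtain ⟨η, _, rfl⟩ := hx; exact chr_cb η
  | zero => exact CB.const 0
  | add x y _ _ hx hy => exact hx.add hy
  | smul a x _ hx => exact (CB.const a).mul hx

lemma TP_mul {S T U : Set (Fin N → ℝ)} (hU : ∀ s ∈ S, ∀ t ∈ T, s + t ∈ U)
    {f g : (Fin N → ℝ) → ℂ} (hf : f ∈ TP S) (hg : g ∈ TP T) :
    (fun y => f y * g y) ∈ TP U := by
  induction hf using Submodule.span_induction with
  | mem x hx =>
    obtain ⟨η, hη, rfl⟩ := hx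
    induction hg using Submodule.span_induction with
    | mem x hx =>
      obtain ⟨θ, hθ, rfl⟩ := hx
      have : (fun y => chr η y * chr θ y) = chr (η + θ) := by
        funext y; rw [chr_add]
      rw [this]; exact chr_mem_TP (hU _ hη _ hθ)
    | zero => convert (TP U).zero_mem using 1; funext z; simp
    | add x y _ _ hx hy =>
      have := (TP U).add_mem hx hy
      convert this using 1; funext z; simp [mul_add]
    | smul a x _ hx =>
      have := (TP U).smul_mem a hx
      convert this using 1; funext z; simp; ring
  | zero => convert (TP U).zero_mem using 1; funext z; simp
  | add x y _ _ hx hy =>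
    have := (TP U).add_mem hx hy
    convert this using 1; funext z; simp [add_mul]
  | smul a x _ hx =>
    have := (TP U).smul_mem a hx
    convert this using 1; funext z; simp; ring

lemma TP_conj {S U : Set (Fin N → ℝ)} (hU : ∀ s ∈ S, -s ∈ U)
    {f : (Fin N → ℝ) → ℂ} (hf : f ∈ TP S) :
    (fun y => (starRingEnd ℂ) (f y)) ∈ TP U := by
  induction hf using Submodule.span_induction with
  | mem x hx =>
    obtain ⟨η, hη, rfl⟩ := hx
    have : (fun y => (starRingEnd ℂ) (chr η y)) = chr (-η) := by
      funext y; rw [chr_neg]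
    rw [this]; exact chr_mem_TP (hU _ hη)
  | zero => convert (TP U).zero_mem using 1; funext z; simp
  | add x y _ _ hx hy =>
    have := (TP U).add_mem hx hy
    convert this using 1; funext z; simp
  | smul a x _ hx =>
    have := (TP U).smul_mem ((starRingEnd ℂ) a) hx
    convert this using 1; funext z; simp

lemma TP_sq {S U : Set (Fin N → ℝ)} (hU : ∀ s ∈ S, ∀ t ∈ S, s - t ∈ U)
    {f : (Fin N → ℝ) → ℂ} (hf : f ∈ TP S) :
    (fun y => ((‖f y‖ ^ 2 : ℝ) : ℂ)) ∈ TP U := by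
  have h1 : (fun y => (starRingEnd ℂ) (f y)) ∈ TP {η | -η ∈ S} :=
    TP_conj (fun s hs => by simpa using hs) hf
  have h2 := TP_mul (U := U) (fun s hs t ht => by simpa using hU s hs _ ht) hf h1
  convert h2 using 1
  funext y
  rw [Complex.mul_conj, Complex.normSq_eq_norm_sq]

/-- The measure `P` has spectrum in `Z`. -/
def Spc (P : Measure (Fin N → ℝ)) (Z : Set (Fin N → ℝ)) : Prop :=
  ∀ η, η ∉ Z → ∫ y, chr η y ∂P = 0

lemma Spc.mono {P : Measure (Fin N → ℝ)} {Z W : Set (Fin N → ℝ)} (h : Spc P Z) (hZ : Z ⊆ W) :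
    Spc P W := fun η hη => h η fun h' => hη (hZ h')

lemma Spc.integral_TP {P : Measure (Fin N → ℝ)} [IsFiniteMeasure P] {Z S : Set (Fin N → ℝ)}
    (h : Spc P Z) (hS : ∀ s ∈ S, s ∉ Z) {f : (Fin N → ℝ) → ℂ} (hf : f ∈ TP S) :
    ∫ y, f y ∂P = 0 := by
  induction hf using Submodule.span_induction with
  | mem x hx => obtain ⟨η, hη, rfl⟩ := hx; exact h _ (hS _ hη)
  | zero => simp
  | add x y hx hy h1 h2 =>
    simp only [Pi.add_apply]
    rw [integral_add (TP_cb hx).integrable (TP_cb hy).integrable, h1, h2, add_zero]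
  | smul a x _ hx =>
    simp only [Pi.smul_apply]
    rw [integral_smul, hx, smul_zero]

/-- `P` weighted by a nonnegative function. -/
def wP (P : Measure (Fin N → ℝ)) (g : (Fin N → ℝ) → ℝ) : Measure (Fin N → ℝ) :=
  P.withDensity fun y => ENNReal.ofReal (g y)

lemma integral_wP {E : Type*} [NormedAddCommGroup E] [NormedSpace ℝ E]
    (P : Measure (Fin N → ℝ)) {g : (Fin N → ℝ) → ℝ} (hg : CB g) (h0 : ∀ y, 0 ≤ g y)
    (h : (Fin N → ℝ) → E) : ∫ y, h y ∂(wP P g) = ∫ y, g y • h y ∂P := by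
  unfold wP
  rw [integral_withDensity_eq_integral_toReal_smul]
  · simp [ENNReal.toReal_ofReal, h0]
  · exact hg.1.measurable.ennreal_ofReal
  · simp

lemma isFiniteMeasure_wP (P : Measure (Fin N → ℝ)) [IsFiniteMeasure P] {g : (Fin N → ℝ) → ℝ}
    (hg : CB g) : IsFiniteMeasure (wP P g) := by
  unfold wP
  exact isFiniteMeasure_withDensity_ofReal hg.integrable.2

lemma integral_chr_mul_TP {P : Measure (Fin N → ℝ)} [IsFiniteMeasure P]
    {Z S : Set (Fin N → ℝ)} {G g : (Fin N → ℝ) → ℂ} (hG : CB G)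
    (h : ∀ η, η ∉ Z → ∫ y, chr η y * G y ∂P = 0) (hg : g ∈ TP S) (η : Fin N → ℝ)
    (hη : ∀ s ∈ S, η + s ∉ Z) : ∫ y, chr η y * (g y * G y) ∂P = 0 := by
  induction hg using Submodule.span_induction with
  | mem x hx =>
    obtain ⟨θ, hθ, rfl⟩ := hx
    rw [← h _ (hη _ hθ)]
    congr 1; funext y; rw [chr_add, mul_assoc]
  | zero => simp
  | add x y hx hy h1 h2 =>
    simp only [Pi.add_apply, add_mul, mul_add]
    rw [integral_add ((chr_cb η).mul ((TP_cb hx).mul hG)).integrable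
      ((chr_cb η).mul ((TP_cb hy).mul hG)).integrable, h1, h2, add_zero]
  | smul a x _ hx =>
    have : ∀ y, chr η y * ((a • x) y * G y) = a * (chr η y * (x y * G y)) := by
      intro y; simp; ring
    simp only [this]
    rw [integral_const_mul, hx, mul_zero]

/-- Weighting by `‖f‖ ^ (2 * M)` enlarges the spectrum in a controlled way. -/
lemma Spc.weight {P : Measure (Fin N → ℝ)} [IsFiniteMeasure P] {κ : Type*}
    {l : κ → (Fin N → ℝ) →ₗ[ℝ] ℝ} {z β : κ → ℝ} (h : Spc P {η | ∀ k, |l k η| ≤ z k})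
    {S : Set (Fin N → ℝ)} (hS : ∀ s ∈ S, ∀ t ∈ S, ∀ k, |l k (s - t)| ≤ β k)
    {f : (Fin N → ℝ) → ℂ} (hf : f ∈ TP S) (M : ℕ) :
    Spc (wP P fun y => ‖f y‖ ^ (2 * M)) {η | ∀ k, |l k η| ≤ z k + M * β k} := by
  have key : ∀ M : ℕ, ∀ η, η ∉ {η | ∀ k, |l k η| ≤ z k + M * β k} →
      ∫ y, chr η y * ((‖f y‖ ^ (2 * M) : ℝ) : ℂ) ∂P = 0 := by
    intro M
    induction M with
    | zero =>
      intro η hη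
      simpa using h η (by simpa using hη)
    | succ M ih =>
      intro η hη
      have hcb : CB (fun y => ((‖f y‖ ^ (2 * M) : ℝ) : ℂ)) := by
        obtain ⟨h1, C, h2⟩ := (TP_cb hf).norm.pow (2 * M)
        exact ⟨Complex.continuous_ofReal.comp h1, C, fun y => by simpa using h2 y⟩
      have := integral_chr_mul_TP hcb ih
        (TP_sq (U := {d | ∀ k, |l k d| ≤ β k}) (fun s hs t ht k => hS s hs t ht k) hf) η ?_
      · rw [← this]
        congr 1; funext y
        rw [← Complex.ofReal_mul, ← pow_add]
        congr 4; ring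
      · intro d hd hmem
        apply hη
        intro k
        have h1 := hmem k
        have h2 := hd k
        rw [map_add] at h1
        have : |l k η| ≤ |l k η + l k d| + |l k d| := by
          have := abs_sub (l k η + l k d) (l k d)
          simpa using this
        push_cast
        linarith
  intro η hη
  rw [integral_wP P ((TP_cb hf).norm.pow _) (fun y => by positivity)]
  rw [← key M η hη]
  congr 1; funext y
  rw [Complex.real_smul, mul_comm]

end

/-- Taylor translation of a power series with exponential normalization. -/
def tl (a : ℝ) : PowerSeries ℝ →ₗ[ℝ] PowerSeries ℝ :=
  LinearMap.mulLeft ℝ (PowerSeries.rescale a (PowerSeries.exp ℝ))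

lemma coeff_tl (a : ℝ) (x : PowerSeries ℝ) (i : ℕ) :
    PowerSeries.coeff i (tl a x) =
      ∑ q ∈ Finset.range (i + 1),
        a ^ (i - q) / ((i - q).factorial : ℝ) * PowerSeries.coeff q x := by
  unfold tl
  rw [LinearMap.mulLeft_apply, PowerSeries.coeff_mul,
    Finset.Nat.sum_antidiagonal_eq_sum_range_succ_mk, ← Finset.sum_range_reflect]
  refine Finset.sum_congr rfl fun q hq => ?_
  have hq' : q ≤ i := by simpa [Nat.lt_succ_iff] using hq
  have h1 : i + 1 - 1 - q = i - q := by omega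
  have h2 : i - (i - q) = q := by omega
  simp only [h1, h2, PowerSeries.coeff_rescale, PowerSeries.coeff_exp]
  simp [div_eq_mul_inv]

lemma tl_tl (a b : ℝ) (x : PowerSeries ℝ) : tl a (tl b x) = tl (a + b) x := by
  unfold tl
  simp only [LinearMap.mulLeft_apply]
  rw [← mul_assoc, PowerSeries.exp_mul_exp_eq_exp_add]

lemma tl_zero (x : PowerSeries ℝ) : tl 0 x = x := by
  ext i
  rw [coeff_tl, Finset.sum_eq_single i]
  · simp
  · intro q hq hne
    have : i - q ≠ 0 := by
      have := Finset.mem_range.1 hq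
      omega
    simp [this]
  · simp

lemma coeff_zero_tl (a : ℝ) (x : PowerSeries ℝ) :
    PowerSeries.coeff 0 (tl a x) = PowerSeries.coeff 0 x := by
  rw [coeff_tl]; simp

/-- Translation followed by dilation. -/
def stl (r a : ℝ) : PowerSeries ℝ →ₗ[ℝ] PowerSeries ℝ where
  toFun x := PowerSeries.rescale r (tl a x)
  map_add' x y := by simp
  map_smul' c x := by ext i; simp [PowerSeries.coeff_rescale]; ring

lemma coeff_stl (r a : ℝ) (x : PowerSeries ℝ) (i : ℕ) :
    PowerSeries.coeff i (stl r a x) = r ^ i * PowerSeries.coeff i (tl a x) :=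
  PowerSeries.coeff_rescale _ _ _

lemma tl_stl {r : ℝ} (hr : r ≠ 0) (a b : ℝ) (x : PowerSeries ℝ) :
    tl b (stl r a x) = stl r (b / r + a) x := by
  have h : PowerSeries.rescale b (PowerSeries.exp ℝ) =
      PowerSeries.rescale r (PowerSeries.rescale (b / r) (PowerSeries.exp ℝ)) := by
    ext i
    simp only [PowerSeries.coeff_rescale]
    rw [div_pow]; field_simp
  change PowerSeries.rescale b (PowerSeries.exp ℝ) * PowerSeries.rescale r (tl a x) =
    PowerSeries.rescale r (tl (b / r + a) x)
  rw [h, ← map_mul, ← tl_tl]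
  rfl

/-- Binomial-type bound for translations. -/
lemma abs_coeff_tl_le {x : PowerSeries ℝ} {i : ℕ} {β : ℕ → ℝ}
    (h : ∀ q ≤ i, |PowerSeries.coeff q x| ≤ β q) (a : ℝ) :
    |PowerSeries.coeff i (tl a x)| ≤
      ∑ q ∈ Finset.range (i + 1), |a| ^ (i - q) * (i.choose q : ℝ) * β q := by
  rw [coeff_tl]
  refine (Finset.abs_sum_le_sum_abs _ _).trans (Finset.sum_le_sum fun q hq => ?_)
  have hq' : q ≤ i := by simpa [Nat.lt_succ_iff] using hq
  rw [abs_mul, abs_div, abs_pow]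
  have h1 : (1 : ℝ) ≤ (i.choose q : ℝ) := by exact_mod_cast Nat.choose_pos hq'
  have h2 : (1 : ℝ) ≤ |((i - q).factorial : ℝ)| := by
    rw [Nat.abs_cast]; exact_mod_cast Nat.factorial_pos _
  refine mul_le_mul ?_ (h q hq') (abs_nonneg _) (by positivity)
  exact (div_le_self (by positivity) h2).trans (le_mul_of_one_le_right (by positivity) h1)

/-- Uniform bound for translations by a parameter in `[-1, 1]`. -/
lemma abs_coeff_tl_le_const {x : PowerSeries ℝ} {i : ℕ} {β : ℝ}
    (h : ∀ q ≤ i, |PowerSeries.coeff q x| ≤ β) {a : ℝ} (ha : |a| ≤ 1) :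
    |PowerSeries.coeff i (tl a x)| ≤ 2 ^ i * β := by
  have hβ : 0 ≤ β := (abs_nonneg _).trans (h 0 (Nat.zero_le _))
  refine (abs_coeff_tl_le (β := fun _ => β) h a).trans ?_
  have : (2 : ℝ) ^ i = ∑ q ∈ Finset.range (i + 1), (i.choose q : ℝ) := by
    exact_mod_cast (Nat.sum_range_choose i).symm
  rw [this, Finset.sum_mul]
  refine Finset.sum_le_sum fun q hq => ?_
  refine mul_le_mul_of_nonneg_right ?_ hβ
  exact mul_le_of_le_one_left (by positivity) (pow_le_one₀ (abs_nonneg _) ha)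

/-- The anisotropic box of the arc with index `k` at level `m`. -/
def Bx (d : ℕ) (B : ℝ) (m k : ℕ) (x : PowerSeries ℝ) : Prop :=
  ∀ i, 1 ≤ i → i ≤ d →
    |PowerSeries.coeff i (tl (-((k : ℝ) / 8 ^ m)) x)| ≤ B * ((1 / 8 : ℝ) ^ m) ^ i

/-- The tiny set of frequencies at scale `8^{-md}`. -/
def Ty (d : ℕ) (B : ℝ) (m : ℕ) (x : PowerSeries ℝ) : Prop :=
  ∀ a : ℝ, 0 ≤ a → a ≤ 1 → ∀ i, 1 ≤ i → i ≤ d →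
    |PowerSeries.coeff i (tl (-a) x)| ≤ B * ((1 / 8 : ℝ) ^ m) ^ d

/-- The box of an arc is contained in the box of its ancestor. -/
lemma Bx.parent {d : ℕ} {B : ℝ} (hB : 1 ≤ B) {a m I j : ℕ} (ham : a ≤ m)
    (hj : j < 8 ^ (m - a)) {x : PowerSeries ℝ} (hx : PowerSeries.coeff 0 x = 1)
    (h : Bx d B m (I * 8 ^ (m - a) + j) x) : Bx d B a I x := by
  intro i hi1 hid
  set s : ℝ := (j : ℝ) / 8 ^ m with hs
  have h8 : (8 : ℝ) ^ m = 8 ^ a * 8 ^ (m - a) := by rw [← pow_add]; congr 1; omega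
  have hz : -((I : ℝ) / 8 ^ a) = s + -(((I * 8 ^ (m - a) + j : ℕ) : ℝ) / 8 ^ m) := by
    rw [hs, h8]; push_cast; field_simp; ring
  have hs0 : 0 ≤ s := by positivity
  have hsS : s + (1 / 8 : ℝ) ^ m ≤ (1 / 8 : ℝ) ^ a := by
    have : (j : ℝ) + 1 ≤ 8 ^ (m - a) := by exact_mod_cast hj
    rw [hs, one_div, inv_pow, inv_pow, h8]
    have h8a : (0 : ℝ) < 8 ^ a := by positivity
    have h8b : (0 : ℝ) < 8 ^ (m - a) := by positivity
    rw [← one_div, ← one_div, ← add_div, div_le_div_iff₀ (by positivity) h8a]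
    nlinarith
  rw [hz, ← tl_tl]
  set u := tl (-(((I * 8 ^ (m - a) + j : ℕ) : ℝ) / 8 ^ m)) x with hu
  have hu0 : PowerSeries.coeff 0 u = 1 := by rw [hu, coeff_zero_tl, hx]
  set σ := (1 / 8 : ℝ) ^ m
  have hσ : 0 ≤ σ := by positivity
  set S := (1 / 8 : ℝ) ^ a
  have hle : ∀ q ≤ i, |PowerSeries.coeff q u| ≤ if q = 0 then 1 else B * σ ^ q := by
    intro q hq
    split_ifs with hq0
    · subst hq0; rw [hu0]; simp
    · exact h q (by omega) (by omega)
  refine (abs_coeff_tl_le hle s).trans ?_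
  rw [abs_of_nonneg hs0, Finset.sum_range_succ']
  have e1 : ∀ q ∈ Finset.range i, s ^ (i - (q + 1)) * (i.choose (q + 1) : ℝ) *
      (if q + 1 = 0 then 1 else B * σ ^ (q + 1)) =
      B * (σ ^ (q + 1) * s ^ (i - (q + 1)) * (i.choose (q + 1) : ℝ)) := by
    intro q _; simp; ring
  rw [Finset.sum_congr rfl e1, ← Finset.mul_sum]
  have e2 := add_pow σ s i
  rw [Finset.sum_range_succ'] at e2
  simp only [pow_zero, Nat.sub_zero, Nat.choose_zero_right, Nat.cast_one, mul_one, one_mul,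
    if_true] at e2 ⊢
  have e3 : (σ + s) ^ i ≤ S ^ i := pow_le_pow_left₀ (by positivity) (by linarith) i
  have e4 : 0 ≤ s ^ i := by positivity
  nlinarith

/-- Sums over consecutive blocks of length `L`. -/
def blk {M : Type*} [AddCommMonoid M] (L : ℕ) (g : ℕ → M) (I : ℕ) : M :=
  ∑ j ∈ Finset.range L, g (I * L + j)

lemma sum_range_mul' {M : Type*} [AddCommMonoid M] (g : ℕ → M) (n L : ℕ) :
    ∑ k ∈ Finset.range (n * L), g k = ∑ I ∈ Finset.range n, blk L g I := by
  induction n with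
  | zero => simp
  | succ n ih =>
    rw [Finset.sum_range_succ, ← ih, Nat.succ_mul, Finset.sum_range_add]; rfl

lemma blk_blk {M : Type*} [AddCommMonoid M] (c L : ℕ) (g : ℕ → M) (I : ℕ) :
    blk c (blk L g) I = blk (c * L) g I := by
  have := sum_range_mul' (fun k => g (I * (c * L) + k)) c L
  unfold blk at *
  rw [this]
  refine Finset.sum_congr rfl fun i _ => Finset.sum_congr rfl fun j _ => ?_
  congr 1; ring

lemma blk_range {M : Type*} [AddCommMonoid M] (L : ℕ) (g : ℕ → M) :
    blk L g 0 = ∑ k ∈ Finset.range L, g k := by simp [blk]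

lemma blk_one {M : Type*} [AddCommMonoid M] (g : ℕ → M) (I : ℕ) : blk 1 g I = g I := by
  simp [blk]

lemma blk_pos {L : ℕ} (hL : 0 < L) {s : ℕ → ℝ} (hs : ∀ k, 0 < s k) (I : ℕ) : 0 < blk L s I :=
  Finset.sum_pos (fun _ _ => hs _) (by simpa using hL.ne')

section

/-- Triangular numbers. -/
def Tri (d : ℕ) : ℕ := d * (d + 1) / 2

lemma two_mul_Tri (d : ℕ) : 2 * Tri d = d * (d + 1) :=
  Nat.mul_div_cancel' (Nat.even_mul_succ_self d).two_dvd

lemma Tri_succ (d : ℕ) : Tri (d + 1) = Tri d + (d + 1) := by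
  have h1 := two_mul_Tri d
  have h2 := two_mul_Tri (d + 1)
  nlinarith

lemma Tri_mono : Monotone Tri := monotone_nat_of_le_succ fun d => by rw [Tri_succ]; omega

lemma Tri_pos {d : ℕ} (h : 1 ≤ d) : 1 ≤ Tri d := Tri_mono h

/-- The data of a decoupling problem for the moment curve of degree `d` at level `m`. -/
structure Dat {N : ℕ} (d : ℕ) (B : ℝ) (m : ℕ) (P : Measure (Fin N → ℝ))
    (ψ : (Fin N → ℝ) →ₗ[ℝ] PowerSeries ℝ) (v : PowerSeries ℝ)
    (f : ℕ → (Fin N → ℝ) → ℂ) (s : ℕ → ℝ) : Prop where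
  fin : IsFiniteMeasure P
  c0 : ∀ η, PowerSeries.coeff 0 (ψ η) = 0
  v0 : PowerSeries.coeff 0 v = 1
  spc : Spc P {η | Ty d B m (ψ η)}
  f_mem : ∀ k < 8 ^ m, f k ∈ TP {η | Bx d B m k (v + ψ η)}
  s_pos : ∀ k, 0 < s k
  f_le : ∀ k < 8 ^ m, ∫ y, ‖f k y‖ ^ (2 * Tri d) ∂P ≤ s k ^ Tri d

/-- Decoupling at level `m` with constant `exp Y`. -/
def WDat (N d : ℕ) (B : ℝ) (m : ℕ) (Y : ℝ) : Prop :=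
  ∀ (P : Measure (Fin N → ℝ)) (ψ : (Fin N → ℝ) →ₗ[ℝ] PowerSeries ℝ) (v : PowerSeries ℝ)
    (f : ℕ → (Fin N → ℝ) → ℂ) (s : ℕ → ℝ), Dat d B m P ψ v f s →
    ∫ y, ‖(blk (8 ^ m) f 0) y‖ ^ (2 * Tri d) ∂P ≤ exp Y * (blk (8 ^ m) s 0) ^ Tri d

/-- Decoupling for the moment curve of degree `d`. -/
def WD (N d : ℕ) : Prop :=
  ∀ B : ℝ, 1 ≤ B → ∀ ε : ℝ, 0 < ε → ∃ C : ℝ, ∀ m : ℕ, WDat N d B m (ε * m + C)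

lemma WDat.mono {N d : ℕ} {B : ℝ} {m : ℕ} {Y Z : ℝ} (h : WDat N d B m Y) (hYZ : Y ≤ Z) :
    WDat N d B m Z := by
  intro P ψ v f s hd
  refine (h P ψ v f s hd).trans (mul_le_mul_of_nonneg_right (exp_le_exp.2 hYZ) ?_)
  exact pow_nonneg (blk_pos (by positivity) hd.s_pos 0).le _

variable {N d : ℕ} {B : ℝ} {m : ℕ} {P : Measure (Fin N → ℝ)}
  {ψ : (Fin N → ℝ) →ₗ[ℝ] PowerSeries ℝ} {v : PowerSeries ℝ}
  {f : ℕ → (Fin N → ℝ) → ℂ} {s : ℕ → ℝ}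

namespace Dat

lemma v0' (h : Dat d B m P ψ v f s) (η : Fin N → ℝ) : PowerSeries.coeff 0 (v + ψ η) = 1 := by
  rw [map_add, h.v0, h.c0, add_zero]

lemma cb (h : Dat d B m P ψ v f s) {k : ℕ} (hk : k < 8 ^ m) : CB (f k) := TP_cb (h.f_mem k hk)

lemma index_lt {a m I j : ℕ} (ham : a ≤ m) (hI : I < 8 ^ a) (hj : j < 8 ^ (m - a)) :
    I * 8 ^ (m - a) + j < 8 ^ m := by
  have h8 : (8 : ℕ) ^ m = 8 ^ a * 8 ^ (m - a) := by rw [← pow_add]; congr 1; omega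
  rw [h8]
  calc I * 8 ^ (m - a) + j < I * 8 ^ (m - a) + 8 ^ (m - a) := by omega
    _ = (I + 1) * 8 ^ (m - a) := by ring
    _ ≤ _ := Nat.mul_le_mul_right _ hI

lemma blk_mem (h : Dat d B m P ψ v f s) (hB : 1 ≤ B) {a I : ℕ} (ham : a ≤ m) (hI : I < 8 ^ a) :
    blk (8 ^ (m - a)) f I ∈ TP {η | Bx d B a I (v + ψ η)} := by
  refine Submodule.sum_mem _ fun j hj => ?_
  have hj' := Finset.mem_range.1 hj
  refine TP_mono ?_ (h.f_mem _ (index_lt ham hI hj'))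
  intro η hη
  exact Bx.parent hB ham hj' (h.v0' η) hη

lemma rescale (h : Dat d B m P ψ v f s) {a I : ℕ} (ham : a ≤ m) (hI : I < 8 ^ a) :
    Dat d B (m - a) P ((stl (8 ^ a) (-((I : ℝ) / 8 ^ a))).comp ψ)
      (stl (8 ^ a) (-((I : ℝ) / 8 ^ a)) v)
      (fun j => f (I * 8 ^ (m - a) + j)) (fun j => s (I * 8 ^ (m - a) + j)) := by
  have h8 : (8 : ℝ) ^ m = 8 ^ a * 8 ^ (m - a) := by rw [← pow_add]; congr 1; omega
  have h8' : (1 / 8 : ℝ) ^ m = (1 / 8) ^ a * (1 / 8) ^ (m - a) := by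
    rw [← pow_add]; congr 1; omega
  have h18 : (8 : ℝ) ^ a * (1 / 8) ^ a = 1 := by rw [← mul_pow]; norm_num
  have hne : (8 : ℝ) ^ a ≠ 0 := by positivity
  refine ⟨h.fin, ?_, ?_, ?_, ?_, fun k => h.s_pos _, ?_⟩
  · intro η
    rw [LinearMap.comp_apply, coeff_stl, coeff_zero_tl, h.c0, mul_zero]
  · rw [coeff_stl, coeff_zero_tl, h.v0]; simp
  · refine h.spc.mono ?_
    intro η hη b hb0 hb1 i hi1 hid
    rw [LinearMap.comp_apply, tl_stl hne, coeff_stl]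
    have hI1 : (I : ℝ) + 1 ≤ 8 ^ a := by exact_mod_cast hI
    have hle : (b + I) / 8 ^ a ≤ 1 := by
      rw [div_le_one (by positivity)]; linarith
    have := hη ((b + I) / 8 ^ a) (by positivity) hle i hi1 hid
    have e : -((b + I) / 8 ^ a) = -b / 8 ^ a + -((I : ℝ) / 8 ^ a) := by ring
    rw [e] at this
    rw [abs_mul, abs_of_pos (by positivity : (0 : ℝ) < (8 ^ a) ^ i)]
    have hB : 0 ≤ B * ((1 / 8 : ℝ) ^ (m - a)) ^ d * ((1 / 8 : ℝ) ^ a) ^ i := by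
      have h0 := (abs_nonneg _).trans this
      have hB0 : 0 ≤ B := by
        by_contra hneg
        have : B * ((1 / 8 : ℝ) ^ m) ^ d < 0 := mul_neg_of_neg_of_pos (by linarith) (by positivity)
        linarith
      positivity
    calc (8 ^ a : ℝ) ^ i * _ ≤ (8 ^ a) ^ i * (B * ((1 / 8 : ℝ) ^ m) ^ d) := by gcongr
      _ ≤ (8 ^ a) ^ i * (B * ((1 / 8 : ℝ) ^ (m - a)) ^ d * ((1 / 8 : ℝ) ^ a) ^ i) := by
        refine mul_le_mul_of_nonneg_left ?_ (by positivity)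
        rw [h8', mul_pow]
        have hp : ((1 / 8 : ℝ) ^ a) ^ d ≤ ((1 / 8 : ℝ) ^ a) ^ i :=
          pow_le_pow_of_le_one (by positivity) (pow_le_one₀ (by norm_num) (by norm_num)) hid
        have hB0 : 0 ≤ B * ((1 / 8 : ℝ) ^ (m - a)) ^ d := by
          have : 0 < ((1 / 8 : ℝ) ^ a) ^ i := by positivity
          exact nonneg_of_mul_nonneg_left hB this
        nlinarith
      _ = B * ((1 / 8 : ℝ) ^ (m - a)) ^ d * ((8 : ℝ) ^ a * (1 / 8) ^ a) ^ i := by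
        rw [mul_pow]; ring
      _ = _ := by rw [h18, one_pow, mul_one]
  · intro j hj
    refine TP_mono ?_ (h.f_mem _ (index_lt ham hI hj))
    intro η hη i hi1 hid
    rw [LinearMap.comp_apply, ← map_add, tl_stl hne, coeff_stl]
    have := hη i hi1 hid
    have e : -(((I * 8 ^ (m - a) + j : ℕ) : ℝ) / 8 ^ m) =
        -((j : ℝ) / 8 ^ (m - a)) / 8 ^ a + -((I : ℝ) / 8 ^ a) := by
      rw [h8]; push_cast; field_simp; ring
    rw [e] at this
    rw [abs_mul, abs_of_pos (by positivity : (0 : ℝ) < (8 ^ a) ^ i)]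
    calc (8 ^ a : ℝ) ^ i * _ ≤ (8 ^ a) ^ i * (B * ((1 / 8 : ℝ) ^ m) ^ i) := by gcongr
      _ = B * ((1 / 8 : ℝ) ^ (m - a)) ^ i * ((8 : ℝ) ^ a * (1 / 8) ^ a) ^ i := by
        rw [h8', mul_pow, mul_pow]; ring
      _ = _ := by rw [h18, one_pow, mul_one]
  · intro j hj
    exact h.f_le _ (index_lt ham hI hj)

/-- Decoupling inside a block. -/
lemma block (h : Dat d B m P ψ v f s) {a I : ℕ} (ham : a ≤ m) (hI : I < 8 ^ a) {Y : ℝ}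
    (hW : WDat N d B (m - a) Y) :
    ∫ y, ‖(blk (8 ^ (m - a)) f I) y‖ ^ (2 * Tri d) ∂P ≤
      exp Y * (blk (8 ^ (m - a)) s I) ^ Tri d := by
  have := hW _ _ _ _ _ (h.rescale ham hI)
  simpa [blk] using this

lemma blk_cb (h : Dat d B m P ψ v f s) {a I : ℕ} (ham : a ≤ m) (hI : I < 8 ^ a) :
    CB (blk (8 ^ (m - a)) f I) := by
  have : blk (8 ^ (m - a)) f I = fun y => ∑ j ∈ Finset.range (8 ^ (m - a)),
      f (I * 8 ^ (m - a) + j) y := by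
    funext y; simp [blk]
  rw [this]
  exact CB.sum _ fun j hj => h.cb (index_lt ham hI (Finset.mem_range.1 hj))

end Dat

/-- Power mean inequality for norms of sums. -/
lemma norm_sum_pow_le {κ : Type*} (t : Finset κ) (g : κ → ℂ) {p : ℕ} (hp : p ≠ 0) :
    ‖∑ k ∈ t, g k‖ ^ p ≤ (t.card : ℝ) ^ p * ∑ k ∈ t, ‖g k‖ ^ p := by
  rcases t.eq_empty_or_nonempty with rfl | hne
  · simp [hp]
  have hc : (1 : ℝ) ≤ t.card := by exact_mod_cast hne.card_pos
  obtain ⟨k₀, hk₀, hmax⟩ := t.exists_max_image (fun k => ‖g k‖) hne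
  calc ‖∑ k ∈ t, g k‖ ^ p ≤ (t.card * ‖g k₀‖) ^ p := by
        gcongr
        refine (norm_sum_le _ _).trans ?_
        refine (Finset.sum_le_sum hmax).trans ?_
        simp
    _ = (t.card : ℝ) ^ p * ‖g k₀‖ ^ p := mul_pow _ _ _
    _ ≤ _ := by
        gcongr
        exact Finset.single_le_sum (f := fun k => ‖g k‖ ^ p) (fun _ _ => by positivity) hk₀

lemma sum_pow_le_pow_sum' {κ : Type*} (t : Finset κ) {g : κ → ℝ} (hg : ∀ k ∈ t, 0 ≤ g k) {p : ℕ}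
    (hp : 1 ≤ p) : ∑ k ∈ t, g k ^ p ≤ (∑ k ∈ t, g k) ^ p := by
  obtain ⟨q, rfl⟩ : ∃ q, p = q + 1 := ⟨p - 1, by omega⟩
  rw [pow_succ, Finset.mul_sum]
  refine Finset.sum_le_sum fun k hk => ?_
  rw [pow_succ]
  refine mul_le_mul_of_nonneg_right ?_ (hg k hk)
  exact pow_le_pow_left₀ (hg k hk) (Finset.single_le_sum hg hk) _

/-- The trivial decoupling bound. -/
lemma WDat_trivial (N d : ℕ) (hd : 1 ≤ d) (B : ℝ) (m : ℕ) :
    WDat N d B m ((2 * Tri d * Real.log 8) * m) := by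
  intro P ψ v f s h
  have := h.fin
  have hexp : exp ((2 * Tri d * Real.log 8) * m) = ((8 : ℝ) ^ m) ^ (2 * Tri d) := by
    rw [← pow_mul, ← Real.exp_log (by positivity : (0 : ℝ) < 8 ^ (m * (2 * Tri d))), Real.log_pow]
    push_cast
    ring_nf
  rw [hexp, blk_range, blk_range]
  calc ∫ y, ‖(∑ k ∈ Finset.range (8 ^ m), f k) y‖ ^ (2 * Tri d) ∂P
      ≤ ∫ y, ((8 : ℝ) ^ m) ^ (2 * Tri d) *
          ∑ k ∈ Finset.range (8 ^ m), ‖f k y‖ ^ (2 * Tri d) ∂P := by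
        refine integral_mono ?_ ?_ fun y => ?_
        · have : CB (fun y => ‖(∑ k ∈ Finset.range (8 ^ m), f k) y‖ ^ (2 * Tri d)) := by
            simp only [Finset.sum_apply]
            exact (CB.sum _ fun k hk => h.cb (Finset.mem_range.1 hk)).norm.pow _
          exact this.integrable
        · exact ((CB.const _).mul (CB.sum _ fun k hk =>
            (h.cb (Finset.mem_range.1 hk)).norm.pow _)).integrable
        · have := norm_sum_pow_le (Finset.range (8 ^ m)) (fun k => f k y) (p := 2 * Tri d)
            (by have := Tri_pos hd; omega)
          simpa using this
    _ = ((8 : ℝ) ^ m) ^ (2 * Tri d) *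
          ∑ k ∈ Finset.range (8 ^ m), ∫ y, ‖f k y‖ ^ (2 * Tri d) ∂P := by
        rw [integral_const_mul, integral_finsetSum]
        intro k hk
        exact ((h.cb (Finset.mem_range.1 hk)).norm.pow _).integrable
    _ ≤ ((8 : ℝ) ^ m) ^ (2 * Tri d) * ∑ k ∈ Finset.range (8 ^ m), s k ^ Tri d := by
        gcongr with k hk
        exact h.f_le k (Finset.mem_range.1 hk)
    _ ≤ _ := by
        gcongr
        exact sum_pow_le_pow_sum' _ (fun k _ => (h.s_pos k).le) (Tri_pos hd)


lemma integral_norm_sum_sq_le {P : Measure (Fin N → ℝ)} [IsFiniteMeasure P] {n R : ℕ}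
    {f : ℕ → (Fin N → ℝ) → ℂ} {s : ℕ → ℝ} (hcb : ∀ k < n, CB (f k))
    (hs : ∀ k < n, ∫ y, ‖f k y‖ ^ 2 ∂P ≤ s k)
    (horth : ∀ k < n, ∀ l < n, (R : ℤ) < |(k : ℤ) - l| →
      ∫ y, f k y * (starRingEnd ℂ) (f l y) ∂P = 0) :
    ∫ y, ‖∑ k ∈ Finset.range n, f k y‖ ^ 2 ∂P ≤ (2 * R + 1) * ∑ k ∈ Finset.range n, s k := by
  have hs0 : ∀ k < n, 0 ≤ s k := fun k hk =>
    (integral_nonneg fun y => by positivity).trans (hs k hk)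
  have hconj : ∀ k < n, CB (fun y => (starRingEnd ℂ) (f k y)) := fun k hk => by
    obtain ⟨h1, C, h2⟩ := hcb k hk
    exact ⟨Complex.continuous_conj.comp h1, C, fun y => by simpa using h2 y⟩
  have e1 : ((∫ y, ‖∑ k ∈ Finset.range n, f k y‖ ^ 2 ∂P : ℝ) : ℂ) =
      ∑ k ∈ Finset.range n, ∑ l ∈ Finset.range n,
        ∫ y, f k y * (starRingEnd ℂ) (f l y) ∂P := by
    rw [← integral_complex_ofReal]
    have : ∀ y, ((‖∑ k ∈ Finset.range n, f k y‖ ^ 2 : ℝ) : ℂ) =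
        ∑ k ∈ Finset.range n, ∑ l ∈ Finset.range n, f k y * (starRingEnd ℂ) (f l y) := by
      intro y
      rw [← Complex.normSq_eq_norm_sq, ← Complex.mul_conj, map_sum, Finset.sum_mul_sum]
    simp only [this]
    rw [integral_finsetSum]
    · refine Finset.sum_congr rfl fun k hk => ?_
      rw [integral_finsetSum]
      intro l hl
      exact ((hcb k (Finset.mem_range.1 hk)).mul (hconj l (Finset.mem_range.1 hl))).integrable
    · intro k hk
      exact (CB.sum _ fun l hl => (hcb k (Finset.mem_range.1 hk)).mul
        (hconj l (Finset.mem_range.1 hl))).integrable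
  have e2 : ∀ k ∈ Finset.range n, ∀ l ∈ Finset.range n,
      ‖∫ y, f k y * (starRingEnd ℂ) (f l y) ∂P‖ ≤
        if |(k : ℤ) - l| ≤ R then (s k + s l) / 2 else 0 := by
    intro k hk l hl
    have hk := Finset.mem_range.1 hk
    have hl := Finset.mem_range.1 hl
    split_ifs with hR
    · calc ‖∫ y, f k y * (starRingEnd ℂ) (f l y) ∂P‖
          ≤ ∫ y, ‖f k y * (starRingEnd ℂ) (f l y)‖ ∂P := norm_integral_le_integral_norm _
        _ ≤ ∫ y, (1 / 2) * (‖f k y‖ ^ 2 + ‖f l y‖ ^ 2) ∂P := by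
            refine integral_mono ((hcb k hk).mul (hconj l hl)).norm.integrable
              ((CB.const _).mul (((hcb k hk).norm.pow 2).add ((hcb l hl).norm.pow 2))).integrable
              fun y => ?_
            simp only [norm_mul, RCLike.norm_conj]
            nlinarith [sq_nonneg (‖f k y‖ - ‖f l y‖)]
        _ = (1 / 2) * (∫ y, ‖f k y‖ ^ 2 ∂P + ∫ y, ‖f l y‖ ^ 2 ∂P) := by
            rw [integral_const_mul, integral_add ((hcb k hk).norm.pow 2).integrable
              ((hcb l hl).norm.pow 2).integrable]
        _ ≤ _ := by linarith [hs k hk, hs l hl]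
    · rw [horth k hk l hl (by omega)]; simp
  have hcount : ∀ k : ℕ, ∑ l ∈ Finset.range n, (if |(k : ℤ) - l| ≤ R then (1 : ℝ) else 0) ≤
      2 * R + 1 := by
    intro k
    rw [Finset.sum_ite, Finset.sum_const_zero, add_zero, Finset.sum_const, nsmul_eq_mul, mul_one]
    have : ((Finset.range n).filter fun l : ℕ => |(k : ℤ) - l| ≤ R) ⊆
        Finset.Icc (k - R) (k + R) := by
      intro l hl
      simp only [Finset.mem_filter] at hl
      rw [Finset.mem_Icc]
      have := abs_le.1 hl.2
      omega
    have h2 := Finset.card_le_card this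
    rw [Nat.card_Icc] at h2
    have h3 : ((Finset.range n).filter fun l : ℕ => |(k : ℤ) - l| ≤ R).card ≤ 2 * R + 1 := by
      omega
    exact_mod_cast h3
  have e3 : ∫ y, ‖∑ k ∈ Finset.range n, f k y‖ ^ 2 ∂P ≤
      ∑ k ∈ Finset.range n, ∑ l ∈ Finset.range n,
        if |(k : ℤ) - l| ≤ R then (s k + s l) / 2 else 0 := by
    calc ∫ y, ‖∑ k ∈ Finset.range n, f k y‖ ^ 2 ∂P
        ≤ ‖((∫ y, ‖∑ k ∈ Finset.range n, f k y‖ ^ 2 ∂P : ℝ) : ℂ)‖ := by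
          rw [Complex.norm_real]; exact le_abs_self _
      _ ≤ _ := by
          rw [e1]
          exact (norm_sum_le _ _).trans (Finset.sum_le_sum fun k hk =>
            (norm_sum_le _ _).trans (Finset.sum_le_sum fun l hl => e2 k hk l hl))
  refine e3.trans ?_
  set χ : ℕ → ℕ → ℝ := fun k l => if |(k : ℤ) - l| ≤ R then (1 : ℝ) else 0 with hχ
  have hsymm : ∀ k l, χ k l = χ l k := by
    intro k l; simp only [hχ, abs_sub_comm]
  have e4 : ∀ k l : ℕ, (if |(k : ℤ) - l| ≤ R then (s k + s l) / 2 else 0) =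
      (1 / 2) * (s k * χ k l) + (1 / 2) * (s l * χ l k) := by
    intro k l
    rw [hsymm l k]
    simp only [hχ]
    split_ifs <;> ring
  simp only [e4, Finset.sum_add_distrib, ← Finset.mul_sum]
  rw [Finset.sum_comm (f := fun k l => s l * χ l k)]
  simp only [← Finset.mul_sum]
  have : ∑ k ∈ Finset.range n, s k * ∑ l ∈ Finset.range n, χ k l ≤
      ∑ k ∈ Finset.range n, s k * (2 * R + 1) :=
    Finset.sum_le_sum fun k hk =>
      mul_le_mul_of_nonneg_left (hcount k) (hs0 k (Finset.mem_range.1 hk))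
  rw [← Finset.sum_mul] at this
  linarith

/-- Decoupling in degree one: local orthogonality. -/
lemma WD_one (N : ℕ) : WD N 1 := by
  intro B hB ε hε
  obtain ⟨R, hR⟩ := exists_nat_ge (3 * B)
  refine ⟨Real.log (2 * R + 1), fun m => ?_⟩
  have hT : Tri 1 = 1 := rfl
  suffices h : WDat N 1 B m (Real.log (2 * R + 1)) from
    h.mono (le_add_of_nonneg_left (by positivity))
  intro P ψ v f s h
  have := h.fin
  have hle := h.f_le
  rw [hT] at hle ⊢
  rw [Real.exp_log (by positivity), blk_range, blk_range]
  simp only [mul_one, pow_one, Finset.sum_apply] at hle ⊢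
  refine integral_norm_sum_sq_le (fun k hk => h.cb hk) hle ?_
  intro k hk l hl hkl
  have hmem := TP_mul (U := {η | ∃ s t, Bx 1 B m k (v + ψ s) ∧ Bx 1 B m l (v + ψ t) ∧ η = s - t})
    (T := {η | -η ∈ {η | Bx 1 B m l (v + ψ η)}}) (fun s hs t ht => ⟨s, -t, hs, ht, by simp⟩)
    (h.f_mem k hk) (TP_conj (fun s hs => by simpa using hs) (h.f_mem l hl))
  refine h.spc.integral_TP ?_ hmem
  rintro _ ⟨s, t, hs, ht, rfl⟩ hTy
  have h1 := hTy 0 le_rfl zero_le_one 1 le_rfl le_rfl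
  have h2 := hs 1 le_rfl le_rfl
  have h3 := ht 1 le_rfl le_rfl
  have hc : ∀ (a : ℝ) (x : PowerSeries ℝ), PowerSeries.coeff 1 (tl a x) =
      a * PowerSeries.coeff 0 x + PowerSeries.coeff 1 x := by
    intro a x
    rw [coeff_tl, Finset.sum_range_succ, Finset.sum_range_one]; simp
  rw [hc, h.v0'] at h2 h3
  rw [hc] at h1
  simp only [map_add, map_sub, mul_one, pow_one, neg_zero, zero_mul, zero_add] at h1 h2 h3
  have hσ : (0 : ℝ) < (1 / 8) ^ m := by positivity
  have e : ∀ k : ℕ, (k : ℝ) / 8 ^ m = k * (1 / 8) ^ m := by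
    intro k; rw [one_div, inv_pow]; rfl
  rw [e] at h2 h3
  have hkl' : (R : ℝ) < |(k : ℝ) - l| := by exact_mod_cast hkl
  have h4 : |((k : ℝ) - l) * (1 / 8) ^ m| ≤ 3 * B * (1 / 8) ^ m := by
    rw [abs_le] at *
    constructor <;> linarith [h1.1, h1.2, h2.1, h2.2, h3.1, h3.2]
  rw [abs_mul, abs_of_pos hσ] at h4
  have := le_of_mul_le_mul_right h4 hσ
  linarith

end

lemma hermite_matrix_injective {d l : ℕ} (hld : l ≤ d) (w : Fin l → ℝ)
    (h : ∀ j : Fin l, ∑ k : Fin l,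
      (if j.1 ≤ k.1 + (d - l) then w k / ((k.1 + (d - l) - j.1).factorial : ℝ) else 0) = 0) :
    w = 0 := by
  classical
  rcases Nat.eq_zero_or_pos l with rfl | hl
  · ext i; exact i.elim0
  set p : Polynomial ℝ := ∑ k : Fin l,
    Polynomial.C (w k / ((k.1 + (d - l)).factorial : ℝ)) * Polynomial.X ^ (k.1 + (d - l)) with hp
  have hcoeff : ∀ k : Fin l, p.coeff (k.1 + (d - l)) = w k / ((k.1 + (d - l)).factorial : ℝ) := by
    intro k
    rw [hp, Polynomial.finsetSum_coeff, Finset.sum_eq_single k]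
    · simp
    · intro b _ hb
      rw [Polynomial.coeff_C_mul, Polynomial.coeff_X_pow, if_neg, mul_zero]
      intro h; apply hb; ext; omega
    · simp
  have hp0 : p = 0 := by
    by_contra hne
    have hX : (Polynomial.X : Polynomial ℝ) ^ (d - l) ∣ p := by
      refine Finset.dvd_sum fun k _ => ?_
      exact Dvd.dvd.mul_left (pow_dvd_pow _ (by omega)) _
    have h1 : (Polynomial.X - Polynomial.C (1 : ℝ)) ^ l ∣ p := by
      have : l - 1 < p.rootMultiplicity 1 := by
        rw [Polynomial.lt_rootMultiplicity_iff_isRoot_iterate_derivative hne]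
        intro m hm
        have := h ⟨m, by omega⟩
        rw [Polynomial.IsRoot.def, hp, Polynomial.iterate_derivative_sum,
          Polynomial.eval_finsetSum, ← this]
        refine Finset.sum_congr rfl fun k _ => ?_
        rw [Polynomial.iterate_derivative_C_mul, Polynomial.iterate_derivative_X_pow_eq_C_mul]
        simp only [Polynomial.eval_mul, Polynomial.eval_C, Polynomial.eval_pow, Polynomial.eval_X,
          one_pow, mul_one]
        split_ifs with hk
        · have e := Nat.factorial_mul_descFactorial hk
          have e' : (((k.1 + (d - l) - m).factorial : ℝ)) *
              ((k.1 + (d - l)).descFactorial m : ℝ) = ((k.1 + (d - l)).factorial : ℝ) := by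
            exact_mod_cast e
          have n1 : ((k.1 + (d - l) - m).factorial : ℝ) ≠ 0 := by positivity
          have n2 : ((k.1 + (d - l)).factorial : ℝ) ≠ 0 := by positivity
          rw [div_mul_eq_mul_div, div_eq_div_iff n2 n1, ← e']
          ring
        · rw [Nat.descFactorial_eq_zero_iff_lt.2 (by omega)]; simp
      exact (Polynomial.le_rootMultiplicity_iff hne).1 (by omega)
    have hco : IsCoprime ((Polynomial.X : Polynomial ℝ) ^ (d - l))
        ((Polynomial.X - Polynomial.C (1 : ℝ)) ^ l) := by
      apply IsCoprime.pow
      have := Polynomial.isCoprime_X_sub_C_of_isUnit_sub (a := (0 : ℝ)) (b := 1) (by simp)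
      simpa using this
    have hdvd := hco.mul_dvd hX h1
    apply hne
    refine Polynomial.eq_zero_of_dvd_of_degree_lt hdvd ?_
    have hdeg : (((Polynomial.X : Polynomial ℝ) ^ (d - l)) *
        ((Polynomial.X - Polynomial.C (1 : ℝ)) ^ l)).degree = ((d : ℕ) : WithBot ℕ) := by
      rw [Polynomial.degree_mul, Polynomial.degree_X_pow, Polynomial.degree_pow,
        Polynomial.degree_X_sub_C]
      rw [nsmul_eq_mul, mul_one]
      norm_cast; omega
    rw [hdeg]
    refine (Polynomial.degree_sum_le _ _).trans_lt ?_
    rw [Finset.sup_lt_iff (by exact WithBot.bot_lt_coe d)]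
    intro k _
    refine (Polynomial.degree_C_mul_X_pow_le _ _).trans_lt ?_
    exact_mod_cast (by omega : k.1 + (d - l) < d)
  ext k
  have := hcoeff k
  rw [hp0, Polynomial.coeff_zero, eq_comm, div_eq_zero_iff] at this
  rcases this with h | h
  · exact h
  · exact absurd h (by positivity)

/-- Dual functionals for the degenerate Taylor map. -/
lemma exists_dual {d l : ℕ} (hld : l ≤ d) : ∃ w : ℕ → ℕ → ℝ, ∀ i j, i < l → j < l →
    ∑ k ∈ Finset.range l,
      (if j ≤ k + (d - l) then w i k / ((k + (d - l) - j).factorial : ℝ) else 0) =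
      if i = j then 1 else 0 := by
  classical
  set M : Matrix (Fin l) (Fin l) ℝ := fun j k =>
    if j.1 ≤ k.1 + (d - l) then 1 / ((k.1 + (d - l) - j.1).factorial : ℝ) else 0 with hM
  have hinj : Function.Injective M.mulVec := by
    rw [← Matrix.coe_mulVecLin]
    rw [← LinearMap.ker_eq_bot, LinearMap.ker_eq_bot']
    intro w hw
    refine hermite_matrix_injective hld w fun j => ?_
    have := congrFun hw j
    rw [Matrix.mulVecLin_apply] at this
    refine Eq.trans ?_ (this.trans (Pi.zero_apply j))
    refine Finset.sum_congr rfl fun k _ => ?_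
    simp only [hM]
    split_ifs <;> ring
  have hu : IsUnit M := Matrix.mulVec_injective_iff_isUnit.1 hinj
  have hdet : IsUnit M.det := (Matrix.isUnit_iff_isUnit_det M).1 hu
  have hmul := Matrix.mul_nonsing_inv M hdet
  refine ⟨fun i k => if h : i < l ∧ k < l then M⁻¹ ⟨k, h.2⟩ ⟨i, h.1⟩ else 0, ?_⟩
  intro i j hi hj
  have := congrFun (congrFun hmul ⟨j, hj⟩) ⟨i, hi⟩
  rw [Matrix.mul_apply] at this
  rw [Finset.sum_range]
  have e : (if i = j then (1 : ℝ) else 0) =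
      (1 : Matrix (Fin l) (Fin l) ℝ) ⟨j, hj⟩ ⟨i, hi⟩ := by
    rw [Matrix.one_apply]; simp [Fin.ext_iff, eq_comm]
  rw [e, ← this]
  refine Finset.sum_congr rfl fun k _ => ?_
  simp only [hM, hi, k.2, and_self, dif_pos]
  split_ifs <;> ring

/-- The functionals picking out the Taylor coefficients at one point from the high-order
Taylor coefficients at a distant point. -/
lemma exists_transfer {d l : ℕ} (hld : l ≤ d) {ρ : ℝ} (hρ : 0 < ρ) (hρ1 : ρ ≤ 1) :
    ∃ K : ℝ, 1 ≤ K ∧ ∀ s : ℝ, ρ ≤ |s| → |s| ≤ 1 →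
      ∃ (W V : ℕ → ℕ → ℝ) (γ : ℕ → ℝ), (∀ i k, |W i k| ≤ K) ∧ (∀ i k, |V i k| ≤ K) ∧
        ∀ (y : PowerSeries ℝ) (i : ℕ), 1 ≤ i → i ≤ l →
          ∑ k ∈ Finset.range l, W i k * PowerSeries.coeff (k + (d - l) + 1) (tl (-s) y) =
            γ i * PowerSeries.coeff 0 y + PowerSeries.coeff i y +
              ∑ q ∈ Finset.Ico (l + 1) (d + 1), V i q * PowerSeries.coeff q y := by
  classical
  obtain ⟨w, hw⟩ := exists_dual hld
  set K0 : ℝ := ∑ i ∈ Finset.range l, ∑ k ∈ Finset.range l, |w i k| with hK0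
  have hK00 : 0 ≤ K0 := Finset.sum_nonneg fun _ _ => Finset.sum_nonneg fun _ _ => abs_nonneg _
  have hwK : ∀ i k, i < l → k < l → |w i k| ≤ K0 := fun i k hi hk =>
    (Finset.single_le_sum (f := fun k => |w i k|) (fun _ _ => abs_nonneg _)
      (Finset.mem_range.2 hk)).trans
    (Finset.single_le_sum (f := fun i => ∑ k ∈ Finset.range l, |w i k|)
      (fun _ _ => Finset.sum_nonneg fun _ _ => abs_nonneg _) (Finset.mem_range.2 hi))
  set K1 : ℝ := K0 * (ρ ^ d)⁻¹ with hK1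
  have hK10 : 0 ≤ K1 := by positivity
  refine ⟨1 + K1 + l * K1, by have : 0 ≤ (l : ℝ) * K1 := by positivity
                              linarith, fun s hs hs1 => ?_⟩
  have hs0 : s ≠ 0 := by rintro rfl; simp at hs; linarith
  set W : ℕ → ℕ → ℝ := fun i k => if 1 ≤ i ∧ i ≤ l ∧ k < l then
    (-s) ^ i * ((-s) ^ (k + (d - l) + 1))⁻¹ * w (i - 1) k else 0 with hW
  have hWK : ∀ i k, |W i k| ≤ K1 := by
    intro i k
    simp only [hW]
    split_ifs with h
    · rw [abs_mul, abs_mul, abs_inv, abs_pow, abs_pow, abs_neg]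
      have h1 : |s| ^ i ≤ 1 := pow_le_one₀ (abs_nonneg _) hs1
      have h2 : (|s| ^ (k + (d - l) + 1))⁻¹ ≤ (ρ ^ d)⁻¹ := by
        apply inv_anti₀ (by positivity)
        calc ρ ^ d ≤ ρ ^ (k + (d - l) + 1) := pow_le_pow_of_le_one hρ.le hρ1 (by omega)
          _ ≤ _ := pow_le_pow_left₀ hρ.le hs _
      calc |s| ^ i * (|s| ^ (k + (d - l) + 1))⁻¹ * |w (i - 1) k|
          ≤ 1 * (ρ ^ d)⁻¹ * K0 := by
            gcongr
            exact hwK _ _ (by omega) h.2.2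
        _ = K1 := by rw [hK1]; ring
    · simpa using hK10
  set A : ℕ → ℕ → ℝ := fun i q => ∑ k ∈ Finset.range l, if q ≤ k + (d - l) + 1 then
    W i k * ((-s) ^ (k + (d - l) + 1 - q) / ((k + (d - l) + 1 - q).factorial : ℝ)) else 0 with hA
  have hAK : ∀ i q, |A i q| ≤ l * K1 := by
    intro i q
    refine (Finset.abs_sum_le_sum_abs _ _).trans ?_
    have : ∀ k ∈ Finset.range l, |if q ≤ k + (d - l) + 1 then
        W i k * ((-s) ^ (k + (d - l) + 1 - q) / ((k + (d - l) + 1 - q).factorial : ℝ)) else 0|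
        ≤ K1 := by
      intro k _
      split_ifs
      · rw [abs_mul, abs_div, abs_pow, abs_neg, Nat.abs_cast]
        have h1 : |s| ^ (k + (d - l) + 1 - q) / ((k + (d - l) + 1 - q).factorial : ℝ) ≤ 1 := by
          refine (div_le_self (by positivity) ?_).trans (pow_le_one₀ (abs_nonneg _) hs1)
          exact_mod_cast Nat.factorial_pos _
        calc _ ≤ K1 * 1 := mul_le_mul (hWK i k) h1 (by positivity) hK10
          _ = K1 := mul_one _
      · simpa using hK10
    refine (Finset.sum_le_sum this).trans ?_
    simp
  have hAδ : ∀ i q, 1 ≤ i → i ≤ l → q < l → A i (q + 1) = if q + 1 = i then 1 else 0 := by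
    intro i q hi1 hil hq
    have h1 := hw (i - 1) q (by omega) hq
    have : A i (q + 1) = (-s) ^ i * ((-s) ^ (q + 1))⁻¹ * ∑ k ∈ Finset.range l,
        (if q ≤ k + (d - l) then w (i - 1) k / ((k + (d - l) - q).factorial : ℝ) else 0) := by
      rw [hA, Finset.mul_sum]
      refine Finset.sum_congr rfl fun k hk => ?_
      have hk := Finset.mem_range.1 hk
      by_cases hqk : q ≤ k + (d - l)
      · rw [if_pos (by omega), if_pos hqk]
        have e1 : k + (d - l) + 1 - (q + 1) = k + (d - l) - q := by omega
        have e2 : (-s) ^ (k + (d - l) + 1) = (-s) ^ (k + (d - l) - q) * (-s) ^ (q + 1) := by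
          rw [← pow_add]; congr 1; omega
        have hns : -s ≠ 0 := neg_ne_zero.2 hs0
        simp only [hW, hi1, hil, hk, and_self, if_true, e1]
        rw [e2]
        field_simp
      · rw [if_neg (by omega), if_neg hqk, mul_zero]
    rw [this, h1]
    by_cases h : q + 1 = i
    · rw [if_pos (by omega), if_pos h, h, mul_one]
      exact mul_inv_cancel₀ (pow_ne_zero _ (neg_ne_zero.2 hs0))
    · rw [if_neg (by omega), if_neg h, mul_zero]
  refine ⟨W, A, fun i => A i 0, fun i k => (hWK i k).trans ?_, fun i k => (hAK i k).trans ?_, ?_⟩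
  · have : 0 ≤ (l : ℝ) * K1 := by positivity
    linarith
  · linarith
  intro y i hi1 hil
  have h1 : ∀ k ∈ Finset.range l,
      W i k * PowerSeries.coeff (k + (d - l) + 1) (tl (-s) y) =
      ∑ q ∈ Finset.range (d + 1), (if q ≤ k + (d - l) + 1 then
        W i k * ((-s) ^ (k + (d - l) + 1 - q) / ((k + (d - l) + 1 - q).factorial : ℝ)) else 0) *
        PowerSeries.coeff q y := by
    intro k hk
    have hk := Finset.mem_range.1 hk
    rw [coeff_tl, Finset.mul_sum]
    have hsub : Finset.range (k + (d - l) + 1 + 1) ⊆ Finset.range (d + 1) :=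
      Finset.range_mono (by omega)
    rw [← Finset.sum_subset hsub]
    · refine Finset.sum_congr rfl fun q hq => ?_
      have hq := Finset.mem_range.1 hq
      rw [if_pos (by omega)]; ring
    · intro q _ hq
      rw [Finset.mem_range] at hq
      rw [if_neg (by omega), zero_mul]
  rw [Finset.sum_congr rfl h1, Finset.sum_comm]
  have h2 : ∀ q ∈ Finset.range (d + 1), ∑ k ∈ Finset.range l, (if q ≤ k + (d - l) + 1 then
        W i k * ((-s) ^ (k + (d - l) + 1 - q) / ((k + (d - l) + 1 - q).factorial : ℝ)) else 0) *
        PowerSeries.coeff q y = A i q * PowerSeries.coeff q y := by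
    intro q _
    rw [hA, Finset.sum_mul]
  rw [Finset.sum_congr rfl h2, ← Finset.sum_range_add_sum_Ico _ (by omega : l + 1 ≤ d + 1),
    Finset.sum_range_succ']
  congr 1
  rw [add_comm]
  congr 1
  rw [Finset.sum_eq_single (i - 1)]
  · rw [hAδ i (i - 1) hi1 hil (by omega), if_pos (by omega), one_mul]
    congr 2; omega
  · intro q hq hne
    rw [hAδ i q hi1 hil (Finset.mem_range.1 hq), if_neg (by omega), zero_mul]
  · intro h
    exact absurd (Finset.mem_range.2 (by omega)) h

/-- Two arcs have non-neighbouring ancestors at level `ν`. -/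
def NA (ν a I b J : ℕ) : Prop :=
  2 ≤ |((I / 8 ^ (a - ν) : ℕ) : ℤ) - ((J / 8 ^ (b - ν) : ℕ) : ℤ)|

lemma NA.symm {ν a I b J : ℕ} (h : NA ν a I b J) : NA ν b J a I := by
  unfold NA at *; rwa [abs_sub_comm]

lemma NA.child {ν a I b J h j : ℕ} (hν : ν ≤ a) (hj : j < 8 ^ h) (hN : NA ν a I b J) :
    NA ν (a + h) (I * 8 ^ h + j) b J := by
  unfold NA at *
  have e : (I * 8 ^ h + j) / 8 ^ (a + h - ν) = I / 8 ^ (a - ν) := by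
    have : 8 ^ (a + h - ν) = 8 ^ h * 8 ^ (a - ν) := by rw [← pow_add]; congr 1; omega
    rw [this, ← Nat.div_div_eq_div_mul]
    congr 1
    rw [mul_comm, Nat.mul_add_div (by positivity), Nat.div_eq_of_lt hj, add_zero]
  rw [e]; exact hN

lemma arc_bounds {ν a I : ℕ} (hν : ν ≤ a) :
    ((I / 8 ^ (a - ν) : ℕ) : ℝ) * (1 / 8) ^ ν ≤ (I : ℝ) / 8 ^ a ∧
      (I : ℝ) / 8 ^ a < (((I / 8 ^ (a - ν) : ℕ) : ℝ) + 1) * (1 / 8) ^ ν := by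
  have h8 : (8 : ℝ) ^ a = 8 ^ ν * 8 ^ (a - ν) := by rw [← pow_add]; congr 1; omega
  have hp : (0 : ℝ) < 8 ^ ν := by positivity
  have hq : (0 : ℝ) < 8 ^ (a - ν) := by positivity
  have h1 : ((I / 8 ^ (a - ν) : ℕ) : ℝ) * 8 ^ (a - ν) ≤ I := by
    exact_mod_cast Nat.div_mul_le_self I (8 ^ (a - ν))
  have h2 : (I : ℝ) < (((I / 8 ^ (a - ν) : ℕ) : ℝ) + 1) * 8 ^ (a - ν) := by
    exact_mod_cast Nat.lt_mul_of_div_lt (Nat.lt_succ_self _) (by positivity)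
  rw [h8, one_div, inv_pow, ← div_eq_mul_inv, ← div_eq_mul_inv]
  constructor
  · rw [div_le_div_iff₀ hp (by positivity)]; nlinarith
  · rw [div_lt_div_iff₀ (by positivity) hp]; nlinarith

lemma NA.sep {ν a I b J : ℕ} (hνa : ν ≤ a) (hνb : ν ≤ b) (h : NA ν a I b J) :
    (1 / 8 : ℝ) ^ ν ≤ |(J : ℝ) / 8 ^ b - (I : ℝ) / 8 ^ a| := by
  unfold NA at h
  obtain ⟨h1, h2⟩ := arc_bounds (I := I) hνa
  obtain ⟨h3, h4⟩ := arc_bounds (I := J) hνb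
  have hp : (0 : ℝ) < (1 / 8) ^ ν := by positivity
  rcases le_abs.1 h with h | h
  · have h' : (2 : ℝ) ≤ ((I / 8 ^ (a - ν) : ℕ) : ℝ) - ((J / 8 ^ (b - ν) : ℕ) : ℝ) := by
      exact_mod_cast h
    rw [abs_sub_comm]
    refine le_trans ?_ (le_abs_self _)
    nlinarith
  · have h' : (2 : ℝ) ≤ ((J / 8 ^ (b - ν) : ℕ) : ℝ) - ((I / 8 ^ (a - ν) : ℕ) : ℝ) := by
      have : (2 : ℤ) ≤ ((J / 8 ^ (b - ν) : ℕ) : ℤ) - ((I / 8 ^ (a - ν) : ℕ) : ℤ) := by linarith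
      exact_mod_cast this
    refine le_trans ?_ (le_abs_self _)
    nlinarith

/-- The bilinear estimate for two separated arcs, with exponents `2 * p` and `2 * q`. -/
def BLg (N d : ℕ) (B : ℝ) (m ν p q a b : ℕ) (Y : ℝ) : Prop :=
  ∀ (P : Measure (Fin N → ℝ)) (ψ : (Fin N → ℝ) →ₗ[ℝ] PowerSeries ℝ) (v : PowerSeries ℝ)
    (f : ℕ → (Fin N → ℝ) → ℂ) (s : ℕ → ℝ), Dat d B m P ψ v f s →
    ∀ I < 8 ^ a, ∀ J < 8 ^ b, NA ν a I b J →
    ∫ y, ‖(blk (8 ^ (m - a)) f I) y‖ ^ (2 * p) * ‖(blk (8 ^ (m - b)) f J) y‖ ^ (2 * q) ∂P ≤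
      exp Y * (blk (8 ^ (m - a)) s I ^ p * blk (8 ^ (m - b)) s J ^ q)

/-- The bilinear estimate with the exponents attached to degree `l`. -/
def BL (N d : ℕ) (B : ℝ) (m ν l a b : ℕ) (Y : ℝ) : Prop :=
  BLg N d B m ν (Tri l) (Tri d - Tri l) a b Y

lemma coeff_tl_add_of_le {x g e : PowerSeries ℝ} {i : ℕ}
    (h : ∀ q ≤ i, PowerSeries.coeff q x = PowerSeries.coeff q g + PowerSeries.coeff q e) (a : ℝ) :
    PowerSeries.coeff i (tl a x) = PowerSeries.coeff i (tl a g) + PowerSeries.coeff i (tl a e) := by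
  rw [← map_add, ← map_add, coeff_tl, coeff_tl]
  refine Finset.sum_congr rfl fun q hq => ?_
  rw [h q (by simpa [Nat.lt_succ_iff] using hq), map_add]

/-- The change of frequency coordinates used for degree lowering. -/
def lowMap (l e a : ℕ) (z : ℝ) (W : ℕ → ℕ → ℝ) (γ : ℕ → ℝ) :
    PowerSeries ℝ →ₗ[ℝ] PowerSeries ℝ where
  toFun x := PowerSeries.mk fun i =>
    if i = 0 then PowerSeries.coeff 0 x
    else (8 ^ a : ℝ) ^ i * (∑ k ∈ Finset.range l,
      W i k * PowerSeries.coeff (k + e + 1) (tl (-z) x) - γ i * PowerSeries.coeff 0 x)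
  map_add' x y := by
    ext i
    simp only [map_add, PowerSeries.coeff_mk]
    split_ifs
    · rfl
    · simp only [mul_add, Finset.sum_add_distrib]; ring
  map_smul' c x := by
    ext i
    simp only [map_smul, PowerSeries.coeff_mk, smul_eq_mul, RingHom.id_apply]
    split_ifs
    · rfl
    · have : ∀ k, W i k * (c * PowerSeries.coeff (k + e + 1) (tl (-z) x)) =
        c * (W i k * PowerSeries.coeff (k + e + 1) (tl (-z) x)) := fun k => by ring
      simp only [this, ← Finset.mul_sum]; ring

lemma coeff_lowMap (l e a : ℕ) (z : ℝ) (W : ℕ → ℕ → ℝ) (γ : ℕ → ℝ) (x : PowerSeries ℝ) (i : ℕ) :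
    PowerSeries.coeff i (lowMap l e a z W γ x) = if i = 0 then PowerSeries.coeff 0 x
    else (8 ^ a : ℝ) ^ i * (∑ k ∈ Finset.range l,
      W i k * PowerSeries.coeff (k + e + 1) (tl (-z) x) - γ i * PowerSeries.coeff 0 x) := by
  have h : lowMap l e a z W γ x = PowerSeries.mk fun i =>
    if i = 0 then PowerSeries.coeff 0 x
    else (8 ^ a : ℝ) ^ i * (∑ k ∈ Finset.range l,
      W i k * PowerSeries.coeff (k + e + 1) (tl (-z) x) - γ i * PowerSeries.coeff 0 x) := rfl
  rw [h, PowerSeries.coeff_mk]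

/-- Boxes are mapped to boxes under degree lowering. -/
lemma lowMap_box {d l a h I j : ℕ} {B K z : ℝ} {W V : ℕ → ℕ → ℝ} {γ : ℕ → ℝ} (hB : 1 ≤ B)
    (hK : 1 ≤ K) (hld : l ≤ d) (hj : j < 8 ^ h) (hal : h * l ≤ a)
    (hV : ∀ i k, |V i k| ≤ K)
    (hWV : ∀ (y : PowerSeries ℝ) (i : ℕ), 1 ≤ i → i ≤ l →
      ∑ k ∈ Finset.range l, W i k *
        PowerSeries.coeff (k + (d - l) + 1) (tl (-(z - (I : ℝ) / 8 ^ a)) y) =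
        γ i * PowerSeries.coeff 0 y + PowerSeries.coeff i y +
          ∑ q ∈ Finset.Ico (l + 1) (d + 1), V i q * PowerSeries.coeff q y)
    {x : PowerSeries ℝ} (hx0 : PowerSeries.coeff 0 x = 1)
    (hx : Bx d B (a + h) (I * 8 ^ h + j) x) :
    Bx l (B + 2 ^ d * d * K * B) h j (lowMap l (d - l) a z W γ x) := by
  intro i hi1 hil
  set x0 : ℝ := (I : ℝ) / 8 ^ a with hx0d
  set y := tl (-x0) x with hy
  have hy0 : PowerSeries.coeff 0 y = 1 := by rw [hy, coeff_zero_tl, hx0]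
  have hxp : Bx d B a I x := by
    have := Bx.parent (m := a + h) hB (Nat.le_add_right a h) (I := I) (j := j) (by simpa using hj)
      hx0 (by simpa using hx)
    exact this
  set g := stl (8 ^ a) (-x0) x with hg
  set e : PowerSeries ℝ := PowerSeries.mk fun q => if q = 0 then 0 else (8 ^ a : ℝ) ^ q *
    ∑ r ∈ Finset.Ico (l + 1) (d + 1), V q r * PowerSeries.coeff r y with he
  have hdec : ∀ q ≤ i, PowerSeries.coeff q (lowMap l (d - l) a z W γ x) =
      PowerSeries.coeff q g + PowerSeries.coeff q e := by
    intro q hq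
    rw [coeff_lowMap, hg, coeff_stl, he, PowerSeries.coeff_mk]
    split_ifs with h0
    · subst h0; rw [coeff_zero_tl]; simp
    · have := hWV y q (by omega) (by omega)
      rw [hy, tl_tl, ← hy, hy0] at this
      have e1 : -(z - x0) + -x0 = -z := by ring
      rw [e1] at this
      rw [this, hx0]; ring
  rw [coeff_tl_add_of_le hdec]
  have hne : (8 : ℝ) ^ a ≠ 0 := by positivity
  have h1 : |PowerSeries.coeff i (tl (-((j : ℝ) / 8 ^ h)) g)| ≤ B * ((1 / 8 : ℝ) ^ h) ^ i := by
    rw [hg, tl_stl hne, coeff_stl, abs_mul, abs_of_pos (by positivity : (0 : ℝ) < (8 ^ a) ^ i)]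
    have := hx i hi1 (by omega)
    have e1 : -(((I * 8 ^ h + j : ℕ) : ℝ) / 8 ^ (a + h)) =
        -((j : ℝ) / 8 ^ h) / 8 ^ a + -x0 := by
      rw [hx0d, pow_add]; push_cast; field_simp; ring
    rw [e1] at this
    have h18 : (8 : ℝ) ^ a * (1 / 8) ^ a = 1 := by rw [← mul_pow]; norm_num
    calc (8 ^ a : ℝ) ^ i * _ ≤ (8 ^ a) ^ i * (B * ((1 / 8 : ℝ) ^ (a + h)) ^ i) := by gcongr
      _ = B * ((1 / 8 : ℝ) ^ h) ^ i * ((8 : ℝ) ^ a * (1 / 8) ^ a) ^ i := by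
        rw [pow_add, mul_pow, mul_pow]; ring
      _ = _ := by rw [h18, one_pow, mul_one]
  have h2 : ∀ q ≤ i, |PowerSeries.coeff q e| ≤ d * (K * B * (1 / 8) ^ a) := by
    intro q hq
    rw [he, PowerSeries.coeff_mk]
    split_ifs with h0
    · rw [abs_zero]; positivity
    rw [abs_mul, abs_of_pos (by positivity : (0 : ℝ) < (8 ^ a) ^ q)]
    have hs : |∑ r ∈ Finset.Ico (l + 1) (d + 1), V q r * PowerSeries.coeff r y| ≤
        d * (K * (B * ((1 / 8 : ℝ) ^ a) ^ (q + 1))) := by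
      refine (Finset.abs_sum_le_sum_abs _ _).trans ?_
      have : ∀ r ∈ Finset.Ico (l + 1) (d + 1), |V q r * PowerSeries.coeff r y| ≤
          K * (B * ((1 / 8 : ℝ) ^ a) ^ (q + 1)) := by
        intro r hr
        rw [Finset.mem_Ico] at hr
        rw [abs_mul]
        refine mul_le_mul (hV q r) ((hxp r (by omega) (by omega)).trans ?_) (abs_nonneg _)
          (by positivity)
        refine mul_le_mul_of_nonneg_left ?_ (by positivity)
        exact pow_le_pow_of_le_one (by positivity) (pow_le_one₀ (by norm_num) (by norm_num))
          (by omega)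
      refine (Finset.sum_le_sum this).trans ?_
      rw [Finset.sum_const, nsmul_eq_mul, Nat.card_Ico]
      gcongr
      omega
    have h18 : (8 : ℝ) ^ a * (1 / 8) ^ a = 1 := by rw [← mul_pow]; norm_num
    calc (8 ^ a : ℝ) ^ q * _ ≤ (8 ^ a) ^ q * (d * (K * (B * ((1 / 8 : ℝ) ^ a) ^ (q + 1)))) := by
          gcongr
      _ = d * (K * B * (1 / 8) ^ a) * ((8 : ℝ) ^ a * (1 / 8) ^ a) ^ q := by
          rw [mul_pow, pow_succ]; ring
      _ = _ := by rw [h18, one_pow, mul_one]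
  have hj1 : |(-((j : ℝ) / 8 ^ h))| ≤ 1 := by
    rw [abs_neg, abs_of_nonneg (by positivity), div_le_one (by positivity)]
    exact_mod_cast hj.le
  have h3 := abs_coeff_tl_le_const h2 hj1
  refine (abs_add_le _ _).trans ?_
  have h4 : (1 / 8 : ℝ) ^ a ≤ ((1 / 8 : ℝ) ^ h) ^ i := by
    rw [← pow_mul]
    refine pow_le_pow_of_le_one (by norm_num) (by norm_num) (le_trans ?_ hal)
    exact Nat.mul_le_mul_left _ hil
  have h5 : (2 : ℝ) ^ i * (d * (K * B * (1 / 8) ^ a)) ≤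
      2 ^ d * (d * (K * B * ((1 / 8 : ℝ) ^ h) ^ i)) := by
    have : (2 : ℝ) ^ i ≤ 2 ^ d := pow_le_pow_right₀ (by norm_num) (by omega)
    gcongr
  calc _ ≤ B * ((1 / 8 : ℝ) ^ h) ^ i + 2 ^ d * (d * (K * B * ((1 / 8 : ℝ) ^ h) ^ i)) :=
        add_le_add h1 (h3.trans h5)
    _ = _ := by ring

/-- Small spectrum stays small under degree lowering. -/
lemma lowMap_tiny {d l a h b : ℕ} {Q K z : ℝ} {W : ℕ → ℕ → ℝ} {γ : ℕ → ℝ} (hQ : 0 ≤ Q)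
    (hK : 1 ≤ K) (hld : l ≤ d) (hW : ∀ i k, |W i k| ≤ K)
    (hab : (a + h) * l ≤ (d - l + 1) * b)
    {x : PowerSeries ℝ} (hx0 : PowerSeries.coeff 0 x = 0)
    (hx : ∀ k < d, |PowerSeries.coeff (k + 1) (tl (-z) x)| ≤ Q * ((1 / 8 : ℝ) ^ b) ^ (k + 1)) :
    Ty l (2 ^ d * d * K * Q) h (lowMap l (d - l) a z W γ x) := by
  intro r hr0 hr1 i hi1 hil
  have h2 : ∀ q ≤ i, |PowerSeries.coeff q (lowMap l (d - l) a z W γ x)| ≤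
      d * (K * Q * ((1 / 8) ^ h) ^ l) := by
    intro q hq
    rw [coeff_lowMap, hx0]
    split_ifs with h0
    · rw [abs_zero]; positivity
    rw [abs_mul, abs_of_pos (by positivity : (0 : ℝ) < (8 ^ a) ^ q), mul_zero, sub_zero]
    have hs : |∑ k ∈ Finset.range l, W q k * PowerSeries.coeff (k + (d - l) + 1) (tl (-z) x)| ≤
        d * (K * (Q * ((1 / 8 : ℝ) ^ b) ^ (d - l + 1))) := by
      refine (Finset.abs_sum_le_sum_abs _ _).trans ?_
      have : ∀ k ∈ Finset.range l,
          |W q k * PowerSeries.coeff (k + (d - l) + 1) (tl (-z) x)| ≤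
          K * (Q * ((1 / 8 : ℝ) ^ b) ^ (d - l + 1)) := by
        intro k hk
        have hk := Finset.mem_range.1 hk
        rw [abs_mul]
        refine mul_le_mul (hW q k) ((hx _ (by omega)).trans ?_) (abs_nonneg _) (by positivity)
        refine mul_le_mul_of_nonneg_left ?_ hQ
        exact pow_le_pow_of_le_one (by positivity) (pow_le_one₀ (by norm_num) (by norm_num))
          (by omega)
      refine (Finset.sum_le_sum this).trans ?_
      rw [Finset.sum_const, nsmul_eq_mul, Finset.card_range]
      gcongr
    have h3 : (8 ^ a : ℝ) ^ q * ((1 / 8 : ℝ) ^ b) ^ (d - l + 1) ≤ ((1 / 8) ^ h) ^ l := by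
      have e1 : (8 ^ a : ℝ) ^ q ≤ (8 ^ a) ^ l :=
        pow_le_pow_right₀ (one_le_pow₀ (by norm_num)) (by omega)
      have e2 : ((1 / 8 : ℝ) ^ b) ^ (d - l + 1) ≤ (1 / 8) ^ ((a + h) * l) := by
        rw [← pow_mul]
        exact pow_le_pow_of_le_one (by norm_num) (by norm_num) (by rw [mul_comm b]; exact hab)
      calc _ ≤ (8 ^ a : ℝ) ^ l * (1 / 8) ^ ((a + h) * l) := by gcongr
        _ = ((8 : ℝ) ^ a * (1 / 8) ^ a) ^ l * ((1 / 8) ^ h) ^ l := by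
          rw [mul_pow, ← pow_mul, ← pow_mul, ← pow_mul, add_mul, pow_add]; ring
        _ = _ := by rw [← mul_pow, ← mul_pow, mul_one_div_cancel (by norm_num), one_pow, one_mul]
    calc (8 ^ a : ℝ) ^ q * _ ≤
          (8 ^ a) ^ q * (d * (K * (Q * ((1 / 8 : ℝ) ^ b) ^ (d - l + 1)))) := by gcongr
      _ = d * (K * Q * ((8 ^ a : ℝ) ^ q * ((1 / 8 : ℝ) ^ b) ^ (d - l + 1))) := by ring
      _ ≤ _ := by gcongr
  have h3 := abs_coeff_tl_le_const h2 (a := -r) (by rw [abs_neg, abs_of_nonneg hr0]; exact hr1)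
  refine h3.trans ?_
  have : (2 : ℝ) ^ i ≤ 2 ^ d := pow_le_pow_right₀ (by norm_num) (by omega)
  calc _ ≤ 2 ^ d * (d * (K * Q * ((1 / 8 : ℝ) ^ h) ^ l)) := by gcongr
    _ = _ := by ring

/-- Degree lowering: lower-degree decoupling improves the first arc of a bilinear estimate. -/
lemma BL_of_WDat {N d l ν : ℕ} {B : ℝ} (hB : 1 ≤ B) (hl : 1 ≤ l) (hld : l ≤ d) :
    ∃ B' : ℝ, 1 ≤ B' ∧ ∀ h m a b : ℕ, ∀ Yh Y : ℝ, h * l ≤ a → ν ≤ a → a + h ≤ m → ν ≤ b →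
      b ≤ m → (a + h) * l ≤ (d - l + 1) * b → WDat N l B' h Yh →
      BL N d B m ν l (a + h) b Y → BL N d B m ν l a b (Y + Yh) := by
  obtain ⟨K, hK, hKs⟩ := exists_transfer hld (ρ := (1 / 8 : ℝ) ^ ν) (by positivity)
    (pow_le_one₀ (by norm_num) (by norm_num))
  set M := Tri d - Tri l with hM
  set B' : ℝ := B + 2 ^ d * d * K * (B + M * (2 * B)) with hB'
  have hBB' : B + 2 ^ d * d * K * B ≤ B' := by
    rw [hB']
    have : 0 ≤ (2 : ℝ) ^ d * d * K * (M * (2 * B)) := by positivity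
    linarith
  have hB1 : 1 ≤ B' := by
    have : 0 ≤ (2 : ℝ) ^ d * d * K * B := by positivity
    linarith
  have hBB'' : 2 ^ d * d * K * (B + M * (2 * B)) ≤ B' := by rw [hB']; linarith
  refine ⟨B', hB1, ?_⟩
  intro h m a b Yh Y hha hνa ham hνb hbm hab hWD hBL P ψ v f s hd I hI J hJ hNA
  have := hd.fin
  set z : ℝ := (J : ℝ) / 8 ^ b with hz
  set x0 : ℝ := (I : ℝ) / 8 ^ a with hx0
  have hz0 : 0 ≤ z := by positivity
  have hz1 : z ≤ 1 := by rw [hz, div_le_one (by positivity)]; exact_mod_cast hJ.le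
  have hx00 : 0 ≤ x0 := by positivity
  have hx01 : x0 ≤ 1 := by rw [hx0, div_le_one (by positivity)]; exact_mod_cast hI.le
  obtain ⟨W, V, γ, hW, hV, hWV⟩ := hKs (z - x0) (hNA.sep hνa hνb)
    (by rw [abs_le]; constructor <;> linarith)
  set FJ := blk (8 ^ (m - b)) f J with hFJ
  set SJ := blk (8 ^ (m - b)) s J with hSJ
  have hSJ0 : 0 < SJ := blk_pos (by positivity) hd.s_pos J
  have hFJmem := hd.blk_mem hB hbm hJ
  rw [← hFJ] at hFJmem
  have hFJcb : CB FJ := TP_cb hFJmem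
  set L := 8 ^ (m - (a + h)) with hL
  have hLL : 8 ^ h * L = 8 ^ (m - a) := by rw [hL, ← pow_add]; congr 1; omega
  have hTl := Tri_pos hl
  obtain ⟨ρ, hρ0, hρ⟩ : ∃ ρ : ℝ, 0 < ρ ∧ ρ ^ Tri l = exp Y * SJ ^ M := by
    refine ⟨(exp Y * SJ ^ M) ^ ((1 : ℝ) / Tri l), by positivity, ?_⟩
    rw [← Real.rpow_natCast, ← Real.rpow_mul (by positivity), one_div, inv_mul_cancel₀, rpow_one]
    positivity
  have hindex : ∀ j < 8 ^ h, I * 8 ^ h + j < 8 ^ (a + h) := by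
    intro j hj
    calc I * 8 ^ h + j < I * 8 ^ h + 8 ^ h := by omega
      _ = (I + 1) * 8 ^ h := by ring
      _ ≤ 8 ^ a * 8 ^ h := Nat.mul_le_mul_right _ hI
      _ = _ := by rw [pow_add]
  have hdat : Dat l B' h (wP P fun y => ‖FJ y‖ ^ (2 * M))
      ((lowMap l (d - l) a z W γ).comp ψ) (lowMap l (d - l) a z W γ v)
      (fun j => blk L f (I * 8 ^ h + j)) (fun j => ρ * blk L s (I * 8 ^ h + j)) := by
    refine ⟨isFiniteMeasure_wP P (hFJcb.norm.pow _), ?_, ?_, ?_, ?_, ?_, ?_⟩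
    · intro η; rw [LinearMap.comp_apply, coeff_lowMap, if_pos rfl, hd.c0]
    · rw [coeff_lowMap, if_pos rfl, hd.v0]
    · have h1 : Spc P {η | ∀ k : Fin d, |((PowerSeries.coeff (k.1 + 1)).comp
          ((tl (-z)).comp ψ)) η| ≤ B * ((1 / 8 : ℝ) ^ m) ^ d} :=
        hd.spc.mono fun η hη k => hη z hz0 hz1 (k.1 + 1) (by omega) (by omega)
      have h2 := h1.weight (β := fun k => 2 * B * ((1 / 8 : ℝ) ^ b) ^ (k.1 + 1)) ?_ hFJmem M
      · refine h2.mono fun η hη => ?_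
        refine fun r hr0 hr1 i hi1 hil => ?_
        have h3 := lowMap_tiny (a := a) (h := h) (Q := B + M * (2 * B)) (by positivity) hK hld hW
          (γ := γ) hab (hd.c0 η) (z := z) ?_ r hr0 hr1 i hi1 hil
        · refine h3.trans (mul_le_mul_of_nonneg_right hBB'' (by positivity))
        · intro k hk
          have h4 := hη ⟨k, hk⟩
          refine (h4 : _).trans ?_
          have h5 : ((1 / 8 : ℝ) ^ m) ^ d ≤ ((1 / 8 : ℝ) ^ b) ^ (k + 1) := by
            rw [← pow_mul, ← pow_mul]
            exact pow_le_pow_of_le_one (by norm_num) (by norm_num)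
              (Nat.mul_le_mul hbm (by omega))
          have : B * ((1 / 8 : ℝ) ^ m) ^ d ≤ B * ((1 / 8 : ℝ) ^ b) ^ (k + 1) := by gcongr
          simp only
          linarith
      · intro p hp q hq k
        have h3 := hp (k.1 + 1) (by omega) (by omega)
        have h4 := hq (k.1 + 1) (by omega) (by omega)
        rw [← hz] at h3 h4
        have e : ((PowerSeries.coeff (k.1 + 1)).comp ((tl (-z)).comp ψ)) (p - q) =
            PowerSeries.coeff (k.1 + 1) (tl (-z) (v + ψ p)) -
            PowerSeries.coeff (k.1 + 1) (tl (-z) (v + ψ q)) := by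
          simp
        rw [e]
        refine (abs_sub _ _).trans ?_
        linarith
    · intro j hj
      have h1 := hd.blk_mem hB ham (hindex j hj)
      refine TP_mono ?_ h1
      intro η hη i hi1 hil
      rw [LinearMap.comp_apply, ← map_add]
      have h2 := lowMap_box hB hK hld hj hha hV hWV (hd.v0' η) hη i hi1 hil
      exact h2.trans (mul_le_mul_of_nonneg_right hBB' (by positivity))
    · intro k
      exact mul_pos hρ0 (blk_pos (by positivity) hd.s_pos _)
    · intro j hj
      rw [integral_wP P (hFJcb.norm.pow _) (fun y => by positivity), mul_pow, hρ]
      have h1 := hBL P ψ v f s hd _ (hindex j hj) J hJ (hNA.child hνa hj)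
      calc _ = ∫ y, ‖(blk (8 ^ (m - (a + h))) f (I * 8 ^ h + j)) y‖ ^ (2 * Tri l) *
            ‖(blk (8 ^ (m - b)) f J) y‖ ^ (2 * (Tri d - Tri l)) ∂P := by
            congr 1; funext y; rw [smul_eq_mul, mul_comm]
        _ ≤ _ := h1
        _ = _ := by ring
  have h1 := hWD _ _ _ _ _ hdat
  rw [integral_wP P (hFJcb.norm.pow _) (fun y => by positivity)] at h1
  have e1 : blk (8 ^ h) (fun j => blk L f (I * 8 ^ h + j)) 0 = blk (8 ^ (m - a)) f I := by
    rw [← hLL, ← blk_blk]; simp [blk]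
  have e2 : blk (8 ^ h) (fun j => ρ * blk L s (I * 8 ^ h + j)) 0 =
      ρ * blk (8 ^ (m - a)) s I := by
    rw [← hLL, ← blk_blk]; simp [blk, Finset.mul_sum]
  rw [e1, e2, mul_pow, hρ] at h1
  calc _ = ∫ y, ‖FJ y‖ ^ (2 * M) • ‖(blk (8 ^ (m - a)) f I) y‖ ^ (2 * Tri l) ∂P := by
        congr 1; funext y; rw [smul_eq_mul, mul_comm]
    _ ≤ _ := h1
    _ = _ := by rw [Real.exp_add]; ring

section

variable {N d : ℕ} {B : ℝ} {m ν p q a b : ℕ} {Y : ℝ}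

lemma BLg.symm (h : BLg N d B m ν p q a b Y) : BLg N d B m ν q p b a Y := by
  intro P ψ v f s hd I hI J hJ hN
  have := h P ψ v f s hd J hJ I hI hN.symm
  simpa only [mul_comm] using this

lemma BLg.mono {Z : ℝ} (h : BLg N d B m ν p q a b Y) (hYZ : Y ≤ Z) :
    BLg N d B m ν p q a b Z := by
  intro P ψ v f s hd I hI J hJ hN
  refine (h P ψ v f s hd I hI J hJ hN).trans
    (mul_le_mul_of_nonneg_right (exp_le_exp.2 hYZ) ?_)
  have h1 := (blk_pos (L := 8 ^ (m - a)) (by positivity) hd.s_pos I).le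
  have h2 := (blk_pos (L := 8 ^ (m - b)) (by positivity) hd.s_pos J).le
  positivity

/-- Passing to the children of the first arc costs a constant. -/
lemma BLg.step (hp : 1 ≤ p) (hν : ν ≤ a) (ham : a + 1 ≤ m) (hbm : b ≤ m)
    (h : BLg N d B m ν p q (a + 1) b Y) :
    BLg N d B m ν p q a b (Y + 2 * p * Real.log 8) := by
  intro P ψ v f s hd I hI J hJ hN
  have := hd.fin
  have hindex : ∀ j < 8, I * 8 + j < 8 ^ (a + 1) := by
    intro j hj; rw [pow_succ]; omega
  have hLL : 8 * 8 ^ (m - (a + 1)) = 8 ^ (m - a) := by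
    rw [← pow_succ']; congr 1; omega
  have hNA : ∀ j < 8, NA ν (a + 1) (I * 8 + j) b J := fun j hj => by
    have := hN.child (h := 1) hν (j := j) (by omega)
    simpa using this
  set F : ℕ → (Fin N → ℝ) → ℂ := blk (8 ^ (m - (a + 1))) f with hF
  set S : ℕ → ℝ := blk (8 ^ (m - (a + 1))) s with hS
  have hS0 : ∀ k, 0 < S k := fun k => blk_pos (by positivity) hd.s_pos k
  set SJ := blk (8 ^ (m - b)) s J
  have hSJ : 0 < SJ := blk_pos (by positivity) hd.s_pos J
  set FJ := blk (8 ^ (m - b)) f J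
  have hFJ : CB FJ := hd.blk_cb hbm hJ
  have hFcb : ∀ j < 8, CB (F (I * 8 + j)) := fun j hj => hd.blk_cb ham (hindex j hj)
  have e1 : blk (8 ^ (m - a)) f I = blk 8 F I := by rw [hF, blk_blk, hLL]
  have e2 : blk (8 ^ (m - a)) s I = blk 8 S I := by rw [hS, blk_blk, hLL]
  rw [e1, e2]
  have hexp : exp (Y + 2 * p * Real.log 8) = exp Y * (8 : ℝ) ^ (2 * p) := by
    rw [Real.exp_add]; congr 1
    rw [← Real.exp_log (by positivity : (0 : ℝ) < 8 ^ (2 * p)), Real.log_pow]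
    push_cast; ring_nf
  have e3 : (blk 8 F I) = fun y => ∑ j ∈ Finset.range 8, F (I * 8 + j) y := by
    funext y; simp only [blk, Finset.sum_apply]
  have hcbs : CB (fun y => ∑ j ∈ Finset.range 8, F (I * 8 + j) y) :=
    CB.sum _ fun j hj => hFcb j (Finset.mem_range.1 hj)
  have hcb2 : ∀ j ∈ Finset.range 8, CB (fun y => ‖F (I * 8 + j) y‖ ^ (2 * p) * ‖FJ y‖ ^ (2 * q)) :=
    fun j hj => ((hFcb j (Finset.mem_range.1 hj)).norm.pow _).mul (hFJ.norm.pow _)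
  calc ∫ y, ‖blk 8 F I y‖ ^ (2 * p) * ‖FJ y‖ ^ (2 * q) ∂P
      ≤ ∫ y, (8 : ℝ) ^ (2 * p) *
          ∑ j ∈ Finset.range 8, ‖F (I * 8 + j) y‖ ^ (2 * p) * ‖FJ y‖ ^ (2 * q) ∂P := by
        rw [e3]
        refine integral_mono ((hcbs.norm.pow _).mul (hFJ.norm.pow _)).integrable
          ((CB.const _).mul (CB.sum _ hcb2)).integrable fun y => ?_
        have := norm_sum_pow_le (Finset.range 8) (fun j => F (I * 8 + j) y) (p := 2 * p) (by omega)
        simp only [Finset.card_range] at this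
        simp only
        rw [← Finset.sum_mul, ← mul_assoc]
        exact mul_le_mul_of_nonneg_right (by exact_mod_cast this) (by positivity)
    _ = (8 : ℝ) ^ (2 * p) *
          ∑ j ∈ Finset.range 8, ∫ y, ‖F (I * 8 + j) y‖ ^ (2 * p) * ‖FJ y‖ ^ (2 * q) ∂P := by
        rw [integral_const_mul, integral_finsetSum]
        exact fun j hj => (hcb2 j hj).integrable
    _ ≤ (8 : ℝ) ^ (2 * p) * ∑ j ∈ Finset.range 8, exp Y * (S (I * 8 + j) ^ p * SJ ^ q) := by
        gcongr with j hj
        have hj := Finset.mem_range.1 hj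
        exact h P ψ v f s hd _ (hindex j hj) J hJ (hNA j hj)
    _ = (8 : ℝ) ^ (2 * p) * exp Y * SJ ^ q * ∑ j ∈ Finset.range 8, S (I * 8 + j) ^ p := by
        rw [Finset.mul_sum, Finset.mul_sum]
        exact Finset.sum_congr rfl fun j _ => by ring
    _ ≤ (8 : ℝ) ^ (2 * p) * exp Y * SJ ^ q * (blk 8 S I) ^ p := by
        gcongr
        exact sum_pow_le_pow_sum' _ (fun k _ => (hS0 _).le) hp
    _ = _ := by rw [hexp]; ring

lemma young_pow {n : ℕ} (hn : 1 ≤ n) {w u v X U V : ℝ} (hw : 0 ≤ w) (hu : 0 ≤ u) (hv : 0 ≤ v)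
    (hX : 0 < X) (hU : 0 < U) (hV : 0 < V) (h : w ^ n = u * v ^ (n - 1))
    (hXn : X ^ n = U * V ^ (n - 1)) :
    w ≤ X * ((1 / n) * (u / U) + ((n - 1) / n) * (v / V)) := by
  have hn0 : (0 : ℝ) < n := by exact_mod_cast hn
  have h1n : (1 : ℝ) ≤ n := by exact_mod_cast hn
  have key := Real.geom_mean_le_arith_mean2_weighted (w₁ := 1 / (n : ℝ)) (w₂ := (n - 1) / n)
    (p₁ := u / U) (p₂ := v / V) (by positivity) (div_nonneg (by linarith) hn0.le)
    (by positivity) (by positivity) (by field_simp; ring)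
  have e : w / X = (u / U) ^ (1 / (n : ℝ)) * (v / V) ^ (((n : ℝ) - 1) / n) := by
    have e1 : (w / X) ^ n = (u / U) * (v / V) ^ (n - 1) := by
      rw [div_pow, h, hXn, div_pow]; field_simp
    have e2 : w / X = ((w / X) ^ n) ^ (1 / (n : ℝ)) := by
      rw [← Real.rpow_natCast, ← Real.rpow_mul (by positivity), mul_one_div_cancel hn0.ne',
        Real.rpow_one]
    rw [e2, e1, Real.mul_rpow (by positivity) (by positivity), ← Real.rpow_natCast (v / V),
      ← Real.rpow_mul (by positivity)]
    congr 2
    rw [Nat.cast_sub hn]; push_cast; ring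
  rw [← e] at key
  calc w = X * (w / X) := by field_simp
    _ ≤ _ := by gcongr

/-- Interpolation of bilinear estimates. -/
lemma BLg.interp {n p₁ q₁ p₂ q₂ : ℕ} {Y₁ Y₂ : ℝ} (hn : 1 ≤ n) (ham : a ≤ m) (hbm : b ≤ m)
    (hp : n * p = p₁ + (n - 1) * p₂) (hq : n * q = q₁ + (n - 1) * q₂)
    (h₁ : BLg N d B m ν p₁ q₁ a b Y₁) (h₂ : BLg N d B m ν p₂ q₂ a b Y₂) :
    BLg N d B m ν p q a b ((1 / n) * Y₁ + ((n - 1) / n) * Y₂) := by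
  intro P ψ v f s hd I hI J hJ hN
  have := hd.fin
  have hn0 : (0 : ℝ) < n := by exact_mod_cast hn
  have h1n : (1 : ℝ) ≤ n := by exact_mod_cast hn
  have h1 := h₁ P ψ v f s hd I hI J hJ hN
  have h2 := h₂ P ψ v f s hd I hI J hJ hN
  set FI := blk (8 ^ (m - a)) f I
  set FJ := blk (8 ^ (m - b)) f J
  set SI := blk (8 ^ (m - a)) s I
  set SJ := blk (8 ^ (m - b)) s J
  have hFI : CB FI := hd.blk_cb ham hI
  have hFJ : CB FJ := hd.blk_cb hbm hJ
  have hSI : 0 < SI := blk_pos (by positivity) hd.s_pos I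
  have hSJ : 0 < SJ := blk_pos (by positivity) hd.s_pos J
  set U := exp Y₁ * (SI ^ p₁ * SJ ^ q₁) with hU
  set V := exp Y₂ * (SI ^ p₂ * SJ ^ q₂) with hV
  set X := exp ((1 / n) * Y₁ + ((n - 1) / n) * Y₂) * (SI ^ p * SJ ^ q) with hX
  have hU0 : 0 < U := by positivity
  have hV0 : 0 < V := by positivity
  have hX0 : 0 < X := by positivity
  have hXn : X ^ n = U * V ^ (n - 1) := by
    have e1 : exp ((1 / n) * Y₁ + ((n - 1) / n) * Y₂) ^ n = exp Y₁ * exp Y₂ ^ (n - 1) := by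
      rw [← Real.exp_nat_mul, ← Real.exp_nat_mul, ← Real.exp_add, Nat.cast_sub hn]
      congr 1; push_cast; field_simp
    rw [hX, hU, hV, mul_pow, e1, mul_pow, ← pow_mul, ← pow_mul, mul_comm p n, mul_comm q n, hp, hq]
    simp only [pow_add, mul_pow, ← pow_mul]
    rw [mul_comm (n - 1) p₂, mul_comm (n - 1) q₂]; ring
  have hcb : ∀ p q : ℕ, CB (fun y => ‖FI y‖ ^ (2 * p) * ‖FJ y‖ ^ (2 * q)) := fun p q =>
    (hFI.norm.pow _).mul (hFJ.norm.pow _)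
  calc ∫ y, ‖FI y‖ ^ (2 * p) * ‖FJ y‖ ^ (2 * q) ∂P
      ≤ ∫ y, (X * (1 / n) / U) * (‖FI y‖ ^ (2 * p₁) * ‖FJ y‖ ^ (2 * q₁)) +
          (X * ((n - 1) / n) / V) * (‖FI y‖ ^ (2 * p₂) * ‖FJ y‖ ^ (2 * q₂)) ∂P := by
        refine integral_mono (hcb p q).integrable (((CB.const _).mul (hcb p₁ q₁)).add
          ((CB.const _).mul (hcb p₂ q₂))).integrable fun y => ?_
        have := young_pow hn (w := ‖FI y‖ ^ (2 * p) * ‖FJ y‖ ^ (2 * q))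
          (u := ‖FI y‖ ^ (2 * p₁) * ‖FJ y‖ ^ (2 * q₁))
          (v := ‖FI y‖ ^ (2 * p₂) * ‖FJ y‖ ^ (2 * q₂)) (by positivity) (by positivity)
          (by positivity) hX0 hU0 hV0 ?_ hXn
        · refine this.trans (le_of_eq ?_); ring
        · rw [mul_pow, ← pow_mul, ← pow_mul, show 2 * p * n = 2 * (n * p) by ring,
            show 2 * q * n = 2 * (n * q) by ring, hp, hq]
          simp only [mul_add, pow_add, mul_pow, ← pow_mul]
          rw [show 2 * ((n - 1) * p₂) = 2 * p₂ * (n - 1) by ring,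
            show 2 * ((n - 1) * q₂) = 2 * q₂ * (n - 1) by ring]; ring
    _ = (X * (1 / n) / U) * ∫ y, (‖FI y‖ ^ (2 * p₁) * ‖FJ y‖ ^ (2 * q₁)) ∂P +
          (X * ((n - 1) / n) / V) * ∫ y, (‖FI y‖ ^ (2 * p₂) * ‖FJ y‖ ^ (2 * q₂)) ∂P := by
        rw [integral_add ((CB.const _).mul (hcb p₁ q₁)).integrable
          ((CB.const _).mul (hcb p₂ q₂)).integrable, integral_const_mul, integral_const_mul]
    _ ≤ (X * (1 / n) / U) * U + (X * ((n - 1) / n) / V) * V := by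
        have : 0 ≤ ((n : ℝ) - 1) / n := div_nonneg (by linarith) hn0.le
        gcongr
    _ = X := by field_simp; ring

/-- The bilinear estimate carried by the second arc alone. -/
lemma BLg.of_snd (hbm : b ≤ m) (h : WDat N d B (m - b) Y) :
    BLg N d B m ν 0 (Tri d) a b Y := by
  intro P ψ v f s hd I hI J hJ hN
  have := hd.block hbm hJ h
  simpa using this

/-- The bilinear estimate following from linear estimates. -/
lemma BLg.of_WDat (ham : a ≤ m) (hbm : b ≤ m) (hpq : p + q = Tri d)
    (ha : WDat N d B (m - a) Y) (hb : WDat N d B (m - b) Y) :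
    BLg N d B m ν p q a b (Y + Real.log 2) := by
  intro P ψ v f s hd I hI J hJ hN
  have := hd.fin
  have h1 := hd.block ham hI ha
  have h2 := hd.block hbm hJ hb
  set FI := blk (8 ^ (m - a)) f I
  set FJ := blk (8 ^ (m - b)) f J
  set SI := blk (8 ^ (m - a)) s I
  set SJ := blk (8 ^ (m - b)) s J
  have hFI : CB FI := hd.blk_cb ham hI
  have hFJ : CB FJ := hd.blk_cb hbm hJ
  have hSI : 0 < SI := blk_pos (by positivity) hd.s_pos I
  have hSJ : 0 < SJ := blk_pos (by positivity) hd.s_pos J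
  set X := SI ^ p * SJ ^ q
  have hX : 0 < X := by positivity
  calc ∫ y, ‖FI y‖ ^ (2 * p) * ‖FJ y‖ ^ (2 * q) ∂P
      ≤ ∫ y, (X / SI ^ Tri d) * ‖FI y‖ ^ (2 * Tri d) +
          (X / SJ ^ Tri d) * ‖FJ y‖ ^ (2 * Tri d) ∂P := by
        refine integral_mono ((hFI.norm.pow _).mul (hFJ.norm.pow _)).integrable
          (((CB.const _).mul (hFI.norm.pow _)).add
          ((CB.const _).mul (hFJ.norm.pow _))).integrable fun y => ?_
        set u := ‖FI y‖ ^ 2 / SI with hu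
        set w := ‖FJ y‖ ^ 2 / SJ with hw
        have hu0 : 0 ≤ u := by positivity
        have hw0 : 0 ≤ w := by positivity
        have e1 : ‖FI y‖ ^ (2 * p) * ‖FJ y‖ ^ (2 * q) = X * (u ^ p * w ^ q) := by
          rw [hu, hw, div_pow, div_pow, ← pow_mul, ← pow_mul]; field_simp; ring
        have e2 : (X / SI ^ Tri d) * ‖FI y‖ ^ (2 * Tri d) = X * u ^ (Tri d) := by
          rw [hu, div_pow, ← pow_mul]; field_simp
        have e3 : (X / SJ ^ Tri d) * ‖FJ y‖ ^ (2 * Tri d) = X * w ^ (Tri d) := by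
          rw [hw, div_pow, ← pow_mul]; field_simp
        simp only
        rw [e1, e2, e3, ← mul_add, ← hpq]
        refine mul_le_mul_of_nonneg_left ?_ hX.le
        rcases le_total u w with h | h
        · have h3 : u ^ p ≤ w ^ p := pow_le_pow_left₀ hu0 h p
          have h4 : u ^ p * w ^ q ≤ w ^ p * w ^ q := by gcongr
          rw [← pow_add w] at h4
          have : 0 ≤ u ^ (p + q) := by positivity
          linarith
        · have h3 : w ^ q ≤ u ^ q := pow_le_pow_left₀ hw0 h q
          have h4 : u ^ p * w ^ q ≤ u ^ p * u ^ q := by gcongr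
          rw [← pow_add u] at h4
          have : 0 ≤ w ^ (p + q) := by positivity
          linarith
    _ = (X / SI ^ Tri d) * ∫ y, ‖FI y‖ ^ (2 * Tri d) ∂P +
          (X / SJ ^ Tri d) * ∫ y, ‖FJ y‖ ^ (2 * Tri d) ∂P := by
        rw [integral_add ((CB.const _).mul (hFI.norm.pow _)).integrable
          ((CB.const _).mul (hFJ.norm.pow _)).integrable, integral_const_mul, integral_const_mul]
    _ ≤ (X / SI ^ Tri d) * (exp Y * SI ^ Tri d) + (X / SJ ^ Tri d) * (exp Y * SJ ^ Tri d) := by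
        gcongr
    _ = _ := by
        rw [Real.exp_add, Real.exp_log (by norm_num)]; field_simp; ring

lemma broad_narrow_pointwise {n p q : ℕ} (hn : 1 ≤ n) (z : ℕ → ℂ) :
    ‖∑ I ∈ Finset.range n, z I‖ ^ (2 * (p + q)) ≤
      4 ^ (2 * (p + q)) * ∑ I ∈ Finset.range n, ‖z I‖ ^ (2 * (p + q)) +
      (n : ℝ) ^ (4 * (p + q)) * ∑ I ∈ Finset.range n, ∑ J ∈ Finset.range n,
        (if 2 ≤ |(I : ℤ) - J| then ‖z I‖ ^ (2 * p) * ‖z J‖ ^ (2 * q) else 0) := by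
  have hne : (Finset.range n).Nonempty := by simpa using (by omega : n ≠ 0)
  obtain ⟨I, hI, hImax⟩ := (Finset.range n).exists_max_image (fun k => ‖z k‖) hne
  have hn1 : (1 : ℝ) ≤ n := by exact_mod_cast hn
  have hdbl : ∀ I ∈ Finset.range n, 0 ≤ ∑ J ∈ Finset.range n,
        (if 2 ≤ |(I : ℤ) - J| then ‖z I‖ ^ (2 * p) * ‖z J‖ ^ (2 * q) else 0) :=
    fun I _ => Finset.sum_nonneg fun J _ => by split_ifs <;> positivity
  set A := (Finset.range n).filter fun J : ℕ => 2 ≤ |(I : ℤ) - J| with hA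
  have hnear : ‖∑ J ∈ (Finset.range n).filter fun J : ℕ => ¬ 2 ≤ |(I : ℤ) - J|, z J‖ ≤
      3 * ‖z I‖ := by
    refine (norm_sum_le _ _).trans ?_
    refine (Finset.sum_le_sum fun J hJ => hImax J (Finset.mem_filter.1 hJ).1).trans ?_
    rw [Finset.sum_const, nsmul_eq_mul]
    refine mul_le_mul_of_nonneg_right ?_ (norm_nonneg _)
    have hsub : ((Finset.range n).filter fun J : ℕ => ¬ 2 ≤ |(I : ℤ) - J|) ⊆
        Finset.Icc (I - 1) (I + 1) := by
      intro J hJ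
      have := (Finset.mem_filter.1 hJ).2
      rw [not_le, abs_lt] at this
      rw [Finset.mem_Icc]; omega
    have := Finset.card_le_card hsub
    rw [Nat.card_Icc] at this
    have h3 : ((Finset.range n).filter fun J : ℕ => ¬ 2 ≤ |(I : ℤ) - J|).card ≤ 3 := by omega
    have := (Nat.cast_le (α := ℝ)).2 h3
    simpa using this
  have hsplit : ∑ J ∈ Finset.range n, z J = ∑ J ∈ A, z J +
      ∑ J ∈ (Finset.range n).filter fun J : ℕ => ¬ 2 ≤ |(I : ℤ) - J|, z J :=
    (Finset.sum_filter_add_sum_filter_not _ _ _).symm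
  by_cases hbroad : ∃ J ∈ A, ‖z I‖ ≤ n * ‖z J‖
  · obtain ⟨J, hJ, hJI⟩ := hbroad
    have hJ' := Finset.mem_filter.1 hJ
    have h1 : ‖∑ I ∈ Finset.range n, z I‖ ≤ n * ‖z I‖ := by
      refine (norm_sum_le _ _).trans ((Finset.sum_le_sum hImax).trans ?_)
      simp
    have h2 : ‖z I‖ ^ (2 * p) * ‖z J‖ ^ (2 * q) ≤ ∑ I ∈ Finset.range n, ∑ J ∈ Finset.range n,
        (if 2 ≤ |(I : ℤ) - J| then ‖z I‖ ^ (2 * p) * ‖z J‖ ^ (2 * q) else 0) := by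
      refine le_trans ?_ (Finset.single_le_sum hdbl hI)
      refine le_trans ?_ (Finset.single_le_sum (fun J _ => by split_ifs <;> positivity) hJ'.1)
      rw [if_pos hJ'.2]
    calc ‖∑ I ∈ Finset.range n, z I‖ ^ (2 * (p + q)) ≤ (n * ‖z I‖) ^ (2 * (p + q)) := by gcongr
      _ = (n : ℝ) ^ (2 * (p + q)) * (‖z I‖ ^ (2 * p) * ‖z I‖ ^ (2 * q)) := by
          rw [mul_pow, ← pow_add]; congr 2; ring
      _ ≤ (n : ℝ) ^ (2 * (p + q)) * (‖z I‖ ^ (2 * p) * (n * ‖z J‖) ^ (2 * q)) := by gcongr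
      _ = (n : ℝ) ^ (2 * (p + q) + 2 * q) * (‖z I‖ ^ (2 * p) * ‖z J‖ ^ (2 * q)) := by
          rw [mul_pow, pow_add]; ring
      _ ≤ (n : ℝ) ^ (4 * (p + q)) * (‖z I‖ ^ (2 * p) * ‖z J‖ ^ (2 * q)) := by
          gcongr
          omega
      _ ≤ (n : ℝ) ^ (4 * (p + q)) * ∑ I ∈ Finset.range n, ∑ J ∈ Finset.range n,
        (if 2 ≤ |(I : ℤ) - J| then ‖z I‖ ^ (2 * p) * ‖z J‖ ^ (2 * q) else 0) := by gcongr
      _ ≤ _ := by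
          refine le_add_of_nonneg_left ?_
          positivity
  · push Not at hbroad
    have hfar : ‖∑ J ∈ A, z J‖ ≤ ‖z I‖ := by
      refine (norm_sum_le _ _).trans ?_
      have : ∀ J ∈ A, ‖z J‖ ≤ ‖z I‖ / n := fun J hJ => by
        rw [le_div_iff₀ (by positivity), mul_comm]; exact (hbroad J hJ).le
      refine (Finset.sum_le_sum this).trans ?_
      rw [Finset.sum_const, nsmul_eq_mul, mul_div_assoc', div_le_iff₀ (by positivity), mul_comm]
      refine mul_le_mul_of_nonneg_left ?_ (norm_nonneg _)
      have := Finset.card_filter_le (Finset.range n) fun J : ℕ => 2 ≤ |(I : ℤ) - J|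
      rw [Finset.card_range] at this
      exact (Nat.cast_le (α := ℝ)).2 this
    have h1 : ‖∑ I ∈ Finset.range n, z I‖ ≤ 4 * ‖z I‖ := by
      rw [hsplit]
      refine (norm_add_le _ _).trans ?_
      linarith
    calc ‖∑ I ∈ Finset.range n, z I‖ ^ (2 * (p + q)) ≤ (4 * ‖z I‖) ^ (2 * (p + q)) := by gcongr
      _ = 4 ^ (2 * (p + q)) * ‖z I‖ ^ (2 * (p + q)) := mul_pow _ _ _
      _ ≤ 4 ^ (2 * (p + q)) * ∑ I ∈ Finset.range n, ‖z I‖ ^ (2 * (p + q)) := by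
          gcongr
          exact Finset.single_le_sum (f := fun k => ‖z k‖ ^ (2 * (p + q)))
            (fun _ _ => by positivity) hI
      _ ≤ _ := by
          refine le_add_of_nonneg_right ?_
          exact mul_nonneg (by positivity) (Finset.sum_nonneg hdbl)

/-- Reduction of linear decoupling to bilinear decoupling. -/
lemma WDat.of_broad_narrow {Y₁ Y₂ : ℝ} (hp : 1 ≤ p) (hq : 1 ≤ q) (hpq : p + q = Tri d)
    (hν : ν ≤ m) (h₁ : WDat N d B (m - ν) Y₁) (h₂ : BLg N d B m ν p q ν ν Y₂) :
    WDat N d B m (Real.log (4 ^ (2 * Tri d) * exp Y₁ +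
      (8 ^ ν : ℝ) ^ (4 * Tri d) * exp Y₂)) := by
  intro P ψ v f s hd
  have := hd.fin
  rw [Real.exp_log (by positivity)]
  have hLL : 8 ^ ν * 8 ^ (m - ν) = 8 ^ m := by rw [← pow_add]; congr 1; omega
  set F : ℕ → (Fin N → ℝ) → ℂ := blk (8 ^ (m - ν)) f with hF
  set S : ℕ → ℝ := blk (8 ^ (m - ν)) s with hS
  have hS0 : ∀ k, 0 < S k := fun k => blk_pos (by positivity) hd.s_pos k
  have e1 : blk (8 ^ m) f 0 = fun y => ∑ I ∈ Finset.range (8 ^ ν), F I y := by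
    rw [← hLL, ← blk_blk, blk_range]; funext y; simp only [Finset.sum_apply, hF]
  have e2 : blk (8 ^ m) s 0 = ∑ I ∈ Finset.range (8 ^ ν), S I := by
    rw [← hLL, ← blk_blk, blk_range]
  rw [e1, e2]
  have hFcb : ∀ I ∈ Finset.range (8 ^ ν), CB (F I) := fun I hI =>
    hd.blk_cb hν (Finset.mem_range.1 hI)
  set G : ℕ → ℕ → (Fin N → ℝ) → ℝ := fun I J y =>
    if 2 ≤ |(I : ℤ) - J| then ‖F I y‖ ^ (2 * p) * ‖F J y‖ ^ (2 * q) else 0 with hG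
  have hGcb : ∀ I ∈ Finset.range (8 ^ ν), ∀ J ∈ Finset.range (8 ^ ν), CB (G I J) := by
    intro I hI J hJ
    simp only [hG]
    split_ifs
    · exact ((hFcb I hI).norm.pow _).mul ((hFcb J hJ).norm.pow _)
    · exact CB.const _
  have hGint : ∀ I ∈ Finset.range (8 ^ ν), ∀ J ∈ Finset.range (8 ^ ν),
      ∫ y, G I J y ∂P ≤ exp Y₂ * (S I ^ p * S J ^ q) := by
    intro I hI J hJ
    simp only [hG]
    split_ifs with h
    · exact h₂ P ψ v f s hd I (Finset.mem_range.1 hI) J (Finset.mem_range.1 hJ)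
        (by unfold NA; simpa using h)
    · rw [integral_zero]
      have := hS0 I; have := hS0 J
      positivity
  have hn1 : (1 : ℝ) ≤ 8 ^ ν := one_le_pow₀ (by norm_num)
  have i1 : CB fun y => ∑ I ∈ Finset.range (8 ^ ν), ‖F I y‖ ^ (2 * Tri d) :=
    CB.sum _ fun I hI => (hFcb I hI).norm.pow _
  have i2 : CB fun y => ∑ I ∈ Finset.range (8 ^ ν), ∑ J ∈ Finset.range (8 ^ ν), G I J y :=
    CB.sum _ fun I hI => CB.sum _ fun J hJ => hGcb I hI J hJ
  calc ∫ y, ‖∑ I ∈ Finset.range (8 ^ ν), F I y‖ ^ (2 * Tri d) ∂P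
      ≤ ∫ y, (4 ^ (2 * Tri d) * ∑ I ∈ Finset.range (8 ^ ν), ‖F I y‖ ^ (2 * Tri d) +
        (8 ^ ν : ℝ) ^ (4 * Tri d) * ∑ I ∈ Finset.range (8 ^ ν), ∑ J ∈ Finset.range (8 ^ ν),
          G I J y) ∂P := by
        refine integral_mono ((CB.sum _ hFcb).norm.pow _).integrable
          (((CB.const _).mul i1).add ((CB.const _).mul i2)).integrable fun y => ?_
        have := broad_narrow_pointwise (n := 8 ^ ν) (p := p) (q := q) (Nat.one_le_pow _ _ (by norm_num))
          (fun I => F I y)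
        rw [hpq] at this
        simpa using this
    _ = 4 ^ (2 * Tri d) * ∑ I ∈ Finset.range (8 ^ ν), ∫ y, ‖F I y‖ ^ (2 * Tri d) ∂P +
        (8 ^ ν : ℝ) ^ (4 * Tri d) * ∑ I ∈ Finset.range (8 ^ ν), ∑ J ∈ Finset.range (8 ^ ν),
          ∫ y, G I J y ∂P := by
        rw [integral_add ((CB.const _).mul i1).integrable ((CB.const _).mul i2).integrable,
          integral_const_mul, integral_const_mul, integral_finsetSum, integral_finsetSum]
        · congr 2
          refine Finset.sum_congr rfl fun I hI => ?_
          rw [integral_finsetSum]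
          exact fun J hJ => (hGcb I hI J hJ).integrable
        · exact fun I hI => (CB.sum _ fun J hJ => hGcb I hI J hJ).integrable
        · exact fun I hI => ((hFcb I hI).norm.pow _).integrable
    _ ≤ 4 ^ (2 * Tri d) * ∑ I ∈ Finset.range (8 ^ ν), exp Y₁ * S I ^ Tri d +
        (8 ^ ν : ℝ) ^ (4 * Tri d) * ∑ I ∈ Finset.range (8 ^ ν), ∑ J ∈ Finset.range (8 ^ ν),
          exp Y₂ * (S I ^ p * S J ^ q) := by
        gcongr with I hI I hI J hJ
        · exact hd.block hν (Finset.mem_range.1 hI) h₁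
        · exact hGint I hI J hJ
    _ = 4 ^ (2 * Tri d) * exp Y₁ * ∑ I ∈ Finset.range (8 ^ ν), S I ^ Tri d +
        (8 ^ ν : ℝ) ^ (4 * Tri d) * exp Y₂ * ((∑ I ∈ Finset.range (8 ^ ν), S I ^ p) *
          ∑ J ∈ Finset.range (8 ^ ν), S J ^ q) := by
        rw [Finset.sum_mul_sum]
        simp only [Finset.mul_sum, mul_assoc]
    _ ≤ 4 ^ (2 * Tri d) * exp Y₁ * (∑ I ∈ Finset.range (8 ^ ν), S I) ^ Tri d +
        (8 ^ ν : ℝ) ^ (4 * Tri d) * exp Y₂ * ((∑ I ∈ Finset.range (8 ^ ν), S I) ^ p *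
          (∑ J ∈ Finset.range (8 ^ ν), S J) ^ q) := by
        have hS0' : ∀ k ∈ Finset.range (8 ^ ν), 0 ≤ S k := fun k _ => (hS0 k).le
        have hsum : 0 ≤ ∑ I ∈ Finset.range (8 ^ ν), S I := Finset.sum_nonneg hS0'
        gcongr
        · exact sum_pow_le_pow_sum' _ hS0' (by omega)
        · exact Finset.sum_nonneg fun k _ => pow_nonneg (hS0 k).le _
        · exact sum_pow_le_pow_sum' _ hS0' hp
        · exact sum_pow_le_pow_sum' _ hS0' hq
    _ = _ := by rw [← pow_add, hpq]; ring

end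

section

variable {N d : ℕ} {B : ℝ} {m ν p q a b : ℕ} {Y : ℝ}

lemma BLg.steps (hp : 1 ≤ p) (hν : ν ≤ a) (hbm : b ≤ m) (k : ℕ) (ham : a + k ≤ m)
    (h : BLg N d B m ν p q (a + k) b Y) :
    BLg N d B m ν p q a b (Y + k * (2 * p * Real.log 8)) := by
  induction k generalizing Y with
  | zero => simpa using h
  | succ k ih =>
    have := ih (by omega) (BLg.step hp (by omega) (by omega) hbm h)
    refine this.mono (le_of_eq ?_)
    push_cast; ring

/-- Iterated degree lowering. -/
lemma BL_sup {l : ℕ} (hB : 1 ≤ B) (hl : 1 ≤ l) (hld : l ≤ d) (hW : WD N l) {ε : ℝ}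
    (hε : 0 < ε) (ν : ℕ) :
    ∃ C : ℝ, ∀ (m a b a' : ℕ) (Y : ℝ), ν ≤ a → a ≤ a' → a' ≤ m → ν ≤ b → b ≤ m →
      a' * l ≤ (d - l + 1) * b → BL N d B m ν l a' b Y → BL N d B m ν l a b (Y + ε * m + C) := by
  obtain ⟨B', hB', hKS⟩ := BL_of_WDat (N := N) (ν := ν) hB hl hld
  obtain ⟨C₁, hC₁⟩ := hW B' hB' (ε / 2) (by positivity)
  obtain ⟨h₀, hh₀⟩ := exists_nat_ge (2 * C₁ / ε + 1)
  have hlog : 0 < Real.log 8 := Real.log_pos (by norm_num)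
  have hW0 : WDat N l B' (h₀ + 1) (ε * (h₀ + 1 : ℕ)) := (hC₁ (h₀ + 1)).mono (by
    have : 2 * C₁ / ε * ε = 2 * C₁ := by field_simp
    push_cast
    nlinarith)
  set h := h₀ + 1 with hh
  have hTl : 1 ≤ Tri l := Tri_pos hl
  have hiter : ∀ (k m a b : ℕ) (Y : ℝ), h * l ≤ a → ν ≤ a → a + k * h ≤ m → ν ≤ b → b ≤ m →
      (a + k * h) * l ≤ (d - l + 1) * b → BL N d B m ν l (a + k * h) b Y →
      BL N d B m ν l a b (Y + ε * (k * h : ℕ)) := by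
    intro k
    induction k with
    | zero => intro m a b Y _ _ _ _ _ _ h; simpa using h
    | succ k ih =>
      intro m a b Y h1 h2 h3 h4 h5 h6 h7
      have e : a + (k + 1) * h = (a + h) + k * h := by ring
      rw [e] at h3 h6 h7
      have h8 := ih m (a + h) b Y (by omega) (by omega) h3 h4 h5 h6 h7
      have h9 : (a + h) * l ≤ (d - l + 1) * b := le_trans (Nat.mul_le_mul_right _ (by omega)) h6
      have := hKS h m a b _ _ h1 h2 (by omega) h4 h5 h9 hW0 h8
      refine this.mono (le_of_eq ?_)
      push_cast; ring
  refine ⟨(h * l + h : ℕ) * (2 * Tri l * Real.log 8), ?_⟩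
  intro m a b a' Y h1 h2 h3 h4 h5 h6 h7
  rcases le_total a' (h * l) with hsm | hbig
  · have := BLg.steps (k := a' - a) hTl h1 h5 (by omega)
      (by rw [show a + (a' - a) = a' by omega]; exact h7)
    refine this.mono ?_
    have : ((a' - a : ℕ) : ℝ) ≤ (h * l + h : ℕ) := by exact_mod_cast (by omega)
    have := mul_le_mul_of_nonneg_right this (by positivity : (0:ℝ) ≤ 2 * Tri l * Real.log 8)
    have : 0 ≤ ε * m := by positivity
    linarith
  · set a₁ := max a (h * l) with ha₁
    have ha₁' : a₁ ≤ a' := max_le h2 hbig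
    set k := (a' - a₁) / h with hk
    have hk1 : k * h ≤ a' - a₁ := Nat.div_mul_le_self _ _
    have hk2 : a' - a₁ < k * h + h := by
      have := Nat.lt_div_mul_add (a := a' - a₁) (b := h) (by omega)
      exact this
    have s1 : BL N d B m ν l (a₁ + k * h) b _ := BLg.steps (k := a' - (a₁ + k * h)) (a := a₁ + k * h) hTl (by omega) h5 (by omega)
      (by rw [show a₁ + k * h + (a' - (a₁ + k * h)) = a' by omega]; exact h7)
    have s2 := hiter k m a₁ b _ (le_max_right _ _) (by omega) (by omega) h4 h5
      (le_trans (Nat.mul_le_mul_right _ (by omega)) h6) s1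
    have s3 := BLg.steps (k := a₁ - a) (a := a) hTl h1 h5 (by omega)
      (by rw [show a + (a₁ - a) = a₁ by omega]; exact s2)
    refine BLg.mono s3 ?_
    have c1 : ((a' - (a₁ + k * h) : ℕ) : ℝ) + (a₁ - a : ℕ) ≤ (h * l + h : ℕ) := by
      exact_mod_cast (by omega)
    have c2 : ((k * h : ℕ) : ℝ) ≤ m := by exact_mod_cast (by omega)
    have c3 := mul_le_mul_of_nonneg_right c1 (by positivity : (0:ℝ) ≤ 2 * Tri l * Real.log 8)
    have c4 := mul_le_mul_of_nonneg_left c2 hε.le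
    linarith

/-- The gain in the exponents after `R` rounds of the bilinear iteration. -/
def itA (d : ℕ) : ℕ → ℕ → ℝ
  | 0, l => if l = 0 then 1 else 0
  | R + 1, l => if l = 0 then 1 else
      itA d R (d - l) / l + ((d - l : ℕ) : ℝ) / ((d - l + 1 : ℕ) : ℝ) * itA d R (l - 1)

lemma itA_nonneg (d R l : ℕ) : 0 ≤ itA d R l := by
  induction R generalizing l with
  | zero => rw [itA]; split_ifs <;> norm_num
  | succ R ih =>
    rw [itA]; split_ifs
    · norm_num
    · have := ih (d - l); have := ih (l - 1); positivity

lemma itA_zero (d R : ℕ) : itA d R 0 = 1 := by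
  cases R <;> simp [itA]

lemma sum_itA (e R : ℕ) : ∑ l ∈ Finset.range e, itA (e + 1) R (l + 1) = R * (e / (e + 1)) := by
  induction R with
  | zero => simp [itA]
  | succ R ih =>
    have h1 : ∀ l ∈ Finset.range e, itA (e + 1) (R + 1) (l + 1) =
        itA (e + 1) R (e - l) / (l + 1) + ((e - l : ℕ) : ℝ) / ((e - l : ℕ) + 1) * itA (e + 1) R l := by
      intro l hl
      rw [itA]
      simp
    have h2 : ∑ l ∈ Finset.range e, itA (e + 1) R (e - l) / ((l : ℝ) + 1) =
        ∑ l ∈ Finset.range e, itA (e + 1) R (l + 1) / ((e - (l + 1) : ℕ) + 1 : ℝ) := by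
      rw [← Finset.sum_range_reflect]
      refine Finset.sum_congr rfl fun l hl => ?_
      have := Finset.mem_range.1 hl
      rw [show e - (e - 1 - l) = l + 1 by omega, show e - 1 - l = e - (l + 1) by omega]
    have h3 : ∑ l ∈ Finset.range e, ((e - l : ℕ) : ℝ) / ((e - l : ℕ) + 1) * itA (e + 1) R l =
        (∑ l ∈ Finset.range e, ((e - (l + 1) : ℕ) : ℝ) / ((e - (l + 1) : ℕ) + 1) *
          itA (e + 1) R (l + 1)) + e / (e + 1) := by
      have := Finset.sum_range_succ (fun l => ((e - l : ℕ) : ℝ) / ((e - l : ℕ) + 1) * itA (e + 1) R l) e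
      rw [Finset.sum_range_succ'] at this
      simp only [Nat.sub_self, Nat.cast_zero, zero_div, zero_mul, add_zero, Nat.sub_zero,
        itA_zero, mul_one] at this
      exact this.symm
    rw [Finset.sum_congr rfl h1, Finset.sum_add_distrib, h2, h3, ← add_assoc,
      ← Finset.sum_add_distrib]
    rw [Finset.sum_congr rfl (g := fun l => itA (e + 1) R (l + 1)), ih]
    · push_cast; ring
    · intro l _
      field_simp
      ring

/-- Linear decoupling with a given exponent. -/
def WL (N d : ℕ) (B lam : ℝ) : Prop := ∃ C : ℝ, ∀ m : ℕ, WDat N d B m (lam * m + C)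

lemma Tri_identity {l : ℕ} (hl : 1 ≤ l) (hld : l ≤ d) :
    (d - l + 1) * Tri l = (Tri d - Tri (d - l)) + (d - l) * Tri (l - 1) := by
  obtain ⟨k, rfl⟩ := Nat.exists_eq_add_of_le hld
  obtain ⟨l, rfl⟩ := Nat.exists_eq_add_of_le' hl
  have h1 := two_mul_Tri (l + 1 + k)
  have h2 := two_mul_Tri k
  have h3 := two_mul_Tri (l + 1)
  have h4 := two_mul_Tri l
  have h5 : Tri k ≤ Tri (l + 1 + k) := Tri_mono (by omega)
  rw [show l + 1 + k - (l + 1) = k by omega, show l + 1 - 1 = l by omega]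
  have : (k + 1) * Tri (l + 1) + Tri k = Tri (l + 1 + k) + k * Tri l := by nlinarith
  omega

/-- The bilinear iteration. -/
lemma BL_iter (hd : 1 ≤ d) (hB : 1 ≤ B) (hW : ∀ l, 1 ≤ l → l < d → WD N l) {lam : ℝ}
    (hlam : 0 ≤ lam) (hL : WL N d B lam) (hν : d ≤ ν) (R : ℕ) {ε : ℝ} (hε : 0 < ε) :
    ∃ C : ℝ, ∀ m l a b : ℕ, l < d → ν ≤ a → a ≤ m → ν ≤ b → a * l ≤ (d - l + 1) * b →
      b * d ^ R ≤ m → BL N d B m ν l a b (lam * (m - itA d R l * b) + ε * m + C) := by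
  obtain ⟨C₀, hC₀⟩ := hL
  have hzero : ∀ R m a b : ℕ, b * d ^ R ≤ m →
      BL N d B m ν 0 a b (lam * (m - itA d R 0 * b) + C₀) := by
    intro R m a b hb
    have hbm : b ≤ m := le_trans (Nat.le_mul_of_pos_right _ (by positivity)) hb
    have := BLg.of_snd (N := N) (d := d) (B := B) (ν := ν) (a := a) hbm (hC₀ (m - b))
    rw [BL, show Tri 0 = 0 from rfl, Nat.sub_zero]
    refine this.mono (le_of_eq ?_)
    rw [itA_zero, Nat.cast_sub hbm]; ring
  induction R generalizing ε with
  | zero =>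
    refine ⟨|C₀| + Real.log 2, fun m l a b hl h1 h2 h3 h4 h5 => ?_⟩
    have hlog : 0 < Real.log 2 := Real.log_pos (by norm_num)
    have hm : 0 ≤ ε * m := by positivity
    rcases Nat.eq_zero_or_pos l with rfl | hl0
    · refine BLg.mono (hzero 0 m a b h5) ?_
      linarith [le_abs_self C₀]
    · have hbm : b ≤ m := by simpa using h5
      have hm1 : ∀ c : ℕ, WDat N d B (m - c) (lam * m + C₀) := fun c => (hC₀ _).mono (by
        have : ((m - c : ℕ) : ℝ) ≤ m := by exact_mod_cast Nat.sub_le _ _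
        have := mul_le_mul_of_nonneg_left this hlam
        linarith)
      have := BLg.of_WDat (N := N) (d := d) (B := B) (ν := ν) (p := Tri l) (q := Tri d - Tri l)
        h2 hbm (by have := Tri_mono hl.le; omega) (hm1 a) (hm1 b)
      refine BLg.mono this ?_
      rw [itA, if_neg (by omega)]
      have := le_abs_self C₀
      linarith
  | succ R ih =>
    obtain ⟨C₁, hC₁⟩ := ih (ε := ε / 2) (by positivity)
    have hsup : ∀ l, ∃ C : ℝ, 1 ≤ l → l < d → ∀ (m a b a' : ℕ) (Y : ℝ), ν ≤ a → a ≤ a' → a' ≤ m →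
        ν ≤ b → b ≤ m → a' * l ≤ (d - l + 1) * b → BL N d B m ν l a' b Y →
        BL N d B m ν l a b (Y + ε / 2 * m + C) := by
      intro l
      by_cases h : 1 ≤ l ∧ l < d
      · obtain ⟨C, hC⟩ := BL_sup hB h.1 h.2.le (hW l h.1 h.2) (by positivity : 0 < ε / 2) ν
        exact ⟨C, fun _ _ => hC⟩
      · exact ⟨0, fun h1 h2 => absurd ⟨h1, h2⟩ h⟩
    choose C₂ hC₂ using hsup
    set S := ∑ l ∈ Finset.range d, (|C₂ l| + lam * itA d R (d - l)) with hS
    have hSn : ∀ l ∈ Finset.range d, 0 ≤ |C₂ l| + lam * itA d R (d - l) := fun l _ =>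
      add_nonneg (abs_nonneg _) (mul_nonneg hlam (itA_nonneg _ _ _))
    refine ⟨|C₀| + |C₁| + S, fun m l a b hl h1 h2 h3 h4 h5 => ?_⟩
    have hm : 0 ≤ ε * m := by positivity
    have hS0 : 0 ≤ S := Finset.sum_nonneg hSn
    rcases Nat.eq_zero_or_pos l with rfl | hl0
    · refine BLg.mono (hzero (R + 1) m a b h5) ?_
      linarith [le_abs_self C₀, abs_nonneg C₁]
    · have hSl : |C₂ l| + lam * itA d R (d - l) ≤ S :=
        Finset.single_le_sum hSn (Finset.mem_range.2 hl)
      have hdR : 1 ≤ d ^ R := Nat.one_le_pow _ _ (by omega)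
      have hbR : b * d ^ R ≤ m := le_trans (by
        rw [pow_succ, ← mul_assoc]; exact Nat.le_mul_of_pos_right _ (by omega)) h5
      have hbm : b ≤ m := le_trans (Nat.le_mul_of_pos_right _ (by omega)) hbR
      set n := d - l + 1 with hn
      set a' := (n * b) / l with ha'
      have ha1 : a' * l ≤ n * b := Nat.div_mul_le_self _ _
      have ha2 : n * b < a' * l + l := Nat.lt_div_mul_add hl0
      have haa : a ≤ a' := (Nat.le_div_iff_mul_le hl0).2 h4
      have ha3 : a' ≤ d * b := by
        have : n * b ≤ d * b := Nat.mul_le_mul_right _ (by omega)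
        exact (Nat.div_le_self _ _).trans this
      have ha4 : a' * d ^ R ≤ m := by
        calc a' * d ^ R ≤ d * b * d ^ R := Nat.mul_le_mul_right _ ha3
          _ = b * d ^ (R + 1) := by ring
          _ ≤ m := h5
      have ha'm : a' ≤ m := le_trans (Nat.le_mul_of_pos_right _ (by omega)) ha4
      have hTl : Tri l ≤ Tri d := Tri_mono hl.le
      have b1 : BL N d B m ν (d - l) b a' _ := hC₁ m (d - l) b a' (by omega) h3 hbm (by omega) (by
        rw [show d - (d - l) + 1 = l + 1 by omega]
        have : (n - 1) * b + b = n * b := by rw [hn]; simp; ring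
        have e : n - 1 = d - l := by omega
        rw [e] at this
        nlinarith) ha4
      have b2 : BL N d B m ν (l - 1) a' b _ := hC₁ m (l - 1) a' b (by omega) (by omega) ha'm h3 (by
        have e : d - (l - 1) + 1 = n + 1 := by omega
        rw [e]
        have : a' * (l - 1) ≤ a' * l := Nat.mul_le_mul_left _ (by omega)
        nlinarith) hbR
      have b3 := BLg.interp (n := n) (p := Tri l) (q := Tri d - Tri l) (by omega) ha'm hbm
        (by rw [show n - 1 = d - l by omega]; exact Tri_identity hl0 hl.le)
        (by
          rw [show n - 1 = d - l by omega]
          have := Tri_identity hl0 hl.le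
          have e1 : Tri (d - l) ≤ Tri d := Tri_mono (by omega)
          have e2 : Tri (l - 1) ≤ Tri d := Tri_mono (by omega)
          zify [hTl, e1, e2] at this ⊢
          push_cast [Nat.cast_sub hl.le] at this ⊢
          have hn' : (n : ℤ) = d - l + 1 := by omega
          rw [hn']
          linarith) b1.symm b2
      have b4 := hC₂ l hl0 hl m a b a' _ h1 haa ha'm h3 hbm ha1 b3
      refine BLg.mono b4 ?_
      have hl0' : (0 : ℝ) < l := by exact_mod_cast hl0
      have hnR : (n : ℝ) = (d - l : ℕ) + 1 := by rw [hn]; push_cast; ring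
      set e : ℝ := ((d - l : ℕ) : ℝ) with he
      have he0 : 0 ≤ e := by positivity
      have ha2' : (n : ℝ) * b ≤ a' * l + l := by exact_mod_cast ha2.le
      have hA := itA_nonneg d R (d - l)
      have hArec : itA d (R + 1) l = itA d R (d - l) / l + e / (e + 1) * itA d R (l - 1) := by
        rw [itA, if_neg (by omega)]; push_cast; rfl
      rw [hArec, hnR]
      have key : lam * (itA d R (d - l) / l * b) ≤
          1 / (e + 1) * (lam * (itA d R (d - l) * a')) + lam * itA d R (d - l) := by
        have h6 : (b : ℝ) / l ≤ 1 / (e + 1) * a' + 1 := by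
          rw [hnR] at ha2'
          rw [div_le_iff₀ hl0']
          have : (b : ℝ) ≤ (a' * l + l) / (e + 1) := by rw [le_div_iff₀ (by positivity)]; linarith
          refine this.trans ?_
          rw [div_le_iff₀ (by positivity)]
          field_simp
          nlinarith
        have h7 := mul_le_mul_of_nonneg_left h6 (mul_nonneg hlam hA)
        calc _ = lam * itA d R (d - l) * (b / l) := by ring
          _ ≤ _ := h7
          _ = _ := by
            have : 1 / (e + 1) ≤ 1 := by rw [div_le_one (by positivity)]; linarith
            ring
      have c1 : 1 / (e + 1) + (e + 1 - 1) / (e + 1) = 1 := by field_simp; ring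
      have expand : 1 / (e + 1) * (lam * (m - itA d R (d - l) * a') + ε / 2 * m + C₁) +
          (e + 1 - 1) / (e + 1) * (lam * (m - itA d R (l - 1) * b) + ε / 2 * m + C₁) =
          lam * m + ε / 2 * m + C₁ - 1 / (e + 1) * (lam * (itA d R (d - l) * a')) -
          lam * (e / (e + 1) * itA d R (l - 1) * b) := by
        field_simp; ring
      rw [expand]
      have := le_abs_self C₁
      have := le_abs_self (C₂ l)
      have := abs_nonneg C₀
      nlinarith

/-- One improvement of the linear exponent. -/
lemma WL_improve {e : ℕ} (hB : 1 ≤ B) (hW : ∀ l, 1 ≤ l → l < e + 2 → WD N l) {lam₀ : ℝ}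
    (hlam₀ : 0 < lam₀) : ∃ ξ : ℝ, 0 < ξ ∧ ∀ lam, lam₀ ≤ lam → WL N (e + 2) B lam →
      WL N (e + 2) B (max (lam - ξ) lam₀) := by
  set d := e + 2 with hd
  have hlog : 0 < Real.log 8 := Real.log_pos (by norm_num)
  have hlog2 : 0 < Real.log 2 := Real.log_pos (by norm_num)
  set κ : ℝ := 2 * Tri d * Real.log 8 with hκ
  have hκ0 : 0 ≤ κ := by positivity
  obtain ⟨R, hR⟩ := exists_nat_ge (2 * ((e + 1) * ((κ + 1) / lam₀)))
  obtain ⟨l, hl, hA⟩ : ∃ l ∈ Finset.range (e + 1), (κ + 1) / lam₀ ≤ itA d R (l + 1) := by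
    by_contra hcon
    push Not at hcon
    have h1 := Finset.sum_lt_sum_of_nonempty (s := Finset.range (e + 1)) (by simp) hcon
    have h2 := sum_itA (e + 1) R
    rw [Finset.sum_const, Finset.card_range, nsmul_eq_mul] at h1
    rw [show e + 1 + 1 = d from rfl] at h2
    rw [h2] at h1
    have h3 : (1 : ℝ) / 2 ≤ ((e + 1 : ℕ) : ℝ) / ((e + 1 : ℕ) + 1) := by
      rw [div_le_div_iff₀ (by norm_num) (by positivity)]
      push_cast
      have : (0 : ℝ) ≤ e := by positivity
      linarith
    have h4 : (R : ℝ) * (1 / 2) ≤ R * (((e + 1 : ℕ) : ℝ) / ((e + 1 : ℕ) + 1)) := by gcongr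
    push_cast at h1 h4
    linarith
  have hl' := Finset.mem_range.1 hl
  have hl1 : l + 1 < d := by omega
  rw [div_le_iff₀ hlam₀] at hA
  set K : ℕ := d ^ R with hK
  have hK1 : 1 ≤ K := Nat.one_le_pow _ _ (by omega)
  have hK0 : (0 : ℝ) < K := by exact_mod_cast hK1
  refine ⟨1 / (2 * K), by positivity, fun lam hlam hL => ?_⟩
  set lam' := max (lam - 1 / (2 * K)) lam₀ with hlam'
  have hlam'0 : 0 < lam' := lt_of_lt_of_le hlam₀ (le_max_right _ _)
  have hlog4 : 0 < Real.log 4 := Real.log_pos (by norm_num)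
  obtain ⟨ν₀, hν₀⟩ := exists_nat_ge ((2 * Tri d * Real.log 4 + Real.log 2) / lam')
  rw [div_le_iff₀ hlam'0] at hν₀
  set ν := ν₀ + d with hν
  have hlam0 : 0 ≤ lam := hlam₀.le.trans hlam
  obtain ⟨C, hC⟩ := BL_iter (N := N) (by omega) hB hW hlam0 hL (by omega : d ≤ ν) R
    (by positivity : (0 : ℝ) < 1 / (2 * K))
  have hT1 : 1 ≤ Tri (l + 1) := Tri_pos (by omega)
  have hT2 : Tri (l + 1) + 1 ≤ Tri d := by
    have : Tri (l + 1 + 1) ≤ Tri d := Tri_mono (by omega)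
    rw [Tri_succ] at this; omega
  set C' := C + (κ + 1) with hC'
  have hbil : ∀ m, K * (ν * d) ≤ m → BL N d B m ν (l + 1) ν ν
      ((lam - 1 / (2 * K)) * m + C') := by
    intro m hm
    set b := m / K with hb
    have hbK : b * K ≤ m := Nat.div_mul_le_self _ _
    have hbK' : m < b * K + K := Nat.lt_div_mul_add (by omega)
    have hνb : ν * d ≤ b := (Nat.le_div_iff_mul_le (by omega)).2 (by rw [mul_comm]; exact hm)
    have hνb' : ν ≤ b := le_trans (Nat.le_mul_of_pos_right _ (by omega)) hνb
    have hbm : b ≤ m := le_trans (Nat.le_mul_of_pos_right _ (by omega)) hbK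
    have h1 := hC m (l + 1) ν b hl1 le_rfl (by omega) hνb' (by
      calc ν * (l + 1) ≤ ν * d := Nat.mul_le_mul_left _ (by omega)
        _ ≤ b := hνb
        _ ≤ _ := Nat.le_mul_of_pos_left _ (by omega)) hbK
    have h2 := BLg.steps (k := b - ν) (a := ν) (by omega : 1 ≤ Tri d - Tri (l + 1)) le_rfl
      (by omega : ν ≤ m) (by omega) (by
        rw [show ν + (b - ν) = b by omega]; exact h1.symm)
    refine BLg.mono h2.symm ?_
    have e1 : ((b - ν : ℕ) : ℝ) ≤ b := by exact_mod_cast Nat.sub_le _ _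
    have e2 : ((Tri d - Tri (l + 1) : ℕ) : ℝ) ≤ Tri d := by exact_mod_cast Nat.sub_le _ _
    have e3 : ((b - ν : ℕ) : ℝ) * (2 * ((Tri d - Tri (l + 1) : ℕ) : ℝ) * Real.log 8) ≤ b * κ := by
      rw [hκ]; gcongr
    have e4 : (m : ℝ) ≤ b * K + K := by exact_mod_cast hbK'.le
    have e5 : (κ + 1) * b ≤ lam * (itA d R (l + 1) * b) := by
      have : (κ + 1) * b ≤ itA d R (l + 1) * lam₀ * b := by gcongr
      have h6 : itA d R (l + 1) * lam₀ * b ≤ itA d R (l + 1) * lam * b := by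
        have := itA_nonneg d R (l + 1); gcongr
      linarith
    have e6 : (1 / (2 * K) : ℝ) * m * 2 ≤ b + 1 := by
      have : (1 / (2 * K) : ℝ) * m * 2 = m / K := by field_simp
      rw [this, div_le_iff₀ hK0]; linarith
    rw [hC']
    linarith
  obtain ⟨C₁, hC₁⟩ : ∃ C₁ : ℝ, κ * (K * (ν * d) : ℕ) ≤ C₁ ∧
      C' + 4 * Tri d * (ν * Real.log 8) + Real.log 2 ≤ C₁ :=
    ⟨_, le_max_left _ _, le_max_right _ _⟩
  refine ⟨C₁, fun m => ?_⟩
  induction m using Nat.strong_induction_on with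
  | _ m ih =>
    rcases lt_or_ge m (K * (ν * d)) with hm | hm
    · refine (WDat_trivial N d (by omega) B m).mono ?_
      have h1 : (m : ℝ) ≤ (K * (ν * d) : ℕ) := by exact_mod_cast hm.le
      have h2 := mul_le_mul_of_nonneg_left h1 hκ0
      have : 0 ≤ lam' * m := by positivity
      linarith [hC₁.1]
    · have hνm : ν ≤ m := by
        calc ν ≤ ν * d := Nat.le_mul_of_pos_right _ (by omega)
          _ ≤ K * (ν * d) := Nat.le_mul_of_pos_left _ (by omega)
          _ ≤ m := hm
      have h1 := ih (m - ν) (by omega)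
      have h2 := WDat.of_broad_narrow hT1 (by omega : 1 ≤ Tri d - Tri (l + 1)) (by omega) hνm h1
        (hbil m hm)
      refine h2.mono ?_
      rw [Real.log_le_iff_le_exp (by positivity)]
      have e1 : (4 : ℝ) ^ (2 * Tri d) * exp (lam' * (m - ν : ℕ) + C₁) ≤
          exp (lam' * m + C₁) / 2 := by
        rw [le_div_iff₀ (by norm_num), ← Real.exp_log (by positivity : (0 : ℝ) < 4 ^ (2 * Tri d)),
          Real.log_pow, ← Real.exp_log (by norm_num : (0 : ℝ) < 2), ← Real.exp_add, ← Real.exp_add]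
        refine exp_le_exp.2 ?_
        rw [Nat.cast_sub hνm, hν]
        push_cast
        have : 0 ≤ lam' * d := by positivity
        linarith
      have e2 : ((8 : ℝ) ^ ν) ^ (4 * Tri d) * exp ((lam - 1 / (2 * K)) * m + C') ≤
          exp (lam' * m + C₁) / 2 := by
        rw [le_div_iff₀ (by norm_num),
          ← Real.exp_log (by positivity : (0 : ℝ) < ((8 : ℝ) ^ ν) ^ (4 * Tri d)),
          Real.log_pow, Real.log_pow, ← Real.exp_log (by norm_num : (0 : ℝ) < 2), ← Real.exp_add,
          ← Real.exp_add, Real.exp_log (by norm_num : (0 : ℝ) < 2)]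
        refine exp_le_exp.2 ?_
        have : (lam - 1 / (2 * K)) * m ≤ lam' * m :=
          mul_le_mul_of_nonneg_right (le_max_left _ _) (by positivity)
        push_cast
        linarith [hC₁.2]
      linarith

/-- **Decoupling for moment curves.** -/
theorem WD_all (N d : ℕ) (hd : 1 ≤ d) : WD N d := by
  induction d using Nat.strong_induction_on with
  | _ d ih =>
    rcases Nat.lt_or_ge d 2 with h | h
    · obtain rfl : d = 1 := by omega
      exact WD_one N
    · obtain ⟨e, rfl⟩ := Nat.exists_eq_add_of_le' h
      intro B hB ε hε
      obtain ⟨ξ, hξ, himp⟩ := WL_improve (N := N) hB (fun l h1 h2 => ih l h2 h1) hε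
      set κ : ℝ := 2 * Tri (e + 2) * Real.log 8 with hκ
      have hk : ∀ k : ℕ, WL N (e + 2) B (max (κ - k * ξ) ε) := by
        intro k
        induction k with
        | zero =>
          refine ⟨0, fun m => (WDat_trivial N (e + 2) (by omega) B m).mono ?_⟩
          rw [add_zero]
          refine mul_le_mul_of_nonneg_right ?_ (by positivity)
          simp [hκ]
        | succ k ihk =>
          have := himp _ (le_max_right _ _) ihk
          obtain ⟨C, hC⟩ := this
          refine ⟨C, fun m => (hC m).mono ?_⟩
          have : max (max (κ - k * ξ) ε - ξ) ε ≤ max (κ - (k + 1 : ℕ) * ξ) ε := by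
            refine max_le ?_ (le_max_right _ _)
            rw [sub_le_iff_le_add]
            refine max_le ?_ ?_
            · have := le_max_left (κ - (k + 1 : ℕ) * ξ) ε
              push_cast at this ⊢; linarith
            · have := le_max_right (κ - (k + 1 : ℕ) * ξ) ε
              linarith
          have := mul_le_mul_of_nonneg_right this (by positivity : (0 : ℝ) ≤ m)
          linarith
      obtain ⟨k, hk'⟩ := exists_nat_ge (κ / ξ)
      rw [div_le_iff₀ hξ] at hk'
      have := hk k
      rwa [max_eq_right (by linarith)] at this

end

/-- The generating polynomial of a frequency vector. -/
def Sr {N : ℕ} : (Fin N → ℝ) →ₗ[ℝ] PowerSeries ℝ where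
  toFun η := PowerSeries.mk fun l => if h : l < N then η ⟨l, h⟩ else 0
  map_add' x y := by ext l; simp only [PowerSeries.coeff_mk, map_add]; split_ifs <;> simp
  map_smul' c x := by
    ext l; simp only [PowerSeries.coeff_mk, map_smul, RingHom.id_apply]; split_ifs <;> simp

lemma coeff_Sr {N : ℕ} (η : Fin N → ℝ) (l : ℕ) :
    PowerSeries.coeff l (Sr η) = if h : l < N then η ⟨l, h⟩ else 0 :=
  PowerSeries.coeff_mk (R := ℝ) l fun l => if h : l < N then η ⟨l, h⟩ else 0

/-- Coefficients `j + 1, …, j + d` of a power series, renormalized. -/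
def winS (j d : ℕ) (Λ σ : ℝ) : PowerSeries ℝ →ₗ[ℝ] PowerSeries ℝ where
  toFun x := PowerSeries.mk fun l =>
    if 1 ≤ l ∧ l ≤ d then PowerSeries.coeff (j + l) x / (Λ * σ ^ l) else 0
  map_add' x y := by
    ext l; simp only [PowerSeries.coeff_mk, map_add]; split_ifs <;> simp [add_div]
  map_smul' c x := by
    ext l; simp only [PowerSeries.coeff_mk, map_smul, RingHom.id_apply]
    split_ifs <;> simp [mul_div_assoc]

lemma coeff_winS (j d : ℕ) (Λ σ : ℝ) (x : PowerSeries ℝ) (l : ℕ) :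
    PowerSeries.coeff l (winS j d Λ σ x) =
      if 1 ≤ l ∧ l ≤ d then PowerSeries.coeff (j + l) x / (Λ * σ ^ l) else 0 :=
  PowerSeries.coeff_mk (R := ℝ) l fun l =>
    if 1 ≤ l ∧ l ≤ d then PowerSeries.coeff (j + l) x / (Λ * σ ^ l) else 0

/-- The frequency window attached to the point `s` of the curve. -/
structure Win (j d : ℕ) (Λ κ : ℝ) (m₁ m₂ : ℕ) (y : PowerSeries ℝ) : Prop where
  hi : ∀ l, 1 ≤ l → l ≤ d → |PowerSeries.coeff (j + l) y| ≤ |Λ| * ((1 / 8 : ℝ) ^ m₂) ^ l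
  mid : |PowerSeries.coeff j y - Λ| ≤ κ * |Λ|
  lo : ∀ k, 1 ≤ k → k ≤ j → |PowerSeries.coeff (j - k) y| ≤ κ * |Λ| * ((8 : ℝ) ^ m₁) ^ k

/-- Renormalizing a window around a point of an arc yields a point of the anisotropic box. -/
lemma Win.bx {j d : ℕ} {Λ κ : ℝ} {m₁ m₂ : ℕ} {y : PowerSeries ℝ} (hw : Win j d Λ κ m₁ m₂ y)
    (hΛ : Λ ≠ 0) {m h k : ℕ} (hm : m₁ ≤ m) (hmh : m + h ≤ m₂) (hk : k < 8 ^ h)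
    (hκ0 : 0 ≤ κ) (hκ : 2 ^ d * ((j + 1) * κ) ≤ ((1 / 8 : ℝ) ^ h) ^ d) {s' : ℝ}
    (hs1 : (k : ℝ) / 8 ^ h ≤ s') (hs2 : s' ≤ ((k : ℝ) + 1) / 8 ^ h) :
    Bx d 10 h k (1 + winS j d Λ ((1 / 8 : ℝ) ^ m) (tl ((1 / 8 : ℝ) ^ m * s') y)) := by
  set σ : ℝ := (1 / 8 : ℝ) ^ m with hσ
  have hσ0 : 0 < σ := by positivity
  set τ : ℝ := (1 / 8 : ℝ) ^ h with hτ
  have hτ0 : 0 < τ := by positivity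
  have hτ8 : τ * 8 ^ h = 1 := by rw [hτ, ← mul_pow]; norm_num
  have hk1 : (k : ℝ) + 1 ≤ 8 ^ h := by exact_mod_cast hk
  have h80 : (0 : ℝ) < 8 ^ h := by positivity
  have hs0 : 0 ≤ s' := le_trans (by positivity) hs1
  have hs1' : s' ≤ 1 := hs2.trans ((div_le_one h80).2 hk1)
  have hΛ0 : 0 < |Λ| := abs_pos.2 hΛ
  -- the ideal series
  let Z : PowerSeries ℝ := PowerSeries.mk fun l =>
    if l = 0 then 1 else PowerSeries.coeff (j + l) y / (Λ * σ ^ l)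
  have hZ0 : PowerSeries.coeff 0 Z = 1 := by simp [Z]
  have hZl : ∀ l, 1 ≤ l → PowerSeries.coeff l Z = PowerSeries.coeff (j + l) y / (Λ * σ ^ l) := by
    intro l hl; simp [Z, PowerSeries.coeff_mk]; omega
  have hZ : ∀ q ≤ d, |PowerSeries.coeff q Z| ≤ τ ^ q := by
    intro q hq
    rcases Nat.eq_zero_or_pos q with rfl | hq1
    · rw [hZ0]; simp
    · rw [hZl q hq1, abs_div, abs_mul, abs_of_pos (pow_pos hσ0 q), div_le_iff₀ (by positivity)]
      refine (hw.hi q hq1 hq).trans ?_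
      have : ((1 / 8 : ℝ) ^ m₂) ≤ τ * σ := by
        rw [hτ, hσ, ← pow_add]
        exact pow_le_pow_of_le_one (by norm_num) (by norm_num) (by omega)
      calc |Λ| * ((1 / 8 : ℝ) ^ m₂) ^ q ≤ |Λ| * (τ * σ) ^ q := by gcongr
        _ = _ := by rw [mul_pow]; ring
  set Y := 1 + winS j d Λ σ (tl (σ * s') y) with hY
  have herr : ∀ l ≤ d, |PowerSeries.coeff l (Y - tl s' Z)| ≤ (j + 1) * κ := by
    intro l hl
    rcases Nat.eq_zero_or_pos l with rfl | hl1
    · rw [map_sub, coeff_zero_tl, hZ0, hY, map_add, coeff_winS]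
      simp; positivity
    · have e1 : PowerSeries.coeff l Y = PowerSeries.coeff (j + l) (tl (σ * s') y) / (Λ * σ ^ l) := by
        rw [hY, map_add, coeff_winS, if_pos ⟨hl1, hl⟩, PowerSeries.coeff_one, if_neg (by omega),
          zero_add]
      have e2 : PowerSeries.coeff (j + l) (tl (σ * s') y) =
          ∑ q ∈ Finset.range j, (σ * s') ^ (j + l - q) / ((j + l - q).factorial : ℝ) *
            PowerSeries.coeff q y +
          ∑ q ∈ Finset.range (l + 1), (σ * s') ^ (l - q) / ((l - q).factorial : ℝ) *
            PowerSeries.coeff (j + q) y := by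
        rw [coeff_tl, add_assoc, Finset.sum_range_add]
        congr 1
        refine Finset.sum_congr rfl fun q _ => ?_
        rw [show j + l - (j + q) = l - q by omega]
      have e3 : PowerSeries.coeff l (tl s' Z) =
          (∑ q ∈ Finset.range (l + 1), (σ * s') ^ (l - q) / ((l - q).factorial : ℝ) *
            PowerSeries.coeff (j + q) y) / (Λ * σ ^ l) -
            s' ^ l / (l.factorial : ℝ) * ((PowerSeries.coeff j y - Λ) / Λ) := by
        rw [coeff_tl, Finset.sum_range_succ', Finset.sum_range_succ', hZ0, add_div, Finset.sum_div]
        have : ∑ q ∈ Finset.range l, s' ^ (l - (q + 1)) / ((l - (q + 1)).factorial : ℝ) *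
            PowerSeries.coeff (q + 1) Z = ∑ q ∈ Finset.range l,
            (σ * s') ^ (l - (q + 1)) / ((l - (q + 1)).factorial : ℝ) *
              PowerSeries.coeff (j + (q + 1)) y / (Λ * σ ^ l) := by
          refine Finset.sum_congr rfl fun q hq => ?_
          have hq := Finset.mem_range.1 hq
          rw [hZl _ (by omega)]
          have : σ ^ l = σ ^ (l - (q + 1)) * σ ^ (q + 1) := by rw [← pow_add]; congr 1; omega
          rw [this, mul_pow]
          field_simp
        rw [this]
        simp only [Nat.sub_zero, add_zero]
        rw [add_sub_assoc]
        congr 1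
        field_simp
        ring
      rw [map_sub, e1, e2, e3, add_div]
      have e4 : ∀ A B D : ℝ, A + B - (B - D) = A + D := by intros; ring
      rw [e4, Finset.sum_div]
      refine (abs_add_le _ _).trans ?_
      rw [add_mul, one_mul]
      refine add_le_add ?_ ?_
      · refine (Finset.abs_sum_le_sum_abs _ _).trans ?_
        refine (Finset.sum_le_card_nsmul _ _ κ ?_).trans (by simp)
        intro q hq
        have hq := Finset.mem_range.1 hq
        have h1 := hw.lo (j - q) (by omega) (by omega)
        rw [show j - (j - q) = q by omega] at h1
        rw [abs_div, abs_mul, abs_div, abs_mul, abs_of_pos (pow_pos hσ0 l), Nat.abs_cast,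
          abs_of_nonneg (by positivity : 0 ≤ (σ * s') ^ (j + l - q)), div_le_iff₀ (by positivity)]
        have h2 : (σ * s') ^ (j + l - q) / ((j + l - q).factorial : ℝ) ≤ σ ^ l * σ ^ (j - q) := by
          refine (div_le_self (by positivity) (by exact_mod_cast Nat.factorial_pos _)).trans ?_
          rw [← pow_add, show l + (j - q) = j + l - q by omega]
          exact pow_le_pow_left₀ (by positivity) (mul_le_of_le_one_right hσ0.le hs1') _
        have h3 : σ ^ (j - q) * ((8 : ℝ) ^ m₁) ^ (j - q) ≤ 1 := by
          rw [← mul_pow]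
          refine pow_le_one₀ (by positivity) ?_
          calc σ * 8 ^ m₁ ≤ σ * 8 ^ m := by gcongr; norm_num
            _ = 1 := by rw [hσ, ← mul_pow]; norm_num
        calc _ ≤ σ ^ l * σ ^ (j - q) * (κ * |Λ| * ((8 : ℝ) ^ m₁) ^ (j - q)) :=
              mul_le_mul h2 h1 (abs_nonneg _) (by positivity)
          _ = κ * (|Λ| * σ ^ l) * (σ ^ (j - q) * ((8 : ℝ) ^ m₁) ^ (j - q)) := by ring
          _ ≤ κ * (|Λ| * σ ^ l) * 1 := by gcongr
          _ = _ := mul_one _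
      · rw [abs_mul, abs_div, abs_div, Nat.abs_cast, abs_of_nonneg (pow_nonneg hs0 l)]
        have h1 : s' ^ l / (l.factorial : ℝ) ≤ 1 :=
          (div_le_self (by positivity) (by exact_mod_cast Nat.factorial_pos _)).trans
            (pow_le_one₀ hs0 hs1')
        have h2 : |PowerSeries.coeff j y - Λ| / |Λ| ≤ κ := by
          rw [div_le_iff₀ hΛ0]; exact hw.mid
        calc _ ≤ 1 * κ := mul_le_mul h1 h2 (by positivity) zero_le_one
          _ = κ := one_mul κ
  intro i hi1 hid
  have hsplit : Y = tl s' Z + (Y - tl s' Z) := by ring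
  rw [hsplit, map_add, tl_tl, map_add]
  refine (abs_add_le _ _).trans ?_
  set u : ℝ := -((k : ℝ) / 8 ^ h) + s' with hu
  have hu0 : 0 ≤ u := by rw [hu]; linarith
  have hu1 : u ≤ τ := by
    have : τ = 1 / 8 ^ h := by rw [hτ, div_pow, one_pow]
    rw [hu, this]
    rw [add_div] at hs2
    linarith
  have b1 : |PowerSeries.coeff i (tl u Z)| ≤ exp 1 * τ ^ i := by
    rw [coeff_tl]
    refine (Finset.abs_sum_le_sum_abs _ _).trans ?_
    have : ∀ q ∈ Finset.range (i + 1), |u ^ (i - q) / ((i - q).factorial : ℝ) *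
        PowerSeries.coeff q Z| ≤ 1 / ((i - q).factorial : ℝ) * τ ^ i := by
      intro q hq
      have hq' : q ≤ i := by simpa [Nat.lt_succ_iff] using hq
      rw [abs_mul, abs_div, Nat.abs_cast, abs_of_nonneg (pow_nonneg hu0 _)]
      have : τ ^ i = τ ^ (i - q) * τ ^ q := by rw [← pow_add]; congr 1; omega
      rw [this]
      calc _ ≤ τ ^ (i - q) / ((i - q).factorial : ℝ) * τ ^ q := by
            gcongr
            exact hZ q (by omega)
        _ = _ := by ring
    refine (Finset.sum_le_sum this).trans ?_
    rw [← Finset.sum_mul]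
    refine mul_le_mul_of_nonneg_right ?_ (by positivity)
    have hr := Finset.sum_range_reflect (fun q => (1 : ℝ) / (q.factorial : ℝ)) (i + 1)
    have hr' : ∑ q ∈ Finset.range (i + 1), (1 : ℝ) / ((i - q).factorial : ℝ) =
        ∑ q ∈ Finset.range (i + 1), (1 : ℝ) / (q.factorial : ℝ) := by
      rw [← hr]
      refine Finset.sum_congr rfl fun q _ => ?_
      rw [show i + 1 - 1 - q = i - q by omega]
    rw [hr']
    have := Real.sum_le_exp_of_nonneg (x := 1) zero_le_one (i + 1)
    simpa using this
  have b2 : |PowerSeries.coeff i (tl (-((k : ℝ) / 8 ^ h)) (Y - tl s' Z))| ≤ τ ^ i := by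
    have ha : |-((k : ℝ) / 8 ^ h)| ≤ 1 := by
      rw [abs_neg, abs_of_nonneg (by positivity), div_le_one h80]; linarith
    refine (abs_coeff_tl_le_const (β := (j + 1) * κ) (fun q hq => herr q (by omega)) ha).trans ?_
    have hj : 0 ≤ ((j : ℝ) + 1) * κ := by positivity
    calc (2 : ℝ) ^ i * ((j + 1) * κ) ≤ 2 ^ d * ((j + 1) * κ) := by
          gcongr; norm_num
      _ ≤ τ ^ d := hκ
      _ ≤ τ ^ i := pow_le_pow_of_le_one hτ0.le (pow_le_one₀ (by norm_num) (by norm_num)) hid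
  have he : exp 1 ≤ 9 := by have := Real.exp_one_lt_d9; linarith
  have hτi : 0 < τ ^ i := by positivity
  nlinarith

/-- The hypotheses of multi-scale decoupling for windows of the moment curve. -/
structure MDat {N : ℕ} (j d : ℕ) (Λ κ β : ℝ) (m₁ m₂ : ℕ) (P : Measure (Fin N → ℝ))
    (g : ℕ → (Fin N → ℝ) → ℂ) (s : ℕ → ℝ) : Prop where
  fin : IsFiniteMeasure P
  spc : Spc P {η | ∀ i, |η i| ≤ β}
  Λ_ge : 1 ≤ |Λ| * ((1 / 8 : ℝ) ^ m₂) ^ d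
  mem : ∀ k : ℕ, k < 8 ^ m₂ → g k ∈ TP {η | ∃ a : ℝ, (k : ℝ) / 8 ^ m₂ ≤ a ∧ a ≤ ((k : ℝ) + 1) / 8 ^ m₂ ∧
    Win j d Λ κ m₁ m₂ (tl (-a) (Sr η))}
  s_pos : ∀ k, 0 < s k
  le : ∀ k : ℕ, k < 8 ^ m₂ → ∫ y, ‖g k y‖ ^ (2 * Tri d) ∂P ≤ s k ^ Tri d

/-- One renormalized decoupling step. -/
lemma MDat.step {N j d : ℕ} {Λ κ β : ℝ} {m₁ m₂ : ℕ} {P : Measure (Fin N → ℝ)}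
    {g : ℕ → (Fin N → ℝ) → ℂ} {s : ℕ → ℝ} (hD : MDat j d Λ κ β m₁ m₂ P g s) (hd : 1 ≤ d)
    {h : ℕ} {Y : ℝ} (hW : WDat N d 10 h Y) (hκ0 : 0 ≤ κ)
    (hκ : 2 ^ d * ((j + 1) * κ) ≤ ((1 / 8 : ℝ) ^ h) ^ d) (hβ0 : 0 ≤ β)
    (hβ : 2 ^ d * (2 ^ (j + d) * β) ≤ 10 * ((1 / 8 : ℝ) ^ h) ^ d)
    {m K I : ℕ} (hm : m₁ ≤ m) (hmK : m + h + K = m₂) (hI : I < 8 ^ m)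
    {t : ℕ → ℝ} (ht0 : ∀ k, 0 < t k)
    (ht : ∀ k < 8 ^ h, ∫ y, ‖blk (8 ^ K) g (I * 8 ^ h + k) y‖ ^ (2 * Tri d) ∂P ≤ t k ^ Tri d) :
    ∫ y, ‖blk (8 ^ (h + K)) g I y‖ ^ (2 * Tri d) ∂P ≤
      exp Y * (∑ k ∈ Finset.range (8 ^ h), t k) ^ Tri d := by
  set σ : ℝ := (1 / 8 : ℝ) ^ m with hσ
  set a₀ : ℝ := (I : ℝ) / 8 ^ m with ha₀
  have hσ0 : 0 < σ := by positivity
  have hσ8 : σ = 1 / 8 ^ m := by rw [hσ, div_pow, one_pow]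
  have hI1 : (I : ℝ) + 1 ≤ 8 ^ m := by exact_mod_cast hI
  have h8m : (0 : ℝ) < 8 ^ m := by positivity
  have ha1 : a₀ ≤ 1 := (div_le_one h8m).2 (by linarith)
  have ha0 : 0 ≤ a₀ := by positivity
  have hΛ : Λ ≠ 0 := by
    rintro rfl
    have := hD.Λ_ge
    simp at this
    linarith
  have hΛ0 : 0 < |Λ| := abs_pos.2 hΛ
  have hΛσ : ∀ l ≤ d, 1 ≤ |Λ| * σ ^ l := by
    intro l hl
    refine hD.Λ_ge.trans (mul_le_mul_of_nonneg_left ?_ hΛ0.le)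
    calc ((1 / 8 : ℝ) ^ m₂) ^ d ≤ ((1 / 8 : ℝ) ^ m₂) ^ l :=
          pow_le_pow_of_le_one (by positivity) (pow_le_one₀ (by norm_num) (by norm_num)) hl
      _ ≤ σ ^ l := pow_le_pow_left₀ (by positivity)
          (pow_le_pow_of_le_one (by norm_num) (by norm_num) (by omega)) l
  have hdat : Dat d 10 h P ((winS j d Λ σ).comp ((tl (-a₀)).comp Sr)) 1
      (fun k => blk (8 ^ K) g (I * 8 ^ h + k)) t := by
    refine ⟨hD.fin, ?_, by simp, ?_, ?_, ht0, ht⟩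
    · intro η
      rw [LinearMap.comp_apply, coeff_winS, if_neg (by omega)]
    · refine hD.spc.mono ?_
      intro η hη a ha0' ha1' i hi1 hid
      have hη' : ∀ q, |PowerSeries.coeff q (Sr η)| ≤ β := by
        intro q
        rw [coeff_Sr]
        split_ifs with hq
        · exact hη _
        · simpa using hβ0
      have hx : ∀ q ≤ i, |PowerSeries.coeff q
          (((winS j d Λ σ).comp ((tl (-a₀)).comp Sr)) η)| ≤ 2 ^ (j + d) * β := by
        intro q hq
        rw [LinearMap.comp_apply, coeff_winS]
        split_ifs with hq1
        · rw [abs_div, abs_mul, abs_of_pos (pow_pos hσ0 q)]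
          have h1 := hΛσ q hq1.2
          refine (div_le_self (abs_nonneg _) h1).trans ?_
          rw [LinearMap.comp_apply]
          refine (abs_coeff_tl_le_const (fun q _ => hη' q) ?_).trans ?_
          · rw [abs_neg, abs_of_nonneg ha0]; exact ha1
          · gcongr
            · norm_num
            · omega
        · simp; positivity
      refine (abs_coeff_tl_le_const hx ?_).trans ?_
      · rw [abs_neg, abs_of_nonneg ha0']; exact ha1'
      · refine le_trans ?_ hβ
        gcongr
        norm_num
    · intro k hk
      refine Submodule.sum_mem _ fun l hl => ?_
      have hl' := Finset.mem_range.1 hl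
      have hidx : (I * 8 ^ h + k) * 8 ^ K + l < 8 ^ m₂ := by
        rw [← hmK, pow_add, pow_add]
        have h1 : I * 8 ^ h + k + 1 ≤ 8 ^ m * 8 ^ h := by
          calc I * 8 ^ h + k + 1 ≤ I * 8 ^ h + 8 ^ h := by omega
            _ = (I + 1) * 8 ^ h := by ring
            _ ≤ _ := Nat.mul_le_mul_right _ hI
        calc (I * 8 ^ h + k) * 8 ^ K + l < (I * 8 ^ h + k + 1) * 8 ^ K := by
              rw [add_mul _ 1]; omega
          _ ≤ _ := Nat.mul_le_mul_right _ h1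
      refine TP_mono ?_ (hD.mem _ hidx)
      rintro η ⟨a, ha1', ha2', hwin⟩
      have h8 : (8 : ℝ) ^ m₂ = 8 ^ m * 8 ^ h * 8 ^ K := by rw [← hmK, pow_add, pow_add]
      have hle : (l : ℝ) + 1 ≤ 8 ^ K := by exact_mod_cast hl'
      have h8h : (0 : ℝ) < 8 ^ h := by positivity
      have h8K : (0 : ℝ) < 8 ^ K := by positivity
      rw [h8, div_le_iff₀ (by positivity)] at ha1'
      rw [h8, le_div_iff₀ (by positivity)] at ha2'
      push_cast at ha1' ha2'
      have e : (tl (-a₀)) (Sr η) = tl (σ * (8 ^ m * (a - a₀))) (tl (-a) (Sr η)) := by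
        rw [tl_tl]
        congr 2
        rw [hσ8]; field_simp; ring
      change Bx d 10 h k (1 + winS j d Λ σ (tl (-a₀) (Sr η)))
      rw [e]
      refine hwin.bx hΛ hm (by omega) hk hκ0 hκ ?_ ?_
      · rw [div_le_iff₀ h8h]
        have : 8 ^ m * (a - a₀) * 8 ^ h = a * (8 ^ m * 8 ^ h) - I * 8 ^ h := by
          rw [ha₀]; field_simp
        rw [this]
        have : ((I : ℝ) * 8 ^ h + k) * 8 ^ K ≤ (a * (8 ^ m * 8 ^ h)) * 8 ^ K := by
          have : (0 : ℝ) ≤ l := by positivity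
          nlinarith
        have := le_of_mul_le_mul_right this h8K
        linarith
      · rw [le_div_iff₀ h8h]
        have : 8 ^ m * (a - a₀) * 8 ^ h = a * (8 ^ m * 8 ^ h) - I * 8 ^ h := by
          rw [ha₀]; field_simp
        rw [this]
        have : (a * (8 ^ m * 8 ^ h)) * 8 ^ K ≤ ((I : ℝ) * 8 ^ h + k + 1) * 8 ^ K := by
          nlinarith
        have := le_of_mul_le_mul_right this h8K
        linarith
  have := hW P _ _ _ _ hdat
  have e : blk (8 ^ (h + K)) g I = blk (8 ^ h) (fun k => blk (8 ^ K) g (I * 8 ^ h + k)) 0 := by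
    rw [pow_add, ← blk_blk]
    simp [blk]
  rw [e]
  simpa only [blk_range] using this

/-- Multi-scale decoupling. -/
lemma MDat.iterate {N j d : ℕ} {Λ κ β : ℝ} {m₁ m₂ : ℕ} {P : Measure (Fin N → ℝ)}
    {g : ℕ → (Fin N → ℝ) → ℂ} {s : ℕ → ℝ} (hD : MDat j d Λ κ β m₁ m₂ P g s) (hd : 1 ≤ d)
    {h : ℕ} {Y : ℝ} (hW : WDat N d 10 h Y) (hκ0 : 0 ≤ κ)
    (hκ : 2 ^ d * ((j + 1) * κ) ≤ ((1 / 8 : ℝ) ^ h) ^ d) (hβ0 : 0 ≤ β)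
    (hβ : 2 ^ d * (2 ^ (j + d) * β) ≤ 10 * ((1 / 8 : ℝ) ^ h) ^ d) (K : ℕ) :
    ∀ m I : ℕ, m₁ ≤ m → m + K * h = m₂ → I < 8 ^ m →
    ∫ y, ‖blk (8 ^ (K * h)) g I y‖ ^ (2 * Tri d) ∂P ≤
      exp (K * Y) * (blk (8 ^ (K * h)) s I) ^ Tri d := by
  have hT : (Tri d : ℝ) ≠ 0 := by have := Tri_pos hd; positivity
  induction K with
  | zero =>
    intro m I hm hmK hI
    simp only [zero_mul, pow_zero, blk_one, Nat.cast_zero, exp_zero, one_mul]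
    exact hD.le I (by rw [← hmK]; simpa using hI)
  | succ K ih =>
    intro m I hm hmK hI
    have hb : ∀ k < 8 ^ h, I * 8 ^ h + k < 8 ^ (m + h) := by
      intro k hk
      rw [pow_add]
      calc I * 8 ^ h + k < I * 8 ^ h + 8 ^ h := by omega
        _ = (I + 1) * 8 ^ h := by ring
        _ ≤ _ := Nat.mul_le_mul_right _ hI
    have hKh : (K + 1) * h = h + K * h := by ring
    have := hD.step hd hW hκ0 hκ hβ0 hβ (K := K * h) hm (by rw [← hmK]; ring) hI
      (t := fun k => exp (K * Y / Tri d) * blk (8 ^ (K * h)) s (I * 8 ^ h + k))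
      (fun k => mul_pos (exp_pos _) (blk_pos (by positivity) hD.s_pos _)) (by
        intro k hk
        have := ih (m + h) (I * 8 ^ h + k) (by omega) (by rw [← hmK]; ring) (hb k hk)
        rw [mul_pow, ← exp_nat_mul, mul_div_cancel₀ _ hT]
        exact this)
    rw [hKh]
    refine this.trans (le_of_eq ?_)
    rw [← Finset.mul_sum, mul_pow, ← exp_nat_mul, mul_div_cancel₀ _ hT, ← mul_assoc, ← exp_add]
    have e : ∑ k ∈ Finset.range (8 ^ h), blk (8 ^ (K * h)) s (I * 8 ^ h + k) =
        blk (8 ^ (h + K * h)) s I := by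
      rw [pow_add, ← blk_blk]; rfl
    rw [e]
    congr 2
    push_cast; ring

/-- Multi-scale decoupling with small loss. -/
theorem MD_all (N j d : ℕ) (hd : 1 ≤ d) (ε : ℝ) (hε : 0 < ε) :
    ∃ h : ℕ, 1 ≤ h ∧ ∃ κ β : ℝ, 0 < κ ∧ 0 < β ∧ ∀ (Λ : ℝ) (m₁ m₂ : ℕ) (P : Measure (Fin N → ℝ))
      (g : ℕ → (Fin N → ℝ) → ℂ) (s : ℕ → ℝ), MDat j d Λ κ β m₁ m₂ P g s → ∀ K I : ℕ,
      m₁ + K * h = m₂ → I < 8 ^ m₁ →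
      ∫ y, ‖blk (8 ^ (K * h)) g I y‖ ^ (2 * Tri d) ∂P ≤
        exp (ε * (K * h)) * (blk (8 ^ (K * h)) s I) ^ Tri d := by
  obtain ⟨C, hC⟩ := WD_all N d hd 10 (by norm_num) (ε / 2) (by positivity)
  obtain ⟨h, hh⟩ := exists_nat_ge (max 1 (2 * C / ε))
  have h1 : (1 : ℝ) ≤ h := (le_max_left _ _).trans hh
  have h2 : 2 * C / ε ≤ h := (le_max_right _ _).trans hh
  have hW : WDat N d 10 h (ε * h) := by
    refine (hC h).mono ?_
    rw [div_le_iff₀ hε] at h2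
    linarith
  set τ : ℝ := ((1 / 8 : ℝ) ^ h) ^ d with hτ
  have hτ0 : 0 < τ := by positivity
  refine ⟨h, by exact_mod_cast h1, τ / (2 ^ d * (j + 1)), τ / (2 ^ d * 2 ^ (j + d)),
    by positivity, by positivity, ?_⟩
  intro Λ m₁ m₂ P g s hD K I hK hI
  have := hD.iterate hd hW (by positivity) (by rw [← hτ]; apply le_of_eq; field_simp)
    (by positivity) (by
      rw [← hτ]
      have : (2 : ℝ) ^ d * (2 ^ (j + d) * (τ / (2 ^ d * 2 ^ (j + d)))) = τ := by field_simp
      rw [this]; linarith) K m₁ I le_rfl hK hI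
  refine this.trans (le_of_eq ?_)
  congr 2; ring

open scoped FourierTransform ContDiff in
/-- A positive integrable weight on the line whose spectrum is contained in a small interval. -/
lemma exists_band_limited_weight {β : ℝ} (hβ : 0 < β) :
    ∃ ρ : ℝ → ℝ, CB ρ ∧ Integrable ρ ∧ (∀ x, 0 ≤ ρ x) ∧ (∃ c : ℝ, 0 < c ∧ ∀ x, |x| ≤ 3 → c ≤ ρ x) ∧
      ∀ η : ℝ, β < |η| → ∫ x, Complex.exp ((η * x : ℝ) * Complex.I) * (ρ x : ℂ) = 0 := by
  have hpi := Real.pi_pos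
  set s : ℝ := min (β / (4 * π)) (1 / 36) with hs
  have hs0 : 0 < s := lt_min (by positivity) (by norm_num)
  let φ : ContDiffBump (0 : ℝ) := ⟨s / 2, s, by positivity, by linarith⟩
  have hsm : ContDiff ℝ ∞ (fun v : ℝ => ((φ v : ℝ) : ℂ)) :=
    Complex.ofRealCLM.contDiff.comp φ.contDiff
  have hcs : HasCompactSupport (fun v : ℝ => ((φ v : ℝ) : ℂ)) :=
    φ.hasCompactSupport.comp_left (g := fun x : ℝ => (x : ℂ)) (by simp)
  let f : SchwartzMap ℝ ℂ := hcs.toSchwartzMap hsm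
  have hf : ∀ v, f v = ((φ v : ℝ) : ℂ) := fun v => rfl
  have hsupp : ∀ v, s ≤ |v| → f v = 0 := by
    intro v hv
    rw [hf, φ.zero_of_le_dist (by simpa [Real.dist_eq] using hv)]
    simp
  have hLp := (𝓕 f).memLp 2 volume
  refine ⟨fun x => ‖𝓕 f x‖ ^ 2, ?_, ?_, fun x => by positivity, ?_, ?_⟩
  · refine (CB.norm ?_).pow 2
    refine ⟨(𝓕 f).continuous, ∫ v, ‖f v‖, fun x => ?_⟩
    rw [SchwartzMap.fourier_coe]
    exact VectorFourier.norm_fourierIntegral_le_integral_norm _ _ _ _ _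
  · simpa using hLp.integrable_norm_pow (by norm_num)
  · have hφi : Integrable (fun v : ℝ => φ v) :=
      φ.continuous.integrable_of_hasCompactSupport φ.hasCompactSupport
    have hpos : 0 < ∫ v, φ v := φ.integral_pos
    refine ⟨(1 / 2 * ∫ v, φ v) ^ 2, by positivity, fun x hx => ?_⟩
    have : 1 / 2 * ∫ v, φ v ≤ ‖𝓕 f x‖ := by
      refine le_trans ?_ (Complex.re_le_norm _)
      rw [SchwartzMap.fourier_coe, Real.fourier_real_eq_integral_exp_smul]
      have hint : Integrable (fun v : ℝ => Complex.exp (((-2 * π * v * x : ℝ) : ℂ) * Complex.I) • f v) := by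
        refine (f.integrable (μ := volume)).norm.mono ?_ ?_
        · refine Continuous.aestronglyMeasurable ?_
          have := f.continuous
          fun_prop
        · refine Filter.Eventually.of_forall fun v => ?_
          rw [norm_smul, Complex.norm_exp_ofReal_mul_I, one_mul, norm_norm]
      have := integral_re hint
      simp only [RCLike.re_to_complex] at this
      rw [← this, ← integral_const_mul]
      refine integral_mono (hφi.const_mul _) hint.re fun v => ?_
      simp only [hf, smul_eq_mul, RCLike.re_to_complex]
      rw [Complex.re_mul_ofReal, Complex.exp_ofReal_mul_I_re]
      by_cases hv : s ≤ |v|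
      · have := hsupp v hv
        rw [hf] at this
        have : φ v = 0 := by exact_mod_cast this
        simp [this]
      · refine mul_le_mul_of_nonneg_right ?_ φ.nonneg
        push Not at hv
        have h36 : |v| ≤ 1 / 36 := hv.le.trans (min_le_right _ _)
        rw [← Real.cos_abs, ← Real.cos_pi_div_three]
        refine Real.cos_le_cos_of_nonneg_of_le_pi (abs_nonneg _) (by linarith) ?_
        rw [abs_mul, abs_mul, abs_mul, abs_of_pos hpi]
        norm_num
        have : |v| * |x| ≤ 1 / 36 * 3 := by gcongr
        nlinarith
    exact pow_le_pow_left₀ (by positivity) this 2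
  · intro η hη
    set a : ℝ := η / (2 * π) with ha
    have ha2 : 2 * s < |a| := by
      rw [ha, abs_div, abs_of_pos (by positivity : 0 < 2 * π), lt_div_iff₀ (by positivity)]
      have : s ≤ β / (4 * π) := min_le_left _ _
      rw [le_div_iff₀ (by positivity)] at this
      linarith
    have hsm' : ContDiff ℝ ∞ ((fun v : ℝ => ((φ v : ℝ) : ℂ)) ∘ fun v => v + a) := by
      exact hsm.comp (by fun_prop)
    have hcs' : HasCompactSupport ((fun v : ℝ => ((φ v : ℝ) : ℂ)) ∘ fun v => v + a) :=
      hcs.comp_homeomorph (Homeomorph.addRight a)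
    let g : SchwartzMap ℝ ℂ := hcs'.toSchwartzMap hsm'
    have hg : ∀ v, g v = f (v + a) := fun v => rfl
    have hgf : ∀ x, 𝓕 g x = Complex.exp ((η * x : ℝ) * Complex.I) * 𝓕 f x := by
      intro x
      have := congrFun (Fourier.fourierIntegral_comp_add_right Real.fourierChar volume (f : ℝ → ℂ) a) x
      rw [SchwartzMap.fourier_coe, SchwartzMap.fourier_coe]
      change Fourier.fourierIntegral Real.fourierChar volume ((f : ℝ → ℂ) ∘ fun v => v + a) x = _ at this
      have e1 : 𝓕 (g : ℝ → ℂ) x = Fourier.fourierIntegral Real.fourierChar volume ((f : ℝ → ℂ) ∘ fun v => v + a) x := by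
        rw [Real.fourier_real_eq]; rfl
      have e2 : 𝓕 (f : ℝ → ℂ) x = Fourier.fourierIntegral Real.fourierChar volume (f : ℝ → ℂ) x := by
        rw [Real.fourier_real_eq]; rfl
      rw [e1, e2, this, Circle.smul_def, Real.fourierChar_apply, smul_eq_mul]
      congr 3
      rw [ha]
      push_cast
      field_simp
    have := SchwartzMap.integral_inner_fourier_fourier f g
    have hz : ∀ v, inner ℂ (f v) (g v) = 0 := by
      intro v
      by_cases hv : s ≤ |v|
      · rw [hsupp v hv, inner_zero_left]
      · rw [hg, hsupp (v + a), inner_zero_right]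
        push Not at hv
        have : |a| ≤ |v + a| + |v| := by
          have := abs_sub (v + a) v
          simpa using this
        linarith
    simp only [hz, integral_zero] at this
    rw [← this]
    refine integral_congr_ae (Filter.Eventually.of_forall fun x => ?_)
    simp only [hgf, RCLike.inner_apply]
    rw [mul_assoc, Complex.mul_conj, Complex.normSq_eq_norm_sq]

/-- A finite measure with small spectrum which dominates Lebesgue measure on a cube. -/
lemma exists_band_limited_measure (N : ℕ) {β : ℝ} (hβ : 0 < β) :
    ∃ P : Measure (Fin N → ℝ), IsFiniteMeasure P ∧ Spc P {η | ∀ i, |η i| ≤ β} ∧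
      ∃ c : ℝ, 0 < c ∧ ∀ G : (Fin N → ℝ) → ℝ, CB G → (∀ y, 0 ≤ G y) →
        c * ∫ y in Set.Icc (fun _ => -3) (fun _ => 3), G y ≤ ∫ y, G y ∂P := by
  obtain ⟨ρ, hρ, hρi, hρ0, ⟨c, hc0, hc⟩, hρη⟩ := exists_band_limited_weight hβ
  have hcb : CB (fun y : Fin N → ℝ => ∏ i, ρ (y i)) := by
    obtain ⟨h1, C, hC⟩ := hρ
    refine ⟨by fun_prop, C ^ N, fun y => ?_⟩
    rw [norm_prod]
    refine (Finset.prod_le_prod (fun _ _ => norm_nonneg _) fun i _ => hC (y i)).trans (by simp)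
  have h0 : ∀ y : Fin N → ℝ, 0 ≤ ∏ i, ρ (y i) := fun y => Finset.prod_nonneg fun i _ => hρ0 _
  have hint : Integrable (fun y : Fin N → ℝ => ∏ i, ρ (y i)) := by
    have := Integrable.fintype_prod (ι := Fin N) (μ := fun _ => (volume : Measure ℝ))
      (f := fun _ => ρ) (fun _ => hρi)
    exact this
  refine ⟨wP volume fun y => ∏ i, ρ (y i), isFiniteMeasure_withDensity_ofReal hint.2, ?_,
    c ^ N, by positivity, ?_⟩
  · intro η hη
    simp only [Set.mem_ofPred_eq, not_forall, not_le] at hη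
    obtain ⟨i, hi⟩ := hη
    rw [integral_wP _ hcb h0]
    have e : ∀ y : Fin N → ℝ, (∏ i, ρ (y i)) • chr η y =
        ∏ i, (Complex.exp ((η i * y i : ℝ) * Complex.I) * (ρ (y i) : ℂ)) := by
      intro y
      rw [Finset.prod_mul_distrib, ← Complex.exp_sum, Complex.real_smul, mul_comm]
      unfold chr dotProduct
      push_cast
      rw [Finset.sum_mul]
    simp only [e]
    rw [integral_fintype_prod_volume_eq_prod
      (fun i x => Complex.exp ((η i * x : ℝ) * Complex.I) * (ρ x : ℂ))]
    exact Finset.prod_eq_zero (Finset.mem_univ i) (hρη _ hi)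
  · intro G hG hG0
    rw [integral_wP _ hcb h0, ← integral_const_mul]
    have hi2 : Integrable (fun y : Fin N → ℝ => (∏ i, ρ (y i)) • G y) := by
      obtain ⟨h1, C, hC⟩ := hG
      exact hint.mul_bdd h1.aestronglyMeasurable (Filter.Eventually.of_forall hC)
    refine le_trans ?_ (setIntegral_le_integral (s := Set.Icc (fun _ => -3) (fun _ => 3)) hi2
      (Filter.Eventually.of_forall fun y => mul_nonneg (h0 y) (hG0 y)))
    refine setIntegral_mono_on ?_ hi2.integrableOn measurableSet_Icc ?_
    · exact (hG.1.integrableOn_Icc).const_mul _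
    · intro y hy
      refine mul_le_mul_of_nonneg_right ?_ (hG0 y)
      have : c ^ N = ∏ _i : Fin N, c := by simp
      rw [this]
      refine Finset.prod_le_prod (fun _ _ => hc0.le) fun i _ => hc _ ?_
      rw [abs_le]
      exact ⟨hy.1 i, hy.2 i⟩

/-- The functional giving the `i`-th coordinate after applying `u_r`. -/
def ηf {N : ℕ} (r : ℝ) (i : Fin N) : Fin N → ℝ := fun l =>
  if i.1 ≤ l.1 then r ^ (l.1 - i.1) / ((l.1 - i.1).factorial : ℝ) else 0

/-- The `i`-th coordinate of `u_r w`. -/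
def xc {N : ℕ} (r : ℝ) (i : Fin N) (w : Fin N → ℝ) : ℝ := ηf r i ⬝ᵥ w

lemma xc_sub {N : ℕ} (r : ℝ) (i : Fin N) (y w : Fin N → ℝ) : xc r i (y - w) = xc r i y - xc r i w :=
  dotProduct_sub _ _ _

lemma continuous_xc {N : ℕ} (r : ℝ) (i : Fin N) : Continuous (xc r i) := by
  unfold xc dotProduct; fun_prop

lemma xc_eq_coeff {N : ℕ} (r : ℝ) (i : Fin N) (w : Fin N → ℝ) :
    xc r i w = PowerSeries.coeff (N - 1 - i.1) (tl r (Sr (w ∘ Fin.rev))) := by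
  rw [coeff_tl]
  unfold xc dotProduct ηf
  have hi := i.2
  have e : ∀ q ∈ Finset.range (N - 1 - i.1 + 1),
      r ^ (N - 1 - i.1 - q) / ((N - 1 - i.1 - q).factorial : ℝ) *
        PowerSeries.coeff q (Sr (w ∘ Fin.rev)) =
      (fun q : ℕ => if h : q < N then (fun l : Fin N => (if i.1 ≤ (Fin.rev l).1 then
        r ^ ((Fin.rev l).1 - i.1) / (((Fin.rev l).1 - i.1).factorial : ℝ) else 0) * w (Fin.rev l)) ⟨q, h⟩
        else 0) q := by
    intro q hq
    have hq := Finset.mem_range.1 hq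
    have hqN : q < N := by omega
    simp only [coeff_Sr, hqN, dif_pos, Function.comp_apply, Fin.val_rev]
    rw [if_pos (by omega), show N - (q + 1) - i.1 = N - 1 - i.1 - q by omega]
  rw [Finset.sum_congr rfl e]
  have e2 : ∑ q ∈ Finset.range (N - 1 - i.1 + 1),
      (fun q : ℕ => if h : q < N then (fun l : Fin N => (if i.1 ≤ (Fin.rev l).1 then
        r ^ ((Fin.rev l).1 - i.1) / (((Fin.rev l).1 - i.1).factorial : ℝ) else 0) * w (Fin.rev l)) ⟨q, h⟩
        else 0) q = ∑ q ∈ Finset.range N,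
      (fun q : ℕ => if h : q < N then (fun l : Fin N => (if i.1 ≤ (Fin.rev l).1 then
        r ^ ((Fin.rev l).1 - i.1) / (((Fin.rev l).1 - i.1).factorial : ℝ) else 0) * w (Fin.rev l)) ⟨q, h⟩
        else 0) q := by
    refine Finset.sum_subset ?_ ?_
    · intro q hq; simp only [Finset.mem_range] at *; omega
    · intro q hq hq'
      simp only [Finset.mem_range] at hq hq'
      simp only [hq, dif_pos, Fin.val_rev]
      rw [if_neg (by omega), zero_mul]
  rw [e2, ← Fin.sum_univ_eq_sum_range]
  rw [← Equiv.sum_comp Fin.revPerm]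
  refine Finset.sum_congr rfl fun l _ => ?_
  simp

lemma xc_zero {N : ℕ} (i : Fin N) (w : Fin N → ℝ) : xc 0 i w = w i := by
  have hi := i.2
  rw [xc_eq_coeff, tl_zero, coeff_Sr, dif_pos (by omega)]
  simp only [Function.comp_apply]
  congr 1
  ext
  simp only [Fin.val_rev]
  omega

lemma xc_shift {N : ℕ} (r s : ℝ) (i : Fin N) (w : Fin N → ℝ) :
    xc (r + s) i w = ∑ k ∈ Finset.range (N - i.1),
      s ^ k / (k.factorial : ℝ) * (if h : i.1 + k < N then xc r ⟨i.1 + k, h⟩ w else 0) := by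
  have hi := i.2
  rw [xc_eq_coeff, add_comm r s, ← tl_tl, coeff_tl, ← Finset.sum_range_reflect]
  rw [show N - 1 - i.1 + 1 = N - i.1 by omega]
  refine Finset.sum_congr rfl fun k hk => ?_
  have hk := Finset.mem_range.1 hk
  rw [dif_pos (by omega), xc_eq_coeff]
  simp only
  rw [show N - 1 - i.1 - (N - i.1 - 1 - k) = k by omega,
    show N - i.1 - 1 - k = N - 1 - (i.1 + k) by omega]

/-- Coordinates at nearby parameters are comparable. -/
lemma abs_xc_shift_le {N : ℕ} {r s σ : ℝ} (hs : |s| ≤ σ) {i : Fin N} {w : Fin N → ℝ} {B : ℝ}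
    (h : ∀ i' : Fin N, i ≤ i' → |xc r i' w| * σ ^ (i'.1 - i.1) ≤ B) : |xc (r + s) i w| ≤ 3 * B := by
  have hσ : 0 ≤ σ := (abs_nonneg s).trans hs
  have hB : 0 ≤ B := le_trans (by positivity) (h i le_rfl)
  rw [xc_shift]
  refine (Finset.abs_sum_le_sum_abs _ _).trans ?_
  have : ∀ k ∈ Finset.range (N - i.1), |s ^ k / (k.factorial : ℝ) *
      (if h : i.1 + k < N then xc r ⟨i.1 + k, h⟩ w else 0)| ≤ 1 ^ k / (k.factorial : ℝ) * B := by
    intro k hk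
    have hk := Finset.mem_range.1 hk
    rw [dif_pos (by omega), abs_mul, abs_div, abs_pow, Nat.abs_cast, one_pow]
    have h1 := h ⟨i.1 + k, by omega⟩ (by rw [Fin.le_def]; simp)
    simp only [Nat.add_sub_cancel_left] at h1
    calc |s| ^ k / (k.factorial : ℝ) * |xc r ⟨i.1 + k, by omega⟩ w|
        ≤ σ ^ k / (k.factorial : ℝ) * |xc r ⟨i.1 + k, by omega⟩ w| := by gcongr
      _ = 1 / (k.factorial : ℝ) * (|xc r ⟨i.1 + k, by omega⟩ w| * σ ^ k) := by ring
      _ ≤ _ := by gcongr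
  refine (Finset.sum_le_sum this).trans ?_
  rw [← Finset.sum_mul]
  have h3 := Real.sum_le_exp_of_nonneg (x := 1) zero_le_one (N - i.1)
  have : exp 1 ≤ 3 := by have := Real.exp_one_lt_d9; linarith
  exact mul_le_mul_of_nonneg_right (h3.trans this) hB

lemma abs_xc_le {N : ℕ} {r B : ℝ} (hr : |r| ≤ 1) {w : Fin N → ℝ} (hw : ∀ i, |w i| ≤ B) (i : Fin N) :
    |xc r i w| ≤ 3 * B := by
  have := abs_xc_shift_le (r := 0) (σ := 1) hr (i := i) (w := w) (B := B) fun i' _ => by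
    rw [xc_zero, one_pow, mul_one]; exact hw i'
  rwa [zero_add] at this

lemma abs_le_of_xc {N : ℕ} {r B : ℝ} (hr : |r| ≤ 1) {w : Fin N → ℝ} (hw : ∀ i, |xc r i w| ≤ B)
    (i : Fin N) : |w i| ≤ 3 * B := by
  have := abs_xc_shift_le (r := r) (s := -r) (σ := 1) (by rwa [abs_neg]) (i := i) (w := w) (B := B)
    fun i' _ => by rw [one_pow, mul_one]; exact hw i'
  rwa [add_neg_cancel, xc_zero] at this

lemma coeff_tl_Sr_ηf {N : ℕ} (r : ℝ) (i : Fin N) {k : ℕ} (hk : k < N) :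
    PowerSeries.coeff k (tl (-r) (Sr (ηf r i))) = if k = i.1 then 1 else 0 := by
  have h1 : ∀ l < N, PowerSeries.coeff l (Sr (ηf r i)) =
      PowerSeries.coeff l (tl r (PowerSeries.X ^ i.1)) := by
    intro l hl
    rw [coeff_Sr, dif_pos hl, coeff_tl]
    simp only [PowerSeries.coeff_X_pow, mul_ite, mul_one, mul_zero, Finset.sum_ite_eq',
      Finset.mem_range, ηf, Nat.lt_succ_iff]
  have h2 : PowerSeries.coeff k (tl (-r) (Sr (ηf r i))) =
      PowerSeries.coeff k (tl (-r) (tl r (PowerSeries.X ^ i.1))) := by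
    rw [coeff_tl, coeff_tl]
    refine Finset.sum_congr rfl fun q hq => ?_
    rw [h1 q (by have := Finset.mem_range.1 hq; omega)]
  rw [h2, tl_tl, neg_add_cancel, tl_zero, PowerSeries.coeff_X_pow]

lemma coeff_tl_Sr_sum {N : ℕ} (r : ℝ) (c : Fin N → ℝ) {k : ℕ} (hk : k < N) :
    PowerSeries.coeff k (tl (-r) (Sr (∑ i, c i • ηf r i))) = c ⟨k, hk⟩ := by
  simp only [map_sum, map_smul, coeff_tl_Sr_ηf r _ hk, smul_eq_mul, mul_ite, mul_one, mul_zero]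
  rw [Finset.sum_eq_single ⟨k, hk⟩]
  · simp
  · intro b _ hb
    rw [if_neg]
    rintro rfl
    exact hb rfl
  · simp

/-- The parameters of a frequency are controlled by its size. -/
lemma abs_coord_le_of_sum {N : ℕ} {r β : ℝ} (hr : |r| ≤ 1) (hβ : 0 ≤ β) (c : Fin N → ℝ)
    (h : ∀ l, |(∑ i, c i • ηf r i) l| ≤ β) (i : Fin N) : |c i| ≤ 2 ^ N * β := by
  have h1 := coeff_tl_Sr_sum r c i.2
  rw [← show c ⟨i.1, i.2⟩ = c i from rfl, ← h1]
  refine (abs_coeff_tl_le_const (β := β) (fun q _ => ?_) (by rwa [abs_neg])).trans ?_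
  · rw [coeff_Sr]
    split_ifs with hq
    · exact h _
    · simpa using hβ
  · gcongr
    · norm_num
    · exact i.2.le

/-- Normalized Fejér kernel. -/
def fj (N : ℕ) (θ : ℝ) : ℝ :=
  ‖∑ k ∈ Finset.range N, Complex.exp ((k * θ : ℝ) * Complex.I)‖ ^ 2 / (N : ℝ) ^ 2

lemma fj_nonneg (N : ℕ) (θ : ℝ) : 0 ≤ fj N θ := by unfold fj; positivity

lemma fj_le_one {N : ℕ} (θ : ℝ) : fj N θ ≤ 1 := by
  unfold fj
  refine div_le_one_of_le₀ (pow_le_pow_left₀ (norm_nonneg _) ?_ 2) (by positivity)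
  refine (norm_sum_le _ _).trans ?_
  simp only [Complex.norm_exp_ofReal_mul_I]
  simp

lemma continuous_fj (N : ℕ) : Continuous (fj N) := by unfold fj; fun_prop

lemma fj_periodic (N : ℕ) (θ : ℝ) (m : ℤ) : fj N (θ + m * (2 * π)) = fj N θ := by
  unfold fj
  congr 4
  funext k
  rw [show ((k * (θ + m * (2 * π)) : ℝ) : ℂ) * Complex.I =
    ((k * θ : ℝ) : ℂ) * Complex.I + ((k * m : ℤ) : ℂ) * (2 * π * Complex.I) by push_cast; ring,
    Complex.exp_add, Complex.exp_int_mul_two_pi_mul_I, mul_one]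

lemma abs_le_sin_of_abs_le {x : ℝ} (h0 : 0 ≤ x) (h1 : x ≤ 3 * π / 4) : 2 / (3 * π) * x ≤ sin x := by
  have hpi := Real.pi_pos
  rcases le_total x (π / 2) with h | h
  · refine le_trans ?_ (Real.mul_le_sin h0 h)
    refine mul_le_mul_of_nonneg_right ?_ h0
    gcongr
    linarith
  · rw [← Real.sin_pi_sub]
    refine le_trans ?_ (Real.mul_le_sin (by linarith) (by linarith))
    rw [div_mul_eq_mul_div, div_mul_eq_mul_div, div_le_div_iff₀ (by positivity) hpi]
    nlinarith

lemma fj_le_sq {N : ℕ} (hN : 1 ≤ N) {θ : ℝ} (h0 : θ ≠ 0) (h : |θ| ≤ 3 * π / 2) :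
    fj N θ ≤ (10 / (N * θ)) ^ 2 := by
  have hpi := Real.pi_pos
  unfold fj
  rw [div_pow, mul_pow, ← div_div, div_right_comm]
  refine div_le_div_of_nonneg_right ?_ (by positivity)
  rw [← div_pow, ← sq_abs (10 / θ)]
  refine pow_le_pow_left₀ (norm_nonneg _) ?_ 2
  set z := Complex.exp (θ * Complex.I) with hz
  have e : ∀ k ∈ Finset.range N, Complex.exp ((k * θ : ℝ) * Complex.I) = z ^ k := by
    intro k _
    rw [hz, ← Complex.exp_nat_mul]; push_cast; ring_nf
  rw [Finset.sum_congr rfl e]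
  have hg := geom_sum_mul z N
  have hz1 : ‖z ^ N - 1‖ ≤ 2 := by
    refine (norm_sub_le _ _).trans ?_
    rw [norm_pow, hz, Complex.norm_exp_ofReal_mul_I]; norm_num
  have hzl : 2 / (3 * π) * |θ| ≤ ‖z - 1‖ := by
    have : z - 1 = Complex.exp ((θ : ℂ) * Complex.I) - 1 := rfl
    have h2 := Complex.norm_exp_I_mul_ofReal_sub_one (x := θ)
    rw [mul_comm] at h2
    rw [this, h2, norm_mul, Real.norm_eq_abs, Real.norm_eq_abs, abs_of_pos (by norm_num : (0:ℝ) < 2)]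
    have h3 := abs_le_sin_of_abs_le (x := |θ| / 2) (by positivity) (by linarith)
    have h4 : sin (|θ| / 2) ≤ |sin (θ / 2)| := by
      rcases abs_cases θ with ⟨h, _⟩ | ⟨h, _⟩
      · rw [h]; exact le_abs_self _
      · rw [h, neg_div, Real.sin_neg]; exact neg_le_abs _
    linarith
  have hθ : 0 < |θ| := abs_pos.2 h0
  have hpos : 0 < 2 / (3 * π) * |θ| := by positivity
  have h5 : ‖∑ k ∈ Finset.range N, z ^ k‖ * (2 / (3 * π) * |θ|) ≤ 2 := by
    refine le_trans ?_ hz1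
    rw [← hg, norm_mul]
    gcongr
  rw [abs_div, abs_of_pos (by norm_num : (0 : ℝ) < 10), le_div_iff₀ hθ]
  have h6 : ‖∑ k ∈ Finset.range N, z ^ k‖ * |θ| ≤ 3 * π := by
    have : ‖∑ k ∈ Finset.range N, z ^ k‖ * |θ| =
        ‖∑ k ∈ Finset.range N, z ^ k‖ * (2 / (3 * π) * |θ|) * (3 * π / 2) := by field_simp
    rw [this]
    nlinarith
  have := Real.pi_lt_d2
  linarith

lemma le_fj {N : ℕ} (hN : 1 ≤ N) {θ : ℝ} (h : N * |θ| ≤ 1) : 1 / 4 ≤ fj N θ := by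
  unfold fj
  have hN' : (0 : ℝ) < N := by exact_mod_cast hN
  rw [le_div_iff₀ (by positivity), show (1 : ℝ) / 4 * (N : ℝ) ^ 2 = (N / 2) ^ 2 by ring]
  refine pow_le_pow_left₀ (by positivity) ?_ 2
  refine le_trans ?_ (Complex.re_le_norm _)
  rw [Complex.re_sum]
  simp only [Complex.exp_ofReal_mul_I_re]
  have : ∀ k ∈ Finset.range N, (1 / 2 : ℝ) ≤ cos (k * θ) := by
    intro k hk
    have hk := Finset.mem_range.1 hk
    rw [← Real.cos_abs, ← Real.cos_pi_div_three]
    have hpi := Real.pi_gt_three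
    refine Real.cos_le_cos_of_nonneg_of_le_pi (abs_nonneg _) (by linarith) ?_
    rw [abs_mul, Nat.abs_cast]
    have : (k : ℝ) * |θ| ≤ N * |θ| := by gcongr
    linarith
  have := Finset.card_nsmul_le_sum _ _ _ this
  simp at this
  linarith

lemma norm_sum_exp_sq (N : ℕ) (θ : ℝ) :
    ((‖∑ k ∈ Finset.range N, Complex.exp ((k * θ : ℝ) * Complex.I)‖ ^ 2 : ℝ) : ℂ) =
      ∑ p ∈ Finset.range N ×ˢ Finset.range N,
        Complex.exp ((((p.1 : ℝ) - p.2) * θ : ℝ) * Complex.I) := by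
  rw [← Complex.normSq_eq_norm_sq, ← Complex.mul_conj, map_sum, Finset.sum_mul_sum,
    Finset.sum_product]
  refine Finset.sum_congr rfl fun k _ => Finset.sum_congr rfl fun l _ => ?_
  rw [← Complex.exp_conj, ← Complex.exp_add]
  congr 1
  simp
  ring

lemma fj_eq_sum (N : ℕ) (θ : ℝ) : (fj N θ : ℂ) = ∑ p ∈ Finset.range N ×ˢ Finset.range N,
    ((1 / (N : ℝ) ^ 2 : ℝ) : ℂ) * Complex.exp ((((p.1 : ℝ) - p.2) * θ : ℝ) * Complex.I) := by
  rw [← Finset.mul_sum, ← norm_sum_exp_sq, ← Complex.ofReal_mul]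
  unfold fj
  congr 1; ring

lemma fj_mul (M T : ℕ) (θ : ℝ) : (fj (M * T) θ : ℂ) = ∑ p ∈ Finset.range T ×ˢ Finset.range T,
    ((1 / (T : ℝ) ^ 2 : ℝ) : ℂ) * (Complex.exp ((((p.1 : ℝ) - p.2) * (M * θ) : ℝ) * Complex.I) *
      fj M θ) := by
  have h : fj (M * T) θ = fj T (M * θ) * fj M θ := by
    unfold fj
    rw [mul_comm M T, sum_range_mul']
    have e : ∀ I ∈ Finset.range T,
        blk M (fun k : ℕ => Complex.exp ((k * θ : ℝ) * Complex.I)) I =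
        Complex.exp ((I * (M * θ) : ℝ) * Complex.I) *
          ∑ j ∈ Finset.range M, Complex.exp ((j * θ : ℝ) * Complex.I) := by
      intro I _
      unfold blk
      rw [Finset.mul_sum]
      refine Finset.sum_congr rfl fun j _ => ?_
      rw [← Complex.exp_add]
      push_cast
      ring_nf
    rw [Finset.sum_congr rfl e, ← Finset.sum_mul, norm_mul]
    push_cast
    ring
  rw [h, Complex.ofReal_mul, fj_eq_sum T, Finset.sum_mul]
  refine Finset.sum_congr rfl fun p _ => ?_
  ring

/-- Product of normalized Fejér kernels in the coordinates at parameter `r`. -/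
def fp {N : ℕ} (n : Fin N → ℕ) (γ r : ℝ) (z : Fin N → ℝ) : ℝ := ∏ i, fj (n i) (γ * xc r i z)

lemma fp_nonneg {N : ℕ} (n : Fin N → ℕ) (γ r : ℝ) (z : Fin N → ℝ) : 0 ≤ fp n γ r z :=
  Finset.prod_nonneg fun _ _ => fj_nonneg _ _

lemma fp_le_one {N : ℕ} (n : Fin N → ℕ) (γ r : ℝ) (z : Fin N → ℝ) : fp n γ r z ≤ 1 :=
  Finset.prod_le_one (fun _ _ => fj_nonneg _ _) fun _ _ => fj_le_one _

lemma continuous_fp {N : ℕ} (n : Fin N → ℕ) (γ r : ℝ) : Continuous (fp n γ r) :=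
  continuous_finsetProd _ fun i _ =>
    (continuous_fj (n i)).comp (continuous_const.mul (continuous_xc r i))

lemma sum_smul_dotProduct_ηf {N : ℕ} (r : ℝ) (c z : Fin N → ℝ) :
    (∑ i, c i • ηf r i) ⬝ᵥ z = ∑ i, c i * xc r i z := by
  rw [sum_dotProduct]
  refine Finset.sum_congr rfl fun i _ => ?_
  rw [smul_dotProduct]; rfl

lemma fp_eq {N : ℕ} (n : Fin N → ℕ) (γ r : ℝ) (z : Fin N → ℝ) :
    (fp n γ r z : ℂ) = ∑ p ∈ Fintype.piFinset fun i => Finset.range (n i) ×ˢ Finset.range (n i),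
      ((∏ i, 1 / (n i : ℝ) ^ 2 : ℝ) : ℂ) *
        chr (∑ i, ((((p i).1 : ℝ) - (p i).2) * γ) • ηf r i) z := by
  unfold fp
  rw [Complex.ofReal_prod]
  simp only [fj_eq_sum]
  rw [Finset.prod_univ_sum]
  refine Finset.sum_congr rfl fun p _ => ?_
  rw [Finset.prod_mul_distrib, ← Complex.exp_sum, Complex.ofReal_prod]
  unfold chr
  rw [sum_smul_dotProduct_ηf]
  congr 2
  rw [Complex.ofReal_sum, Finset.sum_mul]
  refine Finset.sum_congr rfl fun i _ => ?_
  rw [mul_assoc]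

lemma chr_sub {N : ℕ} (η y w : Fin N → ℝ) : chr η (y - w) = chr η y * chr η (-w) := by
  unfold chr
  rw [← Complex.exp_add, sub_eq_add_neg, dotProduct_add]
  push_cast
  ring_nf

lemma const_mul_mem_TP {N : ℕ} {S : Set (Fin N → ℝ)} {f : (Fin N → ℝ) → ℂ} (c : ℂ) (hf : f ∈ TP S) :
    (fun y => c * f y) ∈ TP S := (TP S).smul_mem c hf

lemma sum_mem_TP {N : ℕ} {ι : Type*} {S : Set (Fin N → ℝ)} (s : Finset ι)
    {f : ι → (Fin N → ℝ) → ℂ} (hf : ∀ i ∈ s, f i ∈ TP S) :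
    (fun y => ∑ i ∈ s, f i y) ∈ TP S := by
  have := (TP S).sum_mem hf
  convert this using 1
  ext y; simp

lemma fp_shift_mem_TP {N : ℕ} (n : Fin N → ℕ) {γ : ℝ} (hγ : 0 ≤ γ) (r : ℝ) (η w : Fin N → ℝ) :
    (fun y => chr η (y - w) * (fp n γ r (y - w) : ℂ)) ∈
      TP {θ | ∃ c : Fin N → ℝ, (∀ i, |c i| ≤ n i * γ) ∧ θ = η + ∑ i, c i • ηf r i} := by
  simp only [fp_eq, Finset.mul_sum]
  refine sum_mem_TP _ fun p hp => ?_
  set η' := ∑ i, ((((p i).1 : ℝ) - (p i).2) * γ) • ηf r i with hη'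
  have e : ∀ y : Fin N → ℝ, chr η (y - w) *
      (((∏ i, 1 / (n i : ℝ) ^ 2 : ℝ) : ℂ) * chr η' (y - w)) =
      (((∏ i, 1 / (n i : ℝ) ^ 2 : ℝ) : ℂ) * chr (η + η') (-w)) * chr (η + η') y := by
    intro y
    rw [mul_assoc, mul_comm (chr (η + η') (-w)), ← chr_sub, chr_add]
    ring
  simp only [e]
  refine const_mul_mem_TP _ (chr_mem_TP ⟨fun i => (((p i).1 : ℝ) - (p i).2) * γ, fun i => ?_, rfl⟩)
  rw [abs_mul, abs_of_nonneg hγ]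
  refine mul_le_mul_of_nonneg_right ?_ hγ
  have hp := Finset.mem_product.1 (Fintype.mem_piFinset.1 hp i)
  have h1 : ((p i).1 : ℝ) ≤ n i := by exact_mod_cast (Finset.mem_range.1 hp.1).le
  have h2 : ((p i).2 : ℝ) ≤ n i := by exact_mod_cast (Finset.mem_range.1 hp.2).le
  rw [abs_le]
  have h3 : (0 : ℝ) ≤ (p i).1 := by positivity
  have h4 : (0 : ℝ) ≤ (p i).2 := by positivity
  constructor <;> linarith

lemma integral_fp_le {N : ℕ} {P : Measure (Fin N → ℝ)} [IsFiniteMeasure P] {β : ℝ} (hβ : 0 ≤ β)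
    (hP : Spc P {η | ∀ i, |η i| ≤ β}) {n : Fin N → ℕ} (hn : ∀ i, 1 ≤ n i) {γ r : ℝ}
    (hγ : 2 ^ N * β < γ) (hr : |r| ≤ 1) (w : Fin N → ℝ) :
    ∫ y, fp n γ r (y - w) ∂P ≤ P.real Set.univ / ∏ i, (n i : ℝ) := by
  have hint : ∀ η : Fin N → ℝ, Integrable (fun y => chr η (y - w)) P := by
    intro η
    simp only [chr_sub]
    exact (chr_cb η).integrable.mul_const _
  have h1 : ((∫ y, fp n γ r (y - w) ∂P : ℝ) : ℂ) =
      ∑ p ∈ Fintype.piFinset fun i => Finset.range (n i) ×ˢ Finset.range (n i),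
      ((∏ i, 1 / (n i : ℝ) ^ 2 : ℝ) : ℂ) *
        ∫ y, chr (∑ i, ((((p i).1 : ℝ) - (p i).2) * γ) • ηf r i) (y - w) ∂P := by
    rw [← integral_complex_ofReal]
    simp only [fp_eq]
    rw [integral_finsetSum _ fun p _ => (hint _).const_mul _]
    refine Finset.sum_congr rfl fun p _ => ?_
    rw [integral_const_mul]
  have h2 : ∀ p ∈ Fintype.piFinset fun i => Finset.range (n i) ×ˢ Finset.range (n i),
      ‖∫ y, chr (∑ i, ((((p i).1 : ℝ) - (p i).2) * γ) • ηf r i) (y - w) ∂P‖ ≤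
        P.real Set.univ * ∏ i, if (p i).1 = (p i).2 then 1 else 0 := by
    intro p hp
    by_cases hd : ∀ i, (p i).1 = (p i).2
    · rw [Finset.prod_congr rfl fun i _ => if_pos (hd i), Finset.prod_const_one, mul_one]
      refine (norm_integral_le_of_norm_le_const (C := 1) (ae_of_all _ fun y => ?_)).trans ?_
      · exact (norm_chr _ _).le
      · rw [one_mul]
    · push Not at hd
      obtain ⟨i, hi⟩ := hd
      have hz : ∫ y, chr (∑ i, ((((p i).1 : ℝ) - (p i).2) * γ) • ηf r i) (y - w) ∂P = 0 := by
        simp only [chr_sub]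
        rw [integral_mul_const, hP _ fun hmem => ?_, zero_mul]
        have h3 := abs_coord_le_of_sum hr hβ _ hmem i
        have hγ0 : 0 < γ := lt_of_le_of_lt (by positivity) hγ
        rw [abs_mul, abs_of_pos hγ0] at h3
        have h4 : (1 : ℝ) ≤ |((p i).1 : ℝ) - (p i).2| := by
          have : (1 : ℤ) ≤ |((p i).1 : ℤ) - (p i).2| :=
            Int.one_le_abs (by omega)
          exact_mod_cast this
        nlinarith
      rw [hz, norm_zero]
      exact mul_nonneg measureReal_nonneg (Finset.prod_nonneg fun i _ => by split_ifs <;> norm_num)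
  have h0 : 0 ≤ ∫ y, fp n γ r (y - w) ∂P := integral_nonneg fun y => fp_nonneg _ _ _ _
  have h3 : ∫ y, fp n γ r (y - w) ∂P = ‖((∫ y, fp n γ r (y - w) ∂P : ℝ) : ℂ)‖ := by
    rw [Complex.norm_real, Real.norm_of_nonneg h0]
  rw [h3, h1]
  refine (norm_sum_le _ _).trans ?_
  calc _ ≤ ∑ p ∈ Fintype.piFinset fun i => Finset.range (n i) ×ˢ Finset.range (n i),
        P.real Set.univ * ∏ i, (1 / (n i : ℝ) ^ 2 * if (p i).1 = (p i).2 then 1 else 0) := by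
        refine Finset.sum_le_sum fun p hp => ?_
        rw [norm_mul, Complex.norm_real, Real.norm_of_nonneg (by positivity),
          Finset.prod_mul_distrib, mul_left_comm]
        exact mul_le_mul_of_nonneg_left (h2 p hp) (by positivity)
    _ = P.real Set.univ * ∏ i, ∑ q ∈ Finset.range (n i) ×ˢ Finset.range (n i),
          (1 / (n i : ℝ) ^ 2 * if q.1 = q.2 then 1 else 0) := by
        rw [← Finset.mul_sum, Finset.prod_univ_sum]
    _ = P.real Set.univ * ∏ i, (1 / (n i : ℝ)) := by
        congr 1
        refine Finset.prod_congr rfl fun i _ => ?_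
        have : (n i : ℝ) ≠ 0 := by have := hn i; positivity
        rw [← Finset.mul_sum, Finset.sum_product]
        have e : ∀ x ∈ Finset.range (n i), (∑ y ∈ Finset.range (n i),
            if x = y then (1 : ℝ) else 0) = 1 := by
          intro x hx
          rw [Finset.sum_ite_eq, if_pos hx]
        rw [Finset.sum_congr rfl e]
        simp
        field_simp
    _ = _ := by rw [Finset.prod_div_distrib, Finset.prod_const_one, mul_one_div]

lemma exists_abs_le_pi (θ : ℝ) : ∃ m : ℤ, |θ + m * (2 * π)| ≤ π := by
  have hpi := Real.pi_pos
  refine ⟨-round (θ / (2 * π)), ?_⟩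
  have h := abs_sub_round (θ / (2 * π))
  have : θ + ((-round (θ / (2 * π)) : ℤ) : ℝ) * (2 * π) = (θ / (2 * π) - round (θ / (2 * π))) * (2 * π) := by
    push_cast; field_simp; ring
  rw [this, abs_mul, abs_of_pos (by positivity : 0 < 2 * π)]
  nlinarith

lemma summable_int_inv_sq : Summable fun c : ℤ => 1 / (1 + (c : ℝ) ^ 2) := by
  have h := (Real.summable_one_div_int_pow (p := 2)).2 (by norm_num)
  refine Summable.of_norm_bounded_eventually h ?_
  rw [Filter.eventually_cofinite]
  refine (Set.finite_singleton (0 : ℤ)).subset fun c hc => ?_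
  by_contra h0
  apply hc
  rw [Real.norm_of_nonneg (by positivity)]
  have : (0 : ℝ) < (c : ℝ) ^ 2 := by have : (c : ℝ) ≠ 0 := by exact_mod_cast h0
                                     positivity
  gcongr
  linarith

lemma fj_le_cell {n : ℕ} (hn : 1 ≤ n) {u : ℝ} (hu : |u| ≤ 3 * π / 2) :
    fj n u ≤ 10 ^ 6 * (1 / (1 + (⌊20 * (n * u)⌋ : ℝ) ^ 2)) := by
  set c := ⌊20 * (n * u)⌋ with hc
  have h1 : (c : ℝ) ≤ 20 * (n * u) := Int.floor_le _
  have h2 : 20 * (n * u) < c + 1 := Int.lt_floor_add_one _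
  rw [mul_one_div, le_div_iff₀ (by positivity)]
  by_cases hc2 : (c : ℝ) ^ 2 ≤ 2
  · have := fj_le_one (N := n) u
    nlinarith [fj_nonneg n u]
  · have h3 : 2 ≤ c ∨ c ≤ -2 := by
      by_contra hcon
      push Not at hcon
      apply hc2
      have : c = -1 ∨ c = 0 ∨ c = 1 := by omega
      rcases this with h | h | h <;> rw [h] <;> norm_num
    have h4 : (c : ℝ) ^ 2 / 4 ≤ (20 * (n * u)) ^ 2 := by
      rcases h3 with h | h
      · have : (2 : ℝ) ≤ c := by exact_mod_cast h
        nlinarith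
      · have : (c : ℝ) ≤ -2 := by exact_mod_cast h
        nlinarith
    have h5 : u ≠ 0 := by
      rintro rfl
      simp at h4
      nlinarith
    have h6 := fj_le_sq hn h5 hu
    have hn' : (0 : ℝ) < n := by exact_mod_cast hn
    have h7 : (10 / (n * u)) ^ 2 * (n * u) ^ 2 = 100 := by
      field_simp; norm_num
    have h8 : 0 < (n * u) ^ 2 := by positivity
    have h9 : fj n u * (n * u) ^ 2 ≤ 100 := by rw [← h7]; gcongr
    nlinarith [fj_nonneg n u]

/-- A sum of Fejér kernels is controlled by the largest mass of a cell. -/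
lemma exists_cell_const (N : ℕ) : ∃ C0 : ℝ, 1 ≤ C0 ∧ ∀ (r : ℝ) (n : Fin N → ℕ)
    (G : Finset (Fin N → ℝ)) (a : (Fin N → ℝ) → ℝ) (M0 : ℝ), |r| ≤ 1 → (∀ i, 1 ≤ n i) →
    (∀ w ∈ G, 0 ≤ a w) → (∀ w ∈ G, ∀ i, |w i| ≤ 1) → 0 ≤ M0 →
    (∀ w0 ∈ G, ∑ w ∈ G with ∀ i, n i * |xc r i (w - w0)| ≤ 1, a w ≤ M0) →
    ∀ y, ∑ w ∈ G, a w * fp n (1 / 20) r (y - w) ≤ C0 * M0 := by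
  set φ : ℤ → ℝ := fun c => 10 ^ 6 * (1 / (1 + (c : ℝ) ^ 2)) with hφ
  have hφs : Summable φ := summable_int_inv_sq.mul_left _
  have hφ0 : ∀ c, 0 ≤ φ c := fun c => by simp only [hφ]; positivity
  set S := ∑' c, φ c with hS
  have hS1 : 1 ≤ S := by
    refine le_trans ?_ (hφs.le_tsum 0 fun c _ => hφ0 c)
    simp only [hφ]; norm_num
  refine ⟨S ^ N, one_le_pow₀ hS1, fun r n G a M0 hr hn ha hG hM0 hcell y => ?_⟩
  choose m hm using fun i : Fin N => exists_abs_le_pi (1 / 20 * xc r i y)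
  set u : Fin N → (Fin N → ℝ) → ℝ := fun i w =>
    1 / 20 * xc r i y + m i * (2 * π) - 1 / 20 * xc r i w with hu
  set κ : (Fin N → ℝ) → Fin N → ℤ := fun w i => ⌊20 * (n i * u i w)⌋ with hκ
  have hpi := Real.pi_gt_three
  have h1 : ∀ w ∈ G, fp n (1 / 20) r (y - w) ≤ ∏ i, φ (κ w i) := by
    intro w hw
    refine Finset.prod_le_prod (fun i _ => fj_nonneg _ _) fun i _ => ?_
    have e : fj (n i) (1 / 20 * xc r i (y - w)) = fj (n i) (u i w) := by
      rw [← fj_periodic (n i) _ (m i), xc_sub]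
      congr 1
      simp only [hu]; ring
    rw [e]
    refine fj_le_cell (hn i) ?_
    have h2 := abs_xc_le hr (hG w hw) i
    have h3 := hm i
    simp only [hu]
    refine (abs_sub _ _).trans ?_
    rw [abs_mul (1 / 20) (xc r i w), abs_of_pos (by norm_num : (0 : ℝ) < 1 / 20)]
    linarith
  calc ∑ w ∈ G, a w * fp n (1 / 20) r (y - w) ≤ ∑ w ∈ G, a w * ∏ i, φ (κ w i) :=
        Finset.sum_le_sum fun w hw => mul_le_mul_of_nonneg_left (h1 w hw) (ha w hw)
    _ = ∑ c ∈ G.image κ, ∑ w ∈ G with κ w = c, a w * ∏ i, φ (κ w i) :=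
        (Finset.sum_fiberwise_of_maps_to (fun w hw => Finset.mem_image_of_mem κ hw) _).symm
    _ ≤ ∑ c ∈ G.image κ, M0 * ∏ i, φ (c i) := by
        refine Finset.sum_le_sum fun c hc => ?_
        obtain ⟨w0, hw0, rfl⟩ := Finset.mem_image.1 hc
        have : ∀ w ∈ G.filter (fun w => κ w = κ w0), a w * ∏ i, φ (κ w i) = a w * ∏ i, φ (κ w0 i) := by
          intro w hw
          rw [(Finset.mem_filter.1 hw).2]
        rw [Finset.sum_congr rfl this, ← Finset.sum_mul]
        refine mul_le_mul_of_nonneg_right ?_ (Finset.prod_nonneg fun i _ => hφ0 _)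
        refine (Finset.sum_le_sum_of_subset_of_nonneg ?_ ?_).trans (hcell w0 hw0)
        · intro w hw
          obtain ⟨hw, hk⟩ := Finset.mem_filter.1 hw
          refine Finset.mem_filter.2 ⟨hw, fun i => ?_⟩
          have h5 := Int.abs_sub_lt_one_of_floor_eq_floor (congrFun hk i)
          simp only [hu] at h5
          refine le_trans (le_of_eq ?_) h5.le
          rw [abs_sub_comm, ← Nat.abs_cast (n i), ← abs_mul, xc_sub, Nat.abs_cast]
          congr 1; ring
        · intro w hw _
          exact ha w (Finset.mem_filter.1 hw).1
    _ ≤ ∑ c ∈ Fintype.piFinset fun i => (G.image κ).image (fun c => c i), M0 * ∏ i, φ (c i) := by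
        refine Finset.sum_le_sum_of_subset_of_nonneg ?_ fun c _ _ =>
          mul_nonneg hM0 (Finset.prod_nonneg fun i _ => hφ0 _)
        intro c hc
        exact Fintype.mem_piFinset.2 fun i => Finset.mem_image_of_mem _ hc
    _ = M0 * ∏ i, ∑ x ∈ (G.image κ).image (fun c => c i), φ x := by
        rw [← Finset.mul_sum, Finset.prod_univ_sum]
    _ ≤ M0 * ∏ i : Fin N, S := by
        refine mul_le_mul_of_nonneg_left ?_ hM0
        exact Finset.prod_le_prod (fun i _ => Finset.sum_nonneg fun x _ => hφ0 x) fun i _ =>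
          hφs.sum_le_tsum _ fun x _ => hφ0 x
    _ = S ^ N * M0 := by simp [mul_comm]

lemma volume_box {N : ℕ} (r : ℝ) (ω : Fin N → ℝ) (hω : ∀ i, 0 ≤ ω i) :
    volume.real {y : Fin N → ℝ | ∀ i, |xc r i y| ≤ ω i} = ∏ i, (2 * ω i) := by
  set A : Matrix (Fin N) (Fin N) ℝ := Matrix.of fun i l => ηf r i l with hA
  have hdet : A.det = 1 := by
    rw [Matrix.det_of_upperTriangular]
    · simp [hA, ηf]
    · intro i l hil
      have : ¬ i.1 ≤ l.1 := by
        have : l < i := hil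
        rw [Fin.lt_def] at this; omega
      simp only [hA, ηf, Matrix.of_apply, if_neg this]
  have e : {y : Fin N → ℝ | ∀ i, |xc r i y| ≤ ω i} =
      (Matrix.toLin' A) ⁻¹' (Set.Icc (fun i => -ω i) ω) := by
    ext y
    simp only [Set.mem_ofPred_eq, Set.mem_preimage, Set.mem_Icc, Pi.le_def, Matrix.toLin'_apply, abs_le,
      forall_and]
    rfl
  have hd : LinearMap.det (Matrix.toLin' A) = 1 := by rw [LinearMap.det_toLin', hdet]
  rw [e, Measure.real, Measure.addHaar_preimage_linearMap _ (by rw [hd]; norm_num), hd, Real.volume_Icc_pi]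
  simp only [inv_one, abs_one, ENNReal.ofReal_one, one_mul]
  rw [ENNReal.toReal_prod]
  refine Finset.prod_congr rfl fun i _ => ?_
  rw [ENNReal.toReal_ofReal (by have := hω i; linarith)]
  ring

lemma le_add_pow_div {u lam : ℝ} (hu : 0 ≤ u) (hl : 0 < lam) {p : ℕ} (hp : 1 ≤ p) :
    u ≤ lam + u ^ p / lam ^ (p - 1) := by
  rcases le_total u lam with h | h
  · have : 0 ≤ u ^ p / lam ^ (p - 1) := by positivity
    linarith
  · have : u ≤ u ^ p / lam ^ (p - 1) := by
      rw [le_div_iff₀ (by positivity)]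
      calc u * lam ^ (p - 1) ≤ u * u ^ (p - 1) := by gcongr
        _ = u ^ p := by rw [← pow_succ']; congr 1; omega
    linarith

/-- A power mean inequality for a smoothed counting measure with bounded density. -/
lemma smoothed_power_mean {N : ℕ} {H : Finset (Fin N → ℝ)} {W B : Set (Fin N → ℝ)}
    (hW : MeasurableSet W) (hWv : volume W ≠ ⊤) (hB : MeasurableSet B) (hBv : volume B ≠ ⊤)
    {Φ : (Fin N → ℝ) → ℝ} (hΦ : CB Φ) (hΦ0 : ∀ y, 0 ≤ Φ y) {c : (Fin N → ℝ) → ℝ} {f b X : ℝ}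
    (hf : 0 < f) (hb : 0 < b) (hHf : (H.card : ℝ) ≤ f) (hX : 0 ≤ X)
    (hWB : ∀ w ∈ H, ∀ y, y - w ∈ W → y ∈ B)
    (hc : ∀ w ∈ H, ∀ y, y - w ∈ W → c w ≤ Φ y) (hcb : b * f ≤ ∑ w ∈ H, c w)
    (hover : ∀ y, ((Finset.card (H.filter fun w => (W.indicator (fun _ => (1 : ℝ)) (y - w)) = 1) : ℕ) : ℝ)
      ≤ X * f) {p : ℕ} (hp : 1 ≤ p) :
    (b / 2) ^ p * volume.real W ≤ X * ∫ y in B, Φ y ^ p := by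
  have hlam : 0 < b / 2 := by positivity
  set lam := b / 2 with hlamdef
  have hΨ : CB fun y => Φ y ^ p := hΦ.pow p
  have hΨ0 : ∀ y, 0 ≤ Φ y ^ p := fun y => pow_nonneg (hΦ0 y) p
  -- each translate
  have hWm : ∀ w, MeasurableSet ((fun y => y - w) ⁻¹' W) := fun w => (measurable_id.sub_const w) hW
  have hvol : ∀ w, volume ((fun y => y - w) ⁻¹' W) = volume W := fun w => by
    simp only [sub_eq_add_neg]
    exact measure_preimage_add_right volume (-w) W
  have hvolr : ∀ w, volume.real ((fun y => y - w) ⁻¹' W) = volume.real W := fun w => by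
    rw [Measure.real, hvol]; rfl
  have hfin : ∀ w, IsFiniteMeasure (volume.restrict ((fun y => y - w) ⁻¹' W)) := fun w =>
    ⟨by rw [Measure.restrict_apply_univ, hvol]; exact hWv.lt_top⟩
  have hfinB : IsFiniteMeasure (volume.restrict B) :=
    ⟨by rw [Measure.restrict_apply_univ]; exact hBv.lt_top⟩
  have h1 : ∀ w ∈ H, c w * volume.real W ≤ lam * volume.real W +
      (∫ y in ((fun y => y - w) ⁻¹' W), Φ y ^ p) / lam ^ (p - 1) := by
    intro w hw
    haveI := hfin w
    have e1 : c w * volume.real W = ∫ _ in ((fun y => y - w) ⁻¹' W), c w := by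
      rw [setIntegral_const, smul_eq_mul, hvolr, mul_comm]
    have e2 : lam * volume.real W + (∫ y in ((fun y => y - w) ⁻¹' W), Φ y ^ p) / lam ^ (p - 1) =
        ∫ y in ((fun y => y - w) ⁻¹' W), (lam + Φ y ^ p / lam ^ (p - 1)) := by
      rw [integral_add (integrable_const _) (hΨ.integrable.div_const _), setIntegral_const, smul_eq_mul,
        hvolr, mul_comm, integral_div]
    rw [e1, e2]
    refine setIntegral_mono_on (integrable_const _)
      ((integrable_const _).add (hΨ.integrable.div_const _)) (hWm w) fun y hy => ?_
    exact (hc w hw y hy).trans (le_add_pow_div (hΦ0 y) hlam hp)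
  have h2 : ∑ w ∈ H, ∫ y in ((fun y => y - w) ⁻¹' W), Φ y ^ p ≤ X * f * ∫ y in B, Φ y ^ p := by
    have e1 : ∀ w ∈ H, ∫ y in ((fun y => y - w) ⁻¹' W), Φ y ^ p =
        ∫ y in B, W.indicator (fun _ => (1 : ℝ)) (y - w) * Φ y ^ p := by
      intro w hw
      have e : ∀ y, W.indicator (fun _ => (1 : ℝ)) (y - w) * Φ y ^ p =
          ((fun y => y - w) ⁻¹' W).indicator (fun y => Φ y ^ p) y := by
        intro y
        by_cases h : y - w ∈ W
        · rw [Set.indicator_of_mem h, Set.indicator_of_mem (by exact h), one_mul]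
        · rw [Set.indicator_of_notMem h, Set.indicator_of_notMem (by exact h), zero_mul]
      simp only [e]
      rw [setIntegral_indicator (hWm w)]
      congr 2
      ext y
      exact ⟨fun hy => ⟨hWB w hw y hy, hy⟩, fun hy => hy.2⟩
    have hint : ∀ w, Integrable (fun y => W.indicator (fun _ => (1 : ℝ)) (y - w) * Φ y ^ p)
        (volume.restrict B) := by
      intro w
      refine hΨ.integrable.bdd_mul (c := 1) ?_ ?_
      · exact ((measurable_const.indicator hW).comp (measurable_id.sub_const w)).aestronglyMeasurable
      · refine ae_of_all _ fun y => ?_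
        by_cases h : y - w ∈ W
        · simp [h]
        · simp [h]
    rw [Finset.sum_congr rfl e1, ← integral_finsetSum _ fun w _ => hint w, ← integral_const_mul]
    refine integral_mono (integrable_finsetSum _ fun w _ => hint w) (hΨ.integrable.const_mul _)
      fun y => ?_
    simp only
    rw [← Finset.sum_mul]
    refine mul_le_mul_of_nonneg_right (le_trans (le_of_eq ?_) (hover y)) (hΨ0 y)
    rw [Finset.card_filter]
    push_cast
    refine Finset.sum_congr rfl fun w _ => ?_
    by_cases h : y - w ∈ W
    · simp [h]
    · simp [h]
  have h3 := Finset.sum_le_sum h1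
  rw [← Finset.sum_mul, Finset.sum_add_distrib, Finset.sum_const, nsmul_eq_mul, ← Finset.sum_div] at h3
  have hv0 : 0 ≤ volume.real W := measureReal_nonneg
  have h4 : b * f * volume.real W ≤ f * (lam * volume.real W) +
      X * f * (∫ y in B, Φ y ^ p) / lam ^ (p - 1) := by
    refine (mul_le_mul_of_nonneg_right hcb hv0).trans (h3.trans (add_le_add ?_ ?_))
    · exact mul_le_mul_of_nonneg_right hHf (by positivity)
    · gcongr
  have h5 : lam * volume.real W ≤ X * (∫ y in B, Φ y ^ p) / lam ^ (p - 1) := by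
    have e : b = 2 * lam := by rw [hlamdef]; ring
    rw [e] at h4
    have : f * (lam * volume.real W) ≤ f * (X * (∫ y in B, Φ y ^ p) / lam ^ (p - 1)) := by
      have e2 : X * f * (∫ y in B, Φ y ^ p) / lam ^ (p - 1) =
        f * (X * (∫ y in B, Φ y ^ p) / lam ^ (p - 1)) := by ring
      rw [e2] at h4
      linarith
    exact le_of_mul_le_mul_left this hf
  rw [le_div_iff₀ (by positivity)] at h5
  calc lam ^ p * volume.real W = lam * volume.real W * lam ^ (p - 1) := by
        obtain ⟨q, rfl⟩ : ∃ q, p = q + 1 := ⟨p - 1, by omega⟩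
        simp only [Nat.add_sub_cancel]; ring
    _ ≤ _ := h5

lemma le_fp {N : ℕ} {n : Fin N → ℕ} (hn : ∀ i, 1 ≤ n i) {γ r : ℝ} (hγ : 0 ≤ γ) {z : Fin N → ℝ}
    (h : ∀ i, n i * |xc r i z| * γ ≤ 1) : (1 / 4 : ℝ) ^ N ≤ fp n γ r z := by
  unfold fp
  rw [show (1 / 4 : ℝ) ^ N = ∏ i : Fin N, (1 / 4 : ℝ) by simp]
  refine Finset.prod_le_prod (fun _ _ => by norm_num) fun i _ => le_fj (hn i) ?_
  rw [abs_mul, abs_of_nonneg hγ]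
  linarith [h i]

lemma fp_mul_eq {N : ℕ} {n : Fin N → ℕ} {j : Fin N} {M T : ℕ} (hj : n j = M * T) (γ r : ℝ)
    (z : Fin N → ℝ) :
    (fp n γ r z : ℂ) = ∑ p ∈ Finset.range T ×ˢ Finset.range T, ((1 / (T : ℝ) ^ 2 : ℝ) : ℂ) *
      (chr (((((p.1 : ℝ) - p.2) * M) * γ) • ηf r j) z * (fp (Function.update n j M) γ r z : ℂ)) := by
  unfold fp
  rw [← Finset.mul_prod_erase _ _ (Finset.mem_univ j), hj, Complex.ofReal_mul, fj_mul, Finset.sum_mul]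
  refine Finset.sum_congr rfl fun p _ => ?_
  rw [← Finset.mul_prod_erase Finset.univ (fun i => fj (Function.update n j M i) (γ * xc r i z))
    (Finset.mem_univ j), Function.update_self, Complex.ofReal_mul]
  have e : ∏ i ∈ Finset.univ.erase j, fj (n i) (γ * xc r i z) =
      ∏ i ∈ Finset.univ.erase j, fj (Function.update n j M i) (γ * xc r i z) := by
    refine Finset.prod_congr rfl fun i hi => ?_
    rw [Function.update_of_ne (Finset.ne_of_mem_erase hi)]
  rw [e]
  have e2 : chr (((((p.1 : ℝ) - p.2) * M) * γ) • ηf r j) z =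
      Complex.exp ((((p.1 : ℝ) - p.2) * (M * (γ * xc r j z)) : ℝ) * Complex.I) := by
    unfold chr
    rw [smul_dotProduct, smul_eq_mul]
    congr 3
    change _ * xc r j z = _
    ring
  rw [e2]
  push_cast
  ring

lemma card_close_pairs_le (T i0 : ℕ) :
    ((Finset.range T ×ˢ Finset.range T).filter fun p => |(p.1 : ℤ) - p.2| < i0).card ≤ 2 * i0 * T := by
  have : ((Finset.range T ×ˢ Finset.range T).filter fun p => |(p.1 : ℤ) - p.2| < i0) ⊆
      (Finset.range T ×ˢ Finset.range (2 * i0)).image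
        fun q => (q.1, q.1 + q.2 - i0) := by
    intro p hp
    simp only [Finset.mem_filter, Finset.mem_product, Finset.mem_range, Finset.mem_image, abs_lt] at *
    refine ⟨(p.1, p.2 + i0 - p.1), ⟨by omega, by omega⟩, ?_⟩
    ext <;> simp only; omega
  refine (Finset.card_le_card this).trans (Finset.card_image_le.trans ?_)
  simp [mul_comm]

/-- A weighted sum of modulated Fejér kernels. -/
def gp {N : ℕ} (n : Fin N → ℕ) (γ r : ℝ) (η : Fin N → ℝ) (G : Finset (Fin N → ℝ))
    (a : (Fin N → ℝ) → ℝ) (y : Fin N → ℝ) : ℂ :=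
  ∑ w ∈ G, (a w : ℂ) * (chr η (y - w) * (fp n γ r (y - w) : ℂ))

lemma gp_mem_TP {N : ℕ} (n : Fin N → ℕ) {γ : ℝ} (hγ : 0 ≤ γ) (r : ℝ) (η : Fin N → ℝ)
    (G : Finset (Fin N → ℝ)) (a : (Fin N → ℝ) → ℝ) :
    gp n γ r η G a ∈ TP {θ | ∃ c : Fin N → ℝ, (∀ i, |c i| ≤ n i * γ) ∧ θ = η + ∑ i, c i • ηf r i} :=
  sum_mem_TP _ fun w _ => const_mul_mem_TP _ (fp_shift_mem_TP n hγ r η w)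

lemma norm_gp_le {N : ℕ} (n : Fin N → ℕ) (γ r : ℝ) (η : Fin N → ℝ) {G : Finset (Fin N → ℝ)}
    {a : (Fin N → ℝ) → ℝ} (ha : ∀ w ∈ G, 0 ≤ a w) (y : Fin N → ℝ) :
    ‖gp n γ r η G a y‖ ≤ ∑ w ∈ G, a w * fp n γ r (y - w) := by
  refine (norm_sum_le _ _).trans (Finset.sum_le_sum fun w hw => ?_)
  rw [norm_mul, norm_mul, norm_chr, Complex.norm_real, Complex.norm_real, one_mul,
    Real.norm_of_nonneg (ha w hw), Real.norm_of_nonneg (fp_nonneg _ _ _ _)]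

lemma cb_fp {N : ℕ} (n : Fin N → ℕ) (γ r : ℝ) (w : Fin N → ℝ) : CB fun y => fp n γ r (y - w) :=
  ⟨(continuous_fp n γ r).comp (continuous_id.sub continuous_const), 1, fun y => by
    rw [Real.norm_of_nonneg (fp_nonneg _ _ _ _)]; exact fp_le_one _ _ _ _⟩

lemma integral_norm_gp_le {N : ℕ} {P : Measure (Fin N → ℝ)} [IsFiniteMeasure P] {β : ℝ} (hβ : 0 ≤ β)
    (hP : Spc P {η | ∀ i, |η i| ≤ β}) {n : Fin N → ℕ} (hn : ∀ i, 1 ≤ n i) {γ r : ℝ}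
    (hγ : 2 ^ N * β < γ) (hr : |r| ≤ 1) (η : Fin N → ℝ) {G : Finset (Fin N → ℝ)}
    {a : (Fin N → ℝ) → ℝ} (ha : ∀ w ∈ G, 0 ≤ a w) {A : ℝ} (hA : ∑ w ∈ G, a w ≤ A) :
    ∫ y, ‖gp n γ r η G a y‖ ∂P ≤ A * (P.real Set.univ / ∏ i, (n i : ℝ)) := by
  have hγ0 : 0 ≤ γ := (lt_of_le_of_lt (by positivity) hγ).le
  have hi : ∀ w ∈ G, Integrable (fun y => a w * fp n γ r (y - w)) P := fun w _ =>
    (cb_fp n γ r w).integrable.const_mul _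
  calc ∫ y, ‖gp n γ r η G a y‖ ∂P ≤ ∫ y, ∑ w ∈ G, a w * fp n γ r (y - w) ∂P :=
        integral_mono (TP_cb (gp_mem_TP n hγ0 r η G a)).integrable.norm (integrable_finsetSum _ hi)
          fun y => norm_gp_le n γ r η ha y
    _ = ∑ w ∈ G, a w * ∫ y, fp n γ r (y - w) ∂P := by
        rw [integral_finsetSum _ hi]
        exact Finset.sum_congr rfl fun w _ => integral_const_mul _ _
    _ ≤ ∑ w ∈ G, a w * (P.real Set.univ / ∏ i, (n i : ℝ)) :=
        Finset.sum_le_sum fun w hw => mul_le_mul_of_nonneg_left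
          (integral_fp_le hβ hP hn hγ hr w) (ha w hw)
    _ ≤ _ := by
        rw [← Finset.sum_mul]
        exact mul_le_mul_of_nonneg_right hA (by positivity)

lemma sum_gp_eq {N : ℕ} {n : Fin N → ℕ} {j : Fin N} {M T : ℕ} (hj : n j = M * T) (γ r : ℝ)
    (G : Finset (Fin N → ℝ)) (a : (Fin N → ℝ) → ℝ) (y : Fin N → ℝ) :
    ((∑ w ∈ G, a w * fp n γ r (y - w) : ℝ) : ℂ) =
      ∑ p ∈ Finset.range T ×ˢ Finset.range T, ((1 / (T : ℝ) ^ 2 : ℝ) : ℂ) *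
        gp (Function.update n j M) γ r (((((p.1 : ℝ) - p.2) * M) * γ) • ηf r j) G a y := by
  unfold gp
  rw [Complex.ofReal_sum]
  simp only [Finset.mul_sum]
  rw [Finset.sum_comm]
  refine Finset.sum_congr rfl fun w _ => ?_
  rw [Complex.ofReal_mul, fp_mul_eq hj, Finset.mul_sum]
  refine Finset.sum_congr rfl fun p _ => ?_
  ring

/-- Splitting off the pairs of small frequency. -/
lemma sum_le_add_norm_high {N : ℕ} {n : Fin N → ℕ} {j : Fin N} {M T i0 : ℕ} (hT : 1 ≤ T)
    (hj : n j = M * T) {γ r : ℝ} {G : Finset (Fin N → ℝ)} {a : (Fin N → ℝ) → ℝ}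
    (ha : ∀ w ∈ G, 0 ≤ a w) {δ : ℝ} (hδ : 0 ≤ δ) (y : Fin N → ℝ)
    (hlow : ∑ w ∈ G, a w * fp (Function.update n j M) γ r (y - w) ≤ δ) :
    ∑ w ∈ G, a w * fp n γ r (y - w) ≤ 2 * i0 * δ / T +
      (∑ p ∈ (Finset.range T ×ˢ Finset.range T).filter (fun p => ¬ |(p.1 : ℤ) - p.2| < i0),
        ((1 / (T : ℝ) ^ 2 : ℝ) : ℂ) *
        gp (Function.update n j M) γ r (((((p.1 : ℝ) - p.2) * M) * γ) • ηf r j) G a y).re := by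
  have h := congrArg Complex.re (sum_gp_eq hj γ r G a y)
  rw [Complex.ofReal_re, ← Finset.sum_filter_add_sum_filter_not _
    (fun p : ℕ × ℕ => |(p.1 : ℤ) - p.2| < i0), Complex.add_re] at h
  rw [h]
  refine add_le_add_left ?_ _
  refine (Complex.re_le_norm _).trans ((norm_sum_le _ _).trans ?_)
  have hT0 : (0 : ℝ) < T := by exact_mod_cast hT
  have : ∀ p ∈ (Finset.range T ×ˢ Finset.range T).filter (fun p => |(p.1 : ℤ) - p.2| < i0),
      ‖((1 / (T : ℝ) ^ 2 : ℝ) : ℂ) *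
        gp (Function.update n j M) γ r (((((p.1 : ℝ) - p.2) * M) * γ) • ηf r j) G a y‖ ≤
      1 / (T : ℝ) ^ 2 * δ := by
    intro p _
    rw [norm_mul, Complex.norm_real, Real.norm_of_nonneg (by positivity)]
    exact mul_le_mul_of_nonneg_left ((norm_gp_le _ _ _ _ ha y).trans hlow) (by positivity)
  refine (Finset.sum_le_sum this).trans ?_
  rw [Finset.sum_const, nsmul_eq_mul]
  have hc : (((Finset.range T ×ˢ Finset.range T).filter (fun p => |(p.1 : ℤ) - p.2| < i0)).card : ℝ) ≤
      2 * i0 * T := by exact_mod_cast card_close_pairs_le T i0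
  calc _ ≤ 2 * i0 * T * (1 / (T : ℝ) ^ 2 * δ) := by gcongr
    _ = _ := by field_simp

/-- The configuration of bad parameters inside one arc, to which decoupling is applied. -/
structure CoreDat {N : ℕ} (j : Fin N) (C0 : ℝ) (i0 m₁ m₂ mb J M T : ℕ) (n : Fin N → ℕ)
    (ω : Fin N → ℝ) (A δ x X f : ℝ) (R : Finset ℕ) (rr : ℕ → ℝ) (rJ : ℝ)
    (G : ℕ → Finset (Fin N → ℝ)) (a : ℕ → (Fin N → ℝ) → ℝ) (H : Finset (Fin N → ℝ)) : Prop where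
  mb_le : mb ≤ m₁
  m_le : m₁ ≤ m₂
  J_lt : J < 8 ^ mb
  R_sub : R ⊆ Finset.Ico (J * 8 ^ (m₂ - mb)) ((J + 1) * 8 ^ (m₂ - mb))
  rr_ge : ∀ k ∈ R, (k : ℝ) / 8 ^ m₂ ≤ rr k
  rr_le : ∀ k ∈ R, rr k ≤ ((k : ℝ) + 1) / 8 ^ m₂
  rJ_ge : (J : ℝ) / 8 ^ mb ≤ rJ
  rJ_le : rJ ≤ ((J : ℝ) + 1) / 8 ^ mb
  n_pos : ∀ i, 1 ≤ n i
  M_pos : 1 ≤ M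
  T_pos : 1 ≤ T
  n_j : n j = M * T
  hi : ∀ i, j < i → n i * 8 ^ (m₂ * (i.1 - j.1)) ≤ M
  lo : ∀ i, i < j → n i ≤ M * 8 ^ (m₁ * (j.1 - i.1))
  ω_pos : ∀ i, 0 < ω i
  ω_le : ∀ i, ω i ≤ 1
  nω : ∀ i i', i ≤ i' → n i * (ω i' * ((1 / 8 : ℝ) ^ mb) ^ (i'.1 - i.1)) ≤ 4
  A_pos : 0 < A
  δ_nonneg : 0 ≤ δ
  G_le : ∀ k ∈ R, ∀ w ∈ G k, ∀ i, |w i| ≤ 1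
  a_nonneg : ∀ k ∈ R, ∀ w ∈ G k, 0 ≤ a k w
  a_sum : ∀ k ∈ R, ∑ w ∈ G k, a k w ≤ A
  low : ∀ k ∈ R, ∀ w0 ∈ G k, ∑ w ∈ G k with ∀ i,
    (Function.update n j M i : ℝ) * |xc (rr k) i (w - w0)| ≤ 1, a k w ≤ δ
  one_le : ∀ k ∈ R, ∀ w0 ∈ G k,
    1 ≤ ∑ w ∈ G k with ∀ i, (n i : ℝ) * |xc (rr k) i (w - w0)| ≤ 8, a k w
  H_le : ∀ w ∈ H, ∀ i, |w i| ≤ 1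
  f_pos : 0 < f
  H_card : (H.card : ℝ) ≤ f
  GH : ∀ k ∈ R, x * f ≤ ((G k ∩ H).card : ℝ)
  x_pos : 0 < x
  W : ∀ w0 ∈ H, ((Finset.card (H.filter fun w => ∀ i, |xc rJ i (w - w0)| ≤ ω i) : ℕ) : ℝ) ≤ X * f
  small : δ * (4 * i0 * C0 * 4 ^ N) ≤ x * T

namespace CoreDat

variable {N : ℕ} {j : Fin N} {C0 : ℝ} {i0 m₁ m₂ mb J M T : ℕ} {n : Fin N → ℕ}
    {ω : Fin N → ℝ} {A δ x X f : ℝ} {R : Finset ℕ} {rr : ℕ → ℝ} {rJ : ℝ}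
    {G : ℕ → Finset (Fin N → ℝ)} {a : ℕ → (Fin N → ℝ) → ℝ} {H : Finset (Fin N → ℝ)}

lemma J_add_one_le (h : CoreDat j C0 i0 m₁ m₂ mb J M T n ω A δ x X f R rr rJ G a H) :
    ((J : ℝ) + 1) / 8 ^ mb ≤ 1 := by
  rw [div_le_one (by positivity)]; exact_mod_cast h.J_lt

lemma arc_ge (h : CoreDat j C0 i0 m₁ m₂ mb J M T n ω A δ x X f R rr rJ G a H) {k : ℕ} (hk : k ∈ R) :
    (J : ℝ) / 8 ^ mb ≤ rr k := by
  refine le_trans ?_ (h.rr_ge k hk)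
  have h1 := (Finset.mem_Ico.1 (h.R_sub hk)).1
  have e : (8 : ℝ) ^ m₂ = 8 ^ mb * 8 ^ (m₂ - mb) := by
    rw [← pow_add]; congr 1; have := h.mb_le; have := h.m_le; omega
  rw [e, div_le_div_iff₀ (by positivity) (by positivity)]
  have h2 : (J : ℝ) * 8 ^ (m₂ - mb) ≤ k := by exact_mod_cast h1
  calc (J : ℝ) * (8 ^ mb * 8 ^ (m₂ - mb)) = J * 8 ^ (m₂ - mb) * 8 ^ mb := by ring
    _ ≤ _ := by gcongr

lemma arc_le (h : CoreDat j C0 i0 m₁ m₂ mb J M T n ω A δ x X f R rr rJ G a H) {k : ℕ} (hk : k ∈ R) :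
    rr k ≤ ((J : ℝ) + 1) / 8 ^ mb := by
  refine (h.rr_le k hk).trans ?_
  have h1 := (Finset.mem_Ico.1 (h.R_sub hk)).2
  have e : (8 : ℝ) ^ m₂ = 8 ^ mb * 8 ^ (m₂ - mb) := by
    rw [← pow_add]; congr 1; have := h.mb_le; have := h.m_le; omega
  rw [e, div_le_div_iff₀ (by positivity) (by positivity)]
  have h2 : (k : ℝ) + 1 ≤ (J + 1) * 8 ^ (m₂ - mb) := by exact_mod_cast h1
  calc ((k : ℝ) + 1) * 8 ^ mb ≤ (J + 1) * 8 ^ (m₂ - mb) * 8 ^ mb := by gcongr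
    _ = _ := by ring

lemma abs_rr_le (h : CoreDat j C0 i0 m₁ m₂ mb J M T n ω A δ x X f R rr rJ G a H) {k : ℕ} (hk : k ∈ R) :
    |rr k| ≤ 1 := by
  have h1 := h.arc_ge hk
  have h2 := h.arc_le hk
  have h3 := h.J_add_one_le
  have h4 : (0 : ℝ) ≤ (J : ℝ) / 8 ^ mb := by positivity
  rw [abs_le]; constructor <;> linarith

lemma abs_rJ_le (h : CoreDat j C0 i0 m₁ m₂ mb J M T n ω A δ x X f R rr rJ G a H) : |rJ| ≤ 1 := by
  have h1 := h.rJ_ge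
  have h2 := h.rJ_le
  have h3 := h.J_add_one_le
  have h4 : (0 : ℝ) ≤ (J : ℝ) / 8 ^ mb := by positivity
  rw [abs_le]; constructor <;> linarith

/-- On the thickened point `w` each of the functions `h_k` is bounded below. -/
lemma le_h (h : CoreDat j C0 i0 m₁ m₂ mb J M T n ω A δ x X f R rr rJ G a H) {k : ℕ} (hk : k ∈ R)
    {w : Fin N → ℝ} (hw : w ∈ G k) {y : Fin N → ℝ} (hy : ∀ i, |xc rJ i (y - w)| ≤ ω i / 12) :
    (1 / 4 : ℝ) ^ N ≤ ∑ w' ∈ G k, a k w' * fp n (1 / 20) (rr k) (y - w') := by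
  have hclose : |rr k - rJ| ≤ (1 / 8 : ℝ) ^ mb := by
    have h1 := h.arc_ge hk
    have h2 := h.arc_le hk
    have h3 := h.rJ_ge
    have h4 := h.rJ_le
    have e : ((J : ℝ) + 1) / 8 ^ mb = J / 8 ^ mb + (1 / 8 : ℝ) ^ mb := by
      rw [one_div, inv_pow]; field_simp
    rw [e] at h2 h4
    rw [abs_le]; constructor <;> linarith
  have h1 : ∀ i, (n i : ℝ) * |xc (rr k) i (y - w)| ≤ 1 := by
    intro i
    have hn0 : (0 : ℝ) < n i := by exact_mod_cast h.n_pos i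
    have := abs_xc_shift_le (r := rJ) hclose (i := i) (w := y - w) (B := 1 / (3 * n i)) ?_
    · rw [add_sub_cancel] at this
      calc (n i : ℝ) * |xc (rr k) i (y - w)| ≤ n i * (3 * (1 / (3 * n i))) := by gcongr
        _ = 1 := by field_simp
    · intro i' hi
      rw [le_div_iff₀ (by positivity)]
      have h2 := h.nω i i' hi
      calc |xc rJ i' (y - w)| * ((1 / 8 : ℝ) ^ mb) ^ (i'.1 - i.1) * (3 * n i)
          ≤ ω i' / 12 * ((1 / 8 : ℝ) ^ mb) ^ (i'.1 - i.1) * (3 * n i) := by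
            gcongr; exact hy i'
        _ = n i * (ω i' * ((1 / 8 : ℝ) ^ mb) ^ (i'.1 - i.1)) / 4 := by ring
        _ ≤ 1 := by linarith
  calc (1 / 4 : ℝ) ^ N = 1 * (1 / 4 : ℝ) ^ N := (one_mul _).symm
    _ ≤ (∑ w' ∈ G k with ∀ i, (n i : ℝ) * |xc (rr k) i (w' - w)| ≤ 8, a k w') * (1 / 4 : ℝ) ^ N := by
        gcongr; exact h.one_le k hk w hw
    _ ≤ ∑ w' ∈ G k with ∀ i, (n i : ℝ) * |xc (rr k) i (w' - w)| ≤ 8,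
          a k w' * fp n (1 / 20) (rr k) (y - w') := by
        rw [Finset.sum_mul]
        refine Finset.sum_le_sum fun w' hw' => ?_
        obtain ⟨hw', hb⟩ := Finset.mem_filter.1 hw'
        refine mul_le_mul_of_nonneg_left (le_fp h.n_pos (by norm_num) fun i => ?_) (h.a_nonneg k hk w' hw')
        have e : y - w' = (y - w) - (w' - w) := by abel
        rw [e, xc_sub]
        have hn0 : (0 : ℝ) ≤ n i := by positivity
        calc (n i : ℝ) * |xc (rr k) i (y - w) - xc (rr k) i (w' - w)| * (1 / 20)
            ≤ n i * (|xc (rr k) i (y - w)| + |xc (rr k) i (w' - w)|) * (1 / 20) := by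
              gcongr; exact abs_sub _ _
          _ ≤ 1 := by linarith [h1 i, hb i]
    _ ≤ _ := Finset.sum_le_sum_of_subset_of_nonneg (Finset.filter_subset _ _) fun w' hw' _ =>
        mul_nonneg (h.a_nonneg k hk w' hw') (fp_nonneg _ _ _ _)

end CoreDat

/-- The contribution of one pair of frequencies, as a function of the arc. -/
def gk {N : ℕ} (n : Fin N → ℕ) (j : Fin N) (Λ : ℝ) (R : Finset ℕ) (rr : ℕ → ℝ)
    (G : ℕ → Finset (Fin N → ℝ)) (a : ℕ → (Fin N → ℝ) → ℝ) (k : ℕ) (y : Fin N → ℝ) : ℂ :=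
  if k ∈ R then gp n (1 / 20) (rr k) (Λ • ηf (rr k) j) (G k) (a k) y else 0

namespace CoreDat

variable {N : ℕ} {j : Fin N} {C0 : ℝ} {i0 m₁ m₂ mb J M T : ℕ} {n : Fin N → ℕ}
    {ω : Fin N → ℝ} {A δ x X f : ℝ} {R : Finset ℕ} {rr : ℕ → ℝ} {rJ : ℝ}
    {G : ℕ → Finset (Fin N → ℝ)} {a : ℕ → (Fin N → ℝ) → ℝ} {H : Finset (Fin N → ℝ)}

lemma win (h : CoreDat j C0 i0 m₁ m₂ mb J M T n ω A δ x X f R rr rJ G a H) {d : ℕ}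
    (hjd : j.1 + d + 1 = N) {κ : ℝ} (hκ : 0 < κ) (hi0 : 1 ≤ κ * i0) (hi1 : 1 ≤ i0) {r q : ℝ}
    (hq : (i0 : ℝ) ≤ |q|) {c : Fin N → ℝ}
    (hc : ∀ i, |c i| ≤ (Function.update n j M i : ℕ) * (1 / 20 : ℝ)) :
    Win j.1 d (q * M * (1 / 20)) κ m₁ m₂
      (tl (-r) (Sr ((q * M * (1 / 20)) • ηf r j + ∑ i, c i • ηf r i))) := by
  set Λ : ℝ := q * M * (1 / 20) with hΛ
  have hM0 : (0 : ℝ) ≤ M := by positivity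
  have hi1' : (1 : ℝ) ≤ i0 := by exact_mod_cast hi1
  have hΛa : |Λ| = |q| * (M * (1 / 20)) := by
    rw [hΛ, abs_mul, abs_mul, Nat.abs_cast, abs_of_pos (by norm_num : (0 : ℝ) < 1 / 20)]; ring
  have hΛ1 : (M : ℝ) * (1 / 20) ≤ |Λ| := by
    rw [hΛa]; exact le_mul_of_one_le_left (by positivity) (by linarith)
  have hΛ2 : (M : ℝ) * (1 / 20) ≤ κ * |Λ| := by
    rw [hΛa, ← mul_assoc]
    refine le_mul_of_one_le_left (by positivity) (hi0.trans ?_)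
    gcongr
  have e : Λ • ηf r j + ∑ i, c i • ηf r i = ∑ i, ((if i = j then Λ else 0) + c i) • ηf r i := by
    simp only [add_smul, Finset.sum_add_distrib, ite_smul, zero_smul, Finset.sum_ite_eq',
      Finset.mem_univ, if_true]
  rw [e]
  refine ⟨fun l hl1 hld => ?_, ?_, fun k hk1 hkj => ?_⟩
  · have hlt : j.1 + l < N := by omega
    rw [coeff_tl_Sr_sum r _ hlt]
    have hne : (⟨j.1 + l, hlt⟩ : Fin N) ≠ j := by
      intro hh; have := congrArg Fin.val hh; simp at this; omega
    rw [if_neg hne, zero_add]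
    have h1 := hc ⟨j.1 + l, hlt⟩
    rw [Function.update_of_ne hne] at h1
    have h2 := h.hi ⟨j.1 + l, hlt⟩ (by rw [Fin.lt_def]; simp; omega)
    simp only [Nat.add_sub_cancel_left] at h2
    have h3 : (n ⟨j.1 + l, hlt⟩ : ℝ) * 8 ^ (m₂ * l) ≤ M := by exact_mod_cast h2
    refine h1.trans ?_
    rw [← pow_mul, one_div_pow, mul_one_div |Λ|, le_div_iff₀ (by positivity)]
    calc (n ⟨j.1 + l, hlt⟩ : ℝ) * (1 / 20) * 8 ^ (m₂ * l)
        = n ⟨j.1 + l, hlt⟩ * 8 ^ (m₂ * l) * (1 / 20) := by ring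
      _ ≤ M * (1 / 20) := by gcongr
      _ ≤ _ := hΛ1
  · rw [coeff_tl_Sr_sum r _ j.2, if_pos (by rfl), add_sub_cancel_left]
    have h1 := hc j
    rw [Function.update_self] at h1
    exact h1.trans hΛ2
  · have hlt : j.1 - k < N := by omega
    rw [coeff_tl_Sr_sum r _ hlt]
    have hne : (⟨j.1 - k, hlt⟩ : Fin N) ≠ j := by
      intro hh; have := congrArg Fin.val hh; simp at this; omega
    rw [if_neg hne, zero_add]
    have h1 := hc ⟨j.1 - k, hlt⟩
    rw [Function.update_of_ne hne] at h1
    have h2 := h.lo ⟨j.1 - k, hlt⟩ (by rw [Fin.lt_def]; simp; omega)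
    simp only at h2
    rw [show j.1 - (j.1 - k) = k by omega] at h2
    have h3 : (n ⟨j.1 - k, hlt⟩ : ℝ) ≤ M * 8 ^ (m₁ * k) := by exact_mod_cast h2
    refine h1.trans ?_
    rw [← pow_mul]
    calc (n ⟨j.1 - k, hlt⟩ : ℝ) * (1 / 20) ≤ M * 8 ^ (m₁ * k) * (1 / 20) := by gcongr
      _ = M * (1 / 20) * 8 ^ (m₁ * k) := by ring
      _ ≤ _ := by gcongr

lemma update_pos (h : CoreDat j C0 i0 m₁ m₂ mb J M T n ω A δ x X f R rr rJ G a H) (i : Fin N) :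
    1 ≤ Function.update n j M i := by
  by_cases hi : i = j
  · rw [hi, Function.update_self]; exact h.M_pos
  · rw [Function.update_of_ne hi]; exact h.n_pos i

lemma prod_update (h : CoreDat j C0 i0 m₁ m₂ mb J M T n ω A δ x X f R rr rJ G a H) :
    (∏ i, (n i : ℝ)) = T * ∏ i, (Function.update n j M i : ℝ) := by
  rw [← Finset.mul_prod_erase _ _ (Finset.mem_univ j), h.n_j,
    ← Finset.mul_prod_erase _ (fun i => (Function.update n j M i : ℝ)) (Finset.mem_univ j),
    Function.update_self]
  rw [Finset.prod_congr rfl fun i hi => by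
    rw [← Function.update_of_ne (Finset.ne_of_mem_erase hi) M n]]
  push_cast; ring

lemma gk_mem (h : CoreDat j C0 i0 m₁ m₂ mb J M T n ω A δ x X f R rr rJ G a H) {d : ℕ}
    (hjd : j.1 + d + 1 = N) {κ : ℝ} (hκ : 0 < κ) (hi0 : 1 ≤ κ * i0) (hi1 : 1 ≤ i0) {q : ℝ}
    (hq : (i0 : ℝ) ≤ |q|) (k : ℕ) :
    gk (Function.update n j M) j (q * M * (1 / 20)) R rr G a k ∈ TP {η | ∃ a : ℝ,
      (k : ℝ) / 8 ^ m₂ ≤ a ∧ a ≤ ((k : ℝ) + 1) / 8 ^ m₂ ∧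
      Win j.1 d (q * M * (1 / 20)) κ m₁ m₂ (tl (-a) (Sr η))} := by
  by_cases hk : k ∈ R
  · have e : gk (Function.update n j M) j (q * M * (1 / 20)) R rr G a k =
        gp (Function.update n j M) (1 / 20) (rr k) ((q * M * (1 / 20)) • ηf (rr k) j) (G k) (a k) := by
      funext y; simp [gk, hk]
    rw [e]
    refine TP_mono ?_ (gp_mem_TP _ (by norm_num) _ _ _ _)
    rintro θ ⟨c, hc, rfl⟩
    exact ⟨rr k, h.rr_ge k hk, h.rr_le k hk, h.win hjd hκ hi0 hi1 hq hc⟩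
  · have e : gk (Function.update n j M) j (q * M * (1 / 20)) R rr G a k = 0 := by
      funext y; simp [gk, hk]
    rw [e]
    exact Submodule.zero_mem _

lemma low_le (h : CoreDat j C0 i0 m₁ m₂ mb J M T n ω A δ x X f R rr rJ G a H)
    (hcell : ∀ (r : ℝ) (n : Fin N → ℕ)
      (G : Finset (Fin N → ℝ)) (a : (Fin N → ℝ) → ℝ) (M0 : ℝ), |r| ≤ 1 → (∀ i, 1 ≤ n i) →
      (∀ w ∈ G, 0 ≤ a w) → (∀ w ∈ G, ∀ i, |w i| ≤ 1) → 0 ≤ M0 →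
      (∀ w0 ∈ G, ∑ w ∈ G with ∀ i, n i * |xc r i (w - w0)| ≤ 1, a w ≤ M0) →
      ∀ y, ∑ w ∈ G, a w * fp n (1 / 20) r (y - w) ≤ C0 * M0) {k : ℕ} (hk : k ∈ R) (y : Fin N → ℝ) :
    ∑ w ∈ G k, a k w * fp (Function.update n j M) (1 / 20) (rr k) (y - w) ≤ C0 * δ :=
  hcell _ _ _ _ _ (h.abs_rr_le hk) h.update_pos (h.a_nonneg k hk) (h.G_le k hk) h.δ_nonneg
    (h.low k hk) y

lemma x_le_one (h : CoreDat j C0 i0 m₁ m₂ mb J M T n ω A δ x X f R rr rJ G a H) {k : ℕ} (hk : k ∈ R) :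
    x ≤ 1 := by
  have h1 := h.GH k hk
  have h2 : ((G k ∩ H).card : ℝ) ≤ H.card := by
    exact_mod_cast Finset.card_le_card Finset.inter_subset_right
  have h3 := h.H_card
  have h4 := h.f_pos
  nlinarith

lemma low_le_T (h : CoreDat j C0 i0 m₁ m₂ mb J M T n ω A δ x X f R rr rJ G a H)
    (hi1 : 1 ≤ i0) (hC0 : 1 ≤ C0) {k : ℕ} (hk : k ∈ R) : C0 * δ ≤ T := by
  have h1 := h.small
  have h2 := h.x_le_one hk
  have h3 : (1 : ℝ) ≤ i0 := by exact_mod_cast hi1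
  have h4 : (1 : ℝ) ≤ 4 ^ N := one_le_pow₀ (by norm_num)
  have h5 := h.δ_nonneg
  have h6 : x * T ≤ T := mul_le_of_le_one_left (by positivity) h2
  have h7 : C0 * δ * 1 ≤ C0 * δ * (4 * i0 * 4 ^ N) := by
    refine mul_le_mul_of_nonneg_left ?_ (by positivity)
    nlinarith
  linarith

lemma integral_gk_pow_le (h : CoreDat j C0 i0 m₁ m₂ mb J M T n ω A δ x X f R rr rJ G a H)
    (hi1 : 1 ≤ i0) (hC0 : 1 ≤ C0)
    (hcell : ∀ (r : ℝ) (n : Fin N → ℕ)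
      (G : Finset (Fin N → ℝ)) (a : (Fin N → ℝ) → ℝ) (M0 : ℝ), |r| ≤ 1 → (∀ i, 1 ≤ n i) →
      (∀ w ∈ G, 0 ≤ a w) → (∀ w ∈ G, ∀ i, |w i| ≤ 1) → 0 ≤ M0 →
      (∀ w0 ∈ G, ∑ w ∈ G with ∀ i, n i * |xc r i (w - w0)| ≤ 1, a w ≤ M0) →
      ∀ y, ∑ w ∈ G, a w * fp n (1 / 20) r (y - w) ≤ C0 * M0)
    {P : Measure (Fin N → ℝ)} [IsFiniteMeasure P] {β : ℝ} (hβ : 0 ≤ β)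
    (hP : Spc P {η | ∀ i, |η i| ≤ β}) (hγ : 2 ^ N * β < 1 / 20) (Λ : ℝ) {p : ℕ} (hp : 1 ≤ p)
    {k : ℕ} (hk : k ∈ R) :
    ∫ y, ‖gk (Function.update n j M) j Λ R rr G a k y‖ ^ p ∂P ≤
      T ^ p * (A * (P.real Set.univ + 1) / ∏ i, (n i : ℝ)) := by
  have hb : ∀ y, ‖gk (Function.update n j M) j Λ R rr G a k y‖ ≤ T := by
    intro y
    simp only [gk, hk, if_true]
    exact (norm_gp_le _ _ _ _ (h.a_nonneg k hk) y).trans ((h.low_le hcell hk y).trans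
      (h.low_le_T hi1 hC0 hk))
  have hcb : CB (gk (Function.update n j M) j Λ R rr G a k) := by
    have e : gk (Function.update n j M) j Λ R rr G a k =
        gp (Function.update n j M) (1 / 20) (rr k) (Λ • ηf (rr k) j) (G k) (a k) := by
      funext y; simp [gk, hk]
    rw [e]
    exact TP_cb (gp_mem_TP _ (by norm_num) _ _ _ _)
  have hT0 : (0 : ℝ) < T := by exact_mod_cast h.T_pos
  have hn' : 0 < ∏ i, (Function.update n j M i : ℝ) :=
    Finset.prod_pos fun i _ => by exact_mod_cast h.update_pos i
  calc ∫ y, ‖gk (Function.update n j M) j Λ R rr G a k y‖ ^ p ∂P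
      ≤ ∫ y, (T : ℝ) ^ (p - 1) * ‖gk (Function.update n j M) j Λ R rr G a k y‖ ∂P := by
        refine integral_mono (hcb.norm.pow p).integrable (hcb.norm.integrable.const_mul _) fun y => ?_
        simp only
        conv_lhs => rw [show p = p - 1 + 1 by omega, pow_succ]
        gcongr
        exact hb y
    _ = (T : ℝ) ^ (p - 1) * ∫ y, ‖gk (Function.update n j M) j Λ R rr G a k y‖ ∂P :=
        integral_const_mul _ _
    _ ≤ (T : ℝ) ^ (p - 1) * (A * (P.real Set.univ / ∏ i, (Function.update n j M i : ℝ))) := by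
        refine mul_le_mul_of_nonneg_left ?_ (by positivity)
        simp only [gk, hk, if_true]
        exact integral_norm_gp_le hβ hP h.update_pos hγ (h.abs_rr_le hk) _ (h.a_nonneg k hk)
          (h.a_sum k hk)
    _ ≤ (T : ℝ) ^ (p - 1) * (A * ((P.real Set.univ + 1) / ∏ i, (Function.update n j M i : ℝ))) := by
        have := h.A_pos
        gcongr
        linarith
    _ = _ := by
        rw [h.prod_update]
        obtain ⟨q, rfl⟩ : ∃ q, p = q + 1 := ⟨p - 1, by omega⟩
        simp only [Nat.add_sub_cancel]
        field_simp
        ring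

lemma one_le_Λ (h : CoreDat j C0 i0 m₁ m₂ mb J M T n ω A δ x X f R rr rJ G a H) {d : ℕ}
    (hd : 1 ≤ d) (hjd : j.1 + d + 1 = N) (hi20 : 20 ≤ i0) {q : ℝ} (hq : (i0 : ℝ) ≤ |q|) :
    1 ≤ |q * M * (1 / 20)| * ((1 / 8 : ℝ) ^ m₂) ^ d := by
  have hlt : j.1 + d < N := by omega
  have h2 := h.hi ⟨j.1 + d, hlt⟩ (by rw [Fin.lt_def]; simp; omega)
  simp only [Nat.add_sub_cancel_left] at h2
  have h4 : 8 ^ (m₂ * d) ≤ M := le_trans (Nat.le_mul_of_pos_left _ (h.n_pos _)) h2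
  have h3 : (8 : ℝ) ^ (m₂ * d) ≤ M := by exact_mod_cast h4
  have h20 : (20 : ℝ) ≤ i0 := by exact_mod_cast hi20
  rw [abs_mul, abs_mul, Nat.abs_cast, abs_of_pos (by norm_num : (0 : ℝ) < 1 / 20), ← pow_mul,
    one_div_pow, mul_one_div, le_div_iff₀ (by positivity), one_mul]
  refine h3.trans ?_
  have : (20 : ℝ) ≤ |q| := h20.trans hq
  have hM : (0 : ℝ) ≤ M := by positivity
  nlinarith

/-- The contribution of one pair of frequencies, by multiscale decoupling. -/
lemma integral_pair_le (h : CoreDat j C0 i0 m₁ m₂ mb J M T n ω A δ x X f R rr rJ G a H) {d : ℕ}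
    (hd : 1 ≤ d) (hjd : j.1 + d + 1 = N) (hi20 : 20 ≤ i0) (hC0 : 1 ≤ C0)
    (hcell : ∀ (r : ℝ) (n : Fin N → ℕ)
      (G : Finset (Fin N → ℝ)) (a : (Fin N → ℝ) → ℝ) (M0 : ℝ), |r| ≤ 1 → (∀ i, 1 ≤ n i) →
      (∀ w ∈ G, 0 ≤ a w) → (∀ w ∈ G, ∀ i, |w i| ≤ 1) → 0 ≤ M0 →
      (∀ w0 ∈ G, ∑ w ∈ G with ∀ i, n i * |xc r i (w - w0)| ≤ 1, a w ≤ M0) →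
      ∀ y, ∑ w ∈ G, a w * fp n (1 / 20) r (y - w) ≤ C0 * M0)
    {P : Measure (Fin N → ℝ)} [IsFiniteMeasure P] {β : ℝ} (hβ : 0 ≤ β)
    (hP : Spc P {η | ∀ i, |η i| ≤ β}) (hγ : 2 ^ N * β < 1 / 20)
    {κ β₁ ε : ℝ} (hκ : 0 < κ) (hi0 : 1 ≤ κ * i0) (hβ₁ : β ≤ β₁) {Kh : ℕ} (hK : m₁ + Kh = m₂)
    (hMD : ∀ (Λ : ℝ) (g : ℕ → (Fin N → ℝ) → ℂ) (s : ℕ → ℝ), MDat j.1 d Λ κ β₁ m₁ m₂ P g s →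
      ∀ I, I < 8 ^ m₁ → ∫ y, ‖blk (8 ^ Kh) g I y‖ ^ (2 * Tri d) ∂P ≤
        exp (ε * Kh) * (blk (8 ^ Kh) s I) ^ Tri d)
    (hR : R.Nonempty) {q : ℝ} (hq : (i0 : ℝ) ≤ |q|) :
    ∫ y, ‖∑ k ∈ R, gp (Function.update n j M) (1 / 20) (rr k)
        ((q * M * (1 / 20)) • ηf (rr k) j) (G k) (a k) y‖ ^ (2 * Tri d) ∂P ≤
      ((8 : ℝ) ^ (m₁ - mb)) ^ (2 * Tri d) * (exp (ε * Kh) * (2 * R.card) ^ Tri d *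
        (T ^ (2 * Tri d) * (A * (P.real Set.univ + 1) / ∏ i, (n i : ℝ)))) := by
  have hTri := Tri_pos hd
  have hi1 : 1 ≤ i0 := by omega
  set V : ℝ := T ^ (2 * Tri d) * (A * (P.real Set.univ + 1) / ∏ i, (n i : ℝ)) with hV
  have hV0 : 0 < V := by
    have h1 : (0 : ℝ) < T := by exact_mod_cast h.T_pos
    have h2 := h.A_pos
    have h3 : 0 < ∏ i, (n i : ℝ) := Finset.prod_pos fun i _ => by exact_mod_cast h.n_pos i
    have h4 : 0 < P.real Set.univ + 1 := by positivity
    positivity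
  set σ : ℝ := V ^ (1 / (Tri d : ℝ)) with hσ
  have hσ0 : 0 < σ := Real.rpow_pos_of_pos hV0 _
  have hσV : σ ^ Tri d = V := by
    rw [hσ, ← Real.rpow_natCast, ← Real.rpow_mul hV0.le, one_div, inv_mul_cancel₀ (by positivity),
      Real.rpow_one]
  set s : ℕ → ℝ := fun k => σ * ((if k ∈ R then 1 else 0) + (1 / 8 : ℝ) ^ m₂) with hs
  have hs0 : ∀ k, 0 < s k := fun k => by
    simp only [hs]
    have : (0 : ℝ) ≤ if k ∈ R then 1 else 0 := by split_ifs <;> norm_num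
    positivity
  set g := gk (Function.update n j M) j (q * M * (1 / 20)) R rr G a with hg
  have hgmem := fun k => h.gk_mem hjd hκ hi0 hi1 hq k
  have hgcb : ∀ k, CB (g k) := fun k => TP_cb (hgmem k)
  have hMDat : MDat j.1 d (q * M * (1 / 20)) κ β₁ m₁ m₂ P g s := by
    refine ⟨inferInstance, hP.mono fun η hη i => (hη i).trans hβ₁, h.one_le_Λ hd hjd hi20 hq,
      fun k _ => hgmem k, hs0, fun k _ => ?_⟩
    by_cases hk : k ∈ R
    · refine (h.integral_gk_pow_le hi1 hC0 hcell hβ hP hγ _ (by omega) hk).trans ?_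
      rw [← hV, ← hσV]
      refine pow_le_pow_left₀ hσ0.le ?_ _
      simp only [hs, hk, if_true]
      have : (0 : ℝ) ≤ (1 / 8 : ℝ) ^ m₂ := by positivity
      nlinarith
    · have : ∀ y, ‖g k y‖ ^ (2 * Tri d) = 0 := by
        intro y
        rw [hg]
        simp only [gk, hk, if_false, norm_zero]
        exact zero_pow (by omega)
      simp only [this, integral_zero]
      exact pow_nonneg (hs0 k).le _
  have hmain := hMD _ g s hMDat
  have hmb := h.mb_le
  set c := m₁ - mb with hc
  have hL : (8 : ℕ) ^ (m₂ - mb) = 8 ^ c * 8 ^ Kh := by rw [← pow_add]; congr 1; omega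
  have hIco : ∀ {M' : Type} [AddCommMonoid M'] (u : ℕ → M'),
      ∑ k ∈ Finset.Ico (J * 8 ^ (m₂ - mb)) ((J + 1) * 8 ^ (m₂ - mb)), u k =
      blk (8 ^ c) (blk (8 ^ Kh) u) J := by
    intro M' _ u
    rw [blk_blk, ← hL, Finset.sum_Ico_eq_sum_range, show (J + 1) * 8 ^ (m₂ - mb) - J * 8 ^ (m₂ - mb) =
      8 ^ (m₂ - mb) by rw [add_mul, one_mul, Nat.add_sub_cancel_left]]
    rfl
  have hsum : ∀ y, ∑ k ∈ R, gp (Function.update n j M) (1 / 20) (rr k)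
        ((q * M * (1 / 20)) • ηf (rr k) j) (G k) (a k) y =
      ∑ I ∈ Finset.range (8 ^ c), blk (8 ^ Kh) g (J * 8 ^ c + I) y := by
    intro y
    have h1 : ∑ k ∈ R, gp (Function.update n j M) (1 / 20) (rr k)
        ((q * M * (1 / 20)) • ηf (rr k) j) (G k) (a k) y = ∑ k ∈ R, g k y :=
      Finset.sum_congr rfl fun k hk => by rw [hg]; simp [gk, hk]
    rw [h1, Finset.sum_subset h.R_sub fun k _ hk => by rw [hg]; simp [gk, hk]]
    have h2 := congrFun (hIco g) y
    rw [Finset.sum_apply] at h2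
    rw [h2]
    unfold blk
    rw [Finset.sum_apply]
  have hlt : ∀ I ∈ Finset.range (8 ^ c), J * 8 ^ c + I < 8 ^ m₁ := by
    intro I hI
    have hI := Finset.mem_range.1 hI
    have : (8 : ℕ) ^ m₁ = 8 ^ mb * 8 ^ c := by rw [← pow_add]; congr 1; omega
    rw [this]
    have := h.J_lt
    nlinarith
  have hbcb : ∀ I, CB (blk (8 ^ Kh) g I) := by
    intro I
    have e : blk (8 ^ Kh) g I = fun y => ∑ i ∈ Finset.range (8 ^ Kh), g (I * 8 ^ Kh + i) y := by
      funext y; simp [blk]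
    rw [e]
    exact CB.sum _ fun i _ => hgcb _
  simp only [hsum]
  calc ∫ y, ‖∑ I ∈ Finset.range (8 ^ c), blk (8 ^ Kh) g (J * 8 ^ c + I) y‖ ^ (2 * Tri d) ∂P
      ≤ ∫ y, ((8 : ℝ) ^ c) ^ (2 * Tri d) *
          ∑ I ∈ Finset.range (8 ^ c), ‖blk (8 ^ Kh) g (J * 8 ^ c + I) y‖ ^ (2 * Tri d) ∂P := by
        refine integral_mono ((CB.sum _ fun I _ => hbcb _).norm.pow _).integrable
          ((integrable_finsetSum _ fun I _ => ((hbcb _).norm.pow _).integrable).const_mul _)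
          fun y => ?_
        have := norm_sum_pow_le (Finset.range (8 ^ c)) (fun I => blk (8 ^ Kh) g (J * 8 ^ c + I) y)
          (p := 2 * Tri d) (by omega)
        simpa using this
    _ = ((8 : ℝ) ^ c) ^ (2 * Tri d) * ∑ I ∈ Finset.range (8 ^ c),
          ∫ y, ‖blk (8 ^ Kh) g (J * 8 ^ c + I) y‖ ^ (2 * Tri d) ∂P := by
        rw [integral_const_mul, integral_finsetSum _ fun I _ => ((hbcb _).norm.pow _).integrable]
    _ ≤ ((8 : ℝ) ^ c) ^ (2 * Tri d) * ∑ I ∈ Finset.range (8 ^ c),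
          exp (ε * Kh) * (blk (8 ^ Kh) s (J * 8 ^ c + I)) ^ Tri d := by
        gcongr with I hI
        exact hmain _ (hlt I hI)
    _ ≤ ((8 : ℝ) ^ c) ^ (2 * Tri d) * (exp (ε * Kh) * (2 * R.card * σ) ^ Tri d) := by
        rw [← Finset.mul_sum]
        gcongr
        refine (sum_pow_le_pow_sum' _ (fun I _ => (blk_pos (by positivity) hs0 _).le) hTri).trans ?_
        refine pow_le_pow_left₀ (Finset.sum_nonneg fun I _ => (blk_pos (by positivity) hs0 _).le) ?_ _
        have h3 := hIco s
        have h4 : blk (8 ^ c) (blk (8 ^ Kh) s) J =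
          ∑ I ∈ Finset.range (8 ^ c), blk (8 ^ Kh) s (J * 8 ^ c + I) := rfl
        rw [← h4, ← h3]
        simp only [hs]
        rw [← Finset.mul_sum, Finset.sum_add_distrib, Finset.sum_const, Nat.card_Ico,
          ← Finset.sum_filter, Finset.filter_mem_eq_inter, Finset.inter_eq_right.2 h.R_sub]
        have h5 : (J + 1) * 8 ^ (m₂ - mb) - J * 8 ^ (m₂ - mb) = 8 ^ (m₂ - mb) := by
          rw [add_mul, one_mul, Nat.add_sub_cancel_left]
        rw [h5]
        have h6 : ((8 ^ (m₂ - mb) : ℕ) : ℝ) * (1 / 8 : ℝ) ^ m₂ ≤ 1 := by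
          rw [one_div_pow, mul_one_div, div_le_one (by positivity)]
          push_cast
          exact pow_le_pow_right₀ (by norm_num) (by omega)
        have h7 : (1 : ℝ) ≤ R.card := by exact_mod_cast hR.card_pos
        simp only [Finset.sum_const, nsmul_eq_mul, mul_one]
        nlinarith
    _ = _ := by rw [mul_pow (2 * (R.card : ℝ)) σ, hσV]; ring

end CoreDat

namespace CoreDat

variable {N : ℕ} {j : Fin N} {C0 : ℝ} {i0 m₁ m₂ mb J M T : ℕ} {n : Fin N → ℕ}
    {ω : Fin N → ℝ} {A δ x X f : ℝ} {R : Finset ℕ} {rr : ℕ → ℝ} {rJ : ℝ}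
    {G : ℕ → Finset (Fin N → ℝ)} {a : ℕ → (Fin N → ℝ) → ℝ} {H : Finset (Fin N → ℝ)}

/-- The pairs of Fejér frequencies at distance at least `i0`. -/
def highPairs (T i0 : ℕ) : Finset (ℕ × ℕ) :=
  (Finset.range T ×ˢ Finset.range T).filter fun p => ¬ |(p.1 : ℤ) - p.2| < i0

lemma card_highPairs_le (T i0 : ℕ) : ((highPairs T i0).card : ℝ) ≤ (T : ℝ) ^ 2 := by
  have : (highPairs T i0).card ≤ T ^ 2 := by
    refine (Finset.card_filter_le _ _).trans ?_
    simp [sq]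
  exact_mod_cast this

/-- The contribution of one pair of frequencies, summed over the arcs. -/
def pairSum (n : Fin N → ℕ) (j : Fin N) (M : ℕ) (R : Finset ℕ) (rr : ℕ → ℝ)
    (G : ℕ → Finset (Fin N → ℝ)) (a : ℕ → (Fin N → ℝ) → ℝ) (q : ℝ) (y : Fin N → ℝ) : ℂ :=
  ∑ k ∈ R, gp (Function.update n j M) (1 / 20) (rr k) ((q * M * (1 / 20)) • ηf (rr k) j) (G k) (a k) y

lemma cb_pairSum (n : Fin N → ℕ) (j : Fin N) (M : ℕ) (R : Finset ℕ) (rr : ℕ → ℝ)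
    (G : ℕ → Finset (Fin N → ℝ)) (a : ℕ → (Fin N → ℝ) → ℝ) (q : ℝ) :
    CB (pairSum n j M R rr G a q) := by
  unfold pairSum
  exact CB.sum _ fun k _ => TP_cb (gp_mem_TP _ (by norm_num) _ _ _ _)

lemma le_norm_pairSum (h : CoreDat j C0 i0 m₁ m₂ mb J M T n ω A δ x X f R rr rJ G a H)
    (hC0 : 1 ≤ C0)
    (hcell : ∀ (r : ℝ) (n : Fin N → ℕ)
      (G : Finset (Fin N → ℝ)) (a : (Fin N → ℝ) → ℝ) (M0 : ℝ), |r| ≤ 1 → (∀ i, 1 ≤ n i) →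
      (∀ w ∈ G, 0 ≤ a w) → (∀ w ∈ G, ∀ i, |w i| ≤ 1) → 0 ≤ M0 →
      (∀ w0 ∈ G, ∑ w ∈ G with ∀ i, n i * |xc r i (w - w0)| ≤ 1, a w ≤ M0) →
      ∀ y, ∑ w ∈ G, a w * fp n (1 / 20) r (y - w) ≤ C0 * M0)
    {w y : Fin N → ℝ} (hy : ∀ i, |xc rJ i (y - w)| ≤ ω i / 12) :
    (1 / 4 : ℝ) ^ N * ((R.filter fun k => w ∈ G k).card : ℝ) - R.card * (2 * i0 * (C0 * δ) / T) ≤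
      ‖∑ p ∈ highPairs T i0, ((1 / (T : ℝ) ^ 2 : ℝ) : ℂ) *
        pairSum n j M R rr G a ((p.1 : ℝ) - p.2) y‖ := by
  have h1 : (1 / 4 : ℝ) ^ N * ((R.filter fun k => w ∈ G k).card : ℝ) ≤
      ∑ k ∈ R, ∑ w' ∈ G k, a k w' * fp n (1 / 20) (rr k) (y - w') := by
    rw [mul_comm, ← nsmul_eq_mul, ← Finset.sum_const, Finset.sum_filter]
    refine Finset.sum_le_sum fun k hk => ?_
    split_ifs with hw
    · exact h.le_h hk hw hy
    · exact Finset.sum_nonneg fun w' hw' => mul_nonneg (h.a_nonneg k hk w' hw') (fp_nonneg _ _ _ _)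
  have h2 : ∀ k ∈ R, ∑ w' ∈ G k, a k w' * fp n (1 / 20) (rr k) (y - w') ≤
      2 * i0 * (C0 * δ) / T + (∑ p ∈ highPairs T i0, ((1 / (T : ℝ) ^ 2 : ℝ) : ℂ) *
        gp (Function.update n j M) (1 / 20) (rr k) (((((p.1 : ℝ) - p.2) * M) * (1 / 20)) • ηf (rr k) j)
          (G k) (a k) y).re := fun k hk =>
    sum_le_add_norm_high h.T_pos h.n_j (h.a_nonneg k hk)
      (mul_nonneg (by linarith) h.δ_nonneg) y (h.low_le hcell hk y)
  have h3 := h1.trans (Finset.sum_le_sum h2)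
  rw [Finset.sum_add_distrib, Finset.sum_const, nsmul_eq_mul, ← Complex.re_sum, Finset.sum_comm] at h3
  have h4 := Complex.re_le_norm (∑ p ∈ highPairs T i0, ((1 / (T : ℝ) ^ 2 : ℝ) : ℂ) *
        pairSum n j M R rr G a ((p.1 : ℝ) - p.2) y)
  simp only [pairSum, Finset.mul_sum] at h4 ⊢
  linarith

lemma mul_le_sum_count (h : CoreDat j C0 i0 m₁ m₂ mb J M T n ω A δ x X f R rr rJ G a H)
    (hC0 : 1 ≤ C0) :
    (R.card * x * (1 / 4) ^ N / 2) * f ≤ ∑ w ∈ H,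
      ((1 / 4 : ℝ) ^ N * ((R.filter fun k => w ∈ G k).card : ℝ) - R.card * (2 * i0 * (C0 * δ) / T)) := by
  have hT0 : (0 : ℝ) < T := by exact_mod_cast h.T_pos
  have h1 : ∑ w ∈ H, ((R.filter fun k => w ∈ G k).card : ℝ) = ∑ k ∈ R, ((G k ∩ H).card : ℝ) := by
    have := Finset.sum_card_bipartiteAbove_eq_sum_card_bipartiteBelow (s := H) (t := R)
      (fun w k => w ∈ G k)
    have e : ∀ k, Finset.bipartiteBelow (fun w k => w ∈ G k) H k = G k ∩ H := fun k => by
      ext w; simp [Finset.bipartiteBelow, and_comm]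
    simp only [e] at this
    exact_mod_cast this
  have h2 : R.card * (x * f) ≤ ∑ k ∈ R, ((G k ∩ H).card : ℝ) := by
    rw [← nsmul_eq_mul, ← Finset.sum_const]
    exact Finset.sum_le_sum h.GH
  have h3 : 2 * i0 * (C0 * δ) / T ≤ x * (1 / 4) ^ N / 2 := by
    rw [div_le_iff₀ hT0, one_div_pow]
    have := h.small
    have h4 : (0 : ℝ) < 4 ^ N := by positivity
    calc 2 * i0 * (C0 * δ) = δ * (4 * i0 * C0 * 4 ^ N) / (2 * 4 ^ N) := by field_simp; ring
      _ ≤ x * T / (2 * 4 ^ N) := by gcongr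
      _ = _ := by field_simp
  rw [Finset.sum_sub_distrib, ← Finset.mul_sum, h1, Finset.sum_const, nsmul_eq_mul]
  have h5 : (H.card : ℝ) * (R.card * (2 * i0 * (C0 * δ) / T)) ≤ f * (R.card * (x * (1 / 4) ^ N / 2)) := by
    have := h.H_card
    have := h.f_pos
    have := h.δ_nonneg
    gcongr
  have h6 : (1 / 4 : ℝ) ^ N * (R.card * (x * f)) ≤ (1 / 4 : ℝ) ^ N * ∑ k ∈ R, ((G k ∩ H).card : ℝ) := by
    gcongr
  nlinarith

end CoreDat

lemma exists_card_le (N : ℕ) (j : Fin N) (d : ℕ) (hd : 1 ≤ d) (hjd : j.1 + d + 1 = N) (ε : ℝ) (hε : 0 < ε) :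
    ∃ h : ℕ, 1 ≤ h ∧ ∃ i0 : ℕ, ∃ C0 Kc : ℝ, 1 ≤ C0 ∧ 0 < Kc ∧
    ∀ (m₁ m₂ mb J M T : ℕ) (n : Fin N → ℕ) (ω : Fin N → ℝ) (A δ x X f : ℝ) (R : Finset ℕ)
      (rr : ℕ → ℝ) (rJ : ℝ) (G : ℕ → Finset (Fin N → ℝ)) (a : ℕ → (Fin N → ℝ) → ℝ)
      (H : Finset (Fin N → ℝ)),
      CoreDat j C0 i0 m₁ m₂ mb J M T n ω A δ x X f R rr rJ G a H → R.Nonempty → ∀ K : ℕ,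
      m₁ + K * h = m₂ →
      (R.card : ℝ) ^ Tri d * x ^ (2 * Tri d) * ((∏ i, ω i) * ∏ i, (n i : ℝ)) ≤
        Kc * X * T ^ (2 * Tri d + 2) * ((8 : ℝ) ^ (m₁ - mb)) ^ (2 * Tri d) * exp (ε * (K * h)) * A := by
  obtain ⟨h, hh, κ, β, hκ, hβ, hMD⟩ := MD_all N j.1 d hd ε hε
  obtain ⟨C0, hC0, hcell⟩ := exists_cell_const N
  obtain ⟨i0, hi0⟩ := exists_nat_ge (max 20 (1 / κ))
  have hi20 : 20 ≤ i0 := by exact_mod_cast (le_max_left (20 : ℝ) _).trans hi0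
  have hiκ : 1 ≤ κ * i0 := by
    have := (le_max_right (20 : ℝ) _).trans hi0
    rwa [div_le_iff₀' hκ] at this
  have hβ' : 0 < min β (1 / (40 * 2 ^ N)) := lt_min hβ (by positivity)
  obtain ⟨P, hPf, hP, cP, hcP, hPle⟩ := exists_band_limited_measure N hβ'
  have hγ : (2 : ℝ) ^ N * min β (1 / (40 * 2 ^ N)) < 1 / 20 := by
    calc (2 : ℝ) ^ N * min β (1 / (40 * 2 ^ N)) ≤ 2 ^ N * (1 / (40 * 2 ^ N)) := by
          gcongr; exact min_le_right _ _
      _ = 1 / 40 := by field_simp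
      _ < 1 / 20 := by norm_num
  have hTri := Tri_pos hd
  refine ⟨h, hh, i0, C0, 6 ^ N * (4 * 4 ^ N) ^ (2 * Tri d) * 2 ^ Tri d * (P.real Set.univ + 1) / cP, hC0,
    by positivity, ?_⟩
  intro m₁ m₂ mb J M T n ω A δ x X f R rr rJ G a H D hR K hK
  have hT0 : (0 : ℝ) < T := by exact_mod_cast D.T_pos
  have hA := D.A_pos
  have hx := D.x_pos
  have hf := D.f_pos
  have hR1 : (0 : ℝ) < R.card := by exact_mod_cast hR.card_pos
  have hn0 : 0 < ∏ i, (n i : ℝ) := Finset.prod_pos fun i _ => by exact_mod_cast D.n_pos i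
  obtain ⟨k0, hk0⟩ := hR
  have hHne : H.Nonempty := by
    have h1 := D.GH k0 hk0
    have h2 : (0 : ℝ) < ((G k0 ∩ H).card : ℝ) := lt_of_lt_of_le (by positivity) h1
    have h3 : 0 < (G k0 ∩ H).card := by exact_mod_cast h2
    exact (Finset.card_pos.1 h3).mono Finset.inter_subset_right
  have hX : 0 ≤ X := by
    obtain ⟨w0, hw0⟩ := hHne
    have h1 : 0 ≤ X * f := le_trans (Nat.cast_nonneg _) (D.W w0 hw0)
    exact nonneg_of_mul_nonneg_left h1 hf
  set S := fun y => ∑ p ∈ CoreDat.highPairs T i0, ((1 / (T : ℝ) ^ 2 : ℝ) : ℂ) *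
        CoreDat.pairSum n j M R rr G a ((p.1 : ℝ) - p.2) y with hS
  have hScb : CB S := CB.sum _ fun p _ => CB.mul (CB.const _) (CoreDat.cb_pairSum n j M R rr G a _)
  set W : Set (Fin N → ℝ) := {y | ∀ i, |xc rJ i y| ≤ ω i / 12} with hW
  have hWc : IsClosed W := by
    have : W = ⋂ i, {y | |xc rJ i y| ≤ ω i / 12} := by ext y; simp [hW]
    rw [this]
    exact isClosed_iInter fun i => isClosed_le (continuous_xc rJ i).abs continuous_const
  have hWB : ∀ y ∈ W, ∀ i, |y i| ≤ 2 := by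
    intro y hy i
    have := abs_le_of_xc D.abs_rJ_le (B := 1 / 12) (fun i => (hy i).trans (by
      have := D.ω_le i; linarith)) i
    linarith
  have hWv : volume W ≠ ⊤ := by
    refine ((measure_mono (t := Set.Icc (fun _ => (-2 : ℝ)) (fun _ => 2)) ?_).trans_lt
      isCompact_Icc.measure_lt_top).ne
    intro y hy
    exact ⟨fun i => (abs_le.1 (hWB y hy i)).1, fun i => (abs_le.1 (hWB y hy i)).2⟩
  have hmean := smoothed_power_mean (H := H) (W := W)
    (B := Set.Icc (fun _ => (-3 : ℝ)) (fun _ => 3)) hWc.measurableSet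
    hWv measurableSet_Icc isCompact_Icc.measure_lt_top.ne hScb.norm (fun y => norm_nonneg _)
    (c := fun w => (1 / 4 : ℝ) ^ N * ((R.filter fun k => w ∈ G k).card : ℝ) -
      R.card * (2 * i0 * (C0 * δ) / T)) (b := R.card * x * (1 / 4) ^ N / 2) hf (by positivity)
    D.H_card hX
    (by
      intro w hw y hy
      have h1 := hWB _ hy
      have h2 := D.H_le w hw
      refine ⟨fun i => ?_, fun i => ?_⟩
      · have := abs_le.1 (h1 i); have := abs_le.1 (h2 i); simp only [Pi.sub_apply] at *; linarith
      · have := abs_le.1 (h1 i); have := abs_le.1 (h2 i); simp only [Pi.sub_apply] at *; linarith)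
    (fun w _ y hy => D.le_norm_pairSum hC0 hcell hy) (D.mul_le_sum_count hC0)
    (by
      intro y
      set Y := H.filter fun w => (W.indicator (fun _ => (1 : ℝ)) (y - w)) = 1 with hY
      have hYW : ∀ w ∈ Y, w ∈ H ∧ y - w ∈ W := by
        intro w hw
        obtain ⟨h1, h2⟩ := Finset.mem_filter.1 hw
        refine ⟨h1, ?_⟩
        by_contra h3
        simp [Set.indicator_of_notMem h3] at h2
      rcases Y.eq_empty_or_nonempty with hYe | ⟨w0, hw0⟩
      · rw [hYe]; simp only [Finset.card_empty, Nat.cast_zero]; positivity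
      · refine le_trans ?_ (D.W w0 (hYW w0 hw0).1)
        norm_cast
        refine Finset.card_le_card fun w hw => ?_
        refine Finset.mem_filter.2 ⟨(hYW w hw).1, fun i => ?_⟩
        have h1 := (hYW w hw).2 i
        have h2 := (hYW w0 hw0).2 i
        have e : w - w0 = (y - w0) - (y - w) := by abel
        rw [e, xc_sub]
        have h3 := D.ω_pos i
        calc _ ≤ |xc rJ i (y - w0)| + |xc rJ i (y - w)| := abs_sub _ _
          _ ≤ _ := by linarith)
    (p := 2 * Tri d) (by omega)
  have hvolW : volume.real W = (1 / 6) ^ N * ∏ i, ω i := by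
    rw [hW, volume_box rJ _ fun i => by have := D.ω_pos i; positivity]
    rw [show (1 / 6 : ℝ) ^ N = ∏ i : Fin N, (1 / 6 : ℝ) by simp, ← Finset.prod_mul_distrib]
    exact Finset.prod_congr rfl fun i _ => by ring
  set V : ℝ := ((8 : ℝ) ^ (m₁ - mb)) ^ (2 * Tri d) * (exp (ε * (K * h : ℕ)) * (2 * R.card) ^ Tri d *
        (T ^ (2 * Tri d) * (A * (P.real Set.univ + 1) / ∏ i, (n i : ℝ)))) with hV
  have hV0 : 0 ≤ V := by positivity
  have hint : ∫ y, ‖S y‖ ^ (2 * Tri d) ∂P ≤ T ^ 2 * V := by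
    calc ∫ y, ‖S y‖ ^ (2 * Tri d) ∂P ≤ ∫ y, ∑ p ∈ CoreDat.highPairs T i0,
          ‖CoreDat.pairSum n j M R rr G a ((p.1 : ℝ) - p.2) y‖ ^ (2 * Tri d) ∂P := by
          refine integral_mono (hScb.norm.pow _).integrable (integrable_finsetSum _ fun p _ =>
            ((CoreDat.cb_pairSum n j M R rr G a _).norm.pow _).integrable) fun y => ?_
          refine (norm_sum_pow_le _ _ (by omega)).trans ?_
          rw [Finset.mul_sum]
          refine Finset.sum_le_sum fun p _ => ?_
          rw [← mul_pow, norm_mul, Complex.norm_real, Real.norm_of_nonneg (by positivity), ← mul_assoc]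
          refine pow_le_pow_left₀ (by positivity) ?_ _
          refine mul_le_of_le_one_left (norm_nonneg _) ?_
          rw [mul_one_div, div_le_one (by positivity)]
          exact CoreDat.card_highPairs_le T i0
      _ = ∑ p ∈ CoreDat.highPairs T i0,
          ∫ y, ‖CoreDat.pairSum n j M R rr G a ((p.1 : ℝ) - p.2) y‖ ^ (2 * Tri d) ∂P :=
          integral_finsetSum _ fun p _ => ((CoreDat.cb_pairSum n j M R rr G a _).norm.pow _).integrable
      _ ≤ ∑ p ∈ CoreDat.highPairs T i0, V := by
          refine Finset.sum_le_sum fun p hp => ?_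
          refine D.integral_pair_le hd hjd hi20 hC0 hcell hβ'.le hP hγ hκ hiκ (min_le_left _ _) hK
            (fun Λ g s hm I hI => ?_) ⟨k0, hk0⟩ ?_
          · have := hMD Λ m₁ m₂ P g s hm K I hK hI
            push_cast
            exact this
          · have h1 := (Finset.mem_filter.1 hp).2
            push Not at h1
            exact_mod_cast h1
      _ ≤ _ := by
          rw [Finset.sum_const, nsmul_eq_mul]
          exact mul_le_mul_of_nonneg_right (CoreDat.card_highPairs_le T i0) hV0
  have hB := hPle (fun y => ‖S y‖ ^ (2 * Tri d)) (hScb.norm.pow _) fun y => by positivity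
  have hfin : (R.card * x * (1 / 4) ^ N / 2 / 2) ^ (2 * Tri d) * ((1 / 6) ^ N * ∏ i, ω i) ≤
      X * (T ^ 2 * V / cP) := by
    rw [← hvolW]
    refine hmean.trans (mul_le_mul_of_nonneg_left ?_ hX)
    rw [le_div_iff₀' hcP]
    exact hB.trans hint
  have e1 : (R.card * x * (1 / 4) ^ N / 2 / 2) ^ (2 * Tri d) * ((1 / 6) ^ N * ∏ i, ω i) =
    ((R.card : ℝ) ^ Tri d / (6 ^ N * (4 * 4 ^ N) ^ (2 * Tri d))) *
      ((R.card : ℝ) ^ Tri d * x ^ (2 * Tri d) * ∏ i, ω i) := by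
    have : (R.card * x * (1 / 4) ^ N / 2 / 2 : ℝ) = R.card * x / (4 * 4 ^ N) := by
      rw [one_div_pow]; field_simp; norm_num
    rw [this, div_pow, mul_pow, two_mul, pow_add (R.card : ℝ), one_div_pow]
    field_simp
  have e2 : X * (T ^ 2 * V / cP) = ((R.card : ℝ) ^ Tri d / (6 ^ N * (4 * 4 ^ N) ^ (2 * Tri d))) *
      ((6 ^ N * (4 * 4 ^ N) ^ (2 * Tri d) * 2 ^ Tri d * (P.real Set.univ + 1) / cP * X *
        T ^ (2 * Tri d + 2) * ((8 : ℝ) ^ (m₁ - mb)) ^ (2 * Tri d) * exp (ε * (K * h)) * A) /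
        ∏ i, (n i : ℝ)) := by
    rw [hV, mul_pow 2 (R.card : ℝ), pow_add (T : ℝ)]
    push_cast
    field_simp
  rw [e1, e2] at hfin
  have := le_of_mul_le_mul_left hfin (by positivity)
  rw [le_div_iff₀ hn0] at this
  linarith [this]

/-- For most `r`, a large part of `F` has few points in the boxes of side lengths `ℓ` adapted
to `r`. -/
def Good {N : ℕ} (F : Finset (Fin N → ℝ)) (ℓ : Fin N → ℝ) (x X : ℝ) : Prop :=
  ∃ E ⊆ Set.Icc (0 : ℝ) 1, volume E ≤ ENNReal.ofReal x ∧ ∀ r ∈ Set.Icc (0 : ℝ) 1, r ∉ E →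
    ∃ F' ⊆ F, ((F \ F').card : ℝ) ≤ x * F.card ∧
      ∀ w ∈ F', ((F'.filter fun w' => ∀ i, |xc r i (w' - w)| ≤ ℓ i).card : ℝ) ≤ X * F.card

/-- Greedy extraction of heavy boxes. -/
lemma exists_heavy_pieces {N : ℕ} (r τ : ℝ) (hτ : 0 < τ) (ℓ : Fin N → ℝ) :
    ∀ F : Finset (Fin N → ℝ), ∃ G ⊆ F, ∃ a : (Fin N → ℝ) → ℝ,
      (∀ w ∈ G, 0 ≤ a w ∧ a w ≤ 1 / τ) ∧
      (∀ w0 ∈ G, 1 ≤ ∑ w ∈ G with ∀ i, |xc r i (w - w0)| ≤ 2 * ℓ i, a w) ∧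
      ∀ w ∈ F \ G, (((F \ G).filter fun w' => ∀ i, |xc r i (w' - w)| ≤ ℓ i).card : ℝ) ≤ τ := by
  intro F
  induction F using Finset.strongInduction with
  | H F ih =>
  by_cases hF : ∃ z ∈ F, τ < ((F.filter fun w' => ∀ i, |xc r i (w' - z)| ≤ ℓ i).card : ℝ)
  · obtain ⟨z, hz, hzτ⟩ := hF
    set A := F.filter fun w' => ∀ i, |xc r i (w' - z)| ≤ ℓ i with hA
    have hApos : (0 : ℝ) < A.card := hτ.trans hzτ
    have hAne : A.Nonempty := Finset.card_pos.1 (by exact_mod_cast hApos)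
    have hAF : A ⊆ F := Finset.filter_subset _ _
    obtain ⟨G, hG, a, h1, h2, h3⟩ := ih (F \ A) (Finset.sdiff_ssubset hAF hAne)
    have hdisj : ∀ w ∈ G, w ∉ A := fun w hw => (Finset.mem_sdiff.1 (hG hw)).2
    refine ⟨G ∪ A, Finset.union_subset (hG.trans Finset.sdiff_subset) hAF,
      fun w => if w ∈ A then 1 / A.card else a w, ?_, ?_, ?_⟩
    · intro w hw
      simp only
      split_ifs with hwA
      · exact ⟨by positivity, one_div_le_one_div_of_le hτ hzτ.le⟩
      · exact h1 w ((Finset.mem_union.1 hw).resolve_right hwA)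
    · have hnn : ∀ w ∈ G ∪ A, 0 ≤ if w ∈ A then 1 / (A.card : ℝ) else a w := by
        intro w hw
        split_ifs with hwA
        · positivity
        · exact (h1 w ((Finset.mem_union.1 hw).resolve_right hwA)).1
      intro w0 hw0
      by_cases hw0A : w0 ∈ A
      · have : ∑ w ∈ A, (if w ∈ A then 1 / (A.card : ℝ) else a w) = 1 := by
          rw [Finset.sum_congr rfl fun w hw => if_pos hw, Finset.sum_const, nsmul_eq_mul]
          field_simp
        refine this.symm.le.trans ?_
        have hsub : A ⊆ (G ∪ A).filter fun w => ∀ i, |xc r i (w - w0)| ≤ 2 * ℓ i := by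
          intro w hw
          refine Finset.mem_filter.2 ⟨Finset.mem_union_right _ hw, fun i => ?_⟩
          have e1 := (Finset.mem_filter.1 hw).2 i
          have e2 := (Finset.mem_filter.1 hw0A).2 i
          rw [show w - w0 = (w - z) - (w0 - z) by abel, xc_sub]
          exact (abs_sub _ _).trans (by linarith)
        exact Finset.sum_le_sum_of_subset_of_nonneg hsub
          fun w hw _ => hnn w (Finset.mem_filter.1 hw).1
      · have hw0G := (Finset.mem_union.1 hw0).resolve_right hw0A
        refine (h2 w0 hw0G).trans ?_
        have e : ∑ w ∈ G with ∀ i, |xc r i (w - w0)| ≤ 2 * ℓ i, a w =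
            ∑ w ∈ G with ∀ i, |xc r i (w - w0)| ≤ 2 * ℓ i,
              if w ∈ A then 1 / (A.card : ℝ) else a w :=
          Finset.sum_congr rfl fun w hw => by
            rw [if_neg (hdisj w (Finset.mem_filter.1 hw).1)]
        rw [e]
        exact Finset.sum_le_sum_of_subset_of_nonneg
          (Finset.filter_subset_filter _ Finset.subset_union_left)
          fun w hw _ => hnn w (Finset.mem_filter.1 hw).1
    · have e : F \ (G ∪ A) = (F \ A) \ G := by
        ext w; simp only [Finset.mem_sdiff, Finset.mem_union]; tauto
      rw [e]
      exact h3
  · push Not at hF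
    refine ⟨∅, Finset.empty_subset _, fun _ => 0, by simp, by simp, ?_⟩
    simpa using hF

lemma mem_arc_of_mem_Ico {r : ℝ} (hr : r ∈ Set.Ico (0 : ℝ) 1) (m : ℕ) :
    ⌊r * 8 ^ m⌋₊ < 8 ^ m ∧ (⌊r * 8 ^ m⌋₊ : ℝ) / 8 ^ m ≤ r ∧ r ≤ ((⌊r * 8 ^ m⌋₊ : ℝ) + 1) / 8 ^ m := by
  have h8 : (0 : ℝ) < 8 ^ m := by positivity
  have h0 : 0 ≤ r * 8 ^ m := mul_nonneg hr.1 h8.le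
  refine ⟨?_, ?_, ?_⟩
  · rw [Nat.floor_lt h0]; push_cast; nlinarith [hr.2]
  · rw [div_le_iff₀ h8]; exact Nat.floor_le h0
  · rw [le_div_iff₀ h8]; exact (Nat.lt_floor_add_one _).le

/-- A set meeting few short arcs inside each long arc has small measure. -/
lemma volume_le_of_arcs {mb m₂ : ℕ} (hm : mb ≤ m₂) {B : ℝ} (hB : 0 ≤ B) {S : Set ℝ}
    (hS : S ⊆ Set.Ico 0 1)
    (h : ∀ J < 8 ^ mb, ∃ R : Finset ℕ, (R.card : ℝ) ≤ B ∧ ∀ r ∈ S, ⌊r * 8 ^ mb⌋₊ = J →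
      ⌊r * 8 ^ m₂⌋₊ ∈ R) :
    volume S ≤ ENNReal.ofReal (8 ^ mb * (B * (1 / 8) ^ m₂)) := by
  choose! R hR1 hR2 using h
  have hsub : S ⊆ ⋃ J ∈ Finset.range (8 ^ mb), ⋃ k ∈ R J,
      Set.Icc ((k : ℝ) / 8 ^ m₂) (((k : ℝ) + 1) / 8 ^ m₂) := by
    intro r hr
    have h1 := mem_arc_of_mem_Ico (hS hr) mb
    have h2 := mem_arc_of_mem_Ico (hS hr) m₂
    simp only [Set.mem_iUnion]
    exact ⟨_, Finset.mem_range.2 h1.1, _, hR2 _ h1.1 r hr rfl, h2.2⟩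
  refine (measure_mono hsub).trans ((measure_biUnion_finset_le _ _).trans ?_)
  have h8 : ∀ k : ℕ, volume (Set.Icc ((k : ℝ) / 8 ^ m₂) (((k : ℝ) + 1) / 8 ^ m₂)) =
      ENNReal.ofReal ((1 / 8) ^ m₂) := fun k => by
    rw [Real.volume_Icc]; congr 1; rw [one_div_pow]; ring
  have h9 : ∀ J ∈ Finset.range (8 ^ mb), volume (⋃ k ∈ R J,
      Set.Icc ((k : ℝ) / 8 ^ m₂) (((k : ℝ) + 1) / 8 ^ m₂)) ≤ ENNReal.ofReal (B * (1 / 8) ^ m₂) := by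
    intro J hJ
    refine (measure_biUnion_finset_le _ _).trans ?_
    simp only [h8, Finset.sum_const]
    rw [nsmul_eq_mul, ← ENNReal.ofReal_natCast, ← ENNReal.ofReal_mul (by positivity)]
    exact ENNReal.ofReal_le_ofReal (by have := hR1 J (Finset.mem_range.1 hJ); gcongr)
  refine (Finset.sum_le_sum h9).trans ?_
  rw [Finset.sum_const, Finset.card_range, nsmul_eq_mul, ← ENNReal.ofReal_natCast,
    ← ENNReal.ofReal_mul (by positivity)]
  exact ENNReal.ofReal_le_ofReal (by push_cast; exact le_rfl)

lemma good_of_scales {N : ℕ} {j : Fin N} {C0 : ℝ} {i0 m₁ m₂ mb M T : ℕ} {n : Fin N → ℕ}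
    {ω ℓ ℓ' : Fin N → ℝ} {F : Finset (Fin N → ℝ)} {x₁ x X X₁ X₂ B : ℝ}
    (hF : F.Nonempty) (hF1 : ∀ w ∈ F, ∀ i, |w i| ≤ 1)
    (hmb : mb ≤ m₁) (hm : m₁ ≤ m₂) (hn : ∀ i, 1 ≤ n i) (hM : 1 ≤ M) (hT : 1 ≤ T)
    (hnj : n j = M * T)
    (hi : ∀ i, j < i → n i * 8 ^ (m₂ * (i.1 - j.1)) ≤ M)
    (lo : ∀ i, i < j → n i ≤ M * 8 ^ (m₁ * (j.1 - i.1)))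
    (hω : ∀ i, 0 < ω i) (hω1 : ∀ i, ω i ≤ 1)
    (nω : ∀ i i', i ≤ i' → n i * (ω i' * ((1 / 8 : ℝ) ^ mb) ^ (i'.1 - i.1)) ≤ 4)
    (hℓ : ∀ i, n i * ℓ i ≤ 4) (hℓ' : ∀ i, 1 ≤ (Function.update n j M i : ℝ) * ℓ' i)
    (hlow : Good F ℓ' x₁ X₁) (hW : Good F ω x₁ X₂)
    (hx : 0 < x) (hx₁ : 4 * x₁ ≤ x) (hx₁0 : 0 ≤ x₁) (hX : 0 < X) (hX₁ : 0 ≤ X₁)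
    (hsmall : X₁ * (4 * i0 * C0 * 4 ^ N) ≤ X * (x / 2 * T)) (hB : 0 ≤ B)
    (hcore : ∀ J R rr rJ G a H, CoreDat j C0 i0 m₁ m₂ mb J M T n ω (1 / X) (X₁ / X) (x / 2) X₂ F.card
      R rr rJ G a H → R.Nonempty → (R.card : ℝ) ≤ B)
    (hvol : 2 * x₁ + 8 ^ mb * (B * (1 / 8) ^ m₂) ≤ x) : Good F ℓ x X := by
  obtain ⟨E₁, hE₁, hvE₁, hg₁⟩ := hlow
  obtain ⟨E₂, hE₂, hvE₂, hg₂⟩ := hW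
  have hF0 : (0 : ℝ) < F.card := by exact_mod_cast hF.card_pos
  set gd : ℝ → Prop := fun r => ∃ F' ⊆ F, ((F \ F').card : ℝ) ≤ x * F.card ∧
      ∀ w ∈ F', ((F'.filter fun w' => ∀ i, |xc r i (w' - w)| ≤ ℓ i).card : ℝ) ≤ X * F.card with hgd
  set S : Set ℝ := {r | r ∈ Set.Ico (0 : ℝ) 1 ∧ ¬ gd r ∧ r ∉ E₁ ∧ r ∉ E₂} with hS
  -- the data at a bad parameter
  have hbad : ∀ r ∈ S, ∃ G ⊆ F, ∃ a : (Fin N → ℝ) → ℝ, (∀ w ∈ G, 0 ≤ a w ∧ a w ≤ 1 / (X * F.card)) ∧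
      (∀ w0 ∈ G, 1 ≤ ∑ w ∈ G with ∀ i, |xc r i (w - w0)| ≤ 2 * ℓ i, a w) ∧
      (∀ w0 ∈ G, ∑ w ∈ G with ∀ i, |xc r i (w - w0)| ≤ ℓ' i, a w ≤ X₁ / X) ∧
      (x - x₁) * F.card ≤ (G.card : ℝ) := by
    intro r hr
    obtain ⟨F₁, hF₁, hc₁, hb₁⟩ := hg₁ r ⟨hr.1.1, hr.1.2.le⟩ hr.2.2.1
    obtain ⟨G, hG, a, h1, h2, h3⟩ := exists_heavy_pieces r (X * F.card) (by positivity) ℓ F₁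
    refine ⟨G, hG.trans hF₁, a, h1, h2, fun w0 hw0 => ?_, ?_⟩
    · have hcard : ((G.filter fun w => ∀ i, |xc r i (w - w0)| ≤ ℓ' i).card : ℝ) ≤ X₁ * F.card :=
        le_trans (by exact_mod_cast Finset.card_le_card (Finset.filter_subset_filter _ hG))
          (hb₁ w0 (hG hw0))
      calc _ ≤ ∑ w ∈ G with ∀ i, |xc r i (w - w0)| ≤ ℓ' i, 1 / (X * F.card) :=
            Finset.sum_le_sum fun w hw => (h1 w (Finset.mem_filter.1 hw).1).2
        _ = ((G.filter fun w => ∀ i, |xc r i (w - w0)| ≤ ℓ' i).card : ℝ) * (1 / (X * F.card)) := by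
            rw [Finset.sum_const, nsmul_eq_mul]
        _ ≤ X₁ * F.card * (1 / (X * F.card)) := by gcongr
        _ = _ := by field_simp
    · by_contra hcon
      push Not at hcon
      refine hr.2.1 ⟨F₁ \ G, Finset.sdiff_subset.trans hF₁, ?_, h3⟩
      have : F \ (F₁ \ G) ⊆ (F \ F₁) ∪ G := by
        intro w; simp only [Finset.mem_sdiff, Finset.mem_union]; tauto
      have h4 : ((F \ (F₁ \ G)).card : ℝ) ≤ (F \ F₁).card + G.card := by
        exact_mod_cast (Finset.card_le_card this).trans (Finset.card_union_le _ _)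
      linarith
  have hSv : volume S ≤ ENNReal.ofReal (8 ^ mb * (B * (1 / 8) ^ m₂)) := by
    refine volume_le_of_arcs (hmb.trans hm) hB (fun r hr => hr.1) fun J hJ => ?_
    by_cases hne : ∃ r ∈ S, ⌊r * 8 ^ mb⌋₊ = J
    swap
    · push Not at hne
      exact ⟨∅, by simpa using hB, fun r hr h => absurd h (hne r hr)⟩
    obtain ⟨rJ, hrJ, hrJJ⟩ := hne
    obtain ⟨H, hHF, hHc, hHb⟩ := hg₂ rJ ⟨hrJ.1.1, hrJ.1.2.le⟩ hrJ.2.2.2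
    classical
    set R : Finset ℕ := (Finset.Ico (J * 8 ^ (m₂ - mb)) ((J + 1) * 8 ^ (m₂ - mb))).filter
      fun k => ∃ r ∈ S, ⌊r * 8 ^ m₂⌋₊ = k with hR
    have hRS : ∀ k ∈ R, ∃ r ∈ S, ⌊r * 8 ^ m₂⌋₊ = k := fun k hk => (Finset.mem_filter.1 hk).2
    choose! rr hrrS hrrk using hRS
    choose! G hGF a h1 h2 h3 h4 using hbad
    have hmemR : ∀ r ∈ S, ⌊r * 8 ^ mb⌋₊ = J → ⌊r * 8 ^ m₂⌋₊ ∈ R := by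
      intro r hr hrJ'
      refine Finset.mem_filter.2 ⟨?_, r, hr, rfl⟩
      have e : (8 : ℝ) ^ m₂ = 8 ^ mb * 8 ^ (m₂ - mb) := by rw [← pow_add]; congr 1; omega
      have hf1 := Nat.floor_le (mul_nonneg hr.1.1 (by positivity : (0 : ℝ) ≤ 8 ^ mb))
      have hf2 := Nat.lt_floor_add_one (r * 8 ^ mb)
      rw [hrJ'] at hf1 hf2
      rw [Finset.mem_Ico]
      constructor
      · refine Nat.le_floor ?_
        rw [e, ← mul_assoc]; push_cast; gcongr
      · rw [Nat.floor_lt (mul_nonneg hr.1.1 (by positivity)), e, ← mul_assoc]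
        push_cast; gcongr
    refine ⟨R, ?_, hmemR⟩
    refine hcore J R rr rJ (fun k => G (rr k)) (fun k => a (rr k)) H ?_ ⟨_, hmemR rJ hrJ hrJJ⟩
    have hrJarc := mem_arc_of_mem_Ico hrJ.1 mb
    rw [hrJJ] at hrJarc
    refine ⟨hmb, hm, hJ, Finset.filter_subset _ _, fun k hk => ?_, fun k hk => ?_, hrJarc.2.1,
      hrJarc.2.2, hn, hM, hT, hnj, hi, lo, hω, hω1, nω, by positivity, by positivity,
      fun k hk w hw => hF1 w (hGF _ (hrrS k hk) hw), fun k hk w hw => (h1 _ (hrrS k hk) w hw).1,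
      fun k hk => ?_, fun k hk w0 hw0 => ?_, fun k hk w0 hw0 => ?_, fun w hw => hF1 w (hHF hw),
      hF0, by exact_mod_cast Finset.card_le_card hHF, fun k hk => ?_, by positivity, hHb, ?_⟩
    · have := (mem_arc_of_mem_Ico (hrrS k hk).1 m₂).2.1
      rwa [hrrk k hk] at this
    · have := (mem_arc_of_mem_Ico (hrrS k hk).1 m₂).2.2
      rwa [hrrk k hk] at this
    · calc ∑ w ∈ G (rr k), a (rr k) w ≤ ∑ w ∈ G (rr k), 1 / (X * F.card) :=
            Finset.sum_le_sum fun w hw => (h1 _ (hrrS k hk) w hw).2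
        _ = (G (rr k)).card * (1 / (X * F.card)) := by rw [Finset.sum_const, nsmul_eq_mul]
        _ ≤ F.card * (1 / (X * F.card)) := by
            gcongr
            exact hGF _ (hrrS k hk)
        _ = _ := by field_simp
    · refine le_trans (Finset.sum_le_sum_of_subset_of_nonneg ?_ fun w hw _ =>
        (h1 _ (hrrS k hk) w (Finset.mem_filter.1 hw).1).1) (h3 _ (hrrS k hk) w0 hw0)
      intro w hw
      obtain ⟨e1, e2⟩ := Finset.mem_filter.1 hw
      refine Finset.mem_filter.2 ⟨e1, fun i => ?_⟩
      have hup : (0 : ℝ) < (Function.update n j M i : ℝ) := by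
        by_cases hij : i = j
        · rw [hij, Function.update_self]; exact_mod_cast hM
        · rw [Function.update_of_ne hij]; exact_mod_cast hn i
      exact le_of_mul_le_mul_left ((e2 i).trans (hℓ' i)) hup
    · refine le_trans (h2 _ (hrrS k hk) w0 hw0) (Finset.sum_le_sum_of_subset_of_nonneg ?_ fun w hw _ =>
        (h1 _ (hrrS k hk) w (Finset.mem_filter.1 hw).1).1)
      intro w hw
      obtain ⟨e1, e2⟩ := Finset.mem_filter.1 hw
      refine Finset.mem_filter.2 ⟨e1, fun i => ?_⟩
      have := mul_le_mul_of_nonneg_left (e2 i) (Nat.cast_nonneg (α := ℝ) (n i))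
      have := hℓ i
      linarith
    · have hGk : ((G (rr k)).card : ℝ) ≤ (G (rr k) ∩ H).card + (F \ H).card := by
        have : G (rr k) ⊆ (G (rr k) ∩ H) ∪ (F \ H) := by
          intro w hw
          have := hGF _ (hrrS k hk) hw
          simp only [Finset.mem_union, Finset.mem_inter, Finset.mem_sdiff]; tauto
        exact_mod_cast (Finset.card_le_card this).trans (Finset.card_union_le _ _)
      have := h4 _ (hrrS k hk)
      nlinarith
    · rw [div_mul_eq_mul_div, div_le_iff₀ hX]
      linarith
  refine ⟨{r | r ∈ Set.Icc (0 : ℝ) 1 ∧ ¬ gd r}, fun r hr => hr.1, ?_, fun r hr hrE => ?_⟩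
  · have hsub : {r | r ∈ Set.Icc (0 : ℝ) 1 ∧ ¬ gd r} ⊆ (E₁ ∪ E₂) ∪ (S ∪ {1}) := by
      intro r hr
      by_cases h1 : r = 1
      · exact Or.inr (Or.inr h1)
      by_cases h2 : r ∈ E₁
      · exact Or.inl (Or.inl h2)
      by_cases h3 : r ∈ E₂
      · exact Or.inl (Or.inr h3)
      exact Or.inr (Or.inl ⟨⟨hr.1.1, lt_of_le_of_ne hr.1.2 h1⟩, hr.2, h2, h3⟩)
    calc _ ≤ volume ((E₁ ∪ E₂) ∪ (S ∪ {1})) := measure_mono hsub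
      _ ≤ (volume E₁ + volume E₂) + (volume S + volume {(1 : ℝ)}) :=
          (measure_union_le _ _).trans (add_le_add (measure_union_le _ _) (measure_union_le _ _))
      _ ≤ (ENNReal.ofReal x₁ + ENNReal.ofReal x₁) +
            (ENNReal.ofReal (8 ^ mb * (B * (1 / 8) ^ m₂)) + 0) := by
          gcongr
          simp
      _ ≤ _ := by
          rw [add_zero, ← ENNReal.ofReal_add hx₁0 hx₁0, ← ENNReal.ofReal_add (by positivity) (by positivity)]
          exact ENNReal.ofReal_le_ofReal (by linarith)
  · by_contra hcon
    exact hrE ⟨hr, hcon⟩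

/-- The multislicing statement with box exponents `q` and loss `η`, uniformly over all sets that
are spread out at scales above `1 / L`. -/
def Slice {N : ℕ} (q : Fin N → ℝ) (η : ℝ) : Prop :=
  ∃ c : ℝ, 0 < c ∧ ∃ L₀ : ℝ, 1 ≤ L₀ ∧ ∀ L, L₀ ≤ L → ∀ e : Fin N → ℝ, (∀ i, 0 ≤ e i ∧ e i ≤ 1) →
    ∀ C : ℝ, 1 ≤ C → ∀ F : Finset (Fin N → ℝ), F.Nonempty → (∀ w ∈ F, ∀ i, |w i| ≤ 1) →
    (∀ (z : Fin N → ℝ) (ρ : ℝ), 1 / L ≤ ρ → ρ ≤ 1 →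
      ((F.filter fun w => ∀ i, |w i - z i| ≤ ρ).card : ℝ) ≤ C * ρ ^ (∑ i, e i) * F.card) →
    Good F (fun i => L ^ (-q i)) (L ^ (-c)) (C * L ^ (-(∑ i, e i * q i) + η))

lemma Good.mono {N : ℕ} {F : Finset (Fin N → ℝ)} {ℓ ℓ' : Fin N → ℝ} {x x' X X' : ℝ}
    (h : Good F ℓ x X) (hℓ : ∀ i, ℓ' i ≤ ℓ i) (hx : x ≤ x') (hX : X ≤ X') : Good F ℓ' x' X' := by
  obtain ⟨E, hE, hv, hg⟩ := h
  refine ⟨E, hE, hv.trans (ENNReal.ofReal_le_ofReal hx), fun r hr hrE => ?_⟩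
  obtain ⟨F', hF', hc, hb⟩ := hg r hr hrE
  refine ⟨F', hF', hc.trans (by gcongr), fun w hw => ?_⟩
  calc ((F'.filter fun w' => ∀ i, |xc r i (w' - w)| ≤ ℓ' i).card : ℝ)
      ≤ (F'.filter fun w' => ∀ i, |xc r i (w' - w)| ≤ ℓ i).card := by
        have : (F'.filter fun w' => ∀ i, |xc r i (w' - w)| ≤ ℓ' i) ⊆
            F'.filter fun w' => ∀ i, |xc r i (w' - w)| ≤ ℓ i := by
          intro w' hw'
          obtain ⟨h1, h2⟩ := Finset.mem_filter.1 hw'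
          exact Finset.mem_filter.2 ⟨h1, fun i => (h2 i).trans (hℓ i)⟩
        exact_mod_cast Finset.card_le_card this
    _ ≤ X * F.card := hb w hw
    _ ≤ X' * F.card := by gcongr

lemma ceil_le_two_mul {x : ℝ} (hx : 1 ≤ x) : (⌈x⌉₊ : ℝ) ≤ 2 * x := by
  have := (Nat.ceil_lt_add_one (by linarith : 0 ≤ x)).le
  linarith

lemma exists_scales {L b y t : ℝ} (hL : 1 ≤ L) (hb : 0 ≤ b) (hy : 0 < y) (hyt : 4 * y ≤ t - b)
    (hLy : 32 ≤ L ^ y) {h : ℕ} (hh : 1 ≤ h) :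
    ∃ mb m₁ K : ℕ, mb ≤ m₁ ∧ L ^ b ≤ 8 ^ mb ∧ (8 : ℝ) ^ mb ≤ 8 * L ^ b ∧ 2 * L ^ (b + y) ≤ 8 ^ m₁ ∧
      (8 : ℝ) ^ (m₁ - mb) ≤ 16 * L ^ y ∧ 2 * 8 ^ (m₁ + K * h) ≤ L ^ (t - y) ∧
      L ^ (t - y) ≤ 2 * 8 ^ h * 8 ^ (m₁ + K * h) := by
  have hL0 : 0 < L := by linarith
  have hb1 : 1 ≤ L ^ b := Real.one_le_rpow hL hb
  obtain ⟨u, hu1, hu2⟩ := exists_nat_pow_near hb1 (by norm_num : (1 : ℝ) < 8)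
  have hby : 1 ≤ 2 * L ^ (b + y) := by
    have := Real.one_le_rpow hL (by linarith : 0 ≤ b + y); linarith
  obtain ⟨v, hv1, hv2⟩ := exists_nat_pow_near hby (by norm_num : (1 : ℝ) < 8)
  have hbyy : L ^ b ≤ L ^ (b + y) := Real.rpow_le_rpow_of_exponent_le hL (by linarith)
  have hty : 16 * L ^ (b + y) ≤ L ^ (t - y) / 2 := by
    have h1 : L ^ (b + y + y) ≤ L ^ (t - y) := Real.rpow_le_rpow_of_exponent_le hL (by linarith)
    rw [Real.rpow_add hL0 (b + y)] at h1
    have : 0 < L ^ (b + y) := by positivity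
    nlinarith
  have h8 : (8 : ℝ) ^ (v + 1) ≤ 16 * L ^ (b + y) := by rw [pow_succ]; linarith
  obtain ⟨K, hK1, hK2⟩ := exists_nat_pow_near (x := L ^ (t - y) / 2 / 8 ^ (v + 1))
    (by rw [le_div_iff₀ (by positivity)]; linarith) (y := (8 : ℝ) ^ h)
    (one_lt_pow₀ (by norm_num) (by omega))
  rw [le_div_iff₀ (by positivity)] at hK1
  rw [div_lt_iff₀ (by positivity)] at hK2
  have huv : u ≤ v := by
    by_contra hcon
    have h1 : (8 : ℝ) ^ (v + 1) ≤ 8 ^ u := pow_le_pow_right₀ (by norm_num) (by omega)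
    linarith
  refine ⟨u + 1, v + 1, K, by omega, hu2.le, by rw [pow_succ]; linarith, hv2.le, ?_, ?_, ?_⟩
  · have e : (8 : ℝ) ^ (v + 1) = 8 ^ (v + 1 - (u + 1)) * 8 ^ (u + 1) := by
      rw [← pow_add]; congr 1; omega
    have h1 : (8 : ℝ) ^ (v + 1 - (u + 1)) * L ^ b ≤ 16 * L ^ y * L ^ b := by
      calc _ ≤ (8 : ℝ) ^ (v + 1 - (u + 1)) * 8 ^ (u + 1) := by gcongr
        _ = 8 ^ (v + 1) := e.symm
        _ ≤ _ := by rw [mul_assoc, ← Real.rpow_add hL0, add_comm y b]; exact h8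
    exact le_of_mul_le_mul_right h1 (by positivity)
  · rw [pow_add 8 (v + 1), mul_comm K h, pow_mul]; linarith
  · rw [pow_add 8 (v + 1), mul_comm K h, pow_mul]
    rw [pow_succ] at hK2
    linarith

lemma count_le_of_core {D : ℕ} (hD : 1 ≤ D) {L r x V X X₂ T Q E Kc c y t b η' η₂ ε : ℝ} (hL : 1 ≤ L)
    (hr : 0 ≤ r) (hx : x = L ^ (-c)) (hVl : L ^ (-((t - b) * D)) ≤ V) (hX : 0 < X) (hX₂0 : 0 ≤ X₂)
    (hX₂ : X₂ ≤ X * L ^ (η₂ - η')) (hT0 : 0 ≤ T) (hT : T ≤ 2 * L ^ y) (hQ0 : 0 ≤ Q)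
    (hQ : Q ≤ 16 * L ^ y) (hE0 : 0 ≤ E) (hE : E ≤ L ^ ε) (hKc : 0 < Kc)
    (hexp : η₂ - η' + y * (5 * D + 2) + ε + 4 * c * D ≤ 0)
    (h : r ^ D * (x / 2) ^ (2 * D) * V ≤
      Kc * X₂ * T ^ (2 * D + 2) * Q ^ (2 * D) * E * (1 / X)) :
    r ≤ max 1 (Kc * 2 ^ (4 * D + 2) * 16 ^ (2 * D)) * L ^ (t - b - y - 2 * c) := by
  have hL0 : 0 < L := by linarith
  set K := max 1 (Kc * 2 ^ (4 * D + 2) * 16 ^ (2 * D)) with hK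
  have hK1 : 1 ≤ K := le_max_left _ _
  have h1 : r ^ D * (L ^ (-(2 * c * D)) * (1 / 2) ^ (2 * D)) * L ^ (-((t - b) * D)) ≤
      Kc * (X * L ^ (η₂ - η')) * (2 ^ (2 * D + 2) * L ^ (y * (2 * D + 2))) *
        (16 ^ (2 * D) * L ^ (y * (2 * D))) * L ^ ε * (1 / X) := by
    have e1 : (x / 2) ^ (2 * D) = L ^ (-(2 * c * D)) * (1 / 2) ^ (2 * D) := by
      rw [hx, div_eq_mul_one_div, mul_pow, ← Real.rpow_mul_natCast hL0.le]
      congr 2; push_cast; ring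
    have e2 : (2 * L ^ y) ^ (2 * D + 2) = 2 ^ (2 * D + 2) * L ^ (y * (2 * D + 2)) := by
      rw [mul_pow, ← Real.rpow_mul_natCast hL0.le]; push_cast; rfl
    have e3 : (16 * L ^ y) ^ (2 * D) = 16 ^ (2 * D) * L ^ (y * (2 * D)) := by
      rw [mul_pow, ← Real.rpow_mul_natCast hL0.le]; push_cast; rfl
    rw [e1] at h
    rw [← e2, ← e3]
    calc _ ≤ r ^ D * (L ^ (-(2 * c * D)) * (1 / 2) ^ (2 * D)) * V := by gcongr
      _ ≤ _ := h
      _ ≤ _ := by gcongr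
  have h2 : r ^ D ≤ Kc * 2 ^ (4 * D + 2) * 16 ^ (2 * D) *
      L ^ (η₂ - η' + y * (2 * D + 2) + y * (2 * D) + ε + (2 * c * D) + (t - b) * D) := by
    rw [Real.rpow_add hL0, Real.rpow_add hL0, Real.rpow_add hL0, Real.rpow_add hL0, Real.rpow_add hL0]
    rw [Real.rpow_neg hL0.le, Real.rpow_neg hL0.le] at h1
    have p1 : 0 < L ^ (2 * c * D) := by positivity
    have p2 : 0 < L ^ ((t - b) * D) := by positivity
    have e4 : (2 : ℝ) ^ (4 * D + 2) = 2 ^ (2 * D + 2) * 2 ^ (2 * D) := by rw [← pow_add]; congr 1; ring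
    rw [e4]
    have h3 : r ^ D * ((L ^ (2 * c * D))⁻¹ * (1 / 2) ^ (2 * D)) * (L ^ ((t - b) * D))⁻¹ =
      r ^ D / (L ^ (2 * c * D) * 2 ^ (2 * D) * L ^ ((t - b) * D)) := by
      rw [one_div_pow]; field_simp
    rw [h3, div_le_iff₀ (by positivity)] at h1
    refine h1.trans (le_of_eq ?_)
    field_simp
  have h4 : r ^ D ≤ (K * L ^ (t - b - y - 2 * c)) ^ D := by
    rw [mul_pow, ← Real.rpow_mul_natCast hL0.le]
    refine h2.trans (mul_le_mul ?_ ?_ (by positivity) (by positivity))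
    · exact (le_max_right _ _).trans (le_self_pow₀ hK1 (by omega))
    · refine Real.rpow_le_rpow_of_exponent_le hL ?_
      nlinarith
  exact le_of_pow_le_pow_left₀ (by omega) (by positivity) h4

lemma sum_tsub_eq_Tri {N : ℕ} (j : Fin N) {d : ℕ} (hjd : j.1 + d + 1 = N) :
    ∑ i : Fin N, ((i.1 - j.1 : ℕ) : ℝ) = Tri d := by
  obtain ⟨k, hk⟩ := j
  simp only at hjd ⊢
  subst hjd
  rw [Fin.sum_univ_eq_sum_range (fun i => ((i - k : ℕ) : ℝ)) (k + d + 1), add_assoc,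
    Finset.sum_range_add]
  have h1 : ∑ i ∈ Finset.range k, ((i - k : ℕ) : ℝ) = 0 :=
    Finset.sum_eq_zero fun i hi => by
      rw [Nat.sub_eq_zero_of_le (Finset.mem_range.1 hi).le, Nat.cast_zero]
  rw [h1, zero_add]
  have h2 : ∑ i ∈ Finset.range (d + 1), ((k + i - k : ℕ) : ℝ) =
      ((∑ i ∈ Finset.range (d + 1), i : ℕ) : ℝ) := by
    push_cast
    exact Finset.sum_congr rfl fun i _ => by rw [Nat.add_sub_cancel_left]
  rw [h2, Finset.sum_range_id, Tri, Nat.add_sub_cancel, mul_comm]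

lemma exists_threshold {c : ℝ} (hc : 0 < c) (A : ℝ) : ∃ L₀ : ℝ, 1 ≤ L₀ ∧ ∀ L, L₀ ≤ L → A ≤ L ^ c := by
  refine ⟨max 1 ((max A 1) ^ (1 / c)), le_max_left _ _, fun L hL => ?_⟩
  have h1 : (max A 1) ^ (1 / c) ≤ L := (le_max_right _ _).trans hL
  have h0 : (0 : ℝ) < max A 1 := lt_of_lt_of_le one_pos (le_max_right _ _)
  calc A ≤ max A 1 := le_max_left _ _
    _ = ((max A 1) ^ (1 / c)) ^ c := by
      rw [← Real.rpow_mul h0.le, one_div_mul_cancel hc.ne', Real.rpow_one]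
    _ ≤ L ^ c := Real.rpow_le_rpow (by positivity) h1 hc.le

lemma le_add_of_slopes {N : ℕ} {j : Fin N} {q : Fin N → ℝ} {t b : ℝ} (hbt : b ≤ t)
    (hqj : ∀ i, j ≤ i → q i = q j - ((i.1 - j.1 : ℕ) : ℝ) * t)
    (hql : ∀ i i', i ≤ i' → i' ≤ j → q i ≤ q i' + ((i'.1 - i.1 : ℕ) : ℝ) * b) {i i' : Fin N}
    (hii : i ≤ i') :
    q i ≤ q i' + ((i'.1 - j.1 : ℕ) : ℝ) * (t - b) + ((i'.1 - i.1 : ℕ) : ℝ) * b := by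
  have hii' : i.1 ≤ i'.1 := hii
  rcases le_total i' j with h1 | h1
  · have h2 := hql i i' hii h1
    have : 0 ≤ ((i'.1 - j.1 : ℕ) : ℝ) * (t - b) := mul_nonneg (Nat.cast_nonneg _) (by linarith)
    linarith
  · have h1' : j.1 ≤ i'.1 := h1
    rw [hqj i' h1]
    rcases le_total i j with h2 | h2
    · have h2' : i.1 ≤ j.1 := h2
      have := hql i j h2 le_rfl
      rw [Nat.cast_sub h1', Nat.cast_sub hii']
      rw [Nat.cast_sub h2'] at this
      linarith
    · have h2' : j.1 ≤ i.1 := h2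
      rw [hqj i h2, Nat.cast_sub h1', Nat.cast_sub hii', Nat.cast_sub h2']
      have h3 : (0 : ℝ) ≤ (i.1 : ℝ) - j.1 := by rw [sub_nonneg]; exact_mod_cast h2'
      have h4 := mul_le_mul_of_nonneg_left hbt h3
      linarith

set_option maxHeartbeats 2000000 in
lemma Slice_key {N : ℕ} (j : Fin N) (d : ℕ) (hd : 1 ≤ d) (hjd : j.1 + d + 1 = N) {q : Fin N → ℝ}
    {t b y η' η₁ η₂ : ℝ} (hq0 : ∀ i, 0 ≤ q i) (hb : 0 ≤ b) (ht : t ≤ 1)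
    (hqj : ∀ i, j ≤ i → q i = q j - ((i.1 - j.1 : ℕ) : ℝ) * t)
    (hql : ∀ i i', i ≤ i' → i' ≤ j → q i ≤ q i' + ((i'.1 - i.1 : ℕ) : ℝ) * b)
    (hy : 0 < y) (hyt : 4 * y ≤ t - b) (hη₁ : η₁ < η') (hη₂ : η₂ + (5 * Tri d + 2) * y < η')
    (hlow : Slice (Function.update q j (q j - y)) η₁)
    (hW : Slice (fun i => q i + ((i.1 - j.1 : ℕ) : ℝ) * (t - b)) η₂) : Slice q η' := by
  set D : ℝ := (Tri d : ℝ) with hD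
  have hD1 : 1 ≤ Tri d := by
    have := two_mul_Tri d
    have : d * (d + 1) ≥ 1 * 2 := Nat.mul_le_mul hd (by omega)
    omega
  have hD1' : 1 ≤ D := by rw [hD]; exact_mod_cast hD1
  obtain ⟨c₁, hc₁, L₁, hL₁, hlow⟩ := hlow
  obtain ⟨c₂, hc₂, L₂, hL₂, hW⟩ := hW
  set μ := η' - η₂ - (5 * D + 2) * y with hμ
  have hμ0 : 0 < μ := by linarith
  obtain ⟨h, hh, i0, C0, Kc, hC0, hKc, hmain⟩ := exists_card_le N j d hd hjd (μ / 2) (by linarith)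
  set c := min (min (c₁ / 2) (c₂ / 2)) (min ((η' - η₁) / 2) (μ / (8 * D))) with hc
  have hc0 : 0 < c := by
    refine lt_min (lt_min (by linarith) (by linarith)) (lt_min (by linarith) (by positivity))
  have hcc₁ : 2 * c ≤ c₁ := by
    have := (min_le_left _ _ : c ≤ _).trans (min_le_left _ _); linarith
  have hcc₂ : 2 * c ≤ c₂ := by
    have := (min_le_left _ _ : c ≤ _).trans (min_le_right _ _); linarith
  have hcη : 2 * c ≤ η' - η₁ := by
    have := (min_le_right _ _ : c ≤ _).trans (min_le_left _ _); linarith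
  have hcμ : 8 * c * D ≤ μ := by
    have := (min_le_right _ _ : c ≤ _).trans (min_le_right _ _)
    rw [le_div_iff₀ (by positivity)] at this; linarith
  set K3 := max 1 (Kc * 2 ^ (4 * Tri d + 2) * 16 ^ (2 * Tri d)) with hK3
  clear_value c μ
  have hK31 : 1 ≤ K3 := le_max_left _ _
  clear_value K3
  obtain ⟨L₃, hL₃, hbig₃⟩ := exists_threshold hc0 (max 4 (max (2 * (4 * i0 * C0 * 4 ^ N)) (32 * 8 ^ h * K3)))
  obtain ⟨L₄, hL₄, hbig₄⟩ := exists_threshold hy 32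
  refine ⟨c, hc0, max (max L₁ L₂) (max L₃ L₄), le_max_of_le_left (le_max_of_le_left hL₁), ?_⟩
  intro L hL e he C hC F hF hF1 hsp
  have hLL₁ : L₁ ≤ L := ((le_max_left _ _).trans (le_max_left _ _)).trans hL
  have hLL₂ : L₂ ≤ L := ((le_max_right _ _).trans (le_max_left _ _)).trans hL
  have hLL₃ : L₃ ≤ L := ((le_max_left _ _).trans (le_max_right _ _)).trans hL
  have hLL₄ : L₄ ≤ L := ((le_max_right _ _).trans (le_max_right _ _)).trans hL
  have hL1 : 1 ≤ L := hL₁.trans hLL₁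
  have hL0 : 0 < L := by linarith
  have hLy := hbig₄ L hLL₄
  have hLc := hbig₃ L hLL₃
  have hLc4 : 4 ≤ L ^ c := (le_max_left _ _).trans hLc
  have hLcs : 2 * (4 * i0 * C0 * 4 ^ N) ≤ L ^ c :=
    ((le_max_left _ _).trans (le_max_right _ _)).trans hLc
  have hLcv : 32 * 8 ^ h * K3 ≤ L ^ c :=
    ((le_max_right _ _).trans (le_max_right _ _)).trans hLc
  replace hlow := hlow L hLL₁ e he C hC F hF hF1 hsp
  replace hW := hW L hLL₂ e he C hC F hF hF1 hsp
  have mono {u v : ℝ} (huv : u ≤ v) : L ^ u ≤ L ^ v := Real.rpow_le_rpow_of_exponent_le hL1 huv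
  have pos (u : ℝ) : 0 < L ^ u := Real.rpow_pos_of_pos hL0 u
  have one_le {u : ℝ} (hu : 0 ≤ u) : 1 ≤ L ^ u := Real.one_le_rpow hL1 hu
  obtain ⟨mb, m₁, K, hmb, hmb1, hmb2, hm₁, hQ, hm₂, hm₂'⟩ := exists_scales hL1 hb hy hyt hLy hh
  set m₂ := m₁ + K * h with hm₂d
  -- the parameters
  have hqjt : t ≤ q j := by
    have h1 := hqj ⟨j.1 + 1, by omega⟩ (by simp [Fin.le_def])
    have h2 := hq0 ⟨j.1 + 1, by omega⟩
    rw [h1] at h2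
    simp only [Nat.add_sub_cancel_left, Nat.cast_one, one_mul] at h2
    linarith
  set T := ⌈L ^ y⌉₊ with hT
  set M := ⌈L ^ (q j - y)⌉₊ with hM
  set n : Fin N → ℕ := Function.update (fun i => ⌈L ^ q i⌉₊) j (M * T) with hn
  have hT1 : L ^ y ≤ T := Nat.le_ceil _
  have hT2 : (T : ℝ) ≤ 2 * L ^ y := ceil_le_two_mul (by linarith)
  have hM1 : L ^ (q j - y) ≤ M := Nat.le_ceil _
  have hM2 : (M : ℝ) ≤ 2 * L ^ (q j - y) := ceil_le_two_mul (one_le (by linarith))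
  have hnj : n j = M * T := Function.update_self ..
  have hnne : ∀ i, i ≠ j → n i = ⌈L ^ q i⌉₊ := fun i hi => Function.update_of_ne hi ..
  have hn1 : ∀ i, L ^ q i ≤ n i := by
    intro i
    by_cases hi : i = j
    · rw [hi, hnj]; push_cast
      calc L ^ q j = L ^ (q j - y) * L ^ y := by rw [← Real.rpow_add hL0]; congr 1; ring
        _ ≤ _ := by gcongr
    · rw [hnne i hi]; exact Nat.le_ceil _
  have hn2 : ∀ i, (n i : ℝ) ≤ 4 * L ^ q i := by
    intro i
    by_cases hi : i = j
    · rw [hi, hnj]; push_cast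
      calc (M : ℝ) * T ≤ (2 * L ^ (q j - y)) * (2 * L ^ y) := by gcongr
        _ = 4 * (L ^ (q j - y) * L ^ y) := by ring
        _ = _ := by rw [← Real.rpow_add hL0]; congr 2; ring
    · rw [hnne i hi]
      have := ceil_le_two_mul (one_le (hq0 i))
      have := pos (q i); linarith
  have hn2' : ∀ i, i ≠ j → (n i : ℝ) ≤ 2 * L ^ q i := fun i hi => by
    rw [hnne i hi]; exact ceil_le_two_mul (one_le (hq0 i))
  set W : Fin N → ℝ := fun i => q i + ((i.1 - j.1 : ℕ) : ℝ) * (t - b) with hWd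
  have hWq : ∀ i, q i ≤ W i := fun i => by
    have : 0 ≤ ((i.1 - j.1 : ℕ) : ℝ) * (t - b) := mul_nonneg (Nat.cast_nonneg _) (by linarith)
    simp only [hWd]; linarith
  have hWge : ∀ i i' : Fin N, i ≤ i' → q i ≤ W i' + ((i'.1 - i.1 : ℕ) : ℝ) * b :=
    fun i i' hii => le_add_of_slopes (by linarith) hqj hql hii
  set H := ∑ i, e i * q i with hH
  set x := L ^ (-c) with hx
  set X := C * L ^ (-H + η') with hX
  have hC0' : 0 < C := by linarith
  have hX0 : 0 < X := mul_pos hC0' (pos _)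
  set x₁ := L ^ (-(2 * c)) with hx₁
  have hlow' := hlow.mono (fun i => le_rfl) (mono (by linarith : -c₁ ≤ -(2 * c))) le_rfl
  have hW' := hW.mono (fun i => le_rfl) (mono (by linarith : -c₂ ≤ -(2 * c))) le_rfl
  set X₁ := C * L ^ (-(∑ i, e i * Function.update q j (q j - y) i) + η₁) with hX₁
  set X₂ := C * L ^ (-(∑ i, e i * W i) + η₂) with hX₂
  have hlowH : ∑ i, e i * Function.update q j (q j - y) i = H - e j * y := by
    have : ∀ i, e i * Function.update q j (q j - y) i = e i * q i - if i = j then e j * y else 0 := by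
      intro i
      by_cases hi : i = j
      · subst hi; simp; ring
      · simp [hi]
    simp only [this, Finset.sum_sub_distrib, Finset.sum_ite_eq', Finset.mem_univ, if_true, hH]
  have hX₂le : X₂ ≤ X * L ^ (η₂ - η') := by
    have : H ≤ ∑ i, e i * W i :=
      Finset.sum_le_sum fun i _ => mul_le_mul_of_nonneg_left (hWq i) (he i).1
    rw [hX, mul_assoc, ← Real.rpow_add hL0]
    exact mul_le_mul_of_nonneg_left (mono (by linarith)) hC0'.le
  have hx4 : 4 * x₁ ≤ x := by
    have : x = x₁ * L ^ c := by rw [hx, hx₁, ← Real.rpow_add hL0]; congr 1; ring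
    rw [this, mul_comm]; exact mul_le_mul_of_nonneg_left hLc4 (pos _).le
  have hm₂1 : (8 : ℝ) ^ m₂ ≤ L ^ (t - y) / 2 := by linarith
  refine good_of_scales (j := j) (C0 := C0) (i0 := i0) (m₁ := m₁) (m₂ := m₂) (mb := mb) (M := M)
    (T := T) (n := n) (ω := fun i => L ^ (-W i))
    (ℓ' := fun i => L ^ (-Function.update q j (q j - y) i))
    (x₁ := x₁) (X₁ := X₁) (X₂ := X₂) (B := K3 * L ^ (t - b - y - 2 * c))
    hF hF1 hmb (by omega) ?_ ?_ ?_ hnj ?_ ?_ (fun i => pos _) ?_ ?_ ?_ ?_ hlow' hW' (pos _) hx4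
    (pos _).le hX0 (mul_pos hC0' (pos _)).le ?_ (by positivity) ?_ ?_
  · intro i
    have := (one_le (hq0 i)).trans (hn1 i)
    exact_mod_cast this
  · have := (one_le (by linarith : 0 ≤ q j - y)).trans hM1
    exact_mod_cast this
  · have := (one_le hy.le).trans hT1
    exact_mod_cast this
  · intro i hij
    have hij' : j.1 < i.1 := hij
    obtain ⟨l, hl⟩ : ∃ l, l = i.1 - j.1 := ⟨_, rfl⟩
    have hl1 : 1 ≤ l := by omega
    have e1 := hqj i hij.le
    rw [← hl] at e1 ⊢
    have hl1' : (1 : ℝ) ≤ l := by exact_mod_cast hl1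
    have : (n i : ℝ) * 8 ^ (m₂ * l) ≤ M := by
      calc (n i : ℝ) * 8 ^ (m₂ * l) ≤ (2 * L ^ (q j - l * t)) * (L ^ (t - y) / 2) ^ l := by
            rw [pow_mul, ← e1]; gcongr; exact hn2' i hij.ne'
        _ = L ^ (q j - l * t) * L ^ ((t - y) * l) * (2 * (1 / 2) ^ l) := by
            rw [div_eq_mul_one_div, mul_pow, ← Real.rpow_mul_natCast hL0.le]; ring
        _ ≤ L ^ (q j - l * t) * L ^ ((t - y) * l) * 1 := by
            gcongr
            have : (1 / 2 : ℝ) ^ l ≤ (1 / 2) ^ 1 := pow_le_pow_of_le_one (by norm_num) (by norm_num) hl1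
            linarith
        _ = L ^ (q j - l * y) := by rw [mul_one, ← Real.rpow_add hL0]; congr 1; ring
        _ ≤ L ^ (q j - y) := mono (by have := le_mul_of_one_le_left hy.le hl1'; linarith)
        _ ≤ M := hM1
    exact_mod_cast this
  · intro i hij
    have hij' : i.1 < j.1 := hij
    have e1 := hql i j hij.le le_rfl
    obtain ⟨l, hl⟩ : ∃ l, l = j.1 - i.1 := ⟨_, rfl⟩
    have hl1 : 1 ≤ l := by omega
    rw [← hl] at e1 ⊢
    have hl1' : (1 : ℝ) ≤ l := by exact_mod_cast hl1
    have : (n i : ℝ) ≤ M * 8 ^ (m₁ * l) := by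
      calc (n i : ℝ) ≤ 2 * L ^ q i := hn2' i hij.ne
        _ ≤ 2 * L ^ ((q j - y) + (b + y) * l) := by
            have := mono (by
              have := le_mul_of_one_le_left hy.le hl1'
              rw [add_mul, mul_comm b, mul_comm y]; linarith : q i ≤ (q j - y) + (b + y) * l)
            linarith
        _ = L ^ (q j - y) * (2 * L ^ ((b + y) * l)) := by rw [Real.rpow_add hL0]; ring
        _ ≤ L ^ (q j - y) * (2 ^ l * L ^ ((b + y) * l)) := by
            gcongr; exact le_self_pow₀ (by norm_num) (by omega)
        _ = L ^ (q j - y) * (2 * L ^ (b + y)) ^ l := by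
            rw [mul_pow, ← Real.rpow_mul_natCast hL0.le]
        _ ≤ M * 8 ^ (m₁ * l) := by rw [pow_mul]; gcongr
    exact_mod_cast this
  · intro i
    exact Real.rpow_le_one_of_one_le_of_nonpos hL1 (by have := hWq i; have := hq0 i; linarith)
  · intro i i' hii
    have h1 := hWge i i' hii
    obtain ⟨l, hl⟩ : ∃ l, l = i'.1 - i.1 := ⟨_, rfl⟩
    rw [← hl] at h1 ⊢
    have h8 : (1 / 8 : ℝ) ^ mb ≤ L ^ (-b) := by
      rw [one_div_pow, Real.rpow_neg hL0.le, ← one_div]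
      exact one_div_le_one_div_of_le (pos _) hmb1
    calc (n i : ℝ) * (L ^ (-W i') * ((1 / 8 : ℝ) ^ mb) ^ l)
        ≤ (4 * L ^ q i) * (L ^ (-W i') * (L ^ (-b)) ^ l) := by
          have := pos (-W i'); gcongr; exact hn2 i
      _ = 4 * L ^ (q i + (-W i' + -b * l)) := by
          rw [← Real.rpow_mul_natCast hL0.le, Real.rpow_add hL0, Real.rpow_add hL0]; ring
      _ ≤ 4 * 1 := by
          gcongr; exact Real.rpow_le_one_of_one_le_of_nonpos hL1 (by linarith)
      _ = 4 := by ring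
  · intro i
    calc (n i : ℝ) * L ^ (-q i) ≤ 4 * L ^ q i * L ^ (-q i) := by
          have := pos (-q i); gcongr; exact hn2 i
      _ = 4 := by rw [mul_assoc, ← Real.rpow_add hL0]; simp
  · intro i
    by_cases hi : i = j
    · subst hi
      simp only [Function.update_self]
      calc (1 : ℝ) = L ^ (q i - y) * L ^ (-(q i - y)) := by rw [← Real.rpow_add hL0]; simp
        _ ≤ _ := by gcongr
    · simp only [Function.update_of_ne hi]
      calc (1 : ℝ) = L ^ (q i) * L ^ (-(q i)) := by rw [← Real.rpow_add hL0]; simp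
        _ ≤ _ := by gcongr; exact hn1 i
  · rw [hX₁, hlowH]
    calc C * L ^ (-(H - e j * y) + η₁) * (4 * i0 * C0 * 4 ^ N)
        ≤ C * L ^ (-H + y + η₁) * (L ^ c / 2) := by
          have h1 : L ^ (-(H - e j * y) + η₁) ≤ L ^ (-H + y + η₁) := mono (by
            have := mul_le_of_le_one_left hy.le (he j).2; linarith)
          have h2 : 4 * i0 * C0 * 4 ^ N ≤ L ^ c / 2 := by linarith
          have h3 : 0 ≤ C * L ^ (-H + y + η₁) := mul_nonneg hC0'.le (pos _).le
          exact mul_le_mul (mul_le_mul_of_nonneg_left h1 hC0'.le) h2 (by positivity) h3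
      _ = C * L ^ (-H + y + η₁ + c) / 2 := by rw [Real.rpow_add hL0 (-H + y + η₁)]; ring
      _ ≤ C * L ^ ((-H + η') + (-c + y)) / 2 := by
          have := mono (by linarith : -H + y + η₁ + c ≤ (-H + η') + (-c + y))
          have := mul_le_mul_of_nonneg_left this hC0'.le
          linarith
      _ = X * (x / 2 * L ^ y) := by rw [hX, hx, Real.rpow_add hL0 (-H + η'), Real.rpow_add hL0 (-c)]; ring
      _ ≤ X * (x / 2 * T) := by have := pos (-c); gcongr
  · intro J R rr rJ G a H' hcd hR
    have h1 := hmain _ _ _ _ _ _ _ _ _ _ _ _ _ _ _ _ _ _ _ hcd hR K rfl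
    rw [hK3]
    refine count_le_of_core (t := t) (b := b) (y := y) (η' := η') (η₂ := η₂) (ε := μ / 2) hD1 hL1 (Nat.cast_nonneg _) hx
      ?_ hX0 (mul_pos hC0' (pos _)).le hX₂le (Nat.cast_nonneg _) hT2 (by positivity) hQ (exp_pos _).le ?_
      hKc ?_ h1
    · rw [← Finset.prod_mul_distrib]
      calc L ^ (-((t - b) * Tri d)) = L ^ (∑ i, (-W i + q i)) := by
            congr 1
            rw [← sum_tsub_eq_Tri j hjd, Finset.mul_sum, ← Finset.sum_neg_distrib]
            refine Finset.sum_congr rfl fun i _ => ?_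
            simp only [hWd]; ring
        _ = ∏ i, L ^ (-W i + q i) := Real.rpow_sum_of_pos hL0 _ _
        _ ≤ _ := by
            refine Finset.prod_le_prod (fun i _ => (pos _).le) fun i _ => ?_
            rw [Real.rpow_add hL0]
            exact mul_le_mul_of_nonneg_left (hn1 i) (pos _).le
    · rw [Real.rpow_def_of_pos hL0]
      refine exp_le_exp.2 ?_
      rw [mul_comm]
      refine mul_le_mul_of_nonneg_right ?_ (by linarith)
      rw [Real.le_log_iff_exp_le hL0]
      calc exp ((K : ℝ) * h) = exp 1 ^ (K * h) := by rw [← Real.exp_nat_mul, mul_one]; push_cast; rfl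
        _ ≤ 8 ^ (K * h) := by
            gcongr
            have := Real.exp_one_lt_d9; linarith
        _ ≤ 8 ^ m₂ := pow_le_pow_right₀ (by norm_num) (by omega)
        _ ≤ L ^ (t - y) := by have := pos (t - y); linarith
        _ ≤ L ^ (1 : ℝ) := mono (by linarith)
        _ = L := Real.rpow_one L
    · rw [← hD]; linarith
  · have h8 : (1 / 8 : ℝ) ^ m₂ ≤ 2 * 8 ^ h * L ^ (-(t - y)) := by
      rw [one_div_pow, Real.rpow_neg hL0.le, div_le_iff₀ (by positivity)]
      have := pos (t - y)
      calc (1 : ℝ) = L ^ (t - y) * (L ^ (t - y))⁻¹ := by rw [mul_inv_cancel₀ this.ne']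
        _ ≤ (2 * 8 ^ h * 8 ^ m₂) * (L ^ (t - y))⁻¹ := by gcongr
        _ = _ := by ring
    have h9 : (8 : ℝ) ^ mb * (K3 * L ^ (t - b - y - 2 * c) * (1 / 8) ^ m₂) ≤ x / 2 := by
      calc _ ≤ (8 * L ^ b) * (K3 * L ^ (t - b - y - 2 * c) * (2 * 8 ^ h * L ^ (-(t - y)))) := by
            have := pos (t - b - y - 2 * c); gcongr
        _ = (32 * 8 ^ h * K3) * (L ^ b * L ^ (t - b - y - 2 * c) * L ^ (-(t - y))) / 2 := by ring
        _ = (32 * 8 ^ h * K3) * L ^ (-(2 * c)) / 2 := by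
            rw [← Real.rpow_add hL0, ← Real.rpow_add hL0]; congr 3; ring
        _ ≤ L ^ c * L ^ (-(2 * c)) / 2 := by have := pos (-(2 * c)); gcongr
        _ = x / 2 := by rw [← Real.rpow_add hL0, hx]; congr 2; ring
    linarith

lemma Slice.mono {N : ℕ} {q : Fin N → ℝ} {η η' : ℝ} (h : Slice q η) (hη : η ≤ η') : Slice q η' := by
  obtain ⟨c, hc, L₀, hL₀, h⟩ := h
  refine ⟨c, hc, L₀, hL₀, fun L hL e he C hC F hF hF1 hsp => ?_⟩
  refine (h L hL e he C hC F hF hF1 hsp).mono (fun i => le_rfl) le_rfl ?_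
  have : L ^ (-(∑ i, e i * q i) + η) ≤ L ^ (-(∑ i, e i * q i) + η') :=
    Real.rpow_le_rpow_of_exponent_le (hL₀.trans hL) (by linarith)
  gcongr

lemma Slice_const (N : ℕ) {v η : ℝ} (hv0 : 0 ≤ v) (hv1 : v ≤ 1) (hη : 0 < η) :
    Slice (fun _ : Fin N => v) η := by
  obtain ⟨L₀, hL₀, hbig⟩ := exists_threshold hη (3 ^ N)
  refine ⟨1, one_pos, L₀, hL₀, fun L hL e he C hC F hF hF1 hsp => ?_⟩
  have hL1 := hL₀.trans hL
  have hL0 : 0 < L := by linarith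
  have hLη := hbig L hL
  refine ⟨∅, Set.empty_subset _, by simp, fun r hr _ => ⟨F, subset_rfl, ?_, fun w hw => ?_⟩⟩
  · simp only [sdiff_self, Finset.bot_eq_empty, Finset.card_empty, Nat.cast_zero]; positivity
  have hsum0 : 0 ≤ ∑ i, e i := Finset.sum_nonneg fun i _ => (he i).1
  have hsumN : ∑ i, e i ≤ N := by
    calc ∑ i, e i ≤ ∑ i : Fin N, (1 : ℝ) := Finset.sum_le_sum fun i _ => (he i).2
      _ = N := by simp
  have h3 : (3 * L ^ (-v)) ^ (∑ i, e i) ≤ L ^ (-(∑ i, e i * v) + η) := by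
    rw [Real.mul_rpow (by norm_num) (by positivity), ← Real.rpow_mul hL0.le, Real.rpow_add hL0,
      ← Finset.sum_mul, mul_comm]
    have h4 : (3 : ℝ) ^ (∑ i, e i) ≤ L ^ η := by
      refine le_trans ?_ hLη
      rw [← Real.rpow_natCast]
      exact Real.rpow_le_rpow_of_exponent_le (by norm_num) hsumN
    have : -v * ∑ i, e i = -((∑ i, e i) * v) := by ring
    rw [this]
    gcongr
  refine le_trans ?_ (mul_le_mul_of_nonneg_right (mul_le_mul_of_nonneg_left h3 (by linarith)) (by positivity))
  rcases le_total (3 * L ^ (-v)) 1 with h1 | h1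
  · refine le_trans ?_ (hsp w (3 * L ^ (-v)) ?_ h1)
    · have : (F.filter fun w' => ∀ i, |xc r i (w' - w)| ≤ L ^ (-v)) ⊆
          F.filter fun w' => ∀ i, |w' i - w i| ≤ 3 * L ^ (-v) := by
        intro w' hw'
        obtain ⟨h5, h6⟩ := Finset.mem_filter.1 hw'
        exact Finset.mem_filter.2 ⟨h5, fun i => abs_le_of_xc
          (w := w' - w) (by rw [abs_of_nonneg hr.1]; exact hr.2) h6 i⟩
      exact_mod_cast Finset.card_le_card this
    · have : L ^ (-1 : ℝ) ≤ L ^ (-v) := Real.rpow_le_rpow_of_exponent_le hL1 (by linarith)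
      rw [Real.rpow_neg_one] at this
      rw [one_div]
      have : 0 < L ^ (-v) := by positivity
      linarith
  · have h5 : 1 ≤ C * (3 * L ^ (-v)) ^ (∑ i, e i) :=
      one_le_mul_of_one_le_of_one_le hC (Real.one_le_rpow h1 hsum0)
    calc ((F.filter _).card : ℝ) ≤ 1 * F.card := by
          rw [one_mul]; exact_mod_cast Finset.card_filter_le _ _
      _ ≤ _ := by gcongr

lemma Slice.of_le {N : ℕ} {q q' : Fin N → ℝ} {η : ℝ} (h : Slice q' η) (hq : ∀ i, q' i ≤ q i) :
    Slice q (η + ∑ i, (q i - q' i)) := by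
  obtain ⟨c, hc, L₀, hL₀, h⟩ := h
  refine ⟨c, hc, L₀, hL₀, fun L hL e he C hC F hF hF1 hsp => ?_⟩
  have hL1 := hL₀.trans hL
  refine (h L hL e he C hC F hF hF1 hsp).mono
    (fun i => Real.rpow_le_rpow_of_exponent_le hL1 (by have := hq i; linarith)) le_rfl ?_
  have h1 : ∑ i, e i * q i - ∑ i, e i * q' i ≤ ∑ i, (q i - q' i) := by
    rw [← Finset.sum_sub_distrib]
    refine Finset.sum_le_sum fun i _ => ?_
    rw [← mul_sub]
    exact mul_le_of_le_one_left (by have := hq i; linarith) (he i).2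
  have : L ^ (-(∑ i, e i * q' i) + η) ≤ L ^ (-(∑ i, e i * q i) + (η + ∑ i, (q i - q' i))) :=
    Real.rpow_le_rpow_of_exponent_le hL1 (by linarith)
  gcongr

/-- A box is covered by few boxes of a finer shape. -/
lemma card_box_le_of_cover {N : ℕ} (r : ℝ) {ℓ ℓ' : Fin N → ℝ} (hℓ' : ∀ i, 0 < ℓ' i)
    (hℓ : ∀ i, ℓ' i ≤ ℓ i) (F : Finset (Fin N → ℝ)) {Y : ℝ} (hY : 0 ≤ Y)
    (h : ∀ w ∈ F, ((F.filter fun w' => ∀ i, |xc r i (w' - w)| ≤ ℓ' i).card : ℝ) ≤ Y) (w : Fin N → ℝ) :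
    ((F.filter fun w' => ∀ i, |xc r i (w' - w)| ≤ ℓ i).card : ℝ) ≤ (∏ i, 4 * (ℓ i / ℓ' i)) * Y := by
  classical
  set S := F.filter fun w' => ∀ i, |xc r i (w' - w)| ≤ ℓ i with hS
  set φ : (Fin N → ℝ) → Fin N → ℤ := fun w' i => ⌊xc r i (w' - w) / ℓ' i⌋ with hφ
  set t : Finset (Fin N → ℤ) := Fintype.piFinset fun i => Finset.Icc ⌊-(ℓ i / ℓ' i)⌋ ⌊ℓ i / ℓ' i⌋ with ht
  have hmap : ∀ w' ∈ S, φ w' ∈ t := by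
    intro w' hw'
    rw [ht, Fintype.mem_piFinset]
    intro i
    have h1 := abs_le.1 ((Finset.mem_filter.1 hw').2 i)
    rw [Finset.mem_Icc]
    refine ⟨Int.floor_le_floor ?_, Int.floor_le_floor ?_⟩
    · rw [← neg_div]; exact div_le_div_of_nonneg_right h1.1 (hℓ' i).le
    · exact div_le_div_of_nonneg_right h1.2 (hℓ' i).le
  have htc : (t.card : ℝ) ≤ ∏ i, 4 * (ℓ i / ℓ' i) := by
    rw [ht, Fintype.card_piFinset]
    push_cast
    refine Finset.prod_le_prod (fun i _ => Nat.cast_nonneg _) fun i _ => ?_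
    have h1 : 1 ≤ ℓ i / ℓ' i := by rw [le_div_iff₀ (hℓ' i), one_mul]; exact hℓ i
    have h2 := Int.floor_le (ℓ i / ℓ' i)
    have h3 := Int.lt_floor_add_one (-(ℓ i / ℓ' i))
    have h4 : ⌊-(ℓ i / ℓ' i)⌋ ≤ ⌊ℓ i / ℓ' i⌋ := Int.floor_le_floor (by linarith)
    rw [Int.card_Icc]
    have h5 : (((⌊ℓ i / ℓ' i⌋ + 1 - ⌊-(ℓ i / ℓ' i)⌋).toNat : ℤ) : ℝ) =
        ⌊ℓ i / ℓ' i⌋ + 1 - ⌊-(ℓ i / ℓ' i)⌋ := by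
      rw [Int.toNat_of_nonneg (by linarith)]; push_cast; ring
    rw [← Int.cast_natCast, h5]
    linarith
  have hfib : ∀ k ∈ t, ((S.filter fun w' => φ w' = k).card : ℝ) ≤ Y := by
    intro k _
    rcases (S.filter fun w' => φ w' = k).eq_empty_or_nonempty with h0 | ⟨w0, hw0⟩
    · rw [h0]; simpa using hY
    obtain ⟨h1, h2⟩ := Finset.mem_filter.1 hw0
    refine le_trans ?_ (h w0 (Finset.mem_filter.1 h1).1)
    have : (S.filter fun w' => φ w' = k) ⊆ F.filter fun w' => ∀ i, |xc r i (w' - w0)| ≤ ℓ' i := by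
      intro w' hw'
      obtain ⟨h3, h4⟩ := Finset.mem_filter.1 hw'
      refine Finset.mem_filter.2 ⟨(Finset.mem_filter.1 h3).1, fun i => ?_⟩
      have h5 : ⌊xc r i (w' - w) / ℓ' i⌋ = ⌊xc r i (w0 - w) / ℓ' i⌋ := congrFun (h4.trans h2.symm) i
      have h6 := (Int.abs_sub_lt_one_of_floor_eq_floor h5).le
      rw [← sub_div, abs_div, abs_of_pos (hℓ' i), div_le_one (hℓ' i), ← xc_sub] at h6
      simpa using h6
    exact_mod_cast Finset.card_le_card this
  rw [Finset.card_eq_sum_card_fiberwise hmap]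
  push_cast
  calc ∑ k ∈ t, ((S.filter fun w' => φ w' = k).card : ℝ) ≤ ∑ k ∈ t, Y := Finset.sum_le_sum hfib
    _ = t.card * Y := by rw [Finset.sum_const, nsmul_eq_mul]
    _ ≤ _ := by gcongr

lemma Slice.of_ge {N : ℕ} {q q' : Fin N → ℝ} {η η' : ℝ} (h : Slice q' η) (hq : ∀ i, q i ≤ q' i)
    (hη : η + ∑ i, (q' i - q i) < η') : Slice q η' := by
  obtain ⟨c, hc, L₀, hL₀, h⟩ := h
  obtain ⟨L₁, hL₁, hbig⟩ := exists_threshold (sub_pos.2 hη) (4 ^ N)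
  refine ⟨c, hc, max L₀ L₁, le_max_of_le_left hL₀, fun L hL e he C hC F hF hF1 hsp => ?_⟩
  have hLL₀ := (le_max_left _ _).trans hL
  have hL1 := hL₀.trans hLL₀
  have hL0 : 0 < L := by linarith
  have h4 := hbig L ((le_max_right _ _).trans hL)
  obtain ⟨E, hE, hv, hg⟩ := h L hLL₀ e he C hC F hF hF1 hsp
  refine ⟨E, hE, hv, fun r hr hrE => ?_⟩
  obtain ⟨F', hF', hc', hb⟩ := hg r hr hrE
  refine ⟨F', hF', hc', fun w _ => ?_⟩
  refine (card_box_le_of_cover r (fun i => Real.rpow_pos_of_pos hL0 _)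
    (fun i => Real.rpow_le_rpow_of_exponent_le hL1 (by have := hq i; linarith)) F' (by positivity)
    hb w).trans ?_
  have e1 : ∏ i, 4 * (L ^ (-q i) / L ^ (-q' i)) = 4 ^ N * L ^ (∑ i, (q' i - q i)) := by
    rw [Finset.prod_mul_distrib, Real.rpow_sum_of_pos hL0]
    congr 1
    · simp
    · refine Finset.prod_congr rfl fun i _ => ?_
      rw [← Real.rpow_sub hL0]; congr 1; ring
  rw [e1]
  have h5 : ∑ i, e i * q i ≤ ∑ i, e i * q' i :=
    Finset.sum_le_sum fun i _ => mul_le_mul_of_nonneg_left (hq i) (he i).1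
  calc 4 ^ N * L ^ (∑ i, (q' i - q i)) * (C * L ^ (-(∑ i, e i * q' i) + η) * F.card)
      ≤ L ^ (η' - (η + ∑ i, (q' i - q i))) * L ^ (∑ i, (q' i - q i)) *
        (C * L ^ (-(∑ i, e i * q' i) + η) * F.card) := by gcongr
    _ = C * (L ^ (η' - (η + ∑ i, (q' i - q i))) * L ^ (∑ i, (q' i - q i)) *
        L ^ (-(∑ i, e i * q' i) + η)) * F.card := by ring
    _ = C * L ^ (-(∑ i, e i * q' i) + η') * F.card := by
        rw [← Real.rpow_add hL0, ← Real.rpow_add hL0]; congr 3; ring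
    _ ≤ C * L ^ (-(∑ i, e i * q i) + η') * F.card := by
        gcongr

lemma Slice.of_near {N : ℕ} {q q' : Fin N → ℝ} {η η' : ℝ} (h : Slice q' η)
    (hη : η + ∑ i, |q i - q' i| < η') : Slice q η' := by
  refine (h.of_le (q := fun i => max (q i) (q' i)) fun i => le_max_right _ _).of_ge
    (fun i => le_max_left _ _) ?_
  rw [add_assoc, ← Finset.sum_add_distrib]
  refine lt_of_eq_of_lt ?_ hη
  congr 1
  refine Finset.sum_congr rfl fun i _ => ?_
  rcases le_total (q i) (q' i) with h1 | h1
  · rw [max_eq_right h1, abs_of_nonpos (by linarith)]; ring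
  · rw [max_eq_left h1, abs_of_nonneg (by linarith)]; ring

/-- The optimal loss. -/
def sliceLoss (N : ℕ) (q : ℕ → ℝ) : ℝ := sInf {η | 0 ≤ η ∧ Slice (fun i : Fin N => q i) η}

lemma sliceLoss_bddBelow (N : ℕ) (q : ℕ → ℝ) :
    BddBelow {η | 0 ≤ η ∧ Slice (fun i : Fin N => q i) η} := ⟨0, fun _ h => h.1⟩

lemma sliceLoss_nonempty (N : ℕ) (q : ℕ → ℝ) :
    {η | 0 ≤ η ∧ Slice (fun i : Fin N => q i) η}.Nonempty := by
  refine ⟨2 + ∑ i : Fin N, |q i - 0|, ?_, ?_⟩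
  · have := Finset.sum_nonneg fun (i : Fin N) (_ : i ∈ Finset.univ) => abs_nonneg (q i - 0)
    linarith
  · exact (Slice_const N le_rfl zero_le_one one_pos).of_near (by linarith)

lemma sliceLoss_nonneg (N : ℕ) (q : ℕ → ℝ) : 0 ≤ sliceLoss N q := Real.sInf_nonneg fun _ h => h.1

lemma Slice_of_sliceLoss_lt {N : ℕ} {q : ℕ → ℝ} {η : ℝ} (h : sliceLoss N q < η) :
    Slice (fun i : Fin N => q i) η := by
  obtain ⟨η', h1, h2⟩ := exists_lt_of_csInf_lt (sliceLoss_nonempty N q) h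
  exact h1.2.mono h2.le

lemma sliceLoss_le {N : ℕ} {q : ℕ → ℝ} {η : ℝ} (h0 : 0 ≤ η) (h : Slice (fun i : Fin N => q i) η) :
    sliceLoss N q ≤ η := csInf_le (sliceLoss_bddBelow N q) ⟨h0, h⟩

lemma sliceLoss_lip (N : ℕ) (q q' : ℕ → ℝ) :
    sliceLoss N q ≤ sliceLoss N q' + ∑ i : Fin N, |q i - q' i| := by
  refine le_of_forall_pos_le_add fun ε hε => ?_
  have h1 := Slice_of_sliceLoss_lt (N := N) (q := q') (lt_add_of_pos_right _ (half_pos hε))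
  have h2 := Finset.sum_nonneg fun (i : Fin N) (_ : i ∈ Finset.univ) => abs_nonneg (q i - q' i)
  have h3 := sliceLoss_nonneg N q'
  exact sliceLoss_le (by linarith) (h1.of_near (q := fun i : Fin N => q i) (by linarith))

lemma continuous_sliceLoss (N : ℕ) : Continuous (sliceLoss N) := by
  rw [continuous_iff_continuousAt]
  intro q
  have h : Filter.Tendsto (fun q' : ℕ → ℝ => ∑ i : Fin N, |q' i - q i|) (nhds q) (nhds 0) := by
    have : Continuous fun q' : ℕ → ℝ => ∑ i : Fin N, |q' i - q i| := by fun_prop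
    simpa using this.tendsto q
  rw [ContinuousAt, tendsto_iff_dist_tendsto_zero]
  refine squeeze_zero (fun _ => dist_nonneg) (fun q' => ?_) h
  rw [Real.dist_eq, abs_le]
  have h1 := sliceLoss_lip N q' q
  have h2 := sliceLoss_lip N q q'
  simp only [abs_sub_comm (q _) (q' _)] at h2
  constructor <;> linarith

/-- Concave nonincreasing exponents. -/
def ladders (n : ℕ) : Set (ℕ → ℝ) :=
  {q | (∀ k, 0 ≤ q k ∧ q k ≤ 1) ∧ (∀ k, k + 1 ≤ n → q (k + 1) ≤ q k) ∧
    ∀ k, k + 2 ≤ n → q k + q (k + 2) ≤ 2 * q (k + 1)}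

lemma isCompact_ladders (n : ℕ) : IsCompact (ladders n) := by
  have h : ladders n = Set.Icc (0 : ℕ → ℝ) 1 ∩ ((⋂ k, ⋂ (_ : k + 1 ≤ n), {q : ℕ → ℝ | q (k + 1) ≤ q k}) ∩
      ⋂ k, ⋂ (_ : k + 2 ≤ n), {q : ℕ → ℝ | q k + q (k + 2) ≤ 2 * q (k + 1)}) := by
    ext q
    simp only [ladders, Set.mem_ofPred_eq, Set.mem_inter_iff, Set.mem_Icc, Set.mem_iInter, Pi.le_def,
      Pi.zero_apply, Pi.one_apply, ← forall_and]
  rw [h]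
  refine isCompact_Icc.inter_right (IsClosed.inter ?_ ?_)
  · exact isClosed_iInter fun k => isClosed_iInter fun _ => isClosed_le (by fun_prop) (by fun_prop)
  · exact isClosed_iInter fun k => isClosed_iInter fun _ => isClosed_le (by fun_prop) (by fun_prop)

/-- The energy of a ladder. -/
def gapEnergy (n : ℕ) (q : ℕ → ℝ) : ℝ := ∑ k ∈ Finset.range n, (q k - q (k + 1)) ^ 2

section ladder

variable {n : ℕ} {q : ℕ → ℝ}

lemma gap_mono (hq : q ∈ ladders n) {k l : ℕ} (hkl : k ≤ l) (hl : l + 1 ≤ n) :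
    q k - q (k + 1) ≤ q l - q (l + 1) := by
  induction l, hkl using Nat.le_induction with
  | base => exact le_rfl
  | succ l hkl ih =>
    have h1 := ih (by omega)
    have h2 := hq.2.2 l hl
    rw [add_assoc]
    linarith

lemma gapEnergy_le (hq : q ∈ ladders n) : gapEnergy n q ≤ n := by
  calc gapEnergy n q ≤ ∑ k ∈ Finset.range n, (1 : ℝ) := by
        refine Finset.sum_le_sum fun k _ => ?_
        have h1 := hq.1 k
        have h2 := hq.1 (k + 1)
        rw [sq_le_one_iff_abs_le_one, abs_le]
        constructor <;> linarith
    _ = n := by simp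

lemma gapEnergy_nonneg : 0 ≤ gapEnergy n q := Finset.sum_nonneg fun _ _ => sq_nonneg _

variable {j : ℕ} {t b : ℝ}

lemma update_mem_ladders (hq : q ∈ ladders n) (hj : j + 1 ≤ n) (hgj : ∀ k, j ≤ k → k + 1 ≤ n → q k - q (k + 1) = t)
    (hgb : ∀ k, k < j → q k - q (k + 1) ≤ b) (hb : 0 ≤ b) {y : ℝ} (hy : 0 ≤ y) (hyt : 4 * y ≤ t - b) :
    Function.update q j (q j - y) ∈ ladders n := by
  have e1 := hgj j le_rfl hj
  refine ⟨fun k => ?_, fun k hk => ?_, fun k hk => ?_⟩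
  · by_cases hkj : k = j
    · subst hkj
      rw [Function.update_self]
      have := hq.1 k; have := hq.1 (k + 1)
      constructor <;> linarith
    · rw [Function.update_of_ne hkj]; exact hq.1 k
  · have h1 := hq.2.1 k hk
    by_cases hkj : k = j
    · subst hkj
      rw [Function.update_self, Function.update_of_ne (by omega)]; linarith
    · rw [Function.update_of_ne hkj]
      by_cases hkj' : k + 1 = j
      · subst hkj'
        rw [Function.update_self]; linarith
      · rw [Function.update_of_ne hkj']; exact h1
  · have h1 := hq.2.2 k hk
    by_cases h2 : k = j
    · subst h2
      rw [Function.update_self, Function.update_of_ne (by omega), Function.update_of_ne (by omega)]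
      linarith
    by_cases h3 : k + 1 = j
    · subst h3
      rw [Function.update_self, Function.update_of_ne (by omega), Function.update_of_ne (by omega)]
      have h4 := hgb k (by omega)
      rw [add_assoc] at e1
      linarith
    by_cases h4 : k + 2 = j
    · subst h4
      rw [Function.update_self, Function.update_of_ne (by omega), Function.update_of_ne (by omega)]
      linarith
    · rw [Function.update_of_ne h2, Function.update_of_ne h3, Function.update_of_ne h4]; exact h1

lemma gapEnergy_update_le (hj : j + 1 ≤ n) (hgj : q j - q (j + 1) = t)
    (hgb : ∀ k, k < j → q k - q (k + 1) ≤ b) (hb : 0 ≤ b) {y : ℝ} (hy : 0 ≤ y) (hyt : 4 * y ≤ t - b) :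
    gapEnergy n (Function.update q j (q j - y)) ≤ gapEnergy n q - 3 / 2 * (y * (t - b)) := by
  have h0 : ∀ k ∈ Finset.range n, (Function.update q j (q j - y) k - Function.update q j (q j - y) (k + 1)) ^ 2
      ≤ (q k - q (k + 1)) ^ 2 + ((if k = j then y ^ 2 - 2 * y * t else 0) +
        if k + 1 = j then y ^ 2 + 2 * y * b else 0) := by
    intro k _
    by_cases h2 : k = j
    · subst h2
      rw [Function.update_self, Function.update_of_ne (by omega), if_pos rfl, if_neg (by omega), ← hgj]
      exact le_of_eq (by ring)
    by_cases h3 : k + 1 = j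
    · subst h3
      rw [Function.update_self, Function.update_of_ne (by omega), if_neg (by omega), if_pos rfl]
      have := mul_le_mul_of_nonneg_left (hgb k (by omega)) hy
      linarith
    · rw [Function.update_of_ne h2, Function.update_of_ne h3, if_neg h2, if_neg h3]; simp
  have h1 : ∑ k ∈ Finset.range n, (if k = j then y ^ 2 - 2 * y * t else 0) = y ^ 2 - 2 * y * t := by
    rw [Finset.sum_ite_eq', if_pos (Finset.mem_range.2 hj)]
  have h2 : ∑ k ∈ Finset.range n, (if k + 1 = j then y ^ 2 + 2 * y * b else 0) ≤ y ^ 2 + 2 * y * b := by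
    rcases j with _ | m
    · simp; positivity
    · simp only [add_left_inj]
      rw [Finset.sum_ite_eq', if_pos (Finset.mem_range.2 (by omega))]
  refine (Finset.sum_le_sum h0).trans ?_
  rw [Finset.sum_add_distrib, Finset.sum_add_distrib, h1, gapEnergy]
  nlinarith

/-- Flattening of the last gaps. -/
def flatten (n j : ℕ) (q : ℕ → ℝ) (s : ℝ) (k : ℕ) : ℝ :=
  if k ≤ n then q k + ((k - j : ℕ) : ℝ) * s else 0

lemma flatten_gap (s : ℝ) {k : ℕ} (hk : k + 1 ≤ n) :
    flatten n j q s k - flatten n j q s (k + 1) = q k - q (k + 1) - if j ≤ k then s else 0 := by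
  rw [flatten, flatten, if_pos (by omega), if_pos hk]
  split_ifs with h
  · rw [Nat.cast_sub h, Nat.cast_sub (by omega)]; push_cast; ring
  · rw [Nat.sub_eq_zero_of_le (by omega), Nat.sub_eq_zero_of_le (by omega)]; simp

lemma flatten_mem_ladders (hq : q ∈ ladders n) (hj : j + 1 ≤ n)
    (hgj : ∀ k, j ≤ k → k + 1 ≤ n → q k - q (k + 1) = t)
    (hgb : ∀ k, k < j → q k - q (k + 1) ≤ b) (hb : 0 ≤ b) (hbt : b ≤ t) :
    flatten n j q (t - b) ∈ ladders n := by
  have hmono : ∀ k, k + 1 ≤ n → flatten n j q (t - b) (k + 1) ≤ flatten n j q (t - b) k := by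
    intro k hk
    have h1 := flatten_gap (j := j) (q := q) (t - b) hk
    have h2 := hq.2.1 k hk
    split_ifs at h1 with h
    · have := hgj k h hk; linarith
    · linarith
  have hle : ∀ k, k ≤ n → flatten n j q (t - b) k ≤ 1 := by
    intro k
    induction k with
    | zero => intro _; rw [flatten, if_pos (Nat.zero_le _)]; have := hq.1 0; simp; linarith
    | succ k ih => intro hk; exact (hmono k hk).trans (ih (by omega))
  refine ⟨fun k => ?_, hmono, fun k hk => ?_⟩
  · by_cases hk : k ≤ n
    · refine ⟨?_, hle k hk⟩
      rw [flatten, if_pos hk]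
      have := (hq.1 k).1
      have : 0 ≤ ((k - j : ℕ) : ℝ) * (t - b) := mul_nonneg (Nat.cast_nonneg _) (by linarith)
      linarith
    · rw [flatten, if_neg hk]; norm_num
  · have h1 := flatten_gap (n := n) (j := j) (q := q) (t - b) (k := k) (by omega)
    have h2 := flatten_gap (n := n) (j := j) (q := q) (t - b) (k := k + 1) (by omega)
    have h3 := hq.2.2 k hk
    rw [add_assoc] at h2
    norm_num at h2
    split_ifs at h1 h2 with h4 h5 h5
    · linarith
    · omega
    · have h6 := hgb k (by omega)
      have h7 := hgj (k + 1) h5 (by omega)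
      rw [add_assoc] at h7
      norm_num at h7
      linarith
    · linarith

lemma gapEnergy_flatten_le (hj : j + 1 ≤ n) (hgj : ∀ k, j ≤ k → k + 1 ≤ n → q k - q (k + 1) = t)
    (hb : 0 ≤ b) (hbt : b ≤ t) :
    gapEnergy n (flatten n j q (t - b)) ≤ gapEnergy n q - (t ^ 2 - b ^ 2) := by
  have h0 : ∀ k ∈ Finset.range n, (flatten n j q (t - b) k - flatten n j q (t - b) (k + 1)) ^ 2
      ≤ (q k - q (k + 1)) ^ 2 + if k = j then b ^ 2 - t ^ 2 else 0 := by
    intro k hk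
    rw [flatten_gap _ (Finset.mem_range.1 hk)]
    by_cases h2 : k = j
    · subst h2
      rw [if_pos le_rfl, if_pos rfl, hgj k le_rfl hj]
      exact le_of_eq (by ring)
    · rw [if_neg h2]
      split_ifs with h3
      · rw [hgj k h3 (Finset.mem_range.1 hk)]; nlinarith
      · simp
  refine (Finset.sum_le_sum h0).trans ?_
  rw [Finset.sum_add_distrib, Finset.sum_ite_eq', if_pos (Finset.mem_range.2 hj), gapEnergy]
  linarith

end ladder

lemma sub_eq_mul_of_gap_eq {n : ℕ} {q : ℕ → ℝ} {j : ℕ} {t : ℝ}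
    (hgj : ∀ k, j ≤ k → k + 1 ≤ n → q k - q (k + 1) = t) {k : ℕ} (hjk : j ≤ k) (hk : k ≤ n) :
    q k = q j - ((k - j : ℕ) : ℝ) * t := by
  induction k, hjk using Nat.le_induction with
  | base => simp
  | succ k hjk ih =>
    have h1 := ih (by omega)
    have h2 := hgj k hjk hk
    rw [Nat.cast_sub hjk] at h1
    rw [Nat.cast_sub (by omega)]
    push_cast
    linarith

lemma le_add_mul_of_gap_le {q : ℕ → ℝ} {j : ℕ} {b : ℝ} (hgb : ∀ k, k < j → q k - q (k + 1) ≤ b)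
    {i k : ℕ} (hik : i ≤ k) (hk : k ≤ j) : q i ≤ q k + ((k - i : ℕ) : ℝ) * b := by
  induction k, hik using Nat.le_induction with
  | base => simp
  | succ k hik ih =>
    have h1 := ih (by omega)
    have h2 := hgb k hk
    rw [Nat.cast_sub hik] at h1
    rw [Nat.cast_sub (by omega)]
    push_cast
    linarith

lemma Slice_ladder {n : ℕ} (hn : 1 ≤ n) {q : ℕ → ℝ} (hq : q ∈ ladders n) {η : ℝ} (hη : 0 < η) :
    Slice (fun i : Fin (n + 1) => q i) η := by
  by_contra hcon
  have hlt : η ≤ sliceLoss (n + 1) q := by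
    by_contra h
    exact hcon (Slice_of_sliceLoss_lt (not_le.1 h))
  have hn0 : (0 : ℝ) < n := by exact_mod_cast hn
  set κ := η / (2 * n) with hκ
  have hκ0 : 0 < κ := by positivity
  obtain ⟨p, hp, hmax⟩ := (isCompact_ladders n).exists_isMaxOn ⟨q, hq⟩
    (f := fun q => sliceLoss (n + 1) q - κ * gapEnergy n q)
    (((continuous_sliceLoss _).sub (by unfold gapEnergy; fun_prop)).continuousOn)
  have hmax' : ∀ q' ∈ ladders n, sliceLoss (n + 1) q' ≤
      sliceLoss (n + 1) p - κ * (gapEnergy n p - gapEnergy n q') := by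
    intro q' hq'
    have : sliceLoss (n + 1) q' - κ * gapEnergy n q' ≤ sliceLoss (n + 1) p - κ * gapEnergy n p :=
      hmax hq'
    linarith
  have hppos : 0 < sliceLoss (n + 1) p := by
    have h1 := hmax' q hq
    have h2 := gapEnergy_le hq
    have h3 : 0 ≤ gapEnergy n p := gapEnergy_nonneg
    have h4 : κ * gapEnergy n q ≤ η / 2 := by
      calc κ * gapEnergy n q ≤ κ * n := by gcongr
        _ = η / 2 := by rw [hκ]; field_simp
    have h5 := mul_nonneg hκ0.le h3
    linarith
  obtain ⟨m, rfl⟩ : ∃ m, n = m + 1 := ⟨n - 1, by omega⟩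
  set t := p m - p (m + 1) with ht
  have ht0 : 0 ≤ t := sub_nonneg.2 (hp.2.1 m le_rfl)
  have ht1 : t ≤ 1 := by have := (hp.1 m).2; have := (hp.1 (m + 1)).1; linarith
  have hgt : ∀ k, k + 1 ≤ m + 1 → p k - p (k + 1) ≤ t := fun k hk => gap_mono hp (by omega) le_rfl
  rcases ht0.eq_or_lt with ht00 | htpos
  · have h1 : ∀ k, 0 ≤ k → k + 1 ≤ m + 1 → p k - p (k + 1) = t := by
      intro k _ hk
      refine le_antisymm (hgt k hk) ?_
      rw [← ht00]; exact sub_nonneg.2 (hp.2.1 k hk)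
    have h2 : (fun i : Fin (m + 1 + 1) => p i) = fun _ => p 0 := by
      funext i
      rw [sub_eq_mul_of_gap_eq h1 (Nat.zero_le i.1) (by omega), ← ht00]; simp
    have h3 : Slice (fun i : Fin (m + 1 + 1) => p i) (sliceLoss (m + 1 + 1) p / 2) := by
      rw [h2]; exact Slice_const _ (hp.1 0).1 (hp.1 0).2 (by linarith)
    have := sliceLoss_le (by linarith) h3
    linarith
  classical
  have hex : ∃ k, k + 1 ≤ m + 1 ∧ p k - p (k + 1) = t := ⟨m, le_rfl, rfl⟩
  obtain ⟨j, ⟨hj, hjt⟩, hjmin⟩ : ∃ j, (j + 1 ≤ m + 1 ∧ p j - p (j + 1) = t) ∧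
      ∀ k, k < j → ¬ (k + 1 ≤ m + 1 ∧ p k - p (k + 1) = t) :=
    ⟨Nat.find hex, Nat.find_spec hex, fun k hk => Nat.find_min hex hk⟩
  have hgj : ∀ k, j ≤ k → k + 1 ≤ m + 1 → p k - p (k + 1) = t := fun k hjk hk =>
    le_antisymm (hgt k hk) (by rw [← hjt]; exact gap_mono hp hjk hk)
  obtain ⟨b, hb0, hbt, hgb⟩ : ∃ b, 0 ≤ b ∧ b < t ∧ ∀ k, k < j → p k - p (k + 1) ≤ b := by
    rcases j with _ | i
    · exact ⟨0, le_rfl, htpos, fun k hk => by omega⟩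
    · refine ⟨p i - p (i + 1), sub_nonneg.2 (hp.2.1 i (by omega)), ?_, fun k hk =>
        gap_mono hp (by omega) (by omega)⟩
      exact lt_of_le_of_ne (hgt i (by omega)) fun h => hjmin i (by omega) ⟨by omega, h⟩
  obtain ⟨d, hd⟩ : ∃ d, j + d = m + 1 := ⟨m + 1 - j, by omega⟩
  have hsq : 0 < t ^ 2 - b ^ 2 := by nlinarith
  set y := min ((t - b) / 4) (κ * (t ^ 2 - b ^ 2) / (8 * (5 * Tri d + 2))) with hy
  have hy0 : 0 < y := lt_min (by linarith) (by positivity)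
  have hy1 : 4 * y ≤ t - b := by have : y ≤ _ := min_le_left _ _; linarith
  have hy2 : (5 * Tri d + 2) * y ≤ κ * (t ^ 2 - b ^ 2) / 8 := by
    have : y ≤ _ := min_le_right _ _
    rw [le_div_iff₀ (by positivity)] at this
    linarith
  clear_value y
  set s := sliceLoss (m + 1 + 1) p with hs
  have hytb : 0 < κ * (y * (t - b)) := mul_pos hκ0 (mul_pos hy0 (by linarith))
  have hκs : 0 < κ * (t ^ 2 - b ^ 2) := mul_pos hκ0 hsq
  have hlow : sliceLoss (m + 1 + 1) (Function.update p j (p j - y)) < s - 5 / 4 * (κ * (y * (t - b))) := by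
    have h1 := hmax' _ (update_mem_ladders hp hj hgj hgb hb0 hy0.le hy1)
    have h2 := mul_le_mul_of_nonneg_left (gapEnergy_update_le hj hjt hgb hb0 hy0.le hy1) hκ0.le
    linarith
  have hfl : sliceLoss (m + 1 + 1) (flatten (m + 1) j p (t - b)) < s - κ * (t ^ 2 - b ^ 2) / 2 := by
    have h1 := hmax' _ (flatten_mem_ladders hp hj hgj hgb hb0 hbt.le)
    have h2 := mul_le_mul_of_nonneg_left (gapEnergy_flatten_le (q := p) hj hgj hb0 hbt.le) hκ0.le
    linarith
  set δ := min (κ * (y * (t - b))) (κ * (t ^ 2 - b ^ 2) / 4) with hδ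
  have hδ0 : 0 < δ := lt_min hytb (by linarith)
  have hδ1 : δ ≤ κ * (y * (t - b)) := min_le_left _ _
  have hδ2 : δ ≤ κ * (t ^ 2 - b ^ 2) / 4 := min_le_right _ _
  clear_value δ
  have hkey : Slice (fun i : Fin (m + 1 + 1) => p i) (s - δ) := by
    refine Slice_key (⟨j, by omega⟩ : Fin (m + 1 + 1)) d (by omega) (by simp only; omega) (t := t) (b := b) (y := y)
      (η₁ := s - 5 / 4 * (κ * (y * (t - b)))) (η₂ := s - κ * (t ^ 2 - b ^ 2) / 2)
      (fun i => (hp.1 i).1) hb0 ht1 ?_ ?_ hy0 hy1 (by linarith) (by linarith) ?_ ?_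
    · intro i hi
      exact sub_eq_mul_of_gap_eq hgj (Fin.le_def.1 hi) (by omega)
    · intro i i' hi hi'
      exact le_add_mul_of_gap_le hgb (Fin.le_def.1 hi) (Fin.le_def.1 hi')
    · have := Slice_of_sliceLoss_lt hlow
      convert this using 1
      funext i
      by_cases hi : i = ⟨j, by omega⟩
      · subst hi; simp
      · rw [Function.update_of_ne hi, Function.update_of_ne (fun h => hi (Fin.ext h))]
    · have := Slice_of_sliceLoss_lt hfl
      convert this using 1
      funext i
      rw [flatten, if_pos (by omega)]
  have h1 := sliceLoss_le (q := p) (le_max_right (s - δ) 0) (hkey.mono (le_max_left _ _))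
  rw [← hs] at h1
  rcases le_max_iff.1 h1 with h | h <;> linarith

/-- The exponents of the boxes flattened by the diagonal flow. -/
def flowLadder (n : ℕ) (τ : ℝ) (k : ℕ) : ℝ := if k ≤ n then 1 - k * τ else 0

lemma flowLadder_mem_ladders {n : ℕ} {τ : ℝ} (h0 : 0 ≤ τ) (h1 : n * τ ≤ 1) :
    flowLadder n τ ∈ ladders n := by
  refine ⟨fun k => ?_, fun k hk => ?_, fun k hk => ?_⟩
  · rw [flowLadder]
    split_ifs with hk
    · have h2 : (k : ℝ) * τ ≤ n * τ := by gcongr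
      have h3 : 0 ≤ (k : ℝ) * τ := by positivity
      constructor <;> linarith
    · norm_num
  · rw [flowLadder, flowLadder, if_pos hk, if_pos (by omega)]
    push_cast; linarith
  · rw [flowLadder, flowLadder, flowLadder, if_pos hk, if_pos (by omega), if_pos (by omega)]
    push_cast; linarith

lemma exists_uniform (P : ℕ → ℝ → ℝ → Prop)
    (hP : ∀ k, ∃ c : ℝ, 0 < c ∧ ∃ L₀ : ℝ, 1 ≤ L₀ ∧ ∀ L, L₀ ≤ L → P k c L)
    (hmono : ∀ k c c' L, 1 ≤ L → c' ≤ c → P k c L → P k c' L) (K : ℕ) :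
    ∃ c : ℝ, 0 < c ∧ ∃ L₀ : ℝ, 1 ≤ L₀ ∧ ∀ k, k < K → ∀ L, L₀ ≤ L → P k c L := by
  induction K with
  | zero => exact ⟨1, one_pos, 1, le_rfl, fun k hk => by omega⟩
  | succ K ih =>
    obtain ⟨c, hc, L₀, hL₀, h⟩ := ih
    obtain ⟨c', hc', L₁, hL₁, h'⟩ := hP K
    refine ⟨min c c', lt_min hc hc', max L₀ L₁, le_max_of_le_left hL₀, fun k hk L hL => ?_⟩
    have hl0 := (le_max_left _ _).trans hL
    have hl1 := (le_max_right _ _).trans hL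
    rcases Nat.lt_succ_iff_lt_or_eq.1 hk with h2 | rfl
    · exact hmono _ _ _ _ (hL₀.trans hl0) (min_le_left _ _) (h k h2 L hl0)
    · exact hmono _ _ _ _ (hL₀.trans hl0) (min_le_right _ _) (h' L hl1)

lemma exists_uniform_flow {n : ℕ} (hn : 1 ≤ n) {η : ℝ} (hη : 0 < η) :
    ∃ c : ℝ, 0 < c ∧ ∃ L₀ : ℝ, 1 ≤ L₀ ∧ ∀ L, L₀ ≤ L → ∀ τ : ℝ, 0 ≤ τ → n * τ ≤ 1 →
    ∀ e : Fin (n + 1) → ℝ, (∀ i, 0 ≤ e i ∧ e i ≤ 1) →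
    ∀ C : ℝ, 1 ≤ C → ∀ F : Finset (Fin (n + 1) → ℝ), F.Nonempty → (∀ w ∈ F, ∀ i, |w i| ≤ 1) →
    (∀ (z : Fin (n + 1) → ℝ) (ρ : ℝ), 1 / L ≤ ρ → ρ ≤ 1 →
      ((F.filter fun w => ∀ i, |w i - z i| ≤ ρ).card : ℝ) ≤ C * ρ ^ (∑ i, e i) * F.card) →
    Good F (fun i => L ^ (-(1 - i.1 * τ))) (L ^ (-c)) (C * L ^ (-(∑ i, e i * (1 - i.1 * τ)) + η)) := by
  have hn0 : (0 : ℝ) < n := by exact_mod_cast hn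
  obtain ⟨M, hM⟩ := exists_nat_gt (2 * (n + 1) / η)
  have hM0 : (0 : ℝ) < M := lt_of_le_of_lt (by positivity) hM
  rw [div_lt_iff₀ hη] at hM
  obtain ⟨c, hc, L₀, hL₀, h⟩ := exists_uniform (fun k c L => k ≤ M →
    ∀ e : Fin (n + 1) → ℝ, (∀ i, 0 ≤ e i ∧ e i ≤ 1) →
    ∀ C : ℝ, 1 ≤ C → ∀ F : Finset (Fin (n + 1) → ℝ), F.Nonempty → (∀ w ∈ F, ∀ i, |w i| ≤ 1) →
    (∀ (z : Fin (n + 1) → ℝ) (ρ : ℝ), 1 / L ≤ ρ → ρ ≤ 1 →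
      ((F.filter fun w => ∀ i, |w i - z i| ≤ ρ).card : ℝ) ≤ C * ρ ^ (∑ i, e i) * F.card) →
    Good F (fun i => L ^ (-flowLadder n (k / (n * M)) i)) (L ^ (-c))
      (C * L ^ (-(∑ i : Fin (n + 1), e i * flowLadder n (k / (n * M)) i) + η / 2)))
    (fun k => by
      by_cases hk : k ≤ M
      · obtain ⟨c, hc, L₀, hL₀, h⟩ := Slice_ladder hn (flowLadder_mem_ladders (n := n)
          (τ := k / (n * M)) (by positivity) (by
            rw [← mul_div_assoc, mul_div_mul_left _ _ hn0.ne', div_le_one hM0]; exact_mod_cast hk)) (half_pos hη)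
        exact ⟨c, hc, L₀, hL₀, fun L hL _ => h L hL⟩
      · exact ⟨1, one_pos, 1, le_rfl, fun L _ h => absurd h hk⟩)
    (fun k c c' L hL hcc hP hk e he C hC F hF hF1 hsp =>
      (hP hk e he C hC F hF hF1 hsp).mono (fun i => le_rfl)
        (Real.rpow_le_rpow_of_exponent_le hL (by linarith)) le_rfl) (M + 1)
  refine ⟨c, hc, L₀, hL₀, fun L hL τ hτ0 hτ1 e he C hC F hF hF1 hsp => ?_⟩
  have hL1 := hL₀.trans hL
  set k := ⌈τ * (n * M)⌉₊ with hk
  have hkM : k ≤ M := by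
    refine Nat.ceil_le.2 ?_
    calc τ * (n * M) = n * τ * M := by ring
      _ ≤ 1 * M := by gcongr
      _ = M := one_mul _
  have h1 : τ ≤ k / (n * M) := by rw [le_div_iff₀ (by positivity)]; exact Nat.le_ceil _
  have h2 : k / (n * M) ≤ τ + 1 / (n * M) := by
    rw [div_le_iff₀ (by positivity), add_mul, one_div_mul_cancel (by positivity)]
    exact (Nat.ceil_lt_add_one (by positivity)).le
  have hfl : ∀ i : Fin (n + 1), flowLadder n (k / (n * M)) i = 1 - i.1 * (k / (n * M)) := fun i =>
    if_pos (by omega)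
  have h3 := h k (by omega) L hL hkM e he C hC F hF hF1 hsp
  simp only [hfl] at h3
  refine h3.mono (fun i => Real.rpow_le_rpow_of_exponent_le hL1 ?_) le_rfl ?_
  · have := mul_le_mul_of_nonneg_left h1 (Nat.cast_nonneg (α := ℝ) i.1)
    linarith
  · have h4 : ∑ i : Fin (n + 1), e i * (1 - i.1 * τ) - ∑ i : Fin (n + 1), e i * (1 - i.1 * (k / (n * M))) ≤ η / 2 := by
      rw [← Finset.sum_sub_distrib]
      calc ∑ i : Fin (n + 1), (e i * (1 - i.1 * τ) - e i * (1 - i.1 * (k / (n * M))))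
          ≤ ∑ i : Fin (n + 1), (1 / M : ℝ) := by
            refine Finset.sum_le_sum fun i _ => ?_
            have e1 : e i * (1 - i.1 * τ) - e i * (1 - i.1 * (k / (n * M))) =
              e i * (i.1 * (k / (n * M) - τ)) := by ring
            rw [e1]
            have hi : (i.1 : ℝ) ≤ n := by exact_mod_cast (by omega : i.1 ≤ n)
            calc e i * (i.1 * (k / (n * M) - τ)) ≤ 1 * (n * (1 / (n * M))) := by
                  have := he i
                  have h5 : 0 ≤ k / (n * M) - τ := by linarith
                  have h6 : k / (n * M) - τ ≤ 1 / (n * M) := by linarith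
                  gcongr
                  exact this.2
              _ = 1 / M := by field_simp
        _ = (n + 1) / M := by simp; ring
        _ ≤ η / 2 := by rw [div_le_iff₀ hM0]; linarith
    have : L ^ (-(∑ i : Fin (n + 1), e i * (1 - i.1 * (k / (n * M)))) + η / 2) ≤
        L ^ (-(∑ i : Fin (n + 1), e i * (1 - i.1 * τ)) + η) :=
      Real.rpow_le_rpow_of_exponent_le hL1 (by linarith)
    gcongr

/-- The extremal distribution of total weight `α` among coordinates. -/
def stair (n : ℕ) (α : ℝ) (i : Fin (n + 1)) : ℝ :=
  if i.1 < ⌊α⌋₊ then 1 else if i.1 = ⌊α⌋₊ then α - ⌊α⌋₊ else 0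

lemma stair_mem {n : ℕ} {α : ℝ} (hα : 0 ≤ α) (i : Fin (n + 1)) : 0 ≤ stair n α i ∧ stair n α i ≤ 1 := by
  have h1 := Nat.floor_le hα
  have h2 := Nat.lt_floor_add_one α
  rw [stair]
  split_ifs <;> constructor <;> linarith

lemma sum_stair_mul {n : ℕ} {α : ℝ} (hα : 0 ≤ α) (hαn : α < n + 1) (f : ℕ → ℝ) :
    ∑ i : Fin (n + 1), stair n α i * f i =
      ∑ i ∈ Finset.range ⌊α⌋₊, f i + (α - ⌊α⌋₊) * f ⌊α⌋₊ := by
  have hp : ⌊α⌋₊ < n + 1 := by rw [Nat.floor_lt hα]; exact_mod_cast hαn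
  obtain ⟨m, hm⟩ : ∃ m, n + 1 = ⌊α⌋₊ + 1 + m := ⟨n - ⌊α⌋₊, by omega⟩
  simp only [stair]
  rw [Fin.sum_univ_eq_sum_range (fun i => (if i < ⌊α⌋₊ then 1 else if i = ⌊α⌋₊ then α - ⌊α⌋₊ else 0) * f i)
    (n + 1), hm, Finset.sum_range_add, Finset.sum_range_succ]
  have h1 : ∑ i ∈ Finset.range m, (if ⌊α⌋₊ + 1 + i < ⌊α⌋₊ then 1 else
      if ⌊α⌋₊ + 1 + i = ⌊α⌋₊ then α - ⌊α⌋₊ else 0) * f (⌊α⌋₊ + 1 + i) = 0 :=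
    Finset.sum_eq_zero fun i _ => by rw [if_neg (by omega), if_neg (by omega), zero_mul]
  rw [h1, add_zero, if_neg (lt_irrefl _), if_pos rfl]
  congr 1
  exact Finset.sum_congr rfl fun i hi => by rw [if_pos (Finset.mem_range.1 hi), one_mul]

lemma sum_stair {n : ℕ} {α : ℝ} (hα : 0 ≤ α) (hαn : α < n + 1) : ∑ i, stair n α i = α := by
  have := sum_stair_mul hα hαn fun _ => 1
  simpa using this

lemma sum_range_sub_two_mul (n : ℝ) (p : ℕ) :
    ∑ i ∈ Finset.range p, (n - 2 * (i : ℝ)) = p * n - p * (p - 1) := by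
  induction p with
  | zero => simp
  | succ p ih => rw [Finset.sum_range_succ, ih]; push_cast; ring

lemma varpi_le_sum_stair {n : ℕ} {α : ℝ} (hα : 0 ≤ α) (hαn : α < n + 1) :
    varpi n α ≤ ∑ i : Fin (n + 1), stair n α i * ((n : ℝ) - 2 * (i.1 : ℝ)) := by
  rw [sum_stair_mul hα hαn fun i => (n : ℝ) - 2 * (i : ℝ), sum_range_sub_two_mul, varpi,
    ← natCast_floor_eq_intCast_floor hα]
  have hp : (⌊α⌋₊ : ℝ) ≤ n := by
    have : ⌊α⌋₊ < n + 1 := by rw [Nat.floor_lt hα]; exact_mod_cast hαn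
    exact_mod_cast Nat.lt_succ_iff.1 this
  have h1 := Nat.floor_le hα
  have h2 := Nat.lt_floor_add_one α
  have h3 : (0 : ℝ) ≤ ⌊α⌋₊ := Nat.cast_nonneg _
  refine max_le ?_ ?_
  · nlinarith
  · nlinarith

section transfer

variable {n : ℕ}

/-- The underlying vector of coordinates. -/
def coordEmb (n : ℕ) : EuclideanSpace ℝ (Fin (n + 1)) ↪ (Fin (n + 1) → ℝ) :=
  (EuclideanSpace.equiv (Fin (n + 1)) ℝ).toLinearEquiv.toEquiv.toEmbedding

lemma coordEmb_apply (w : EuclideanSpace ℝ (Fin (n + 1))) (i : Fin (n + 1)) : coordEmb n w i = w i := rfl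

lemma uAct_apply (r : ℝ) (w : EuclideanSpace ℝ (Fin (n + 1))) (i : Fin (n + 1)) :
    uAct n r w i = xc r i (coordEmb n w) := by
  simp only [uAct, xc, dotProduct, ηf, xiD, coordEmb_apply]
  change ∑ l, w l * (if i.1 + 1 ≤ l.1 + 1 then r ^ (l.1 + 1 - (i.1 + 1)) / ((l.1 + 1 - (i.1 + 1)).factorial : ℝ)
    else 0) = _
  refine Finset.sum_congr rfl fun l _ => ?_
  rw [mul_comm, Nat.add_sub_add_right]
  simp only [add_le_add_iff_right]

lemma abs_xc_le_of_norm_le {t δ r : ℝ} {w w' : EuclideanSpace ℝ (Fin (n + 1))}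
    (h : ‖aAct n t (uAct n r w') - aAct n t (uAct n r w)‖ ≤ δ) (i : Fin (n + 1)) :
    |xc r i (coordEmb n w' - coordEmb n w)| ≤ δ * exp (-(((n : ℝ) - 2 * (i.1 : ℝ)) * t) / 2) := by
  have h1 := (PiLp.norm_apply_le (aAct n t (uAct n r w') - aAct n t (uAct n r w)) i).trans h
  have h2 : (aAct n t (uAct n r w') - aAct n t (uAct n r w)) i =
      exp ((((n : ℝ) - 2 * (i.1 : ℝ)) * t) / 2) * xc r i (coordEmb n w' - coordEmb n w) := by
    rw [xc_sub, ← uAct_apply, ← uAct_apply, mul_sub]; rfl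
  rw [h2, Real.norm_eq_abs, abs_mul, abs_of_pos (exp_pos _)] at h1
  rw [neg_div, Real.exp_neg, ← div_eq_mul_inv, le_div_iff₀ (exp_pos _), mul_comm]
  exact h1

lemma norm_le_of_abs_le {ρ : ℝ} {v : EuclideanSpace ℝ (Fin (n + 1))} (hρ : 0 ≤ ρ)
    (h : ∀ i, |v i| ≤ ρ) : ‖v‖ ≤ ((n : ℝ) + 1) * ρ := by
  rw [EuclideanSpace.norm_eq]
  refine Real.sqrt_le_iff.2 ⟨by positivity, ?_⟩
  calc ∑ i, ‖v i‖ ^ 2 ≤ ∑ i : Fin (n + 1), ρ ^ 2 := by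
        refine Finset.sum_le_sum fun i _ => ?_
        rw [Real.norm_eq_abs]
        exact pow_le_pow_left₀ (abs_nonneg _) (h i) 2
    _ = ((n : ℝ) + 1) * ρ ^ 2 := by simp
    _ ≤ (((n : ℝ) + 1) * ρ) ^ 2 := by
        have : (0 : ℝ) ≤ n := Nat.cast_nonneg n
        nlinarith [sq_nonneg ρ, mul_nonneg this (sq_nonneg ρ)]

lemma mass_le_iff {V : Type*} {F : Finset V} (hF : F.Nonempty) {A : Set V} {S : Finset V}
    (hS : A ∩ (F : Set V) = S) {x : ℝ} : mass F A ≤ x ↔ (S.card : ℝ) ≤ x * F.card := by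
  have hF0 : (0 : ℝ) < F.card := by exact_mod_cast hF.card_pos
  rw [mass, hS, div_le_iff₀ hF0]
  simp

/-- The ball condition passes to boxes. -/
lemma card_box_le_of_mass {F : Finset (EuclideanSpace ℝ (Fin (n + 1)))} (hF : F.Nonempty)
    {α C δ₀ : ℝ} (hα : 0 ≤ α) (hαn : α < n + 1) (hC : 1 ≤ C) (hδ₀ : 0 ≤ δ₀)
    (h : ∀ (x : EuclideanSpace ℝ (Fin (n + 1))) (δ : ℝ), δ ∈ Set.Icc δ₀ 1 →
      mass F (closedBall x δ) ≤ C * δ ^ α) (z : Fin (n + 1) → ℝ) {ρ : ℝ} (hρ : δ₀ ≤ ρ) :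
    (((F.map (coordEmb n)).filter fun w => ∀ i, |w i - z i| ≤ ρ).card : ℝ) ≤
      C * ((n : ℝ) + 1) ^ (n + 1) * ρ ^ α * (F.map (coordEmb n)).card := by
  classical
  have hρ0 : 0 ≤ ρ := hδ₀.trans hρ
  have hN : (1 : ℝ) ≤ (n : ℝ) + 1 := by have : (0 : ℝ) ≤ n := Nat.cast_nonneg n; linarith
  have hpow : (((n : ℝ) + 1) * ρ) ^ α ≤ ((n : ℝ) + 1) ^ (n + 1) * ρ ^ α := by
    rw [Real.mul_rpow (by linarith) hρ0]
    gcongr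
    rw [← Real.rpow_natCast]
    exact Real.rpow_le_rpow_of_exponent_le hN (by push_cast; exact hαn.le)
  rw [Finset.card_map, mul_assoc C]
  refine le_trans ?_ (mul_le_mul_of_nonneg_right
    (mul_le_mul_of_nonneg_left hpow (by linarith)) (Nat.cast_nonneg _))
  rcases le_total (((n : ℝ) + 1) * ρ) 1 with h1 | h1
  · set x : EuclideanSpace ℝ (Fin (n + 1)) := (EuclideanSpace.equiv (Fin (n + 1)) ℝ).symm z with hx
    have h2 := h x _ ⟨hρ.trans (le_mul_of_one_le_left hρ0 hN), h1⟩
    rw [mass_le_iff hF (S := F.filter fun w => w ∈ closedBall x (((n : ℝ) + 1) * ρ))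
      (by ext w; simp [and_comm])] at h2
    refine le_trans ?_ h2
    rw [Finset.filter_map, Finset.card_map]
    refine Nat.cast_le.2 (Finset.card_le_card fun w hw => ?_)
    obtain ⟨h3, h4⟩ := Finset.mem_filter.1 hw
    refine Finset.mem_filter.2 ⟨h3, ?_⟩
    rw [mem_closedBall, dist_eq_norm]
    exact norm_le_of_abs_le hρ0 h4
  · have h2 : 1 ≤ C * (((n : ℝ) + 1) * ρ) ^ α :=
      one_le_mul_of_one_le_of_one_le hC (Real.one_le_rpow h1 hα)
    calc (((F.map (coordEmb n)).filter fun w => ∀ i, |w i - z i| ≤ ρ).card : ℝ)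
        ≤ ((F.map (coordEmb n)).card : ℝ) := by exact_mod_cast Finset.card_filter_le _ _
      _ = 1 * F.card := by rw [Finset.card_map, one_mul]
      _ ≤ _ := by gcongr

/-- The multislicing estimate expressed for the group action. -/
lemma exists_of_good {F : Finset (EuclideanSpace ℝ (Fin (n + 1)))} (hF : F.Nonempty)
    {t δ x y X Y : ℝ} {ℓ : Fin (n + 1) → ℝ}
    (hℓ : ∀ i, δ * exp (-(((n : ℝ) - 2 * (i.1 : ℝ)) * t) / 2) ≤ ℓ i)
    (h : Good (F.map (coordEmb n)) ℓ x X) (hxy : x ≤ y) (hXY : X ≤ Y) :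
    ∃ 𝓔 : Set ℝ, 𝓔 ⊆ Set.Icc 0 1 ∧ volume 𝓔 ≤ ENNReal.ofReal y ∧
      ∀ r ∈ Set.Icc (0 : ℝ) 1 \ 𝓔,
        ∃ F' : Finset (EuclideanSpace ℝ (Fin (n + 1))), F' ⊆ F ∧
          mass F ((F : Set (EuclideanSpace ℝ (Fin (n + 1)))) \ (F' : Set _)) ≤ y ∧
          ∀ w ∈ F', mass F {w' | w' ∈ F' ∧
            ‖aAct n t (uAct n r w') - aAct n t (uAct n r w)‖ ≤ δ} ≤ Y := by
  classical
  obtain ⟨E, hE, hv, hg⟩ := h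
  refine ⟨E, hE, hv.trans (ENNReal.ofReal_le_ofReal hxy), fun r hr => ?_⟩
  obtain ⟨G, hG, hc, hb⟩ := hg r hr.1 hr.2
  obtain ⟨F', hF', rfl⟩ := Finset.subset_map_iff.1 hG
  refine ⟨F', hF', ?_, fun w hw => ?_⟩
  · rw [mass_le_iff hF (S := F \ F') (by ext w; simp; tauto)]
    have : F.map (coordEmb n) \ F'.map (coordEmb n) = (F \ F').map (coordEmb n) := by
      rw [Finset.map_sdiff]
    rw [this, Finset.card_map, Finset.card_map] at hc
    exact hc.trans (by gcongr)
  · rw [mass_le_iff hF (S := F'.filter fun w' => ‖aAct n t (uAct n r w') - aAct n t (uAct n r w)‖ ≤ δ)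
      (by ext w'; simp only [Set.mem_inter_iff, Set.mem_ofPred_eq, Finset.mem_coe, Finset.mem_filter]
          exact ⟨fun h => h.1, fun h => ⟨h, hF' h.1⟩⟩)]
    have h1 := hb (coordEmb n w) (Finset.mem_map_of_mem _ hw)
    rw [Finset.filter_map, Finset.card_map, Finset.card_map] at h1
    refine le_trans (Nat.cast_le.2 (Finset.card_le_card fun w' hw' => ?_)) (h1.trans (by gcongr))
    obtain ⟨h3, h4⟩ := Finset.mem_filter.1 hw'
    exact Finset.mem_filter.2 ⟨h3, fun i => (abs_xc_le_of_norm_le h4 i).trans (hℓ i)⟩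

end transfer

theorem stmt1 :
    ∀ n : ℕ, 1 ≤ n →
    ∀ ε : ℝ, 0 < ε →
    ∃ D c : ℝ, 1 ≤ D ∧ 0 < c ∧
      ∀ (α C δ₀ : ℝ) (F : Finset (EuclideanSpace ℝ (Fin (n + 1)))),
        0 < α → α < (n : ℝ) + 1 → 1 ≤ C → 0 < δ₀ → δ₀ ≤ 1 → F.Nonempty →
        (F : Set (EuclideanSpace ℝ (Fin (n + 1)))) ⊆ closedBall 0 1 →
        (∀ (x : EuclideanSpace ℝ (Fin (n + 1))) (δ : ℝ), δ ∈ Set.Icc δ₀ 1 →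
          mass F (closedBall x δ) ≤ C * δ ^ α) →
        ε < min α ((n : ℝ) + 1 - α) / (10 ^ 4 * (n : ℝ)) →
        ∀ δ t : ℝ, δ₀ ≤ δ → δ ≤ 1 / 100 → D ≤ t →
          Real.exp ((n : ℝ) * t / 2) * δ₀ ≤ δ → δ ≤ Real.exp (-((n : ℝ) * t) / 2) →
          ∃ 𝓔 : Set ℝ, 𝓔 ⊆ Set.Icc 0 1 ∧
            volume 𝓔 ≤ ENNReal.ofReal (D * Real.exp (-(c * ε ^ 2 * t))) ∧
            ∀ r ∈ Set.Icc (0 : ℝ) 1 \ 𝓔,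
              ∃ F' : Finset (EuclideanSpace ℝ (Fin (n + 1))), F' ⊆ F ∧
                mass F ((F : Set (EuclideanSpace ℝ (Fin (n + 1)))) \ (F' : Set _)) ≤
                  D * Real.exp (-(c * ε ^ 2 * t)) ∧
                ∀ w ∈ F',
                  mass F {w' | w' ∈ F' ∧
                      ‖aAct n t (uAct n r w') - aAct n t (uAct n r w)‖ ≤ δ} ≤
                    D * C * Real.exp (-(varpi n α * t) / 2) * δ ^ (α - ε) := by
  intro n hn ε hε
  obtain ⟨c, hc, L₀, hL₀, hmain⟩ := exists_uniform_flow hn (half_pos hε)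
  have hN1 : (1 : ℝ) ≤ ((n : ℝ) + 1) ^ (n + 1) := one_le_pow₀ (by
    have : (0 : ℝ) ≤ n := Nat.cast_nonneg n; linarith)
  set D := max L₀ (((n : ℝ) + 1) ^ (n + 1)) with hD
  have hD1 : 1 ≤ D := le_max_of_le_left hL₀
  refine ⟨D, c / ε ^ 2, hD1, by positivity, ?_⟩
  intro α C δ₀ F hα hαn hC hδ₀ _ hF hFb hmass _ δ t hδ _ ht h1 h2
  have ht1 : 1 ≤ t := hD1.trans ht
  have hδ0 : 0 < δ := hδ₀.trans_le hδ
  have hn1 : (1 : ℝ) ≤ n := by exact_mod_cast hn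
  have hnt : t ≤ n * t := le_mul_of_one_le_left (by linarith) hn1
  set lam := n * t / 2 - Real.log δ with hlam
  have hlogδ : Real.log δ ≤ -(n * t) / 2 := by
    rw [Real.log_le_iff_le_exp hδ0]; exact h2
  have hlamt : n * t ≤ lam := by rw [hlam]; linarith
  have hlam0 : 0 < lam := by linarith
  have hlamδ : lam ≤ -2 * Real.log δ := by rw [hlam]; linarith
  set L := exp lam with hL
  have hpow : ∀ u : ℝ, L ^ u = exp (lam * u) := fun u => by rw [hL, ← Real.exp_mul]
  have hLL₀ : L₀ ≤ L := by
    calc L₀ ≤ D := le_max_left _ _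
      _ ≤ t := ht
      _ ≤ lam := by linarith
      _ ≤ lam + 1 := by linarith
      _ ≤ L := Real.add_one_le_exp lam
  have hLδ₀ : δ₀ ≤ 1 / L := by
    rw [hL, hlam, Real.exp_sub, Real.exp_log hδ0, one_div_div, le_div_iff₀ (exp_pos _), mul_comm]
    exact h1
  set τ := t / lam with hτ
  have hτlam : lam * τ = t := by rw [hτ]; field_simp
  have hgood := hmain L hLL₀ τ (by positivity) (by
      rw [hτ, ← mul_div_assoc, div_le_one hlam0]; exact hlamt) (stair n α) (stair_mem hα.le)
    (C * ((n : ℝ) + 1) ^ (n + 1)) (one_le_mul_of_one_le_of_one_le hC hN1) (F.map (coordEmb n))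
    (hF.map) (by
      intro w hw i
      obtain ⟨v, hv, rfl⟩ := Finset.mem_map.1 hw
      have h3 := hFb hv
      rw [mem_closedBall, dist_zero_right] at h3
      exact (PiLp.norm_apply_le v i).trans h3)
    (by
      intro z ρ hρ _
      rw [sum_stair hα.le hαn]
      exact card_box_le_of_mass hF hα.le hαn hC hδ₀.le hmass z (hLδ₀.trans hρ))
  refine exists_of_good hF (fun i => ?_) hgood ?_ ?_
  · rw [hpow]
    nth_rewrite 1 [← Real.exp_log hδ0]
    rw [← Real.exp_add]
    refine exp_le_exp.2 (le_of_eq ?_)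
    have : lam * -(1 - i.1 * τ) = -lam + i.1 * (lam * τ) := by ring
    rw [this, hτlam, hlam]; ring
  · rw [hpow, div_mul_cancel₀ _ (by positivity)]
    calc exp (lam * -c) ≤ exp (-(c * t)) := exp_le_exp.2 (by
          have := mul_le_mul_of_nonneg_left (hnt.trans hlamt) hc.le; linarith)
      _ ≤ D * exp (-(c * t)) := le_mul_of_one_le_left (exp_pos _).le hD1
  · have hND : ((n : ℝ) + 1) ^ (n + 1) ≤ D := le_max_right _ _
    have e1 : lam * ∑ i : Fin (n + 1), stair n α i * (1 - i.1 * τ) =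
        (∑ i : Fin (n + 1), stair n α i * ((n : ℝ) - 2 * (i.1 : ℝ))) * t / 2 - α * Real.log δ := by
      have e0 : α * Real.log δ = ∑ i : Fin (n + 1), stair n α i * Real.log δ := by
        rw [← Finset.sum_mul, sum_stair hα.le hαn]
      rw [e0, Finset.mul_sum, mul_div_assoc, Finset.sum_mul, ← Finset.sum_sub_distrib]
      refine Finset.sum_congr rfl fun i _ => ?_
      have : lam * (stair n α i * (1 - i.1 * τ)) = stair n α i * (lam - i.1 * (lam * τ)) := by ring
      rw [this, hτlam, hlam]; ring
    have hϖ := mul_le_mul_of_nonneg_right (varpi_le_sum_stair hα.le hαn) (by linarith : 0 ≤ t)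
    calc C * ((n : ℝ) + 1) ^ (n + 1) * L ^ (-(∑ i : Fin (n + 1), stair n α i * (1 - i.1 * τ)) + ε / 2)
        ≤ C * D * (exp (-(varpi n α * t) / 2) * δ ^ (α - ε)) := by
          rw [hpow, Real.rpow_def_of_pos hδ0, ← Real.exp_add]
          gcongr
          have h4 := mul_le_mul_of_nonneg_right hlamδ hε.le
          have h5 : lam * (-(∑ i : Fin (n + 1), stair n α i * (1 - i.1 * τ)) + ε / 2) =
            -(lam * ∑ i : Fin (n + 1), stair n α i * (1 - i.1 * τ)) + lam * ε / 2 := by ring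
          rw [h5, e1]
          linarith
      _ = D * C * exp (-(varpi n α * t) / 2) * δ ^ (α - ε) := by ring
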